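/- For every sufficiently small δ > 0 (so small that B(e₁, 3δ) contains none of the points Q_l^k with l ≥ 1 for large k), one has w̃_k → 0 and ∇w̃_k → 0 uniformly on the annulus B(e₁, δ) \ B(e₁, δ/8) as k → ∞. -/

import Mathlib

open MeasureTheory Filter Metric Set

noncomputable section

/-- Directional derivative of a function `f : ℂ → ℝ` in direction `v`. -/
def dderiv (v : ℂ) (f : ℂ → ℝ) : ℂ → ℝ := fun z => fderiv ℝ f z v

/-- Iterated partial derivative `∂ₓ^m ∂_y^n f` of `f : ℂ → ℝ`. -/
def pd (m n : ℕ) (f : ℂ → ℝ) : ℂ → ℝ := (dderiv 1)^[m] ((dderiv Complex.I)^[n] f)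

/-- Laplacian of `f : ℂ → ℝ`. -/
def lap (f : ℂ → ℝ) : ℂ → ℝ := fun z => pd 2 0 f z + pd 0 2 f z

/-- Gradient of `f : ℂ → ℝ` at `z`, viewed as a complex number. -/
def grad (f : ℂ → ℝ) (z : ℂ) : ℂ :=
  (dderiv 1 f z : ℂ) + (dderiv Complex.I f z : ℂ) * Complex.I

open ComplexConjugate

/-- The real-linear map `ω ↦ a ω + b ω̄`. -/
def wirtL (a b : ℂ) : ℂ →L[ℝ] ℂ :=
  a • ContinuousLinearMap.id ℝ ℂ + b • (Complex.conjCLE : ℂ →L[ℝ] ℂ)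

@[simp] lemma wirtL_apply (a b ω : ℂ) : wirtL a b ω = a * ω + b * conj ω := by
  simp [wirtL]

/-- `g` is real differentiable at `y` with `∂g = a` and `∂̄g = b`. -/
def HasWirt (g : ℂ → ℂ) (a b y : ℂ) : Prop := HasFDerivAt g (wirtL a b) y

/-- The Wirtinger derivative `∂g = (g_x - i g_y) / 2`. -/
def dz (g : ℂ → ℂ) (y : ℂ) : ℂ := (fderiv ℝ g y 1 - Complex.I * fderiv ℝ g y Complex.I) / 2

/-- The Wirtinger derivative `∂̄g = (g_x + i g_y) / 2`. -/
def dzb (g : ℂ → ℂ) (y : ℂ) : ℂ := (fderiv ℝ g y 1 + Complex.I * fderiv ℝ g y Complex.I) / 2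

lemma HasWirt.dz {g : ℂ → ℂ} {a b y : ℂ} (h : HasWirt g a b y) : dz g y = a := by
  unfold _root_.dz
  rw [HasFDerivAt.fderiv h]
  simp only [wirtL_apply, map_one, Complex.conj_I]
  linear_combination (-a / 2 + b / 2) * Complex.I_mul_I

lemma HasWirt.dzb {g : ℂ → ℂ} {a b y : ℂ} (h : HasWirt g a b y) : dzb g y = b := by
  unfold _root_.dzb
  rw [HasFDerivAt.fderiv h]
  simp only [wirtL_apply, map_one, Complex.conj_I]
  linear_combination (a / 2 - b / 2) * Complex.I_mul_I

lemma linear_eq_wirtL (L : ℂ →L[ℝ] ℂ) :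
    L = wirtL ((L 1 - Complex.I * L Complex.I) / 2) ((L 1 + Complex.I * L Complex.I) / 2) := by
  ext ω
  have h : ω = ω.re • (1 : ℂ) + ω.im • Complex.I := by simp
  have h1 : L ω = ω.re * L 1 + ω.im * L Complex.I := by
    conv_lhs => rw [h]
    rw [map_add, map_smul, map_smul]; simp
  have h2 : conj ω = ω.re - ω.im * Complex.I := by
    apply Complex.ext <;> simp
  have h3 : ω = ω.re + ω.im * Complex.I := by simp
  rw [wirtL_apply, h1, h2]
  conv_rhs => rw [h3]
  simp only [Complex.add_re, Complex.ofReal_re, Complex.mul_re, Complex.I_re, Complex.ofReal_im,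
    Complex.I_im, Complex.add_im, Complex.mul_im]
  push_cast
  linear_combination ((ω.im : ℂ) * L Complex.I) * Complex.I_mul_I

lemma DifferentiableAt.hasWirt {g : ℂ → ℂ} {y : ℂ} (h : DifferentiableAt ℝ g y) :
    HasWirt g (_root_.dz g y) (_root_.dzb g y) y := by
  have := h.hasFDerivAt
  rw [linear_eq_wirtL (fderiv ℝ g y)] at this
  exact this

lemma HasWirt.add {g h : ℂ → ℂ} {a b c d y : ℂ} (hg : HasWirt g a b y) (hh : HasWirt h c d y) :
    HasWirt (fun z => g z + h z) (a + c) (b + d) y := by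
  refine (HasFDerivAt.add hg hh).congr_fderiv ?_
  ext ω; simp; ring

lemma HasWirt.sub {g h : ℂ → ℂ} {a b c d y : ℂ} (hg : HasWirt g a b y) (hh : HasWirt h c d y) :
    HasWirt (fun z => g z - h z) (a - c) (b - d) y := by
  refine (HasFDerivAt.sub hg hh).congr_fderiv ?_
  ext ω; simp; ring

lemma HasWirt.mul {g h : ℂ → ℂ} {a b c d y : ℂ} (hg : HasWirt g a b y) (hh : HasWirt h c d y) :
    HasWirt (fun z => g z * h z) (a * h y + g y * c) (b * h y + g y * d) y := by
  refine (HasFDerivAt.mul hg hh).congr_fderiv ?_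
  ext ω; simp; ring

lemma hasWirt_const (c y : ℂ) : HasWirt (fun _ => c) 0 0 y := by
  refine (hasFDerivAt_const c y).congr_fderiv ?_
  ext ω; simp

lemma HasWirt.const_mul {g : ℂ → ℂ} {a b y : ℂ} (c : ℂ) (hg : HasWirt g a b y) :
    HasWirt (fun z => c * g z) (c * a) (c * b) y := by
  simpa using (hasWirt_const c y).mul hg

lemma hasWirt_id (y : ℂ) : HasWirt (fun z => z) 1 0 y := by
  refine (hasFDerivAt_id y).congr_fderiv ?_
  ext ω; simp

lemma HasWirt.conj {g : ℂ → ℂ} {a b y : ℂ} (hg : HasWirt g a b y) :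
    HasWirt (fun z => conj (g z)) (conj b) (conj a) y := by
  refine ((Complex.conjCLE : ℂ →L[ℝ] ℂ).hasFDerivAt.comp y hg).congr_fderiv ?_
  ext ω; simp; ring

lemma HasWirt.comp_holo {g f : ℂ → ℂ} {a b y f' : ℂ} (hg : HasWirt g a b y)
    (hf : HasDerivAt f f' (g y)) : HasWirt (fun z => f (g z)) (f' * a) (f' * b) y := by
  refine ((hf.hasFDerivAt.restrictScalars ℝ).comp y hg).congr_fderiv ?_
  ext ω; simp; ring

lemma HasWirt.pow {g : ℂ → ℂ} {a b y : ℂ} (hg : HasWirt g a b y) (n : ℕ) :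
    HasWirt (fun z => g z ^ n) (n * g y ^ (n - 1) * a) (n * g y ^ (n - 1) * b) y :=
  hg.comp_holo (hasDerivAt_pow n (g y))

lemma HasWirt.cexp {g : ℂ → ℂ} {a b y : ℂ} (hg : HasWirt g a b y) :
    HasWirt (fun z => Complex.exp (g z)) (Complex.exp (g y) * a) (Complex.exp (g y) * b) y :=
  hg.comp_holo (Complex.hasDerivAt_exp (g y))

lemma HasWirt.inv {g : ℂ → ℂ} {a b y : ℂ} (hg : HasWirt g a b y) (h0 : g y ≠ 0) :
    HasWirt (fun z => (g z)⁻¹) (-(g y ^ 2)⁻¹ * a) (-(g y ^ 2)⁻¹ * b) y :=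
  hg.comp_holo (hasDerivAt_inv h0)

lemma ContDiff.dz {g : ℂ → ℂ} {n : ℕ} (h : ContDiff ℝ (n + 1) g) : ContDiff ℝ n (dz g) := by
  have h1 : ContDiff ℝ n (fderiv ℝ g) := h.fderiv_right le_rfl
  unfold _root_.dz
  fun_prop

lemma ContDiff.dzb {g : ℂ → ℂ} {n : ℕ} (h : ContDiff ℝ (n + 1) g) : ContDiff ℝ n (dzb g) := by
  have h1 : ContDiff ℝ n (fderiv ℝ g) := h.fderiv_right le_rfl
  unfold _root_.dzb
  fun_prop

lemma dzb_dz_comm {g : ℂ → ℂ} (h : ContDiff ℝ 2 g) (y : ℂ) : dzb (dz g) y = dz (dzb g) y := by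
  have h1 : ContDiff ℝ 1 (fderiv ℝ g) := h.fderiv_right (by norm_num)
  have hd : DifferentiableAt ℝ (fderiv ℝ g) y := h1.differentiable (by norm_num) y
  have key : ∀ ω : ℂ, HasFDerivAt (fun z => fderiv ℝ g z ω)
      ((fderiv ℝ (fderiv ℝ g) y).flip ω) y := fun ω => by
    simpa using hd.hasFDerivAt.clm_apply (hasFDerivAt_const ω y)
  have hA : HasFDerivAt (dz g) _ y :=
    ((key 1).sub ((key Complex.I).const_mul Complex.I)).mul_const (2 : ℂ)⁻¹
  have hB : HasFDerivAt (dzb g) _ y :=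
    ((key 1).add ((key Complex.I).const_mul Complex.I)).mul_const (2 : ℂ)⁻¹
  have hs := (h.contDiffAt (x := y)).isSymmSndFDerivAt (by simp) 1 Complex.I
  simp only [dzb, dz]
  change (fderiv ℝ (_root_.dz g) y 1 + Complex.I * fderiv ℝ (_root_.dz g) y Complex.I) / 2 =
    (fderiv ℝ (_root_.dzb g) y 1 - Complex.I * fderiv ℝ (_root_.dzb g) y Complex.I) / 2
  rw [hA.fderiv, hB.fderiv]
  simp
  rw [hs]
  ring

lemma integral_fderiv_apply_eq_zero {g : ℂ → ℂ} (hg : ContDiff ℝ 1 g) (hc : HasCompactSupport g)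
    (ω : ℂ) : ∫ z, fderiv ℝ g z ω = 0 := by
  have hd : ContDiff ℝ 0 (fderiv ℝ g) := hg.fderiv_right (by norm_num)
  have h1 : Integrable (fun x => fderiv ℝ g x ω) := by
    refine Continuous.integrable_of_hasCompactSupport ?_ (hc.fderiv_apply ℝ ω)
    exact hd.continuous.clm_apply continuous_const
  have := integral_mul_fderiv_eq_neg_fderiv_mul_of_integrable (f := fun _ : ℂ => (1 : ℂ)) (g := g)
    (v := ω) (μ := volume) (by simp) (by simpa using h1)
    (by simpa using hg.continuous.integrable_of_hasCompactSupport hc)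
    (fun _ _ => differentiableAt_const _) (fun x _ => hg.differentiable (by norm_num) x)
  simpa using this

lemma integrable_fderiv_apply {g : ℂ → ℂ} (hg : ContDiff ℝ 1 g) (hc : HasCompactSupport g)
    (ω : ℂ) : Integrable (fun z => fderiv ℝ g z ω) := by
  have hd : ContDiff ℝ 0 (fderiv ℝ g) := hg.fderiv_right (by norm_num)
  exact (hd.continuous.clm_apply continuous_const).integrable_of_hasCompactSupport
    (hc.fderiv_apply ℝ ω)

lemma integral_dz_eq_zero {g : ℂ → ℂ} (hg : ContDiff ℝ 1 g) (hc : HasCompactSupport g) :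
    ∫ z, dz g z = 0 := by
  unfold dz
  rw [integral_div, integral_sub (integrable_fderiv_apply hg hc 1)
    ((integrable_fderiv_apply hg hc Complex.I).const_mul _), integral_const_mul,
    integral_fderiv_apply_eq_zero hg hc, integral_fderiv_apply_eq_zero hg hc]
  simp

lemma integral_dzb_eq_zero {g : ℂ → ℂ} (hg : ContDiff ℝ 1 g) (hc : HasCompactSupport g) :
    ∫ z, dzb g z = 0 := by
  unfold dzb
  rw [integral_div, integral_add (integrable_fderiv_apply hg hc 1)
    ((integrable_fderiv_apply hg hc Complex.I).const_mul _), integral_const_mul,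
    integral_fderiv_apply_eq_zero hg hc, integral_fderiv_apply_eq_zero hg hc]
  simp

lemma HasCompactSupport.dz {g : ℂ → ℂ} (hc : HasCompactSupport g) : HasCompactSupport (dz g) := by
  refine (hc.fderiv ℝ).mono fun z hz => ?_
  contrapose! hz
  simp only [Function.mem_support, ne_eq, not_not] at hz
  simp [_root_.dz, hz]

lemma HasCompactSupport.dzb {g : ℂ → ℂ} (hc : HasCompactSupport g) :
    HasCompactSupport (dzb g) := by
  refine (hc.fderiv ℝ).mono fun z hz => ?_
  contrapose! hz
  simp only [Function.mem_support, ne_eq, not_not] at hz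
  simp [_root_.dzb, hz]

lemma contDiff_coe {v : ℂ → ℝ} {n : WithTop ℕ∞} (hv : ContDiff ℝ n v) :
    ContDiff ℝ n (fun y => (v y : ℂ)) := Complex.ofRealCLM.contDiff.comp hv

lemma HasFDerivAt.hasWirt_ofReal {v : ℂ → ℝ} {L : ℂ →L[ℝ] ℝ} {y : ℂ} (h : HasFDerivAt v L y) :
    HasWirt (fun z => (v z : ℂ)) ((L 1 - L Complex.I * Complex.I) / 2)
      ((L 1 + L Complex.I * Complex.I) / 2) y := by
  refine (Complex.ofRealCLM.hasFDerivAt.comp y h).congr_fderiv ?_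
  rw [linear_eq_wirtL (Complex.ofRealCLM.comp L)]
  simp [mul_comm]

lemma dzb_ofReal (v : ℂ → ℝ) {y : ℂ} (h : DifferentiableAt ℝ v y) :
    dzb (fun z => (v z : ℂ)) y = conj (dz (fun z => (v z : ℂ)) y) := by
  rw [(h.hasFDerivAt.hasWirt_ofReal).dzb, (h.hasFDerivAt.hasWirt_ofReal).dz, map_div₀]
  simp [Complex.conj_ofNat]

lemma dz_ofReal_eq_grad {v : ℂ → ℝ} {y : ℂ} (h : DifferentiableAt ℝ v y) :
    dz (fun z => (v z : ℂ)) y = conj (grad v y) / 2 := by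
  rw [(h.hasFDerivAt.hasWirt_ofReal).dz]
  simp [grad, dderiv, sub_eq_add_neg]

lemma norm_grad {v : ℂ → ℝ} {y : ℂ} (h : DifferentiableAt ℝ v y) :
    ‖grad v y‖ = 2 * ‖dz (fun z => (v z : ℂ)) y‖ := by
  rw [dz_ofReal_eq_grad h]; simp; ring

lemma fderiv_ofReal_apply {v : ℂ → ℝ} {y : ℂ} (h : DifferentiableAt ℝ v y) (ω : ℂ) :
    fderiv ℝ v y ω = 2 * (ω * dz (fun z => (v z : ℂ)) y).re := by
  rw [(h.hasFDerivAt.hasWirt_ofReal).dz]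
  have : ω = ω.re • (1 : ℂ) + ω.im • Complex.I := by simp
  conv_lhs => rw [this, map_add, map_smul, map_smul]
  simp
  ring

lemma norm_dz_ofReal_le {v : ℂ → ℝ} {y : ℂ} (h : DifferentiableAt ℝ v y) :
    ‖dz (fun z => (v z : ℂ)) y‖ ≤ ‖fderiv ℝ v y‖ := by
  rw [(h.hasFDerivAt.hasWirt_ofReal).dz]
  have h1 := (fderiv ℝ v y).le_opNorm 1
  have h2 := (fderiv ℝ v y).le_opNorm Complex.I
  simp only [norm_one, mul_one, Complex.norm_I] at h1 h2
  rw [norm_div]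
  have := norm_sub_le ((fderiv ℝ v y 1 : ℂ)) (fderiv ℝ v y Complex.I * Complex.I)
  simp only [norm_mul, Complex.norm_real, Complex.norm_I, mul_one] at this
  simp only [Complex.norm_ofNat]
  linarith

lemma dzb_dz_ofReal {v : ℂ → ℝ} (h : ContDiff ℝ 2 v) (y : ℂ) :
    dzb (dz (fun z => (v z : ℂ))) y = lap v y / 4 := by
  have h1 : ContDiff ℝ 1 (fderiv ℝ v) := h.fderiv_right (by norm_num)
  have hd : DifferentiableAt ℝ (fderiv ℝ v) y := h1.differentiable (by norm_num) y
  have key : ∀ ω : ℂ, HasFDerivAt (fun z => fderiv ℝ v z ω)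
      ((fderiv ℝ (fderiv ℝ v) y).flip ω) y := fun ω => by
    simpa using hd.hasFDerivAt.clm_apply (hasFDerivAt_const ω y)
  have hs := (h.contDiffAt (x := y)).isSymmSndFDerivAt (by simp) 1 Complex.I
  have e : dz (fun z => (v z : ℂ)) = fun z =>
      2⁻¹ * ((fderiv ℝ v z 1 : ℂ) - Complex.I * (fderiv ℝ v z Complex.I : ℂ)) := by
    funext z
    rw [((h.differentiable (by norm_num) z).hasFDerivAt.hasWirt_ofReal).dz]
    ring
  have hw := (((key 1).hasWirt_ofReal).sub
    (((key Complex.I).hasWirt_ofReal).const_mul Complex.I)).const_mul 2⁻¹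
  rw [e, hw.dzb]
  simp only [lap, pd, dderiv, Function.iterate_succ, Function.iterate_zero, Function.comp_apply,
    id_eq, ContinuousLinearMap.flip_apply]
  have k1 : fderiv ℝ (dderiv 1 v) y = _ := (key 1).fderiv
  have k2 : fderiv ℝ (dderiv Complex.I v) y = _ := (key Complex.I).fderiv
  rw [k1, k2, hs]
  simp only [ContinuousLinearMap.flip_apply]
  push_cast
  linear_combination (-(fderiv ℝ (fderiv ℝ v) y Complex.I Complex.I : ℂ) / 4) * Complex.I_mul_I

/-- The quadratic-differential quantity `z (v_zz - v_z² / 2) - N v_z` attached to `v`. -/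
def quadDiff (N : ℕ) (v : ℂ → ℝ) (z : ℂ) : ℂ :=
  z * (dz (dz fun y => (v y : ℂ)) z - dz (fun y => (v y : ℂ)) z ^ 2 / 2)
    - N * dz (fun y => (v y : ℂ)) z

lemma ContDiff.hasWirt {g : ℂ → ℂ} {n : WithTop ℕ∞} (hg : ContDiff ℝ n g) (hn : n ≠ 0) (y : ℂ) :
    HasWirt g (_root_.dz g y) (_root_.dzb g y) y :=
  (hg.differentiable hn y).hasWirt

lemma dz_eq_zero_of_notMem {g : ℂ → ℂ} {z : ℂ} (hz : z ∉ tsupport g) : dz g z = 0 := by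
  simp [dz, fderiv_of_notMem_tsupport (𝕜 := ℝ) hz]

lemma dzb_eq_zero_of_notMem {g : ℂ → ℂ} {z : ℂ} (hz : z ∉ tsupport g) : dzb g z = 0 := by
  simp [dzb, fderiv_of_notMem_tsupport (𝕜 := ℝ) hz]

lemma hasCompactSupport_of_tsupport {f g : ℂ → ℂ} (hc : HasCompactSupport g)
    (h : ∀ z, z ∉ tsupport g → f z = 0) : HasCompactSupport f :=
  hc.mono' fun z hz => by
    by_contra h'
    exact hz (h z h')

lemma continuous_quadDiff (N : ℕ) {v : ℂ → ℝ} (hv : ContDiff ℝ 2 v) :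
    Continuous (quadDiff N v) := by
  have h1 : ContDiff ℝ (1 : ℕ) (dz fun y => (v y : ℂ)) := ContDiff.dz (n := 1) (contDiff_coe hv)
  have h2 : ContDiff ℝ (0 : ℕ) (dz (dz fun y => (v y : ℂ))) := ContDiff.dz (n := 0) h1
  have := h1.continuous
  have := h2.continuous
  unfold quadDiff
  fun_prop

lemma integral_quadDiff_mul_dzb (N : ℕ) {v κ : ℂ → ℝ} {ψ : ℂ → ℂ} (hv : ContDiff ℝ 2 v)
    (hκ : ContDiff ℝ 1 κ) (hψ : ContDiff ℝ 2 ψ) (hc : HasCompactSupport ψ)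
    (hpde : ∀ z ∈ tsupport ψ, lap v z = -(‖z‖ ^ (2 * N) * κ z * Real.exp (v z))) :
    ∫ z, quadDiff N v z * dzb ψ z =
      4⁻¹ * ∫ z, z ^ (N + 1) * conj z ^ N * dz (fun y => (κ y : ℂ)) z * Complex.exp (v z) * ψ z := by
  set vc : ℂ → ℂ := fun y => (v y : ℂ) with hvc
  set κc : ℂ → ℂ := fun y => (κ y : ℂ) with hκc
  have hv2 : ContDiff ℝ 2 vc := contDiff_coe hv
  have hκ1 : ContDiff ℝ 1 κc := contDiff_coe hκ
  have hvz : ContDiff ℝ 1 (dz vc) := ContDiff.dz (n := 1) hv2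
  have hψz : ContDiff ℝ 1 (dz ψ) := ContDiff.dz (n := 1) hψ
  have hψb : ContDiff ℝ 1 (dzb ψ) := ContDiff.dzb (n := 1) hψ
  have hψ1 : ContDiff ℝ 1 ψ := hψ.of_le (by norm_num)
  have hv1 : ContDiff ℝ 1 vc := hv2.of_le (by norm_num)
  have hconj : ContDiff ℝ 1 (fun z : ℂ => conj z) := Complex.conjCLE.contDiff
  set F : ℂ → ℂ := fun z => dz vc z * (z * dzb ψ z) -
    4⁻¹ * (z ^ (N + 1) * conj z ^ N * κc z * Complex.exp (vc z) * ψ z) with hF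
  set G : ℂ → ℂ := fun z => dz vc z * (ψ z + z * dz ψ z) + 2⁻¹ * (dz vc z ^ 2 * (z * ψ z)) +
    N * (dz vc z * ψ z) with hG
  have hF1 : ContDiff ℝ 1 F := by
    have : ContDiff ℝ 1 (fun z => Complex.exp (vc z)) := hv1.cexp
    fun_prop
  have hG1 : ContDiff ℝ 1 G := by fun_prop
  have hFc : HasCompactSupport F := hasCompactSupport_of_tsupport hc fun z hz => by
    simp [hF, dzb_eq_zero_of_notMem hz, image_eq_zero_of_notMem_tsupport hz]
  have hGc : HasCompactSupport G := hasCompactSupport_of_tsupport hc fun z hz => by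
    simp [hG, dz_eq_zero_of_notMem hz, image_eq_zero_of_notMem_tsupport hz]
  have key : ∀ z, quadDiff N v z * dzb ψ z -
      4⁻¹ * (z ^ (N + 1) * conj z ^ N * dz κc z * Complex.exp (v z) * ψ z) =
      dz F z - dzb G z := by
    intro z
    have e1 := hvz.hasWirt (by norm_num) z
    have e2 := hψz.hasWirt (by norm_num) z
    have e3 := hψb.hasWirt (by norm_num) z
    have e4 := hψ1.hasWirt (by norm_num) z
    have e5 := hv1.hasWirt (by norm_num) z
    have e6 := hκ1.hasWirt (by norm_num) z
    have e7 := hasWirt_id z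
    have e8 := e7.conj
    have dF := ((e1.mul (e7.mul e3)).sub (((((e7.pow (N + 1)).mul (e8.pow N)).mul e6).mul
      e5.cexp |>.mul e4).const_mul 4⁻¹)).dz
    have dG := (((e1.mul (e4.add (e7.mul e2))).add (((e1.pow 2).mul (e7.mul e4)).const_mul 2⁻¹)).add
      ((e1.mul e4).const_mul (N : ℂ))).dzb
    rw [hF, hG, dF, dG, ← dzb_dz_comm hψ z, dzb_dz_ofReal hv z]
    have hz0 : ((lap v z : ℂ) / 4 + 4⁻¹ * (z ^ N * conj z ^ N * κc z * Complex.exp (v z))) *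
        (ψ z + z * dz ψ z + dz vc z * (z * ψ z) + N * ψ z) = 0 := by
      by_cases hz : z ∈ tsupport ψ
      · have : ((‖z‖ : ℂ)) ^ (2 * N) = z ^ N * conj z ^ N := by
          rw [← mul_pow, Complex.mul_conj, pow_mul, Complex.normSq_eq_norm_sq]; push_cast; rfl
        rw [hpde z hz]
        push_cast
        rw [this]
        ring
      · simp [dz_eq_zero_of_notMem hz, image_eq_zero_of_notMem_tsupport hz]
    unfold quadDiff
    simp only [Nat.add_sub_cancel, map_zero, mul_zero, add_zero, mul_one, zero_mul,
      Nat.cast_add, Nat.cast_one, hvc, hκc] at hz0 ⊢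
    rw [pow_succ]
    linear_combination hz0
  have i1 : Integrable (fun z => quadDiff N v z * dzb ψ z) :=
    ((continuous_quadDiff N hv).mul hψb.continuous).integrable_of_hasCompactSupport
      (hasCompactSupport_of_tsupport hc fun z hz => by simp [dzb_eq_zero_of_notMem hz])
  have hκz : Continuous (dz κc) := (ContDiff.dz (n := 0) (by simpa using hκ1)).continuous
  have i2 : Integrable (fun z => z ^ (N + 1) * conj z ^ N * dz κc z * Complex.exp (v z) * ψ z) := by
    refine Continuous.integrable_of_hasCompactSupport ?_
      (hasCompactSupport_of_tsupport hc fun z hz => by simp [image_eq_zero_of_notMem_tsupport hz])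
    have := hψ.continuous
    have := hv.continuous
    have := hconj.continuous
    fun_prop
  have hFi : Integrable (dz F) := (ContDiff.dz (n := 0) (by simpa using hF1)).continuous
    |>.integrable_of_hasCompactSupport hFc.dz
  have hGi : Integrable (dzb G) := (ContDiff.dzb (n := 0) (by simpa using hG1)).continuous
    |>.integrable_of_hasCompactSupport hGc.dzb
  have : ∫ z, (quadDiff N v z * dzb ψ z -
      4⁻¹ * (z ^ (N + 1) * conj z ^ N * dz κc z * Complex.exp (v z) * ψ z)) = 0 := by
    simp_rw [key]
    rw [integral_sub hFi hGi, integral_dz_eq_zero hF1 hFc, integral_dzb_eq_zero hG1 hGc, sub_zero]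
  rw [integral_sub i1 (i2.const_mul _), integral_const_mul, sub_eq_zero] at this
  exact this

/-- A smooth approximation of the Cauchy kernel `1 / (z - y)`. -/
def cauchyReg (y : ℂ) (s : ℝ) (z : ℂ) : ℂ :=
  conj (z - y) * ((z - y) * conj (z - y) + (s : ℂ) ^ 2)⁻¹

lemma cauchyReg_denom (y z : ℂ) (s : ℝ) :
    (z - y) * conj (z - y) + (s : ℂ) ^ 2 = ((‖z - y‖ ^ 2 + s ^ 2 : ℝ) : ℂ) := by
  rw [Complex.mul_conj, Complex.normSq_eq_norm_sq]; push_cast; rfl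

lemma cauchyReg_denom_ne (y z : ℂ) {s : ℝ} (hs : 0 < s) :
    (z - y) * conj (z - y) + (s : ℂ) ^ 2 ≠ 0 := by
  rw [cauchyReg_denom]
  exact_mod_cast (by positivity : (0 : ℝ) < ‖z - y‖ ^ 2 + s ^ 2).ne'

lemma hasWirt_cauchyReg (y z : ℂ) {s : ℝ} (hs : 0 < s) :
    HasWirt (cauchyReg y s)
      (-(conj (z - y) ^ 2 * (((z - y) * conj (z - y) + (s : ℂ) ^ 2) ^ 2)⁻¹))
      ((s : ℂ) ^ 2 * (((z - y) * conj (z - y) + (s : ℂ) ^ 2) ^ 2)⁻¹) z := by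
  have h1 : HasWirt (fun z => z - y) 1 0 z := by
    simpa using (hasWirt_id z).sub (hasWirt_const y z)
  have h0 := cauchyReg_denom_ne y z hs
  have h2 := h1.conj.mul (((h1.mul h1.conj).add (hasWirt_const ((s : ℂ) ^ 2) z)).inv h0)
  have e1 := h2.dz
  have e2 := h2.dzb
  unfold HasWirt cauchyReg at *
  convert h2 using 2
  · simp only [map_zero]
    ring
  · simp only [map_one]
    field_simp
    ring

lemma contDiff_cauchyReg (y : ℂ) {s : ℝ} (hs : 0 < s) {n : WithTop ℕ∞} :
    ContDiff ℝ n (cauchyReg y s) := by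
  have hconj : ContDiff ℝ n (fun z : ℂ => conj (z - y)) :=
    Complex.conjCLE.contDiff.comp (contDiff_id.sub contDiff_const)
  unfold cauchyReg
  refine hconj.mul (ContDiff.inv ?_ fun z => cauchyReg_denom_ne y z hs)
  fun_prop

lemma norm_cauchyReg_le (y z : ℂ) (s : ℝ) : ‖cauchyReg y s z‖ ≤ ‖z - y‖⁻¹ := by
  unfold cauchyReg
  rw [cauchyReg_denom, norm_mul, norm_inv, Complex.norm_real, RCLike.norm_conj,
    Real.norm_of_nonneg (by positivity)]
  rcases eq_or_ne (‖z - y‖) 0 with h | h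
  · simp [h]
  · have : 0 < ‖z - y‖ := lt_of_le_of_ne (norm_nonneg _) h.symm
    rw [← div_eq_mul_inv, inv_eq_one_div, div_le_div_iff₀ (by positivity) this]
    nlinarith [sq_nonneg s]

lemma norm_dz_cauchyReg_le (y z : ℂ) {s : ℝ} (hs : 0 < s) :
    ‖dz (cauchyReg y s) z‖ ≤ (‖z - y‖ ^ 2)⁻¹ := by
  rw [(hasWirt_cauchyReg y z hs).dz, cauchyReg_denom, norm_neg, norm_mul, norm_inv, norm_pow,
    norm_pow, Complex.norm_real, RCLike.norm_conj, Real.norm_of_nonneg (by positivity)]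
  rcases eq_or_ne (‖z - y‖) 0 with h | h
  · simp [h]
  · have : 0 < ‖z - y‖ := lt_of_le_of_ne (norm_nonneg _) h.symm
    rw [← div_eq_mul_inv, inv_eq_one_div, div_le_div_iff₀ (by positivity) (by positivity)]
    have : ‖z - y‖ ^ 2 ≤ ‖z - y‖ ^ 2 + s ^ 2 := by nlinarith [sq_nonneg s]
    nlinarith [sq_nonneg ‖z - y‖]

lemma integrable_one_add_normSq_inv_sq :
    Integrable (fun t : ℂ => ((1 + ‖t‖ ^ 2) ^ 2)⁻¹) := by
  have := integrable_rpow_neg_one_add_norm_sq (E := ℂ) (μ := volume) (r := 4) (by simp; norm_num)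
  refine this.congr (Eventually.of_forall fun t => ?_)
  have h : (0 : ℝ) < 1 + ‖t‖ ^ 2 := by positivity
  simp only
  rw [show (-4 : ℝ) / 2 = -((2 : ℕ) : ℝ) by norm_num, Real.rpow_neg h.le, Real.rpow_natCast]

lemma tendsto_integral_mul_approx {g : ℂ → ℂ} (hg : Continuous g) (hc : HasCompactSupport g)
    (y : ℂ) :
    Tendsto (fun s : ℝ => ∫ z, g z * ((s : ℂ) ^ 2 * (((z - y) * conj (z - y) + (s : ℂ) ^ 2) ^ 2)⁻¹))
      (nhdsWithin 0 (Ioi 0)) (nhds (g y * ((∫ t : ℂ, ((1 + ‖t‖ ^ 2) ^ 2)⁻¹ : ℝ) : ℂ))) := by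
  obtain ⟨C, hC⟩ := hc.exists_bound_of_continuous hg
  have h1 : Tendsto (fun s : ℝ => ∫ t : ℂ, g (y + s • t) * (((1 + ‖t‖ ^ 2) ^ 2)⁻¹ : ℝ))
      (nhdsWithin 0 (Ioi 0)) (nhds (∫ t : ℂ, g y * (((1 + ‖t‖ ^ 2) ^ 2)⁻¹ : ℝ))) := by
    refine tendsto_integral_filter_of_dominated_convergence
      (fun t => C * ((1 + ‖t‖ ^ 2) ^ 2)⁻¹) ?_ ?_
      (integrable_one_add_normSq_inv_sq.const_mul C) ?_
    · refine Eventually.of_forall fun s => Continuous.aestronglyMeasurable ?_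
      have : Continuous fun t : ℂ => (((1 + ‖t‖ ^ 2) ^ 2)⁻¹ : ℝ) :=
        Continuous.inv₀ (by fun_prop) fun t => by positivity
      fun_prop
    · refine Eventually.of_forall fun s => Eventually.of_forall fun t => ?_
      rw [norm_mul, Complex.norm_real, Real.norm_of_nonneg (by positivity)]
      exact mul_le_mul_of_nonneg_right (hC _) (by positivity)
    · refine Eventually.of_forall fun t => ?_
      have : Continuous fun s : ℝ => g (y + s • t) * (((1 + ‖t‖ ^ 2) ^ 2)⁻¹ : ℝ) := by fun_prop
      simpa using (this.tendsto 0).mono_left nhdsWithin_le_nhds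
  rw [integral_const_mul, integral_complex_ofReal] at h1
  refine h1.congr' ?_
  filter_upwards [self_mem_nhdsWithin] with s hs
  have hs : 0 < s := hs
  set f : ℂ → ℂ := fun u => g (y + u) * ((s : ℂ) ^ 2 * ((u * conj u + (s : ℂ) ^ 2) ^ 2)⁻¹) with hf
  have e1 : ∫ z, g z * ((s : ℂ) ^ 2 * (((z - y) * conj (z - y) + (s : ℂ) ^ 2) ^ 2)⁻¹) =
      ∫ u, f u := by
    rw [← integral_sub_right_eq_self f y]
    simp [hf]
  have e2 := Measure.integral_comp_smul volume f s
  rw [e1]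
  have e3 : ∫ u, f u = (s ^ 2) • ∫ u, f (s • u) := by
    rw [e2, Complex.finrank_real_complex, smul_smul, abs_of_pos (by positivity),
      mul_inv_cancel₀ (by positivity), one_smul]
  rw [e3, ← integral_smul]
  congr 1
  funext t
  have h3 : (s • t) * conj (s • t) + (s : ℂ) ^ 2 = (s : ℂ) ^ 2 * ((1 + ‖t‖ ^ 2 : ℝ) : ℂ) := by
    rw [Complex.mul_conj, Complex.normSq_eq_norm_sq, norm_smul, Real.norm_of_nonneg hs.le]
    push_cast; ring
  simp only [hf]
  rw [h3]
  simp only [Complex.real_smul]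
  have h4 : (s : ℂ) ≠ 0 := by exact_mod_cast hs.ne'
  have h5 : ((1 + ‖t‖ ^ 2 : ℝ) : ℂ) ≠ 0 := by
    exact_mod_cast (by positivity : (0 : ℝ) < 1 + ‖t‖ ^ 2).ne'
  push_cast at h5 ⊢
  field_simp

lemma enorm_quadDiff_le (N : ℕ) {v κ χ : ℂ → ℝ} (hv : ContDiff ℝ 2 v)
    (hκ : ContDiff ℝ 1 κ) (hχ : ContDiff ℝ 2 χ) (hc : HasCompactSupport χ)
    (hpde : ∀ z ∈ tsupport χ, lap v z = -(‖z‖ ^ (2 * N) * κ z * Real.exp (v z)))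
    {y : ℂ} (hy : χ y = 1) {A : ℝ}
    (hA : ∀ s : ℝ, 0 < s → ‖∫ z, quadDiff N v z * (dzb (fun y => (χ y : ℂ)) z * cauchyReg y s z)‖ ≤ A) :
    ‖quadDiff N v y * ((∫ t : ℂ, ((1 + ‖t‖ ^ 2) ^ 2)⁻¹ : ℝ) : ℂ)‖ₑ ≤ ENNReal.ofReal A +
      4⁻¹ * ∫⁻ z, ‖z‖ₑ ^ (2 * N + 1) * ‖dz (fun y => (κ y : ℂ)) z‖ₑ *
        ENNReal.ofReal (Real.exp (v z)) * ‖χ z‖ₑ * ‖z - y‖ₑ⁻¹ := by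
  set χc : ℂ → ℂ := fun y => (χ y : ℂ) with hχc
  have hχ2 : ContDiff ℝ 2 χc := contDiff_coe hχ
  have hcc : HasCompactSupport χc := hc.comp_left (g := Complex.ofReal) Complex.ofReal_zero
  have hts : tsupport χc = tsupport χ := by
    simp [tsupport, hχc, Function.support]
  have hg : Continuous fun z => quadDiff N v z * χc z :=
    (continuous_quadDiff N hv).mul hχ2.continuous
  have hgc : HasCompactSupport fun z => quadDiff N v z * χc z := hcc.mul_left
  have lim := (tendsto_integral_mul_approx hg hgc y).enorm
  simp only [hχc, hy, Complex.ofReal_one, mul_one] at lim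
  refine le_of_tendsto lim ?_
  filter_upwards [self_mem_nhdsWithin] with s hs
  have hs : 0 < s := hs
  have hk : ContDiff ℝ 2 (cauchyReg y s) := contDiff_cauchyReg y hs
  set ψ : ℂ → ℂ := fun z => χc z * cauchyReg y s z with hψ
  have hψ2 : ContDiff ℝ 2 ψ := hχ2.mul hk
  have hψc : HasCompactSupport ψ := hcc.mul_right
  have hsub : tsupport ψ ⊆ tsupport χ := by
    rw [← hts]; exact closure_mono (Function.support_mul_subset_left _ _)
  have main := integral_quadDiff_mul_dzb N hv hκ hψ2 hψc fun z hz => hpde z (hsub hz)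
  have e1 : ∀ z, quadDiff N v z * dzb ψ z = quadDiff N v z * (dzb χc z * cauchyReg y s z) +
      quadDiff N v z * χc z * ((s : ℂ) ^ 2 * (((z - y) * conj (z - y) + (s : ℂ) ^ 2) ^ 2)⁻¹) := by
    intro z
    rw [((hχ2.hasWirt (by norm_num) z).mul (hasWirt_cauchyReg y z hs)).dzb]
    ring
  have i1 : Integrable fun z => quadDiff N v z * (dzb χc z * cauchyReg y s z) := by
    refine Continuous.integrable_of_hasCompactSupport ?_ (hcc.dzb.mul_right.mul_left)
    have h1 := (ContDiff.dzb (n := 1) hχ2).continuous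
    exact (continuous_quadDiff N hv).mul (h1.mul hk.continuous)
  have i2 : Integrable fun z => quadDiff N v z * χc z *
      ((s : ℂ) ^ 2 * (((z - y) * conj (z - y) + (s : ℂ) ^ 2) ^ 2)⁻¹) := by
    refine Continuous.integrable_of_hasCompactSupport ?_ hgc.mul_right
    refine hg.mul (continuous_const.mul (Continuous.inv₀ ?_ fun z => ?_))
    · have := Complex.continuous_conj
      fun_prop
    · exact pow_ne_zero _ (cauchyReg_denom_ne y z hs)
  simp_rw [e1] at main
  rw [integral_add i1 i2] at main
  rw [eq_sub_of_add_eq' main]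
  refine (enorm_sub_le).trans ?_
  rw [add_comm]
  refine add_le_add ?_ ?_
  · rw [← ofReal_norm]
    exact ENNReal.ofReal_le_ofReal (hA s hs)
  · rw [enorm_mul]
    have : ‖(4 : ℂ)⁻¹‖ₑ = 4⁻¹ := by
      rw [enorm_inv (by norm_num)]
      congr 1
      rw [← ofReal_norm]; simp
    rw [this]
    refine mul_le_mul_right ((enorm_integral_le_lintegral_enorm _).trans (lintegral_mono fun z => ?_)) _
    have h1 : ‖Complex.exp (v z)‖ₑ = ENNReal.ofReal (Real.exp (v z)) := by
      rw [← ofReal_norm, ← Complex.ofReal_exp, Complex.norm_real,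
        Real.norm_of_nonneg (Real.exp_pos _).le]
    have h2 : ‖conj z‖ₑ = ‖z‖ₑ := by rw [← ofReal_norm, RCLike.norm_conj, ofReal_norm]
    have h3 : ‖χc z‖ₑ = ‖χ z‖ₑ := by
      rw [← ofReal_norm, Complex.norm_real, ofReal_norm]
    have h4 : ‖cauchyReg y s z‖ₑ ≤ ‖z - y‖ₑ⁻¹ := by
      rcases eq_or_ne (z - y) 0 with h | h
      · simp [h]
      · rw [← enorm_inv h, enorm_le_iff_norm_le, norm_inv]
        exact norm_cauchyReg_le y z s
    simp only [hψ, enorm_mul, enorm_pow, h1, h2, h3]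
    calc _ = ‖z‖ₑ ^ (2 * N + 1) * ‖dz (fun y => (κ y : ℂ)) z‖ₑ *
        ENNReal.ofReal (Real.exp (v z)) * ‖χ z‖ₑ * ‖cauchyReg y s z‖ₑ := by ring
      _ ≤ _ := by gcongr

lemma HasWirt.comp_real_mul {g : ℂ → ℂ} {a b z : ℂ} (c : ℝ) (hg : HasWirt g a b (c * z)) :
    HasWirt (fun y => g (c * y)) (c * a) (c * b) z := by
  have h1 : HasFDerivAt (fun y : ℂ => (c : ℂ) * y) (wirtL c 0) z := by
    have := (hasWirt_id z).const_mul (c : ℂ)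
    simpa [HasWirt] using this
  refine (HasFDerivAt.comp z hg h1).congr_fderiv ?_
  ext ω; simp; ring

lemma dzb_comp_real_mul {g : ℂ → ℂ} (hg : ContDiff ℝ 1 g) (c : ℝ) :
    dzb (fun y => g (c * y)) = fun z => c * dzb g (c * z) :=
  funext fun z => ((hg.hasWirt (by norm_num) (c * z)).comp_real_mul c).dzb

/-- The properties of the pair of cutoff functions at scale `R` used in the boundary estimate. -/
structure IsCutoffPair (A R : ℝ) (χ θ : ℂ → ℝ) : Prop where
  smooth : ContDiff ℝ 2 χ
  smooth' : ContDiff ℝ 2 θ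
  compact : HasCompactSupport χ
  compact' : HasCompactSupport θ
  tsupp : tsupport χ ⊆ closedBall 0 (5 * R / 8)
  tsupp' : tsupport θ ⊆ closedBall 0 (3 * R / 4) \ ball 0 (3 * R / 8)
  tsupp_dzb : tsupport (dzb fun z => (χ z : ℂ)) ⊆ closedBall 0 (5 * R / 8) \ ball 0 (R / 2)
  le_one : ∀ z, |χ z| ≤ 1
  eq_one : ∀ z ∈ ball (0 : ℂ) (R / 2), χ z = 1
  nonneg' : ∀ z, 0 ≤ θ z
  le_one' : ∀ z, θ z ≤ 1
  eq_one' : ∀ z ∈ closedBall (0 : ℂ) (5 * R / 8) \ ball 0 (R / 2), θ z = 1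
  dzb_le : ∀ z, ‖dzb (fun z => (χ z : ℂ)) z‖ ≤ A / R
  dz_dzb_le : ∀ z, ‖dz (dzb fun z => (χ z : ℂ)) z‖ ≤ A / R ^ 2
  dz_dzb_le' : ∀ z, ‖dz (dzb fun z => (θ z : ℂ)) z‖ ≤ A / R ^ 2

lemma exists_isCutoffPair : ∃ A : ℝ, 0 < A ∧ ∀ R : ℝ, 0 < R → ∃ χ θ, IsCutoffPair A R χ θ := by
  let f₁ : ContDiffBump (0 : ℂ) := ⟨1 / 2, 5 / 8, by norm_num, by norm_num⟩
  let f₂ : ContDiffBump (0 : ℂ) := ⟨5 / 8, 3 / 4, by norm_num, by norm_num⟩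
  let f₃ : ContDiffBump (0 : ℂ) := ⟨3 / 8, 1 / 2, by norm_num, by norm_num⟩
  set g : ℂ → ℝ := fun z => f₂ z - f₃ z with hg
  set fc : ℂ → ℂ := fun z => (f₁ z : ℂ) with hfc
  set gc : ℂ → ℂ := fun z => (g z : ℂ) with hgc
  have hf2 : ContDiff ℝ 2 fc := contDiff_coe f₁.contDiff
  have hg2 : ContDiff ℝ 2 gc := contDiff_coe (f₂.contDiff.sub f₃.contDiff)
  have hfs : HasCompactSupport fc :=
    f₁.hasCompactSupport.comp_left (g := Complex.ofReal) Complex.ofReal_zero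
  have hgs : HasCompactSupport gc :=
    (f₂.hasCompactSupport.sub f₃.hasCompactSupport).comp_left (g := Complex.ofReal)
      Complex.ofReal_zero
  obtain ⟨A₁, hA₁⟩ := hfs.dzb.exists_bound_of_continuous (ContDiff.dzb (n := 1) hf2).continuous
  obtain ⟨A₂, hA₂⟩ := hfs.dzb.dz.exists_bound_of_continuous
    (ContDiff.dz (n := 0) (ContDiff.dzb (n := 1) hf2)).continuous
  obtain ⟨A₃, hA₃⟩ := hgs.dzb.dz.exists_bound_of_continuous
    (ContDiff.dz (n := 0) (ContDiff.dzb (n := 1) hg2)).continuous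
  refine ⟨max 1 (max A₁ (max A₂ A₃)), by positivity, fun R hR => ?_⟩
  set A := max 1 (max A₁ (max A₂ A₃))
  have hcast : ∀ z : ℂ, ‖((R⁻¹ : ℝ) : ℂ) * z‖ = ‖z‖ / R := fun z => by
    rw [norm_mul, Complex.norm_real, Real.norm_of_nonneg (by positivity)]; field_simp
  have hlin : ContDiff ℝ 2 fun z : ℂ => ((R⁻¹ : ℝ) : ℂ) * z := by fun_prop
  have hf_one : ∀ z ∈ closedBall (0 : ℂ) (R / 2), f₁ ((R⁻¹ : ℝ) * z) = 1 := fun z hz => by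
    refine f₁.one_of_mem_closedBall ?_
    simp only [mem_closedBall_zero_iff] at hz ⊢
    rw [hcast, div_le_iff₀ hR]
    change ‖z‖ ≤ 1 / 2 * R
    linarith
  have hf_zero : ∀ z : ℂ, z ∉ closedBall (0 : ℂ) (5 * R / 8) → f₁ ((R⁻¹ : ℝ) * z) = 0 :=
    fun z hz => by
    refine f₁.zero_of_le_dist ?_
    simp only [mem_closedBall_zero_iff, not_le] at hz
    rw [dist_zero_right, hcast, le_div_iff₀ hR]
    change 5 / 8 * R ≤ _
    linarith
  have hts : tsupport (fun z : ℂ => f₁ ((R⁻¹ : ℝ) * z)) ⊆ closedBall 0 (5 * R / 8) := by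
    refine closure_minimal (fun z hz => ?_) isClosed_closedBall
    by_contra h
    exact hz (hf_zero z h)
  have hts' : tsupport (fun z : ℂ => g ((R⁻¹ : ℝ) * z)) ⊆
      closedBall 0 (3 * R / 4) \ ball 0 (3 * R / 8) := by
    refine closure_minimal (fun z hz => ?_) (isClosed_closedBall.sdiff isOpen_ball)
    simp only [Set.mem_sdiff, mem_closedBall_zero_iff, mem_ball_zero_iff, not_lt]
    constructor
    · by_contra! h
      refine hz ?_
      simp only [hg]
      rw [f₂.zero_of_le_dist, f₃.zero_of_le_dist, sub_self]
      · rw [dist_zero_right, hcast, le_div_iff₀ hR]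
        change 1 / 2 * R ≤ _
        linarith
      · rw [dist_zero_right, hcast, le_div_iff₀ hR]
        change 3 / 4 * R ≤ _
        linarith
    · by_contra! h
      refine hz ?_
      simp only [hg]
      rw [f₂.one_of_mem_closedBall, f₃.one_of_mem_closedBall, sub_self]
      · rw [mem_closedBall_zero_iff, hcast, div_le_iff₀ hR]
        change _ ≤ 3 / 8 * R
        linarith
      · rw [mem_closedBall_zero_iff, hcast, div_le_iff₀ hR]
        change _ ≤ 5 / 8 * R
        linarith
  have hd1 : (dzb fun z : ℂ => ((f₁ ((R⁻¹ : ℝ) * z) : ℝ) : ℂ)) =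
      fun z => ((R⁻¹ : ℝ) : ℂ) * dzb fc ((R⁻¹ : ℝ) * z) :=
    dzb_comp_real_mul (hf2.of_le (by norm_num)) R⁻¹
  have hd1' : (dzb fun z : ℂ => ((g ((R⁻¹ : ℝ) * z) : ℝ) : ℂ)) =
      fun z => ((R⁻¹ : ℝ) : ℂ) * dzb gc ((R⁻¹ : ℝ) * z) :=
    dzb_comp_real_mul (hg2.of_le (by norm_num)) R⁻¹
  have hd2 : ∀ (q : ℂ → ℂ), ContDiff ℝ 2 q → ∀ z : ℂ,
      dz (fun z => ((R⁻¹ : ℝ) : ℂ) * dzb q ((R⁻¹ : ℝ) * z)) z =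
      ((R⁻¹ : ℝ) : ℂ) * (((R⁻¹ : ℝ) : ℂ) * dz (dzb q) ((R⁻¹ : ℝ) * z)) := fun q hq z =>
    ((((ContDiff.dzb (n := 1) hq).hasWirt (by norm_num) _).comp_real_mul R⁻¹).const_mul _).dz
  have hnR : ‖((R⁻¹ : ℝ) : ℂ)‖ = R⁻¹ := by
    rw [Complex.norm_real, Real.norm_of_nonneg (by positivity)]
  refine ⟨fun z => f₁ ((R⁻¹ : ℝ) * z), fun z => g ((R⁻¹ : ℝ) * z), ?_⟩
  constructor
  · exact f₁.contDiff.comp hlin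
  · exact (f₂.contDiff.sub f₃.contDiff).comp hlin
  · exact (isCompact_closedBall _ _).of_isClosed_subset (isClosed_tsupport _) hts
  · exact (isCompact_closedBall _ _).of_isClosed_subset (isClosed_tsupport _)
      (hts'.trans sdiff_subset)
  · exact hts
  · exact hts'
  · refine closure_minimal (fun z hz => ?_) (isClosed_closedBall.sdiff isOpen_ball)
    constructor
    · by_contra h
      refine hz (dzb_eq_zero_of_notMem fun h' => h (hts ?_))
      refine closure_mono (fun x hx => ?_) h'
      simpa using hx
    · intro h
      refine hz ?_
      have : (fun z : ℂ => ((f₁ ((R⁻¹ : ℝ) * z) : ℝ) : ℂ)) =ᶠ[nhds z] fun _ => 1 := by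
        filter_upwards [isOpen_ball.mem_nhds h] with x hx
        rw [hf_one x (ball_subset_closedBall hx)]; simp
      rw [dzb, this.fderiv_eq]
      simp
  · intro z
    rw [abs_of_nonneg f₁.nonneg]; exact f₁.le_one
  · exact fun z hz => hf_one z (ball_subset_closedBall hz)
  · intro z
    simp only [hg, sub_nonneg]
    by_cases h : ‖z‖ ≤ 5 * R / 8
    · rw [f₂.one_of_mem_closedBall]
      · exact f₃.le_one
      · rw [mem_closedBall_zero_iff, hcast, div_le_iff₀ hR]
        change _ ≤ 5 / 8 * R
        linarith
    · rw [f₃.zero_of_le_dist]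
      · exact f₂.nonneg
      · rw [dist_zero_right, hcast, le_div_iff₀ hR]
        change 1 / 2 * R ≤ _
        linarith
  · intro z
    have := f₂.le_one (x := (R⁻¹ : ℝ) * z)
    have := f₃.nonneg (x := (R⁻¹ : ℝ) * z)
    simp only [hg]; linarith
  · intro z hz
    simp only [Set.mem_sdiff, mem_closedBall_zero_iff, mem_ball_zero_iff, not_lt] at hz
    simp only [hg]
    rw [f₂.one_of_mem_closedBall, f₃.zero_of_le_dist, sub_zero]
    · rw [dist_zero_right, hcast, le_div_iff₀ hR]
      change 1 / 2 * R ≤ _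
      linarith
    · rw [mem_closedBall_zero_iff, hcast, div_le_iff₀ hR]
      change _ ≤ 5 / 8 * R
      linarith
  · intro z
    rw [hd1, norm_mul, hnR, mul_comm, ← div_eq_mul_inv]
    gcongr
    exact (hA₁ _).trans (by simp [A])
  · intro z
    rw [hd1, hd2 fc hf2, norm_mul, norm_mul, hnR, div_eq_mul_inv, pow_two, mul_inv, ← mul_assoc,
      mul_comm]
    gcongr
    exact (hA₂ _).trans (by simp [A])
  · intro z
    rw [hd1', hd2 gc hg2, norm_mul, norm_mul, hnR, div_eq_mul_inv, pow_two, mul_inv, ← mul_assoc,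
      mul_comm]
    gcongr
    exact (hA₃ _).trans (by simp [A])

lemma integral_cutoff_mul_normSq_dz {w θ : ℂ → ℝ} (hw : ContDiff ℝ 2 w) (hθ : ContDiff ℝ 2 θ)
    (hc : HasCompactSupport θ) :
    ((∫ z, θ z * ‖dz (fun y => (w y : ℂ)) z‖ ^ 2 : ℝ) : ℂ) =
      ∫ z, (2⁻¹ * ((w z : ℂ) ^ 2 * dz (dzb fun y => (θ y : ℂ)) z) - 4⁻¹ * (θ z * w z * lap w z)) := by
  set wc : ℂ → ℂ := fun y => (w y : ℂ) with hwc
  set θc : ℂ → ℂ := fun y => (θ y : ℂ) with hθc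
  have hw2 : ContDiff ℝ 2 wc := contDiff_coe hw
  have hθ2 : ContDiff ℝ 2 θc := contDiff_coe hθ
  have hw1 : ContDiff ℝ 1 wc := hw2.of_le (by norm_num)
  have hθ1 : ContDiff ℝ 1 θc := hθ2.of_le (by norm_num)
  have hwz : ContDiff ℝ 1 (dz wc) := ContDiff.dz (n := 1) hw2
  have hθb : ContDiff ℝ 1 (dzb θc) := ContDiff.dzb (n := 1) hθ2
  have hθbz : ContDiff ℝ (0 : ℕ) (dz (dzb θc)) := ContDiff.dz (n := 0) hθb
  have hcc : HasCompactSupport θc := hc.comp_left (g := Complex.ofReal) Complex.ofReal_zero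
  set F : ℂ → ℂ := fun z => θc z * (wc z * dz wc z) with hF
  set G : ℂ → ℂ := fun z => dzb θc z * wc z ^ 2 with hG
  have hF1 : ContDiff ℝ 1 F := by fun_prop
  have hG1 : ContDiff ℝ 1 G := by fun_prop
  have hFc : HasCompactSupport F := hcc.mul_right
  have hGc : HasCompactSupport G := hcc.dzb.mul_right
  have hFi : Integrable (dzb F) := (ContDiff.dzb (n := 0) (by simpa using hF1)).continuous
    |>.integrable_of_hasCompactSupport hFc.dzb
  have hGi : Integrable (dz G) := (ContDiff.dz (n := 0) (by simpa using hG1)).continuous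
    |>.integrable_of_hasCompactSupport hGc.dz
  have key : ∀ z, ((θ z * ‖dz wc z‖ ^ 2 : ℝ) : ℂ) = (2⁻¹ * ((w z : ℂ) ^ 2 * dz (dzb θc) z) -
      4⁻¹ * (θ z * w z * lap w z)) + (dzb F z - 2⁻¹ * dz G z) := by
    intro z
    have e1 := hwz.hasWirt (by norm_num) z
    have e2 := hw1.hasWirt (by norm_num) z
    have e3 := hθ1.hasWirt (by norm_num) z
    have e4 := hθb.hasWirt (by norm_num) z
    have n1 : ((θ z * ‖dz wc z‖ ^ 2 : ℝ) : ℂ) = θc z * (dzb wc z * dz wc z) := by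
      rw [hwc, dzb_ofReal w (hw.differentiable (by norm_num) z), mul_comm (conj _), Complex.mul_conj,
        Complex.normSq_eq_norm_sq]
      push_cast; rfl
    rw [n1, hF, hG, (e3.mul (e2.mul e1)).dzb, (e4.mul (e2.pow 2)).dz, dzb_dz_ofReal hw z]
    simp only [hwc, hθc]
    push_cast
    ring
  have hmul : ∀ z, dz wc z * conj (dz wc z) = ((‖dz wc z‖ ^ 2 : ℝ) : ℂ) := fun z => by
    rw [Complex.mul_conj, Complex.normSq_eq_norm_sq]
  have i1 : Integrable fun z => ((θ z * ‖dz wc z‖ ^ 2 : ℝ) : ℂ) := by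
    refine Continuous.integrable_of_hasCompactSupport ?_ ?_
    · have := hwz.continuous
      have := hθ.continuous
      fun_prop
    · exact (hc.mul_right).comp_left (g := Complex.ofReal) Complex.ofReal_zero
  have i2 : Integrable fun z => dzb F z - 2⁻¹ * dz G z := hFi.sub (hGi.const_mul _)
  have i3 : Integrable fun z => (2⁻¹ * ((w z : ℂ) ^ 2 * dz (dzb θc) z) -
      4⁻¹ * (θ z * w z * lap w z)) := by
    refine (i1.sub i2).congr (Eventually.of_forall fun z => ?_)
    have := key z
    simp only [Pi.sub_apply]
    linear_combination this
  rw [← integral_complex_ofReal]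
  simp_rw [key]
  rw [integral_add i3 i2, integral_sub hFi (hGi.const_mul _), integral_const_mul,
    integral_dz_eq_zero hG1 hGc, integral_dzb_eq_zero hF1 hFc]
  simp

lemma integral_cutoff_mul_normSq_dz_le {w θ χ : ℂ → ℝ} {A R S m : ℝ} (hR : 0 < R) (hS : 0 ≤ S)
    (hw : ContDiff ℝ 2 w) (hc : IsCutoffPair A R χ θ)
    (hwS : ∀ z ∈ closedBall (0 : ℂ) (3 * R / 4) \ ball 0 (3 * R / 8), |w z| ≤ S)
    (hm : ∫ z in closedBall (0 : ℂ) (3 * R / 4) \ ball 0 (3 * R / 8), |lap w z| ≤ m) :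
    ∫ z, θ z * ‖dz (fun y => (w y : ℂ)) z‖ ^ 2 ≤ 2 * Real.pi * A * S ^ 2 + S * m := by
  set K := closedBall (0 : ℂ) (3 * R / 4) \ ball 0 (3 * R / 8) with hK
  have hKc : IsCompact K := (isCompact_closedBall _ _).diff isOpen_ball
  have hA : 0 ≤ A / R ^ 2 := (norm_nonneg _).trans (hc.dz_dzb_le 0)
  have hlap : Continuous (lap w) := by
    have h1 : ContDiff ℝ (0 : ℕ) (dzb (dz (fun z => (w z : ℂ)))) :=
      ContDiff.dzb (n := 0) (ContDiff.dz (n := 1) (contDiff_coe hw))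
    have h2 : lap w = fun z => (dzb (dz (fun z => (w z : ℂ))) z).re * 4 := by
      funext z
      rw [dzb_dz_ofReal hw z]
      simp
    rw [h2]
    have := h1.continuous
    fun_prop
  have h0 : ∀ z, z ∉ K → θ z = 0 := fun z hz =>
    image_eq_zero_of_notMem_tsupport fun h => hz (hc.tsupp' h)
  have hts : tsupport (fun z => (θ z : ℂ)) ⊆ K := by
    refine (closure_mono fun x hx => ?_).trans hc.tsupp'
    simpa using hx
  have h0' : ∀ z, z ∉ K → dz (dzb fun y => (θ y : ℂ)) z = 0 := fun z hz => by
    refine dz_eq_zero_of_notMem fun h => hz (hts ?_)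
    exact closure_minimal (fun x hx => by
      by_contra h'
      exact hx (dzb_eq_zero_of_notMem h')) (isClosed_tsupport _) h
  have e := integral_cutoff_mul_normSq_dz hw hc.smooth' hc.compact'
  have hnn : 0 ≤ ∫ z, θ z * ‖dz (fun y => (w y : ℂ)) z‖ ^ 2 :=
    integral_nonneg fun z => mul_nonneg (hc.nonneg' z) (by positivity)
  have hvol : (volume.real K) ≤ Real.pi * R ^ 2 := by
    have : volume.real K ≤ volume.real (closedBall (0 : ℂ) R) := by
      refine measureReal_mono (fun z hz => ?_) ?_
      · exact closedBall_subset_closedBall (by linarith) hz.1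
      · exact (isCompact_closedBall _ _).measure_lt_top.ne
    refine this.trans (le_of_eq ?_)
    simp [Measure.real, Complex.volume_closedBall, hR.le]
    ring
  have i1 : IntegrableOn (fun z => (2⁻¹ * (S ^ 2 * (A / R ^ 2)) : ℝ)) K :=
    integrableOn_const hKc.measure_lt_top.ne
  have i2 : IntegrableOn (fun z => 4⁻¹ * (S * |lap w z|)) K :=
    (Continuous.continuousOn (by fun_prop)).integrableOn_compact hKc
  calc _ = ‖((∫ z, θ z * ‖dz (fun y => (w y : ℂ)) z‖ ^ 2 : ℝ) : ℂ)‖ := by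
        rw [Complex.norm_real, Real.norm_of_nonneg hnn]
    _ = ‖∫ z in K, (2⁻¹ * ((w z : ℂ) ^ 2 * dz (dzb fun y => (θ y : ℂ)) z) -
          4⁻¹ * (θ z * w z * lap w z))‖ := by
        rw [e, setIntegral_eq_integral_of_forall_compl_eq_zero]
        intro z hz
        rw [h0 z hz, h0' z hz]; simp
    _ ≤ ∫ z in K, (2⁻¹ * (S ^ 2 * (A / R ^ 2)) + 4⁻¹ * (S * |lap w z|)) := by
        refine norm_integral_le_of_norm_le (i1.add i2) ?_
        refine (ae_restrict_iff' hKc.measurableSet).2 (Eventually.of_forall fun z hz => ?_)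
        refine (norm_sub_le _ _).trans ?_
        simp only [norm_mul, norm_inv, Complex.norm_real, Complex.norm_ofNat, norm_pow,
          Real.norm_eq_abs]
        have hb := hwS z hz
        have hθ : |θ z| ≤ 1 := by rw [abs_of_nonneg (hc.nonneg' z)]; exact hc.le_one' z
        refine add_le_add ?_ ?_
        · have := hc.dz_dzb_le' z
          gcongr
        · refine mul_le_mul_of_nonneg_left ?_ (by norm_num)
          refine mul_le_mul_of_nonneg_right ?_ (abs_nonneg _)
          calc |θ z| * |w z| ≤ 1 * S := by gcongr
            _ = S := one_mul S
    _ = volume.real K * (2⁻¹ * (S ^ 2 * (A / R ^ 2))) + 4⁻¹ * (S * ∫ z in K, |lap w z|) := by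
        rw [integral_add i1 i2, setIntegral_const, integral_const_mul, integral_const_mul,
          smul_eq_mul]
    _ ≤ Real.pi * R ^ 2 * (2⁻¹ * (S ^ 2 * (A / R ^ 2))) + 4⁻¹ * (S * m) := by gcongr
    _ ≤ _ := by
        have hm0 : 0 ≤ m := (integral_nonneg fun z => abs_nonneg _).trans hm
        have : 0 ≤ S * m := mul_nonneg hS hm0
        have hA' : 0 ≤ A := by
          have := mul_nonneg hA (sq_nonneg R)
          rwa [div_mul_cancel₀ _ (by positivity)] at this
        have h3 : Real.pi * R ^ 2 * (2⁻¹ * (S ^ 2 * (A / R ^ 2))) = 2⁻¹ * (Real.pi * A * S ^ 2) := by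
          field_simp
        rw [h3]
        have : 0 ≤ Real.pi * A * S ^ 2 := by positivity
        nlinarith

lemma quadDiff_sub (N : ℕ) {v V : ℂ → ℝ} (hv : ContDiff ℝ 2 v) (hV : ContDiff ℝ 2 V) (z : ℂ) :
    quadDiff N v z = quadDiff N V z + (z * dz (dz fun y => ((v y - V y : ℝ) : ℂ)) z
      - z * dz (fun y => (V y : ℂ)) z * dz (fun y => ((v y - V y : ℝ) : ℂ)) z
      - 2⁻¹ * (z * dz (fun y => ((v y - V y : ℝ) : ℂ)) z ^ 2)
      - N * dz (fun y => ((v y - V y : ℝ) : ℂ)) z) := by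
  have hv1 : ContDiff ℝ 2 fun y => (v y : ℂ) := contDiff_coe hv
  have hV1 : ContDiff ℝ 2 fun y => (V y : ℂ) := contDiff_coe hV
  have e1 : (dz fun y => ((v y - V y : ℝ) : ℂ)) =
      fun z => dz (fun y => (v y : ℂ)) z - dz (fun y => (V y : ℂ)) z := by
    funext z
    simp only [Complex.ofReal_sub]
    exact ((hv1.hasWirt (by norm_num) z).sub (hV1.hasWirt (by norm_num) z)).dz
  have hvz : ContDiff ℝ 1 (dz fun y => (v y : ℂ)) := ContDiff.dz (n := 1) hv1
  have hVz : ContDiff ℝ 1 (dz fun y => (V y : ℂ)) := ContDiff.dz (n := 1) hV1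
  rw [e1, ((hvz.hasWirt (by norm_num) z).sub (hVz.hasWirt (by norm_num) z)).dz]
  unfold quadDiff
  ring

lemma norm_integral_quadDiff_cutoff_le {N : ℕ} {v V θ χ : ℂ → ℝ} {A D R S m : ℝ} (hR : 0 < R)
    (hA : 0 < A) (hD : 0 ≤ D)
    (hS : 0 < S) (hm0 : 0 ≤ m) (hv : ContDiff ℝ 2 v) (hV : ContDiff ℝ 2 V)
    (hc : IsCutoffPair A R χ θ)
    (hwS : ∀ z ∈ closedBall (0 : ℂ) (3 * R / 4) \ ball 0 (3 * R / 8), |v z - V z| ≤ S)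
    (hm : ∫ z in closedBall (0 : ℂ) (3 * R / 4) \ ball 0 (3 * R / 8),
      |lap (fun y => v y - V y) z| ≤ m)
    (hVq : ∀ z ∈ closedBall (0 : ℂ) (3 * R / 4) \ ball 0 (3 * R / 8), quadDiff N V z = 0)
    (hVz : ∀ z ∈ closedBall (0 : ℂ) (3 * R / 4) \ ball 0 (3 * R / 8),
      ‖z * dz (fun y => (V y : ℂ)) z‖ ≤ D)
    {y : ℂ} (hy : ‖y‖ ≤ R / 8) {s : ℝ} (hs : 0 < s) :
    ‖∫ z, quadDiff N v z * (dzb (fun y => (χ y : ℂ)) z * cauchyReg y s z)‖ ≤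
      200 * A * (1 + D + N) * (1 + A) * ((S + m) * (1 + S)) / R := by
  set w : ℂ → ℝ := fun y => v y - V y with hw
  have hw2 : ContDiff ℝ 2 w := hv.sub hV
  set wz : ℂ → ℂ := dz fun y => (w y : ℂ) with hwz
  set K := closedBall (0 : ℂ) (3 * R / 4) \ ball 0 (3 * R / 8) with hK
  set K' := closedBall (0 : ℂ) (5 * R / 8) \ ball 0 (R / 2) with hK'
  have hKK : K' ⊆ K := fun z hz => by
    simp only [hK, hK', Set.mem_sdiff, mem_closedBall_zero_iff, mem_ball_zero_iff, not_lt] at hz ⊢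
    constructor <;> linarith [hz.1, hz.2]
  have hχ2 : ContDiff ℝ 2 fun y => (χ y : ℂ) := contDiff_coe hc.smooth
  have hχb : ContDiff ℝ 1 (dzb fun y => (χ y : ℂ)) := ContDiff.dzb (n := 1) hχ2
  have hwz1 : ContDiff ℝ 1 wz := ContDiff.dz (n := 1) (contDiff_coe hw2)
  have hk1 : ContDiff ℝ 1 (cauchyReg y s) := contDiff_cauchyReg y hs
  set k : ℂ → ℂ := fun z => dzb (fun y => (χ y : ℂ)) z * cauchyReg y s z with hk
  have hkc1 : ContDiff ℝ 1 k := hχb.mul hk1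
  have hcc : HasCompactSupport fun y => (χ y : ℂ) :=
    hc.compact.comp_left (g := Complex.ofReal) Complex.ofReal_zero
  have hkc : HasCompactSupport k := hcc.dzb.mul_right
  have hkts : tsupport k ⊆ K' :=
    (closure_mono (Function.support_mul_subset_left _ _)).trans hc.tsupp_dzb
  have hkz : ∀ z, z ∉ K' → k z = 0 := fun z hz =>
    image_eq_zero_of_notMem_tsupport fun h => hz (hkts h)
  have hkz' : ∀ z, z ∉ K' → dz k z = 0 := fun z hz => dz_eq_zero_of_notMem fun h => hz (hkts h)
  -- the integrand after one integration by parts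
  set F : ℂ → ℂ := fun z => z * k z * wz z with hF
  have hF1 : ContDiff ℝ 1 F := by fun_prop
  have hFc : HasCompactSupport F := (hkc.mul_left).mul_right
  set J : ℂ → ℂ := fun z => -(k z + z * dz k z + z * dz (fun y => (V y : ℂ)) z * k z + N * k z) * wz z
    - 2⁻¹ * (z * k z * wz z ^ 2) with hJ
  have key : ∀ z, quadDiff N v z * k z = J z + dz F z := by
    intro z
    by_cases hz : z ∈ K'
    · have e1 := hasWirt_id z
      have e2 := hkc1.hasWirt (by norm_num) z
      have e3 := hwz1.hasWirt (by norm_num) z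
      rw [quadDiff_sub N hv hV z, hVq z (hKK hz), hF, ((e1.mul e2).mul e3).dz]
      simp only [hJ, hwz, hw]
      ring
    · have e1 := hasWirt_id z
      have e2 := hkc1.hasWirt (by norm_num) z
      have e3 := hwz1.hasWirt (by norm_num) z
      rw [hF, ((e1.mul e2).mul e3).dz]
      simp only [hJ, hkz z hz, hkz' z hz]
      ring
  have hFi : Integrable (dz F) := (ContDiff.dz (n := 0) (by simpa using hF1)).continuous
    |>.integrable_of_hasCompactSupport hFc.dz
  have hqi : Integrable fun z => quadDiff N v z * k z :=
    ((continuous_quadDiff N hv).mul hkc1.continuous).integrable_of_hasCompactSupport hkc.mul_left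
  have hJi : Integrable J := by
    refine (hqi.sub hFi).congr (Eventually.of_forall fun z => ?_)
    simp only [Pi.sub_apply]
    rw [key z]; ring
  have e : ∫ z, quadDiff N v z * k z = ∫ z, J z := by
    simp_rw [key]
    rw [integral_add hJi hFi, integral_dz_eq_zero hF1 hFc, add_zero]
  rw [e]
  -- pointwise bounds
  have hdist : ∀ z ∈ K', 3 * R / 8 ≤ ‖z - y‖ := fun z hz => by
    simp only [hK', Set.mem_sdiff, mem_closedBall_zero_iff, mem_ball_zero_iff, not_lt] at hz
    have := norm_sub_norm_le z y
    linarith [hz.2]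
  have hinv : ∀ z ∈ K', ‖z - y‖⁻¹ ≤ 8 / (3 * R) := fun z hz => by
    have := inv_anti₀ (by positivity) (hdist z hz)
    refine this.trans (le_of_eq ?_)
    rw [inv_div]
  have hkb : ∀ z ∈ K', ‖k z‖ ≤ 8 / 3 * A / R ^ 2 := fun z hz => by
    calc ‖k z‖ = ‖dzb (fun y => (χ y : ℂ)) z‖ * ‖cauchyReg y s z‖ := norm_mul _ _
      _ ≤ A / R * (8 / (3 * R)) :=
        mul_le_mul (hc.dzb_le z) ((norm_cauchyReg_le y z s).trans (hinv z hz)) (norm_nonneg _)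
          (by positivity)
      _ = _ := by field_simp
  have hkb' : ∀ z ∈ K', ‖dz k z‖ ≤ 88 / 9 * A / R ^ 3 := fun z hz => by
    rw [hk, ((hχb.hasWirt (by norm_num) z).mul (hk1.hasWirt (by norm_num) z)).dz]
    calc _ ≤ ‖dz (dzb fun y => (χ y : ℂ)) z‖ * ‖cauchyReg y s z‖ +
          ‖dzb (fun y => (χ y : ℂ)) z‖ * ‖dz (cauchyReg y s) z‖ := by
          refine (norm_add_le _ _).trans ?_
          rw [norm_mul, norm_mul]
      _ ≤ A / R ^ 2 * (8 / (3 * R)) + A / R * (8 / (3 * R)) ^ 2 := by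
          refine add_le_add ?_ ?_
          · exact mul_le_mul (hc.dz_dzb_le z) ((norm_cauchyReg_le y z s).trans (hinv z hz))
              (norm_nonneg _) (by positivity)
          · refine mul_le_mul (hc.dzb_le z) ((norm_dz_cauchyReg_le y z hs).trans ?_)
              (norm_nonneg _) (by positivity)
            rw [← inv_pow]
            exact pow_le_pow_left₀ (by positivity) (hinv z hz) 2
      _ = _ := by field_simp; norm_num
  have hzR : ∀ z ∈ K', ‖z‖ ≤ 5 * R / 8 := fun z hz => by simpa using hz.1
  set c : ℝ := 10 * A * (1 + D + N) with hcdef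
  have hN0 : (0 : ℝ) ≤ N := Nat.cast_nonneg N
  have hc0 : 0 < c := by positivity
  set t := S + m with ht
  have ht0 : 0 < t := by positivity
  have hJb : ∀ z, ‖J z‖ ≤ (closedBall (0 : ℂ) R).indicator (fun _ => c * t / R ^ 3) z +
      c / R * (1 + 1 / t) * (θ z * ‖wz z‖ ^ 2) := fun z => by
    by_cases hz : z ∈ K'
    · have hzR' : z ∈ closedBall (0 : ℂ) R := by
        have := hzR z hz
        simp; linarith
      rw [indicator_of_mem hzR', hc.eq_one' z hz]
      have b1 : ‖k z + z * dz k z + z * dz (fun y => (V y : ℂ)) z * k z + N * k z‖ ≤ c / R ^ 2 := by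
        calc _ ≤ ‖k z‖ + ‖z‖ * ‖dz k z‖ + ‖z * dz (fun y => (V y : ℂ)) z‖ * ‖k z‖ + N * ‖k z‖ := by
              refine (norm_add_le _ _).trans (add_le_add ((norm_add_le _ _).trans
                (add_le_add ((norm_add_le _ _).trans (add_le_add le_rfl ?_)) ?_)) ?_)
              · rw [norm_mul]
              · rw [norm_mul]
              · rw [norm_mul]; simp
          _ ≤ 8 / 3 * A / R ^ 2 + (5 * R / 8) * (88 / 9 * A / R ^ 3) + D * (8 / 3 * A / R ^ 2) +
              N * (8 / 3 * A / R ^ 2) := by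
              have := hkb z hz
              have := hkb' z hz
              have := hzR z hz
              have := hVz z (hKK hz)
              gcongr
          _ = A * (8 / 3 + 55 / 9 + 8 / 3 * D + 8 / 3 * N) / R ^ 2 := by field_simp; ring
          _ ≤ c / R ^ 2 := by
              gcongr
              rw [hcdef]
              nlinarith [mul_nonneg hA.le hD, mul_nonneg hA.le hN0]
      have b2 : ‖2⁻¹ * (z * k z * wz z ^ 2)‖ ≤ c / R * ‖wz z‖ ^ 2 := by
        rw [norm_mul, norm_mul, norm_mul, norm_pow, ← mul_assoc]
        refine mul_le_mul_of_nonneg_right ?_ (by positivity)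
        calc ‖(2⁻¹ : ℂ)‖ * (‖z‖ * ‖k z‖) ≤ 2⁻¹ * ((5 * R / 8) * (8 / 3 * A / R ^ 2)) := by
              have := hkb z hz
              have := hzR z hz
              have h2 : ‖(2⁻¹ : ℂ)‖ = 2⁻¹ := by simp
              rw [h2]
              gcongr
          _ = (5 / 6 * A) / R := by field_simp; norm_num
          _ ≤ c / R := by
              gcongr
              rw [hcdef]
              nlinarith [mul_nonneg hA.le hD, mul_nonneg hA.le hN0]
      have b3 : c / R ^ 2 * ‖wz z‖ ≤ c * t / R ^ 3 + c / R * (1 / t) * ‖wz z‖ ^ 2 := by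
        have h1 : ‖wz z‖ ≤ t / R + R * (1 / t) * ‖wz z‖ ^ 2 := by
          have h2 : 0 ≤ t / R := by positivity
          have h3 : R * (1 / t) * ‖wz z‖ ^ 2 = ‖wz z‖ ^ 2 / (t / R) := by field_simp
          rw [h3, ← sub_nonneg]
          have h4 : 0 ≤ (‖wz z‖ - t / R) ^ 2 + ‖wz z‖ * (t / R) := by positivity
          have h5 : t / R + ‖wz z‖ ^ 2 / (t / R) - ‖wz z‖ =
            ((‖wz z‖ - t / R) ^ 2 + ‖wz z‖ * (t / R)) / (t / R) := by
              field_simp; ring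
          rw [h5]; positivity
        calc c / R ^ 2 * ‖wz z‖ ≤ c / R ^ 2 * (t / R + R * (1 / t) * ‖wz z‖ ^ 2) := by gcongr
          _ = _ := by field_simp
      calc ‖J z‖ ≤ c / R ^ 2 * ‖wz z‖ + c / R * ‖wz z‖ ^ 2 := by
            refine (norm_sub_le _ _).trans (add_le_add ?_ b2)
            rw [norm_mul, norm_neg]
            gcongr
        _ ≤ c * t / R ^ 3 + c / R * (1 / t) * ‖wz z‖ ^ 2 + c / R * ‖wz z‖ ^ 2 := by gcongr
        _ = _ := by ring
    · have : J z = 0 := by simp [hJ, hkz z hz, hkz' z hz]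
      rw [this, norm_zero]
      have := hc.nonneg' z
      refine add_nonneg (indicator_nonneg (fun _ _ => by positivity) _) (by positivity)
  have hcac := integral_cutoff_mul_normSq_dz_le hR hS.le hw2 hc hwS hm
  have i1 : Integrable ((closedBall (0 : ℂ) R).indicator (fun _ => c * t / R ^ 3)) :=
    (integrable_indicator_iff measurableSet_closedBall).2
      (integrableOn_const (isCompact_closedBall _ _).measure_lt_top.ne)
  have i2 : Integrable fun z => θ z * ‖wz z‖ ^ 2 := by
    refine Continuous.integrable_of_hasCompactSupport ?_ hc.compact'.mul_right
    have := hwz1.continuous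
    have := hc.smooth'.continuous
    fun_prop
  have hvol : volume.real (closedBall (0 : ℂ) R) = Real.pi * R ^ 2 := by
    simp [Measure.real, Complex.volume_closedBall, hR.le]
    ring
  have hpi : Real.pi ≤ 4 := Real.pi_le_four
  calc ‖∫ z, J z‖ ≤ ∫ z, ((closedBall (0 : ℂ) R).indicator (fun _ => c * t / R ^ 3) z +
      c / R * (1 + 1 / t) * (θ z * ‖wz z‖ ^ 2)) :=
        norm_integral_le_of_norm_le (i1.add (i2.const_mul _)) (Eventually.of_forall hJb)
    _ = Real.pi * R ^ 2 * (c * t / R ^ 3) + c / R * (1 + 1 / t) * ∫ z, θ z * ‖wz z‖ ^ 2 := by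
        rw [integral_add i1 (i2.const_mul _), integral_indicator measurableSet_closedBall,
          setIntegral_const, integral_const_mul, smul_eq_mul, hvol]
    _ ≤ 4 * R ^ 2 * (c * t / R ^ 3) + c / R * (1 + 1 / t) * (2 * 4 * A * S ^ 2 + S * m) := by
        gcongr
        refine hcac.trans ?_
        gcongr
    _ = c / R * (4 * t + (1 + 1 / t) * (8 * A * S ^ 2 + S * m)) := by field_simp; ring
    _ ≤ c / R * (4 * t + (1 + 1 / t) * ((8 * A + 1) * (S * t))) := by
        gcongr
        rw [ht]
        nlinarith [mul_nonneg hS.le hm0, mul_nonneg hA.le (mul_nonneg hS.le hm0), sq_nonneg S]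
    _ = c / R * (4 * t + (8 * A + 1) * (S * t + S)) := by field_simp
    _ ≤ c / R * (20 * (1 + A) * (t * (1 + S))) := by
        gcongr
        have h1 : S ≤ t := by linarith
        have h2 : 0 ≤ S * t := by positivity
        nlinarith [mul_nonneg hA.le h2, mul_nonneg hA.le ht0.le, mul_nonneg hA.le (sub_nonneg.2 h1)]
    _ = _ := by rw [hcdef]; ring

lemma HasWirt.comp_real {t : ℂ → ℝ} {f : ℝ → ℝ} {a b y : ℂ} {d : ℝ}
    (h : HasWirt (fun z => (t z : ℂ)) a b y) (hf : HasDerivAt f d (t y)) :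
    HasWirt (fun z => (f (t z) : ℂ)) (d * a) (d * b) y := by
  have h0 : HasFDerivAt t (Complex.reCLM.comp (wirtL a b)) y := 
    Complex.reCLM.hasFDerivAt.comp y h
  have h1 : Complex.ofRealCLM.comp (Complex.reCLM.comp (wirtL a b)) = wirtL a b :=
    (Complex.ofRealCLM.hasFDerivAt.comp y h0).unique h
  have h2 := Complex.ofRealCLM.hasFDerivAt.comp y (hf.comp_hasFDerivAt y h0)
  refine h2.congr_fderiv ?_
  ext ω
  have h3 := DFunLike.congr_fun h1 ω
  simp only [ContinuousLinearMap.comp_apply, Complex.ofRealCLM_apply, Complex.reCLM_apply] at h3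
  simp only [ContinuousLinearMap.comp_apply, Complex.ofRealCLM_apply, Complex.reCLM_apply,
    _root_.smul_apply, smul_eq_mul, Complex.ofReal_mul, h3]
  simp [wirtL]
  ring

lemma hasDerivAt_comp_min_one {f f' : ℝ → ℝ} (h : ∀ t, 0 < t → HasDerivAt f (f' t) t)
    (h1 : f' 1 = 0) {t : ℝ} (ht : 0 < t) :
    HasDerivAt (fun x => f (min x 1)) (f' (min t 1)) t := by
  rcases lt_trichotomy t 1 with h2 | h2 | h2
  · rw [min_eq_left h2.le]
    refine (h t ht).congr_of_eventuallyEq ?_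
    filter_upwards [Iio_mem_nhds h2] with x hx
    rw [min_eq_left (le_of_lt hx)]
  · subst h2
    rw [min_self, ← hasDerivWithinAt_univ, ← Iic_union_Ici (a := (1 : ℝ))]
    refine HasDerivWithinAt.union ?_ ?_
    · exact (h 1 ht).hasDerivWithinAt.congr (fun x hx => by rw [min_eq_left hx]) (by simp)
    · rw [h1]
      exact (hasDerivWithinAt_const 1 _ (f 1)).congr (fun x hx => by rw [min_eq_right hx]) (by simp)
  · rw [min_eq_right h2.le, h1]
    refine (hasDerivAt_const t (f 1)).congr_of_eventuallyEq ?_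
    filter_upwards [Ioi_mem_nhds h2] with x hx
    rw [min_eq_right (le_of_lt hx)]

/-- A truncation of `-(log t) / 2`, as a function of the squared distance. -/
def truncLog (t : ℝ) : ℝ :=
  (-Real.log (min t 1) - (1 - min t 1) - (1 - min t 1) ^ 2 / 2) / 2

/-- The first derivative of `truncLog`. -/
def truncLog₁ (t : ℝ) : ℝ := -(1 - min t 1) ^ 2 / (2 * min t 1)

/-- The second derivative of `truncLog`. -/
def truncLog₂ (t : ℝ) : ℝ := ((min t 1 ^ 2)⁻¹ - 1) / 2

lemma hasDerivAt_truncLog {t : ℝ} (ht : 0 < t) : HasDerivAt truncLog (truncLog₁ t) t := by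
  refine hasDerivAt_comp_min_one (f := fun x => (-Real.log x - (1 - x) - (1 - x) ^ 2 / 2) / 2)
    (f' := fun x => -(1 - x) ^ 2 / (2 * x)) (fun x hx => ?_) (by norm_num) ht
  have h1 : HasDerivAt (fun x : ℝ => 1 - x) (-1) x := by
    simpa using (hasDerivAt_id x).const_sub 1
  have h2 := ((((Real.hasDerivAt_log hx.ne').neg).sub h1).sub ((h1.pow 2).div_const 2)).div_const 2
  refine h2.congr_deriv ?_
  field_simp
  push_cast
  ring

lemma hasDerivAt_truncLog₁ {t : ℝ} (ht : 0 < t) : HasDerivAt truncLog₁ (truncLog₂ t) t := by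
  refine hasDerivAt_comp_min_one (f := fun x => -(1 - x) ^ 2 / (2 * x))
    (f' := fun x => ((x ^ 2)⁻¹ - 1) / 2) (fun x hx => ?_) (by norm_num) ht
  have h1 : HasDerivAt (fun x : ℝ => 1 - x) (-1) x := by
    simpa using (hasDerivAt_id x).const_sub 1
  have h2 := ((h1.pow 2).neg).div ((hasDerivAt_id x).const_mul 2) (by simpa using hx.ne')
  refine h2.congr_deriv ?_
  simp
  field_simp
  ring

lemma continuousOn_truncLog₂ : ContinuousOn truncLog₂ (Ioi 0) := by
  unfold truncLog₂
  have : ∀ x ∈ Ioi (0 : ℝ), min x 1 ^ 2 ≠ 0 := fun x hx => by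
    have : (0 : ℝ) < min x 1 := lt_min hx one_pos
    positivity
  exact ((ContinuousOn.inv₀ (by fun_prop) this).sub continuousOn_const).div_const 2

lemma contDiffAt_one_of_hasDerivAt {f f' : ℝ → ℝ} (h : ∀ t, 0 < t → HasDerivAt f (f' t) t)
    (hc : ContinuousOn f' (Ioi 0)) {t : ℝ} (ht : 0 < t) : ContDiffAt ℝ 1 f t := by
  rw [contDiffAt_one_iff]
  refine ⟨fun x => ContinuousLinearMap.toSpanSingleton ℝ (f' x), Ioi 0, Ioi_mem_nhds ht, ?_,
    fun x hx => (h x hx).hasFDerivAt⟩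
  exact (ContinuousLinearMap.toSpanSingletonCLE (𝕜 := ℝ) (E := ℝ)).continuous.comp_continuousOn hc

lemma truncLog_eq_zero {t : ℝ} (ht : 1 ≤ t) : truncLog t = 0 := by
  simp [truncLog, min_eq_right ht]

lemma truncLog₁_eq_zero {t : ℝ} (ht : 1 ≤ t) : truncLog₁ t = 0 := by
  simp [truncLog₁, min_eq_right ht]

lemma truncLog_nonneg {t : ℝ} (ht : 0 < t) : 0 ≤ truncLog t := by
  have h0 : (0 : ℝ) < min t 1 := lt_min ht one_pos
  have h1 : min t 1 ≤ 1 := min_le_right _ _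
  set x := min t 1 with hx
  have h4 : ∀ y, 0 < y → HasDerivAt
      (fun x => (-Real.log x - (1 - x) - (1 - x) ^ 2 / 2) / 2) (-(1 - y) ^ 2 / (2 * y)) y := by
    intro x hx
    have h1 : HasDerivAt (fun x : ℝ => 1 - x) (-1) x := by
      simpa using (hasDerivAt_id x).const_sub 1
    have h2 := ((((Real.hasDerivAt_log hx.ne').neg).sub h1).sub ((h1.pow 2).div_const 2)).div_const 2
    refine h2.congr_deriv ?_
    field_simp
    push_cast
    ring
  have h5 : AntitoneOn (fun x : ℝ => (-Real.log x - (1 - x) - (1 - x) ^ 2 / 2) / 2) (Ioi 0) := by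
    refine antitoneOn_of_deriv_nonpos (convex_Ioi 0)
      (fun y hy => (h4 y hy).continuousAt.continuousWithinAt) (fun y hy => ?_) (fun y hy => ?_)
    · rw [interior_Ioi] at hy
      exact (h4 y hy).differentiableAt.differentiableWithinAt
    · rw [interior_Ioi] at hy
      have hy : 0 < y := hy
      rw [(h4 y hy).deriv]
      exact div_nonpos_of_nonpos_of_nonneg (by nlinarith [sq_nonneg (1 - y)]) (by positivity)
  have h6 := h5 h0 (mem_Ioi.2 one_pos) h1
  simp only [truncLog]
  norm_num at h6
  rw [← hx]
  linarith

lemma truncLog_le {t : ℝ} (h1 : t ≤ 1) : truncLog t ≤ -Real.log t / 2 := by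
  rw [truncLog, min_eq_left h1]
  nlinarith [sq_nonneg (1 - t)]

lemma le_truncLog {t : ℝ} (ht : 0 < t) : -Real.log t / 2 - 3 / 4 ≤ truncLog t := by
  rcases le_total t 1 with h1 | h1
  · rw [truncLog, min_eq_left h1]
    nlinarith [sq_nonneg (1 - t)]
  · rw [truncLog_eq_zero h1]
    have := Real.log_nonneg h1
    linarith

/-- Regularised and rescaled squared distance to `c`. -/
def sqDist (c : ℂ) (r s : ℝ) (z : ℂ) : ℝ := (‖z - c‖ ^ 2 + s ^ 2) / r ^ 2

lemma sqDist_pos (c z : ℂ) {r s : ℝ} (hr : 0 < r) (hs : 0 < s) : 0 < sqDist c r s z := by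
  unfold sqDist; positivity

lemma contDiff_sqDist (c : ℂ) (r s : ℝ) : ContDiff ℝ 2 (sqDist c r s) := by
  unfold sqDist
  have : ContDiff ℝ 2 fun z : ℂ => ‖z - c‖ ^ 2 := (contDiff_id.sub contDiff_const).norm_sq ℝ
  fun_prop

lemma one_le_sqDist {c z : ℂ} {r s : ℝ} (hr : 0 < r) (hz : z ∉ ball c r) : 1 ≤ sqDist c r s z := by
  rw [mem_ball, not_lt, dist_eq_norm] at hz
  rw [sqDist, le_div_iff₀ (by positivity)]
  nlinarith [sq_nonneg s]

lemma hasWirt_sqDist (c y : ℂ) (r s : ℝ) :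
    HasWirt (fun z => (sqDist c r s z : ℂ)) (conj (y - c) / r ^ 2) ((y - c) / r ^ 2) y := by
  have h1 : HasWirt (fun z => z - c) 1 0 y := by
    simpa using (hasWirt_id y).sub (hasWirt_const c y)
  have h2 := ((h1.mul h1.conj).add (hasWirt_const ((s : ℂ) ^ 2) y)).const_mul (((r : ℂ) ^ 2)⁻¹)
  have e : (fun z => (sqDist c r s z : ℂ)) =
      fun z => ((r : ℂ) ^ 2)⁻¹ * ((z - c) * conj (z - c) + (s : ℂ) ^ 2) := by
    funext z
    rw [Complex.mul_conj, Complex.normSq_eq_norm_sq, sqDist]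
    push_cast
    ring
  rw [e]
  convert h2 using 1
  · simp; ring
  · simp; ring

lemma truncLog₂_mul_add {t : ℝ} (ht : 0 < t) : truncLog₂ t * t + truncLog₁ t = max (1 - t) 0 := by
  rcases le_total t 1 with h | h
  · rw [max_eq_left (by linarith), truncLog₂, truncLog₁, min_eq_left h]
    field_simp
    ring
  · rw [max_eq_right (by linarith), truncLog₂, truncLog₁, min_eq_right h]
    simp

lemma ContDiff.continuous_lap {v : ℂ → ℝ} (hv : ContDiff ℝ 2 v) : Continuous (lap v) := by
  have h1 : Continuous fun z => 4 * (_root_.dzb (_root_.dz fun y => (v y : ℂ)) z).re :=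
    continuous_const.mul (Complex.continuous_re.comp (ContDiff.dzb (n := 0)
      (ContDiff.dz (n := 1) (contDiff_coe hv))).continuous)
  convert h1 using 2 with z
  rw [dzb_dz_ofReal hv]
  have : (lap v z / 4 : ℂ) = ((lap v z / 4 : ℝ) : ℂ) := by push_cast; rfl
  rw [this, Complex.ofReal_re]; ring

lemma integral_truncLog_mul_lap {v : ℂ → ℝ} (hv : ContDiff ℝ 2 v) (c : ℂ) {r s : ℝ} (hr : 0 < r)
    (hs : 0 < s) :
    ∫ z, truncLog (sqDist c r s z) * lap v z =
      4 / r ^ 2 * (∫ z, v z * max (1 - sqDist c r s z) 0) -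
        4 * s ^ 2 / r ^ 4 * ∫ z, v z * truncLog₂ (sqDist c r s z) := by
  have hvC : ContDiff ℝ 2 fun y => (v y : ℂ) := contDiff_coe hv
  have hzb : ContDiff ℝ 1 (dzb fun y => (v y : ℂ)) := ContDiff.dzb (n := 1) hvC
  set t := sqDist c r s with ht
  have htpos : ∀ z, 0 < t z := fun z => sqDist_pos c z hr hs
  have ht2 : ContDiff ℝ 2 t := contDiff_sqDist c r s
  have ht1 : ContDiff ℝ 1 t := ht2.of_le (by norm_num)
  have hc1 : ContinuousOn truncLog₁ (Ioi 0) := fun x hx =>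
    (hasDerivAt_truncLog₁ hx).continuousAt.continuousWithinAt
  have cL : ContDiff ℝ 1 fun z => truncLog (t z) := contDiff_iff_contDiffAt.2 fun z =>
    (contDiffAt_one_of_hasDerivAt (fun _ => hasDerivAt_truncLog) hc1 (htpos z)).comp z
      ht1.contDiffAt
  have cL1 : ContDiff ℝ 1 fun z => truncLog₁ (t z) := contDiff_iff_contDiffAt.2 fun z =>
    (contDiffAt_one_of_hasDerivAt (fun _ => hasDerivAt_truncLog₁) continuousOn_truncLog₂
      (htpos z)).comp z ht1.contDiffAt
  have cL2 : Continuous fun z => truncLog₂ (t z) := continuousOn_truncLog₂.comp_continuous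
    ht1.continuous htpos
  have hball : ∀ z, z ∉ closedBall c r → 1 ≤ t z := fun z hz =>
    one_le_sqDist hr fun h => hz (ball_subset_closedBall h)
  -- the two vector fields
  set X : ℂ → ℂ := fun z => (v z : ℂ) * ((truncLog₁ (t z) : ℂ) * (conj (z - c) / r ^ 2)) with hX
  set Y : ℂ → ℂ := fun z => (truncLog (t z) : ℂ) * dzb (fun y => (v y : ℂ)) z with hY
  have hconj : ContDiff ℝ 1 fun z : ℂ => conj (z - c) / (r : ℂ) ^ 2 :=
    ((Complex.conjCLE : ℂ →L[ℝ] ℂ).contDiff.comp (contDiff_id.sub contDiff_const)).div_const _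
  have hXc : ContDiff ℝ 1 X :=
    (hvC.of_le (by norm_num)).mul ((contDiff_coe cL1).mul hconj)
  have hYc : ContDiff ℝ 1 Y := (contDiff_coe cL).mul hzb
  have hXs : HasCompactSupport X := HasCompactSupport.intro (isCompact_closedBall c r) fun z hz => by
    simp [hX, truncLog₁_eq_zero (hball z hz)]
  have hYs : HasCompactSupport Y := HasCompactSupport.intro (isCompact_closedBall c r) fun z hz => by
    simp [hY, truncLog_eq_zero (hball z hz)]
  have dX : ∀ z, dzb X z = dzb (fun y => (v y : ℂ)) z * ((truncLog₁ (t z) : ℂ) * (conj (z - c) / r ^ 2))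
      + ((v z * (1 / r ^ 2 * (max (1 - t z) 0 - s ^ 2 / r ^ 2 * truncLog₂ (t z))) : ℝ) : ℂ) := by
    intro z
    have h1 := (hasWirt_sqDist c z r s).comp_real (hasDerivAt_truncLog₁ (htpos z))
    have h2 : HasWirt (fun z : ℂ => conj (z - c) / (r : ℂ) ^ 2) 0 (1 / r ^ 2) z := by
      have h3 : HasWirt (fun z => z - c) 1 0 z := by
        simpa using (hasWirt_id z).sub (hasWirt_const c z)
      have h4 := h3.conj.const_mul (((r : ℂ) ^ 2)⁻¹)
      convert h4 using 1
      · funext z; ring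
      · simp
      · simp
    have h5 := ((hvC.hasWirt (by norm_num) z).mul (h1.mul h2)).dzb
    simp only [hX]
    refine h5.trans ?_
    rw [← truncLog₂_mul_add (htpos z)]
    have h6 : (t z : ℂ) = ((z - c) * conj (z - c) + s ^ 2) / r ^ 2 := by
      rw [Complex.mul_conj, Complex.normSq_eq_norm_sq, ht, sqDist]
      push_cast
      ring
    push_cast
    rw [h6, ← ht]
    ring
  have dY : ∀ z, dz Y z = dzb (fun y => (v y : ℂ)) z * ((truncLog₁ (t z) : ℂ) * (conj (z - c) / r ^ 2))
      + ((truncLog (t z) * lap v z / 4 : ℝ) : ℂ) := by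
    intro z
    have h1 := (hasWirt_sqDist c z r s).comp_real (hasDerivAt_truncLog (htpos z))
    have h5 := (h1.mul (hzb.hasWirt (by norm_num) z)).dz
    simp only [hY]
    refine h5.trans ?_
    rw [← dzb_dz_comm hvC, dzb_dz_ofReal hv]
    push_cast
    ring
  have iX := integral_dzb_eq_zero hXc hXs
  have iY := integral_dz_eq_zero hYc hYs
  have jX : Integrable (dzb X) := (ContDiff.dzb (n := 0) (by simpa using hXc)).continuous.integrable_of_hasCompactSupport
    hXs.dzb
  have jY : Integrable (dz Y) := (ContDiff.dz (n := 0) (by simpa using hYc)).continuous.integrable_of_hasCompactSupport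
    hYs.dz
  have key : ∫ z, (dzb X z - dz Y z) = 0 := by rw [integral_sub jX jY, iX, iY, sub_zero]
  have e : ∀ z, dzb X z - dz Y z =
      ((v z * (1 / r ^ 2 * (max (1 - t z) 0 - s ^ 2 / r ^ 2 * truncLog₂ (t z))) -
        truncLog (t z) * lap v z / 4 : ℝ) : ℂ) := fun z => by
    rw [dX, dY]; push_cast; ring
  simp_rw [e] at key
  rw [integral_complex_ofReal, Complex.ofReal_eq_zero] at key
  have k1 : Integrable fun z => v z * max (1 - t z) 0 := by
    refine Continuous.integrable_of_hasCompactSupport ?_ (HasCompactSupport.intro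
      (isCompact_closedBall c r) fun z hz => ?_)
    · have := hv.continuous
      have := ht1.continuous
      fun_prop
    · rw [max_eq_right (by linarith [hball z hz]), mul_zero]
  have k2 : Integrable fun z => v z * truncLog₂ (t z) := by
    refine Continuous.integrable_of_hasCompactSupport (hv.continuous.mul cL2)
      (HasCompactSupport.intro (isCompact_closedBall c r) fun z hz => ?_)
    simp [truncLog₂, min_eq_right (hball z hz)]
  have k3 : Integrable fun z => truncLog (t z) * lap v z := by
    refine Continuous.integrable_of_hasCompactSupport (cL.continuous.mul ?_)
      (HasCompactSupport.intro (isCompact_closedBall c r) fun z hz => ?_)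
    · exact hv.continuous_lap
    · simp [truncLog_eq_zero (hball z hz)]
  have e2 : ∀ z, v z * (1 / r ^ 2 * (max (1 - t z) 0 - s ^ 2 / r ^ 2 * truncLog₂ (t z))) -
        truncLog (t z) * lap v z / 4 = 1 / r ^ 2 * (v z * max (1 - t z) 0) -
        s ^ 2 / r ^ 4 * (v z * truncLog₂ (t z)) - (truncLog (t z) * lap v z) / 4 := fun z => by
    field_simp
  simp_rw [e2] at key
  have k4 : Integrable fun z => 1 / r ^ 2 * (v z * max (1 - t z) 0) -
      s ^ 2 / r ^ 4 * (v z * truncLog₂ (t z)) := (k1.const_mul _).sub (k2.const_mul _)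
  rw [integral_sub k4 (k3.div_const _), integral_sub (k1.const_mul _) (k2.const_mul _), integral_const_mul, integral_const_mul,
    integral_div] at key
  linear_combination -4 * key

/-- The (unnormalised) weighted mean of `v` over `ball c r`. -/
def discMean (v : ℂ → ℝ) (c : ℂ) (r : ℝ) : ℝ :=
  4 / r ^ 2 * ∫ z, v z * max (1 - ‖z - c‖ ^ 2 / r ^ 2) 0

/-- The normalising constant `∫ (1 + |t|²)⁻²`. -/
def bubbleMass : ℝ := ∫ t : ℂ, ((1 + ‖t‖ ^ 2) ^ 2)⁻¹

lemma bubbleMass_pos : 0 < bubbleMass := by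
  refine (integral_pos_iff_support_of_nonneg (fun t => by positivity)
    integrable_one_add_normSq_inv_sq).2 ?_
  have : (Function.support fun t : ℂ => ((1 + ‖t‖ ^ 2) ^ 2)⁻¹) = univ := by
    ext t
    simp only [Function.mem_support, mem_univ, iff_true]
    positivity
  rw [this]
  simp

lemma exists_abs_le_closedBall {v : ℂ → ℝ} (hv : Continuous v) (c : ℂ) (r : ℝ) :
    ∃ M, 0 ≤ M ∧ ∀ z ∈ closedBall c r, |v z| ≤ M := by
  obtain ⟨M, hM⟩ := (isCompact_closedBall c r).exists_bound_of_continuousOn hv.continuousOn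
  exact ⟨max M 0, le_max_right _ _, fun z hz => (hM z hz).trans (le_max_left _ _)⟩

lemma tendsto_integral_mul_max {v : ℂ → ℝ} (hv : Continuous v) (c : ℂ) {r : ℝ} (hr : 0 < r) :
    Tendsto (fun s => 4 / r ^ 2 * ∫ z, v z * max (1 - sqDist c r s z) 0) (nhdsWithin 0 (Ioi 0))
      (nhds (discMean v c r)) := by
  obtain ⟨M, hM0, hM⟩ := exists_abs_le_closedBall hv c r
  refine Tendsto.const_mul _ ?_
  have hcont : ∀ s, Continuous (sqDist c r s) := fun s => (contDiff_sqDist c r s).continuous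
  refine tendsto_integral_filter_of_dominated_convergence
    ((closedBall c r).indicator fun _ => M) ?_ ?_ ?_ ?_
  · refine Eventually.of_forall fun s => Continuous.aestronglyMeasurable ?_
    have := hcont s
    fun_prop
  · refine Eventually.of_forall fun s => Eventually.of_forall fun z => ?_
    by_cases hz : z ∈ closedBall c r
    · rw [indicator_of_mem hz, norm_mul, Real.norm_eq_abs, Real.norm_eq_abs,
        abs_of_nonneg (le_max_right (1 - sqDist c r s z) 0)]
      have h1 : max (1 - sqDist c r s z) 0 ≤ 1 := by
        have : 0 ≤ sqDist c r s z := by unfold sqDist; positivity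
        exact max_le (by linarith) zero_le_one
      nlinarith [hM z hz, abs_nonneg (v z), le_max_right (1 - sqDist c r s z) 0]
    · rw [indicator_of_notMem hz]
      have := one_le_sqDist (s := s) hr fun h => hz (ball_subset_closedBall h)
      rw [max_eq_right (by linarith)]
      simp
  · exact (integrable_indicator_iff measurableSet_closedBall).2
      (integrableOn_const (isCompact_closedBall _ _).measure_lt_top.ne)
  · refine Eventually.of_forall fun z => ?_
    have : Continuous fun s => v z * max (1 - sqDist c r s z) 0 := by unfold sqDist; fun_prop
    have h := (this.tendsto 0).mono_left (nhdsWithin_le_nhds (s := Ioi 0))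
    simpa [sqDist] using h

lemma tendsto_integral_mul_truncLog₂ {v : ℂ → ℝ} (hv : Continuous v) (c : ℂ) {r : ℝ} (hr : 0 < r) :
    Tendsto (fun s => 4 * s ^ 2 / r ^ 4 * ∫ z, v z * truncLog₂ (sqDist c r s z))
      (nhdsWithin 0 (Ioi 0)) (nhds (2 * bubbleMass * v c)) := by
  obtain ⟨M, hM0, hM⟩ := exists_abs_le_closedBall hv c r
  set k : ℝ → ℂ → ℝ := fun s t => 4 * s ^ 4 / r ^ 4 * truncLog₂ (s ^ 2 * (1 + ‖t‖ ^ 2) / r ^ 2) with hk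
  have hk1 : ∀ s t, 0 < s → s ^ 2 * (1 + ‖t‖ ^ 2) / r ^ 2 ≤ 1 →
      k s t = 2 * ((1 + ‖t‖ ^ 2) ^ 2)⁻¹ - 2 * s ^ 4 / r ^ 4 := fun s t hs h => by
    simp only [hk, truncLog₂]
    rw [min_eq_left h]
    have : 0 < 1 + ‖t‖ ^ 2 := by positivity
    field_simp
    ring
  have hk2 : ∀ s t, 1 ≤ s ^ 2 * (1 + ‖t‖ ^ 2) / r ^ 2 → k s t = 0 := fun s t h => by
    simp [hk, truncLog₂, min_eq_right h]
  have lim : Tendsto (fun s => ∫ t, v (c + s • t) * k s t) (nhdsWithin 0 (Ioi 0))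
      (nhds (∫ t : ℂ, v c * (2 * ((1 + ‖t‖ ^ 2) ^ 2)⁻¹))) := by
    refine tendsto_integral_filter_of_dominated_convergence
      (fun t => M * (2 * ((1 + ‖t‖ ^ 2) ^ 2)⁻¹)) ?_ ?_
      ((integrable_one_add_normSq_inv_sq.const_mul 2).const_mul M) ?_
    · filter_upwards [self_mem_nhdsWithin] with s hs
      have hs : 0 < s := hs
      refine Continuous.aestronglyMeasurable ?_
      have h1 : Continuous fun t : ℂ => truncLog₂ (s ^ 2 * (1 + ‖t‖ ^ 2) / r ^ 2) :=
        continuousOn_truncLog₂.comp_continuous (by fun_prop) fun t => by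
          simp only [mem_Ioi]; positivity
      simp only [hk]
      fun_prop
    · filter_upwards [self_mem_nhdsWithin] with s hs
      have hs : 0 < s := hs
      refine Eventually.of_forall fun t => ?_
      rcases le_total (s ^ 2 * (1 + ‖t‖ ^ 2) / r ^ 2) 1 with h | h
      · rw [hk1 s t hs h, norm_mul]
        have hin : c + s • t ∈ closedBall c r := by
          rw [mem_closedBall, dist_eq_norm, add_sub_cancel_left, norm_smul, Real.norm_of_nonneg hs.le]
          rw [div_le_one (by positivity)] at h
          refine abs_le_of_sq_le_sq' ?_ hr.le |>.2
          nlinarith [sq_nonneg s]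
        refine mul_le_mul (hM _ hin) ?_ (norm_nonneg _) hM0
        have h3 : 2 * s ^ 4 / r ^ 4 ≤ 2 * ((1 + ‖t‖ ^ 2) ^ 2)⁻¹ := by
          rw [← div_eq_mul_inv, div_le_div_iff₀ (by positivity) (by positivity)]
          rw [div_le_one (by positivity)] at h
          have := pow_le_pow_left₀ (by positivity) h 2
          nlinarith
        have h4 : 0 ≤ 2 * s ^ 4 / r ^ 4 := by positivity
        rw [Real.norm_of_nonneg (by linarith)]
        linarith
      · rw [hk2 s t h]
        simp
        positivity
    · refine Eventually.of_forall fun t => Tendsto.mul ?_ ?_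
      · have : Continuous fun s : ℝ => v (c + s • t) := by fun_prop
        simpa using (this.tendsto 0).mono_left (nhdsWithin_le_nhds (s := Ioi 0))
      · have h1 : Continuous fun s : ℝ => s ^ 2 * (1 + ‖t‖ ^ 2) / r ^ 2 := by fun_prop
        have h2 : ∀ᶠ s in nhdsWithin (0 : ℝ) (Ioi 0), s ^ 2 * (1 + ‖t‖ ^ 2) / r ^ 2 < 1 :=
          nhdsWithin_le_nhds ((h1.tendsto 0).eventually (gt_mem_nhds (by simp)))
        have h3 : Continuous fun s : ℝ => 2 * ((1 + ‖t‖ ^ 2) ^ 2)⁻¹ - 2 * s ^ 4 / r ^ 4 := by fun_prop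
        have h4 := (h3.tendsto 0).mono_left (nhdsWithin_le_nhds (s := Ioi 0))
        have h5 : Tendsto (fun s : ℝ => 2 * ((1 + ‖t‖ ^ 2) ^ 2)⁻¹ - 2 * s ^ 4 / r ^ 4)
            (nhdsWithin 0 (Ioi 0)) (nhds (2 * ((1 + ‖t‖ ^ 2) ^ 2)⁻¹)) := by
          convert h4 using 2; simp
        refine h5.congr' ?_
        filter_upwards [h2, self_mem_nhdsWithin] with s h hs
        exact (hk1 s t hs h.le).symm
  rw [integral_const_mul, integral_const_mul] at lim
  have e0 : 2 * bubbleMass * v c = v c * (2 * ∫ t : ℂ, ((1 + ‖t‖ ^ 2) ^ 2)⁻¹) := by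
    rw [bubbleMass]; ring
  rw [e0]
  refine lim.congr' ?_
  filter_upwards [self_mem_nhdsWithin] with s hs
  have hs : 0 < s := hs
  set f : ℂ → ℝ := fun u => v (c + u) * truncLog₂ (sqDist c r s (c + u)) with hf
  have e1 : ∫ z, v z * truncLog₂ (sqDist c r s z) = ∫ u, f u := by
    simp only [hf]
    exact (integral_add_left_eq_self (fun z => v z * truncLog₂ (sqDist c r s z)) c).symm
  have e2 := Measure.integral_comp_smul volume f s
  have e3 : ∫ u, f u = (s ^ 2) • ∫ u, f (s • u) := by
    rw [e2, Complex.finrank_real_complex, smul_smul, abs_of_pos (by positivity),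
      mul_inv_cancel₀ (by positivity), one_smul]
  rw [e1, e3, smul_eq_mul, ← mul_assoc, ← integral_const_mul]
  congr 1
  funext t
  simp only [hf, hk, sqDist, add_sub_cancel_left, norm_smul, Real.norm_of_nonneg hs.le]
  rw [show ((s * ‖t‖) ^ 2 + s ^ 2) / r ^ 2 = s ^ 2 * (1 + ‖t‖ ^ 2) / r ^ 2 by ring]
  ring

lemma tendsto_integral_truncLog_mul_lap {v : ℂ → ℝ} (hv : ContDiff ℝ 2 v) (c : ℂ) {r : ℝ}
    (hr : 0 < r) :
    Tendsto (fun s => ∫ z, truncLog (sqDist c r s z) * (-lap v z)) (nhdsWithin 0 (Ioi 0))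
      (nhds (2 * bubbleMass * v c - discMean v c r)) := by
  have h := (tendsto_integral_mul_truncLog₂ hv.continuous c hr).sub
    (tendsto_integral_mul_max hv.continuous c hr)
  refine h.congr' ?_
  filter_upwards [self_mem_nhdsWithin] with s hs
  have := integral_truncLog_mul_lap hv c hr hs
  simp only [mul_neg, integral_neg, this]
  ring

lemma truncLog_sqDist_mul_nonneg {v : ℂ → ℝ} {c : ℂ} {r : ℝ} (hr : 0 < r)
    (hlap : ∀ z ∈ ball c r, 0 ≤ -lap v z) {s : ℝ} (hs : 0 < s) (z : ℂ) :
    0 ≤ truncLog (sqDist c r s z) * (-lap v z) := by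
  by_cases hz : z ∈ ball c r
  · exact mul_nonneg (truncLog_nonneg (sqDist_pos c z hr hs)) (hlap z hz)
  · rw [truncLog_eq_zero (one_le_sqDist hr hz), zero_mul]

lemma discMean_le {v : ℂ → ℝ} (hv : ContDiff ℝ 2 v) {c : ℂ} {r : ℝ}
    (hr : 0 < r) (hlap : ∀ z ∈ ball c r, 0 ≤ -lap v z) :
    discMean v c r ≤ 2 * bubbleMass * v c := by
  have h := tendsto_integral_truncLog_mul_lap hv c hr
  have : 0 ≤ 2 * bubbleMass * v c - discMean v c r := by
    refine ge_of_tendsto h ?_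
    filter_upwards [self_mem_nhdsWithin] with s hs
    exact integral_nonneg fun z => truncLog_sqDist_mul_nonneg hr hlap hs z
  linarith

lemma discMean_one (c : ℂ) {r : ℝ} (hr : 0 < r) :
    4 / r ^ 2 * ∫ z : ℂ, max (1 - ‖z - c‖ ^ 2 / r ^ 2) 0 = 2 * bubbleMass := by
  have h := tendsto_integral_truncLog_mul_lap (v := fun _ => 1) contDiff_const c hr
  have h0 : lap (fun _ => (1 : ℝ)) = fun _ => 0 := by
    funext z
    simp [lap, pd, dderiv]
    have : dderiv 1 (fun _ => (1 : ℝ)) = fun _ => 0 := by funext z; simp [dderiv]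
    have h2 : dderiv Complex.I (fun _ => (1 : ℝ)) = fun _ => 0 := by funext z; simp [dderiv]
    rw [this, h2]
    simp
  simp only [h0, neg_zero, mul_zero, integral_zero] at h
  have := tendsto_nhds_unique h tendsto_const_nhds
  simp only [discMean, one_mul, mul_one] at this
  linarith

lemma continuous_truncLog_sqDist (c : ℂ) {r s : ℝ} (hr : 0 < r) (hs : 0 < s) :
    Continuous fun z => truncLog (sqDist c r s z) :=
  continuous_iff_continuousAt.2 fun z =>
    (hasDerivAt_truncLog (sqDist_pos c z hr hs)).continuousAt.comp
      (contDiff_sqDist c r s).continuous.continuousAt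

lemma integrable_truncLog_mul_lap {v : ℂ → ℝ} (hv : ContDiff ℝ 2 v) (c : ℂ) {r s : ℝ}
    (hr : 0 < r) (hs : 0 < s) : Integrable fun z => truncLog (sqDist c r s z) * (-lap v z) := by
  refine Continuous.integrable_of_hasCompactSupport
    ((continuous_truncLog_sqDist c hr hs).mul hv.continuous_lap.neg)
    (HasCompactSupport.intro (isCompact_closedBall c r) fun z hz => ?_)
  rw [truncLog_eq_zero (one_le_sqDist hr fun h => hz (ball_subset_closedBall h)), zero_mul]

lemma lintegral_truncLog_mul_lap_le {v : ℂ → ℝ} (hv : ContDiff ℝ 2 v) {c : ℂ} {r : ℝ}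
    (hr : 0 < r) (hlap : ∀ z ∈ ball c r, 0 ≤ -lap v z) :
    ∫⁻ z in ball c r, ENNReal.ofReal (Real.log (r / ‖z - c‖) - 3 / 4) * ENNReal.ofReal (-lap v z) ≤
      ENNReal.ofReal (2 * bubbleMass * v c - discMean v c r) := by
  have hseq : Tendsto (fun n : ℕ => 1 / ((n : ℝ) + 1)) atTop (nhdsWithin 0 (Ioi 0)) :=
    tendsto_nhdsWithin_iff.2 ⟨tendsto_one_div_add_atTop_nhds_zero_nat,
      Eventually.of_forall fun n => by simp only [mem_Ioi]; positivity⟩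
  have h := (tendsto_integral_truncLog_mul_lap hv c hr).comp hseq
  have h1 := (ENNReal.continuous_ofReal.tendsto _).comp h
  have hpos : ∀ n : ℕ, (0 : ℝ) < 1 / ((n : ℝ) + 1) := fun n => by positivity
  have e : ∀ n : ℕ, ∫⁻ z in ball c r, ENNReal.ofReal
      (truncLog (sqDist c r (1 / ((n : ℝ) + 1)) z) * (-lap v z)) ≤
      ENNReal.ofReal (∫ z, truncLog (sqDist c r (1 / ((n : ℝ) + 1)) z) * (-lap v z)) := fun n => by
    rw [ofReal_integral_eq_lintegral_ofReal (integrable_truncLog_mul_lap hv c hr (hpos n))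
      (Eventually.of_forall fun z => truncLog_sqDist_mul_nonneg hr hlap (hpos n) z)]
    exact setLIntegral_le_lintegral _ _
  refine le_trans ?_ (le_trans (liminf_le_liminf (Eventually.of_forall e)) h1.liminf_eq.le)
  refine le_trans ?_ (lintegral_liminf_le fun n => ?_)
  · refine setLIntegral_mono' measurableSet_ball fun z hz => ?_
    have hl := hlap z hz
    rcases eq_or_ne z c with rfl | hzc
    · rw [ENNReal.ofReal_of_nonpos (by simp; norm_num), zero_mul]
      exact zero_le
    have hd : 0 < ‖z - c‖ := norm_pos_iff.2 (sub_ne_zero.2 hzc)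
    have hτ : 0 < ‖z - c‖ ^ 2 / r ^ 2 := by positivity
    have h2 : Tendsto (fun n : ℕ => truncLog (sqDist c r (1 / ((n : ℝ) + 1)) z) * (-lap v z)) atTop
        (nhds (truncLog (‖z - c‖ ^ 2 / r ^ 2) * (-lap v z))) := by
      refine Tendsto.mul_const _ ((hasDerivAt_truncLog hτ).continuousAt.tendsto.comp ?_)
      have h3 : Continuous fun s => sqDist c r s z := by unfold sqDist; fun_prop
      have := ((h3.tendsto 0).mono_left nhdsWithin_le_nhds).comp hseq
      have h4 : sqDist c r 0 z = ‖z - c‖ ^ 2 / r ^ 2 := by simp [sqDist]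
      rw [← h4]
      exact this
    have h5 := ((ENNReal.continuous_ofReal.tendsto _).comp h2).liminf_eq
    simp only [Function.comp_def] at h5
    rw [h5, ENNReal.ofReal_mul (truncLog_nonneg hτ)]
    gcongr
    refine le_trans (le_of_eq ?_) (le_truncLog hτ)
    rw [← div_pow, Real.log_pow, ← inv_div, Real.log_inv]
    push_cast
    ring
  · exact (Continuous.mul (continuous_truncLog_sqDist c hr (hpos n))
      hv.continuous_lap.neg).measurable.ennreal_ofReal

lemma discMean_sub_discMean_le {v : ℂ → ℝ} (hv : ContDiff ℝ 2 v) {c : ℂ} {r l m : ℝ}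
    (hl : 0 < l) (hlr : l ≤ r) (hlap : ∀ z ∈ ball c r, 0 ≤ -lap v z)
    (hm : ∫ z in ball c r, -lap v z ≤ m) :
    discMean v c l - discMean v c r ≤ (Real.log (r / l) + 3 / 4) * m := by
  have hr : 0 < r := hl.trans_le hlr
  have h1 := (tendsto_integral_truncLog_mul_lap hv c hr).sub
    (tendsto_integral_truncLog_mul_lap hv c hl)
  have hlog : 0 ≤ Real.log (r / l) := Real.log_nonneg ((one_le_div hl).2 hlr)
  have hint : IntegrableOn (fun z => -lap v z) (ball c r) :=
    (hv.continuous_lap.neg.continuousOn.integrableOn_compact (isCompact_closedBall c r)).mono_set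
      ball_subset_closedBall
  have h2 : 2 * bubbleMass * v c - discMean v c r - (2 * bubbleMass * v c - discMean v c l) ≤
      (Real.log (r / l) + 3 / 4) * m := by
    refine le_of_tendsto h1 ?_
    filter_upwards [self_mem_nhdsWithin] with s hs
    have hs : 0 < s := hs
    rw [← integral_sub (integrable_truncLog_mul_lap hv c hr hs)
      (integrable_truncLog_mul_lap hv c hl hs)]
    refine le_trans ?_ (mul_le_mul_of_nonneg_left hm (by positivity))
    rw [← integral_const_mul, ← integral_indicator measurableSet_ball]
    refine integral_mono ((integrable_truncLog_mul_lap hv c hr hs).sub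
      (integrable_truncLog_mul_lap hv c hl hs))
      ((integrable_indicator_iff measurableSet_ball).2 (hint.const_mul _)) fun z => ?_
    by_cases hz : z ∈ ball c r
    · rw [indicator_of_mem hz]
      simp only
      rw [← sub_mul]
      refine mul_le_mul_of_nonneg_right ?_ (hlap z hz)
      have ht1 := sqDist_pos c z hr hs
      have ht2 := sqDist_pos c z hl hs
      rcases le_total (sqDist c r s z) 1 with h | h
      · have a1 := truncLog_le h
        have a2 := le_truncLog ht2
        have a3 : Real.log (sqDist c l s z) = Real.log (sqDist c r s z) + 2 * Real.log (r / l) := by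
          have : sqDist c l s z = sqDist c r s z * (r / l) ^ 2 := by
            unfold sqDist; field_simp
          rw [this, Real.log_mul ht1.ne' (by positivity), Real.log_pow]
          push_cast; ring
        linarith
      · rw [truncLog_eq_zero h]
        have := truncLog_nonneg ht2
        linarith
    · rw [indicator_of_notMem hz, truncLog_eq_zero (one_le_sqDist hr hz),
        truncLog_eq_zero (one_le_sqDist hl fun h => hz (ball_subset_ball hlr h))]
      simp
  linarith

/-- The denominator of the standard bubble with parameters `c` and `m`. -/
def bubDen (N : ℕ) (c m : ℝ) (y : ℂ) : ℝ := 1 + c * Real.exp m * ‖y ^ (N + 1) - 1‖ ^ 2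

/-- The standard bubble. -/
def bub (N : ℕ) (c m : ℝ) (y : ℂ) : ℝ := m - 2 * Real.log (bubDen N c m y)

section
variable {N : ℕ} {c m : ℝ}

lemma one_le_bubDen (hc : 0 < c) (y : ℂ) : 1 ≤ bubDen N c m y := by
  have : 0 ≤ c * Real.exp m * ‖y ^ (N + 1) - 1‖ ^ 2 := by positivity
  unfold bubDen; linarith

lemma bubDen_pos (hc : 0 < c) (y : ℂ) : 0 < bubDen N c m y := one_pos.trans_le (one_le_bubDen hc y)

lemma contDiff_bub (hc : 0 < c) : ContDiff ℝ 2 (bub N c m) := by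
  have h1 : ContDiff ℝ 2 fun y : ℂ => ‖y ^ (N + 1) - 1‖ ^ 2 :=
    ((contDiff_id.pow (N + 1)).sub contDiff_const).norm_sq ℝ
  have h2 : ContDiff ℝ 2 (bubDen N c m) := by unfold bubDen; fun_prop
  unfold bub
  exact contDiff_const.sub (contDiff_const.mul (h2.log fun y => (bubDen_pos hc y).ne'))

lemma hasWirt_pow_sub_one (y : ℂ) :
    HasWirt (fun y => y ^ (N + 1) - 1) ((N + 1) * y ^ N) 0 y := by
  have := ((hasWirt_id y).pow (N + 1)).sub (hasWirt_const 1 y)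
  convert this using 1 <;> simp

lemma bubDen_coe (y : ℂ) : (bubDen N c m y : ℂ) =
    1 + c * Real.exp m * ((y ^ (N + 1) - 1) * conj (y ^ (N + 1) - 1)) := by
  rw [Complex.mul_conj, Complex.normSq_eq_norm_sq, bubDen]
  push_cast
  ring

lemma hasWirt_bubDen (y : ℂ) : HasWirt (fun z => (bubDen N c m z : ℂ))
    (c * Real.exp m * ((N + 1) * y ^ N * conj (y ^ (N + 1) - 1)))
    (c * Real.exp m * ((N + 1) * conj y ^ N * (y ^ (N + 1) - 1))) y := by
  have h := (hasWirt_pow_sub_one (N := N) y)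
  have h2 := (hasWirt_const 1 y).add ((h.mul h.conj).const_mul ((c : ℂ) * Real.exp m))
  have e : (fun z => (bubDen N c m z : ℂ)) = fun y : ℂ =>
      1 + (c * Real.exp m) * ((y ^ (N + 1) - 1) * conj (y ^ (N + 1) - 1)) := by
    funext z; exact bubDen_coe z
  rw [e]
  convert h2 using 1
  · simp
  · rw [map_mul, map_pow]
    simp only [map_add, map_natCast, map_one]
    ring

lemma dz_bub (hc : 0 < c) (y : ℂ) : dz (fun z => (bub N c m z : ℂ)) y =
    -2 * (c * Real.exp m * ((N + 1) * y ^ N * conj (y ^ (N + 1) - 1))) *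
      (bubDen N c m y : ℂ)⁻¹ := by
  have h := ((hasWirt_bubDen (N := N) (c := c) (m := m) y).comp_real
    (Real.hasDerivAt_log (bubDen_pos hc y).ne')).const_mul 2
  have h2 := (hasWirt_const (m : ℂ) y).sub h
  have e : (fun z => (bub N c m z : ℂ)) = fun z => (m : ℂ) - 2 * (Real.log (bubDen N c m z) : ℂ) := by
    funext z; simp [bub]
  rw [e, h2.dz]
  push_cast
  ring

lemma hasWirt_dz_bub (hc : 0 < c) (y : ℂ) : HasWirt (dz fun z => (bub N c m z : ℂ))
    (-2 * (c * Real.exp m * ((N + 1) * (N * y ^ (N - 1)) * conj (y ^ (N + 1) - 1))) *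
      (bubDen N c m y : ℂ)⁻¹ + 2 * (c * Real.exp m * ((N + 1) * y ^ N * conj (y ^ (N + 1) - 1)) *
      (bubDen N c m y : ℂ)⁻¹) ^ 2)
    (-2 * (c * Real.exp m * (N + 1) ^ 2 * y ^ N * conj y ^ N) * ((bubDen N c m y : ℂ) ^ 2)⁻¹) y := by
  have h0 : (bubDen N c m y : ℂ) ≠ 0 := by exact_mod_cast (bubDen_pos hc y).ne'
  have h := (hasWirt_pow_sub_one (N := N) y)
  have h1 := ((((hasWirt_id y).pow N).mul h.conj).const_mul (-2 * (c * Real.exp m * (N + 1) : ℂ))).mul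
    ((hasWirt_bubDen (N := N) (c := c) (m := m) y).inv h0)
  have e : (dz fun z => (bub N c m z : ℂ)) = fun y => -2 * (c * Real.exp m * (N + 1) : ℂ) *
      (y ^ N * conj (y ^ (N + 1) - 1)) * (bubDen N c m y : ℂ)⁻¹ := by
    funext z
    rw [dz_bub hc]
    ring
  rw [e]
  convert h1 using 1
  · field_simp
    simp
    ring
  · have h3 := bubDen_coe (N := N) (c := c) (m := m) y
    field_simp
    simp only [map_mul, map_add, map_natCast, map_one, map_pow]
    rw [h3]
    simp only [map_sub, map_pow, map_one]
    ring

lemma lap_bub (hc : 0 < c) (y : ℂ) :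
    lap (bub N c m) y = -(‖y‖ ^ (2 * N) * (8 * (N + 1) ^ 2 * c) * Real.exp (bub N c m y)) := by
  have h1 := dzb_dz_ofReal (contDiff_bub (N := N) (m := m) hc) y
  rw [(hasWirt_dz_bub hc y).dzb] at h1
  have h2 : Real.exp (bub N c m y) = Real.exp m * ((bubDen N c m y) ^ 2)⁻¹ := by
    rw [bub, Real.exp_sub, two_mul, Real.exp_add, Real.exp_log (bubDen_pos hc y)]
    field_simp
  have h3 : y ^ N * conj y ^ N = ((‖y‖ ^ (2 * N) : ℝ) : ℂ) := by
    rw [← mul_pow, Complex.mul_conj, Complex.normSq_eq_norm_sq]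
    push_cast
    rw [pow_mul]
  rw [h2]
  have h4 : (lap (bub N c m) y : ℂ) =
      ((-(‖y‖ ^ (2 * N) * (8 * (N + 1) ^ 2 * c) * (Real.exp m * ((bubDen N c m y) ^ 2)⁻¹)) : ℝ) : ℂ) := by
    have : (lap (bub N c m) y : ℂ) = 4 * (lap (bub N c m) y / 4 : ℂ) := by ring
    rw [this, ← h1, mul_assoc _ (y ^ N), h3]
    push_cast
    ring
  exact_mod_cast h4

lemma quadDiff_bub (hN : 1 ≤ N) (hc : 0 < c) (y : ℂ) : quadDiff N (bub N c m) y = 0 := by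
  unfold quadDiff
  rw [(hasWirt_dz_bub hc y).dz, dz_bub hc]
  obtain ⟨n, rfl⟩ : ∃ n, N = n + 1 := ⟨N - 1, by omega⟩
  simp only [Nat.add_sub_cancel]
  push_cast
  ring

lemma half_pow_le_norm_pow_sub_one {y : ℂ} (hy : 2 ≤ ‖y‖) :
    ‖y‖ ^ (N + 1) / 2 ≤ ‖y ^ (N + 1) - 1‖ := by
  have h1 := norm_sub_norm_le (y ^ (N + 1)) 1
  rw [norm_pow, norm_one] at h1
  have h2 : (2 : ℝ) ≤ ‖y‖ ^ (N + 1) := hy.trans (le_self_pow₀ (by linarith) (by omega))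
  linarith

lemma norm_mul_dz_bub_le (hc : 0 < c) {y : ℂ} (hy : 2 ≤ ‖y‖) :
    ‖y * dz (fun z => (bub N c m z : ℂ)) y‖ ≤ 4 * (N + 1) := by
  rw [dz_bub hc]
  have h1 := half_pow_le_norm_pow_sub_one (N := N) hy
  set w := ‖y ^ (N + 1) - 1‖ with hw
  have h2 : ‖(bubDen N c m y : ℂ)‖ = 1 + c * Real.exp m * w ^ 2 := by
    rw [Complex.norm_real, Real.norm_of_nonneg (bubDen_pos hc y).le, bubDen]
  have h3 : ‖(N + 1 : ℂ)‖ = N + 1 := by exact_mod_cast Complex.norm_natCast (N + 1)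
  have h5 : ‖(c : ℂ) * Real.exp m‖ = c * Real.exp m := by
    rw [← Complex.ofReal_mul, Complex.norm_real, Real.norm_of_nonneg (by positivity)]
  rw [show y * (-2 * (c * Real.exp m * ((N + 1) * y ^ N * conj (y ^ (N + 1) - 1))) *
      (bubDen N c m y : ℂ)⁻¹) = -2 * (c * Real.exp m * ((N + 1) * y ^ (N + 1) * conj (y ^ (N + 1) - 1))) *
      (bubDen N c m y : ℂ)⁻¹ by ring]
  simp only [norm_mul, norm_neg, norm_inv, norm_pow, RCLike.norm_conj, Complex.norm_ofNat, h2, h3] at *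
  rw [h5, ← hw, ← div_eq_mul_inv, div_le_iff₀ (by positivity)]
  have h4 : 0 ≤ c * Real.exp m := by positivity
  have h6 : 0 ≤ w := norm_nonneg _
  have h7 : (‖y‖ ^ (N + 1)) * w ≤ 2 * w * w := by nlinarith
  have h8 := mul_le_mul_of_nonneg_left h7 h4
  have h9 : (0 : ℝ) ≤ N + 1 := by positivity
  have h10 := mul_le_mul_of_nonneg_left h8 h9
  nlinarith

lemma bub_le (hc : 0 < c) (y : ℂ) : bub N c m y ≤ m := by
  have := Real.log_nonneg (one_le_bubDen (N := N) (m := m) hc y)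
  unfold bub; linarith

lemma exp_bub (hc : 0 < c) (y : ℂ) : Real.exp (bub N c m y) = Real.exp m * (bubDen N c m y ^ 2)⁻¹ := by
  rw [bub, Real.exp_sub, two_mul, Real.exp_add, Real.exp_log (bubDen_pos hc y)]
  field_simp

lemma exp_bub_le (hc : 0 < c) {a : ℝ} (ha : 0 < a) {y : ℂ} (hy : a ≤ ‖y ^ (N + 1) - 1‖) :
    Real.exp (bub N c m y) ≤ Real.exp (-m) * (c ^ 2 * a ^ 4)⁻¹ := by
  rw [exp_bub hc]
  have h1 : c * Real.exp m * a ^ 2 ≤ bubDen N c m y := by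
    have : c * Real.exp m * a ^ 2 ≤ c * Real.exp m * ‖y ^ (N + 1) - 1‖ ^ 2 := by gcongr
    unfold bubDen; linarith
  calc Real.exp m * (bubDen N c m y ^ 2)⁻¹ ≤ Real.exp m * ((c * Real.exp m * a ^ 2) ^ 2)⁻¹ := by
        gcongr
    _ = _ := by rw [Real.exp_neg]; field_simp

lemma bub_one : bub N c m 1 = m := by simp [bub, bubDen]

lemma le_bub (hc : 0 < c) (hm : 0 ≤ m) {a : ℝ} (ha : 1 ≤ a) {y : ℂ} (hy : ‖y ^ (N + 1) - 1‖ ≤ a) :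
    -m - 2 * Real.log (1 + c) - 4 * Real.log a ≤ bub N c m y := by
  have h1 : bubDen N c m y ≤ (1 + c) * Real.exp m * a ^ 2 := by
    have h2 : ‖y ^ (N + 1) - 1‖ ^ 2 ≤ a ^ 2 := by gcongr
    have h3 : 1 ≤ Real.exp m * a ^ 2 := by
      nlinarith [Real.one_le_exp hm, mul_le_mul ha ha zero_le_one (by linarith)]
    have h4 : c * Real.exp m * ‖y ^ (N + 1) - 1‖ ^ 2 ≤ c * Real.exp m * a ^ 2 := by gcongr
    unfold bubDen; nlinarith
  have h2 := Real.log_le_log (bubDen_pos hc y) h1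
  have ha0 : 0 < a := by linarith
  rw [Real.log_mul (by positivity) (by positivity), Real.log_mul (by positivity) (by positivity),
    Real.log_exp, Real.log_pow] at h2
  unfold bub
  push_cast at h2
  linarith

end

/-- The density `|z|^{2N} e^v`. -/
def dens (N : ℕ) (v : ℂ → ℝ) (z : ℂ) : ENNReal := ‖z‖ₑ ^ (2 * N) * ENNReal.ofReal (Real.exp (v z))

/-- The Newton-type potential of the density over `ball 0 4` with kernel `1/|z - y|`. -/
def pot (N : ℕ) (v : ℂ → ℝ) (y : ℂ) : ENNReal := ∫⁻ z in ball (0 : ℂ) 4, dens N v z * ‖z - y‖ₑ⁻¹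

/-- A rescaled blowup solution on a ball of radius `R`. -/
structure BubbleData (N : ℕ) (B R μ : ℝ) (v κ : ℂ → ℝ) : Prop where
  one_le_N : 1 ≤ N
  one_le : 1 ≤ B
  le_R : 64 ≤ R
  contDiff : ContDiff ℝ 2 v
  contDiff_weight : ContDiff ℝ 1 κ
  pde : ∀ z ∈ ball (0 : ℂ) R, lap v z = -(‖z‖ ^ (2 * N) * κ z * Real.exp (v z))
  le_weight : ∀ z ∈ ball (0 : ℂ) R, B⁻¹ ≤ κ z
  weight_le : ∀ z ∈ ball (0 : ℂ) R, κ z ≤ B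
  dz_weight_le : ∀ z ∈ ball (0 : ℂ) R, ‖dz (fun y => (κ y : ℂ)) z‖ ≤ B / R
  mass : ∫⁻ z in ball (0 : ℂ) R, dens N v z ≤ ENNReal.ofReal B
  apply_one : v 1 = μ
  dz_one : dz (fun y => (v y : ℂ)) 1 = 0
  le_outer : ∀ z ∈ ball (0 : ℂ) R, R / 8 ≤ ‖z‖ → v z ≤ B
  mu_nonneg : 0 ≤ μ
  mu_le : μ ≤ B * Real.log R

lemma measurable_dens (N : ℕ) {v : ℂ → ℝ} (hv : Continuous v) : Measurable (dens N v) := by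
  have := hv.measurable
  unfold dens
  fun_prop

lemma dens_eq (N : ℕ) (v : ℂ → ℝ) (z : ℂ) :
    dens N v z = ENNReal.ofReal (‖z‖ ^ (2 * N) * Real.exp (v z)) := by
  rw [dens, ENNReal.ofReal_mul (by positivity), ENNReal.ofReal_pow (norm_nonneg _),
    ofReal_norm]

lemma measurable_pot (N : ℕ) {v : ℂ → ℝ} (hv : Continuous v) : Measurable (pot N v) := by
  unfold pot
  refine Measurable.lintegral_prod_right' (f := fun p : ℂ × ℂ => dens N v p.2 * ‖p.2 - p.1‖ₑ⁻¹) ?_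
  have h : Measurable fun p : ℂ × ℂ => dens N v p.2 := (measurable_dens N hv).comp measurable_snd
  exact h.mul (by fun_prop)

/-- The reference annulus. -/
def refAnnulus (R : ℝ) : Set ℂ := closedBall (0 : ℂ) (3 * R / 4) \ ball 0 (3 * R / 8)

lemma enorm_quadDiff_le_pot (N : ℕ) (B : ℝ) : ∃ C : ℝ, 0 < C ∧ ∀ {R μ : ℝ} {v κ : ℂ → ℝ}
    (_ : BubbleData N B R μ v κ) {S m s₁ s₂ : ℝ} (_ : 0 < S) (_ : 0 ≤ m) (_ : 0 ≤ s₁) (_ : 0 ≤ s₂)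
    (_ : ∀ z ∈ refAnnulus R, |v z - bub N (κ 1 / (8 * (N + 1) ^ 2)) μ z| ≤ S)
    (_ : ∫ z in refAnnulus R,
      |lap (fun y => v y - bub N (κ 1 / (8 * (N + 1) ^ 2)) μ y) z| ≤ m)
    (_ : ∀ z ∈ ball (0 : ℂ) 4, ‖dz (fun y => (κ y : ℂ)) z‖ ≤ s₁)
    (_ : ∫⁻ z in ball (0 : ℂ) R \ ball 0 4, dens N v z * ‖dz (fun y => (κ y : ℂ)) z‖ₑ ≤
      ENNReal.ofReal s₂) (y : ℂ) (_ : ‖y‖ ≤ 2),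
    ‖quadDiff N v y‖ₑ ≤ ENNReal.ofReal (C * s₁) * pot N v y +
      ENNReal.ofReal (C * (s₂ + (S + m) * (1 + S) / R)) := by
  obtain ⟨A, hA, hcut⟩ := exists_isCutoffPair
  set E : ℝ := 200 * A * (1 + 4 * (N + 1) + N) * (1 + A) with hE
  have hE0 : 0 < E := by positivity
  have hI := bubbleMass_pos
  refine ⟨(1 + E) / bubbleMass, by positivity, ?_⟩
  intro R μ v κ D S m s₁ s₂ hS hm0 hs₁ hs₂ hwS hm hk1 hk2 y hy
  have hR : 64 ≤ R := D.le_R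
  have hR0 : 0 < R := by linarith
  obtain ⟨χ, θ, hc⟩ := hcut R hR0
  have h1R : (1 : ℂ) ∈ ball (0 : ℂ) R := by simp; linarith
  have hκ1 : 0 < κ 1 := (inv_pos.2 (one_pos.trans_le D.one_le)).trans_le (D.le_weight 1 h1R)
  have hc0 : 0 < κ 1 / (8 * (N + 1) ^ 2) := by positivity
  have hK2 : ∀ z ∈ refAnnulus R, 2 ≤ ‖z‖ := by
    intro z hz
    have := hz.2
    simp only [mem_ball, dist_zero_right, not_lt] at this
    linarith
  have hbd := fun s hs => norm_integral_quadDiff_cutoff_le (N := N) (D := 4 * (N + 1)) hR0 hA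
    (by positivity) hS hm0 D.contDiff (contDiff_bub (m := μ) hc0) hc hwS hm
    (fun z _ => quadDiff_bub D.one_le_N hc0 z) (fun z hz => norm_mul_dz_bub_le hc0 (hK2 z hz))
    (y := y) (s := s) (by linarith) hs
  have hsub : closedBall (0 : ℂ) (5 * R / 8) ⊆ ball 0 R := closedBall_subset_ball (by linarith)
  have hmain := enorm_quadDiff_le N D.contDiff D.contDiff_weight hc.smooth hc.compact
    (fun z hz => D.pde z (hsub (hc.tsupp hz)))
    (hc.eq_one y (by simp; linarith)) hbd
  have hint : ∫⁻ z, ‖z‖ₑ ^ (2 * N + 1) * ‖dz (fun y => (κ y : ℂ)) z‖ₑ *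
        ENNReal.ofReal (Real.exp (v z)) * ‖χ z‖ₑ * ‖z - y‖ₑ⁻¹ ≤
      4 * ENNReal.ofReal s₁ * pot N v y + 2 * ENNReal.ofReal s₂ := by
    have hχ1 : ∀ z, ‖χ z‖ₑ ≤ 1 := fun z => by
      rw [← ofReal_norm, Real.norm_eq_abs]
      exact ENNReal.ofReal_le_one.2 (hc.le_one z)
    have hs : Function.support (fun z => ‖z‖ₑ ^ (2 * N + 1) * ‖dz (fun y => (κ y : ℂ)) z‖ₑ *
        ENNReal.ofReal (Real.exp (v z)) * ‖χ z‖ₑ * ‖z - y‖ₑ⁻¹) ⊆ ball 0 R := by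
      intro z hz
      by_contra h
      have : χ z = 0 := image_eq_zero_of_notMem_tsupport fun h' => h (hsub (hc.tsupp h'))
      simp [this] at hz
    rw [← setLIntegral_eq_of_support_subset hs,
      ← union_sdiff_cancel (ball_subset_ball (by linarith : (4:ℝ) ≤ R)),
      lintegral_union (measurableSet_ball.diff measurableSet_ball) disjoint_sdiff_self_right]
    refine add_le_add ?_ ?_
    · unfold pot
      rw [← lintegral_const_mul' _ _ (by finiteness)]
      refine setLIntegral_mono_ae' measurableSet_ball (ae_of_all _ fun z hz => ?_)
      have h1 : ‖z‖ₑ ≤ 4 := by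
        rw [← ofReal_norm]
        refine ENNReal.ofReal_le_of_le_toReal ?_
        simpa using (mem_ball_zero_iff.1 hz).le
      have h2 : ‖dz (fun y => (κ y : ℂ)) z‖ₑ ≤ ENNReal.ofReal s₁ := by
        rw [← ofReal_norm]
        exact ENNReal.ofReal_le_ofReal (hk1 z hz)
      calc _ = (‖z‖ₑ * ‖dz (fun y => (κ y : ℂ)) z‖ₑ * ‖χ z‖ₑ) * (dens N v z * ‖z - y‖ₑ⁻¹) := by
            unfold dens; ring
        _ ≤ (4 * ENNReal.ofReal s₁ * 1) * (dens N v z * ‖z - y‖ₑ⁻¹) := by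
            gcongr
            exact hχ1 z
        _ = _ := by ring
    · refine le_trans ?_ (mul_le_mul_right hk2 2)
      rw [← lintegral_const_mul' _ _ (by finiteness)]
      refine setLIntegral_mono_ae' (measurableSet_ball.diff measurableSet_ball)
        (ae_of_all _ fun z hz => ?_)
      have hz4 : 4 ≤ ‖z‖ := by simpa using hz.2
      have h1 : ‖z‖ₑ * ‖z - y‖ₑ⁻¹ ≤ 2 := by
        have h3 := norm_sub_norm_le z y
        have h4 : 0 < ‖z - y‖ := by linarith
        rw [← div_eq_mul_inv]
        refine ENNReal.div_le_of_le_mul ?_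
        rw [← ofReal_norm, ← ofReal_norm, ← ENNReal.ofReal_ofNat 2,
          ← ENNReal.ofReal_mul (by norm_num)]
        exact ENNReal.ofReal_le_ofReal (by linarith)
      calc _ = (‖z‖ₑ * ‖z - y‖ₑ⁻¹) * ‖χ z‖ₑ * (dens N v z * ‖dz (fun y => (κ y : ℂ)) z‖ₑ) := by
            unfold dens; ring
        _ ≤ 2 * 1 * (dens N v z * ‖dz (fun y => (κ y : ℂ)) z‖ₑ) := by
            gcongr
            exact hχ1 z
        _ = _ := by ring
  have hI2 : ‖((∫ t : ℂ, ((1 + ‖t‖ ^ 2) ^ 2)⁻¹ : ℝ) : ℂ)‖ₑ = ENNReal.ofReal bubbleMass := by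
    rw [← ofReal_norm, Complex.norm_real]
    exact congrArg _ (Real.norm_of_nonneg hI.le)
  rw [enorm_mul, hI2] at hmain
  have hb0 : 0 ≤ (S + m) * (1 + S) / R := by positivity
  have hfin : ‖quadDiff N v y‖ₑ * ENNReal.ofReal bubbleMass ≤
      ENNReal.ofReal ((1 + E) * s₁) * pot N v y +
      ENNReal.ofReal ((1 + E) * (s₂ + (S + m) * (1 + S) / R)) := by
    refine hmain.trans ?_
    refine (add_le_add le_rfl (mul_le_mul_right hint 4⁻¹)).trans ?_
    have h4 : (4⁻¹ : ENNReal) * (4 * ENNReal.ofReal s₁ * pot N v y + 2 * ENNReal.ofReal s₂) ≤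
        ENNReal.ofReal s₁ * pot N v y + ENNReal.ofReal s₂ := by
      have h5 : (4⁻¹ : ENNReal) * 4 = 1 := ENNReal.inv_mul_cancel (by norm_num) (by norm_num)
      have h6 : (4⁻¹ : ENNReal) * 2 ≤ 1 := by
        rw [← h5]; gcongr; norm_num
      calc _ = (4⁻¹ * 4) * (ENNReal.ofReal s₁ * pot N v y) + (4⁻¹ * 2) * ENNReal.ofReal s₂ := by ring
        _ ≤ 1 * (ENNReal.ofReal s₁ * pot N v y) + 1 * ENNReal.ofReal s₂ := by
            rw [h5]; gcongr
        _ = _ := by ring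
    refine (add_le_add le_rfl h4).trans ?_
    rw [← hE, mul_div_assoc, add_left_comm, ← ENNReal.ofReal_add (by positivity) hs₂]
    gcongr
    · nlinarith
    · nlinarith
  rw [← ENNReal.le_div_iff_mul_le (by simp [hI]) (by simp)] at hfin
  refine hfin.trans (le_of_eq ?_)
  rw [ENNReal.div_eq_inv_mul, mul_add, ← mul_assoc, ← ENNReal.ofReal_inv_of_pos hI,
    ← ENNReal.ofReal_mul (by positivity), ← ENNReal.ofReal_mul (by positivity)]
  rw [show bubbleMass⁻¹ * ((1 + E) * s₁) = (1 + E) / bubbleMass * s₁ by ring,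
    show bubbleMass⁻¹ * ((1 + E) * (s₂ + (S + m) * (1 + S) / R)) =
      (1 + E) / bubbleMass * (s₂ + (S + m) * (1 + S) / R) by ring]

/-- A Grönwall inequality with variable coefficients on `[0, 1]`. -/
lemma norm_le_mul_exp_of_norm_deriv_le {E : Type*} [NormedAddCommGroup E] [NormedSpace ℝ E]
    {X X' : ℝ → E} {k j : ℝ → ℝ} (hk : Continuous k) (hj : Continuous j)
    (hj0 : ∀ t, 0 ≤ j t) (hX : ∀ t ∈ Icc (0 : ℝ) 1, HasDerivAt X (X' t) t)
    (h : ∀ t ∈ Icc (0 : ℝ) 1, ‖X' t‖ ≤ k t * ‖X t‖ + j t) (hk0 : ∀ t, 0 ≤ k t) :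
    ‖X 1‖ ≤ (‖X 0‖ + ∫ t in (0 : ℝ)..1, j t) * Real.exp (∫ t in (0 : ℝ)..1, k t) := by
  have key : ∀ η : ℝ, 0 < η → ‖X 1‖ ≤
      (‖X 0‖ + η + ∫ t in (0 : ℝ)..1, (j t + η)) * Real.exp (∫ t in (0 : ℝ)..1, k t) := by
    intro η hη
    have hjd : ∀ t, HasDerivAt (fun t => ∫ s in (0 : ℝ)..t, (j s + η)) (j t + η) t := fun t =>
      intervalIntegral.integral_hasDerivAt_right
        ((hj.add continuous_const).intervalIntegrable _ _)
        (hj.add continuous_const).stronglyMeasurable.stronglyMeasurableAtFilter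
        (hj.add continuous_const).continuousAt
    have hkd : ∀ t, HasDerivAt (fun t => ∫ s in (0 : ℝ)..t, k s) (k t) t := fun t =>
      intervalIntegral.integral_hasDerivAt_right (hk.intervalIntegrable _ _)
        hk.stronglyMeasurable.stronglyMeasurableAtFilter hk.continuousAt
    have hBd : ∀ t, HasDerivAt (fun t => (‖X 0‖ + η + ∫ s in (0 : ℝ)..t, (j s + η)) *
        Real.exp (∫ s in (0 : ℝ)..t, k s))
        ((j t + η) * Real.exp (∫ s in (0 : ℝ)..t, k s) +
          (‖X 0‖ + η + ∫ s in (0 : ℝ)..t, (j s + η)) *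
          (Real.exp (∫ s in (0 : ℝ)..t, k s) * k t)) t := fun t =>
      ((hjd t).const_add _).mul (hkd t).exp
    have := image_norm_le_of_norm_deriv_right_lt_deriv_boundary (a := 0) (b := 1) (f := X)
      (f' := X') (fun t ht => (hX t ht).continuousAt.continuousWithinAt)
      (fun t ht => (hX t (Ico_subset_Icc_self ht)).hasDerivWithinAt) (B := fun t =>
        (‖X 0‖ + η + ∫ s in (0 : ℝ)..t, (j s + η)) * Real.exp (∫ s in (0 : ℝ)..t, k s))
      (by simp; exact hη.le) hBd ?_ (right_mem_Icc.2 zero_le_one)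
    · exact this
    · intro t ht heq
      have h1 := h t (Ico_subset_Icc_self ht)
      have h2 : 1 ≤ Real.exp (∫ s in (0 : ℝ)..t, k s) :=
        Real.one_le_exp (intervalIntegral.integral_nonneg ht.1 fun s _ => hk0 s)
      rw [heq] at h1
      nlinarith [hj0 t]
  have hlim : Tendsto (fun η : ℝ => (‖X 0‖ + η + ((∫ t in (0 : ℝ)..1, j t) + η)) *
      Real.exp (∫ t in (0 : ℝ)..1, k t)) (nhdsWithin 0 (Ioi 0))
      (nhds ((‖X 0‖ + 0 + ((∫ t in (0 : ℝ)..1, j t) + 0)) * Real.exp (∫ t in (0 : ℝ)..1, k t))) := by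
    refine Tendsto.mono_left ?_ nhdsWithin_le_nhds
    exact Continuous.tendsto (by fun_prop) 0
  rw [add_zero, add_zero] at hlim
  refine ge_of_tendsto hlim ?_
  filter_upwards [self_mem_nhdsWithin] with η hη
  have h1 := key η hη
  rwa [intervalIntegral.integral_add (hj.intervalIntegrable _ _) (by simp),
    intervalIntegral.integral_const, sub_zero, one_smul] at h1

/-- The function `e^{-v/2}`. -/
def expHalf (v : ℂ → ℝ) (z : ℂ) : ℂ := (Real.exp (-v z / 2) : ℂ)

/-- The weighted derivative of `e^{-v/2}`. -/
def wDeriv (N : ℕ) (v : ℂ → ℝ) (z : ℂ) : ℂ :=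
  -(1 / 2) * ((z ^ N)⁻¹ * (expHalf v z * dz (fun y => (v y : ℂ)) z))

/-- The weighted second derivative of `e^{-v/2}`. -/
def wDeriv₂ (N : ℕ) (v κ : ℂ → ℝ) (z : ℂ) : ℂ :=
  ((1 / 8) * (κ z : ℂ) + wDeriv N v z * conj (wDeriv N v z)) * (expHalf v z)⁻¹

lemma expHalf_ne (v : ℂ → ℝ) (z : ℂ) : expHalf v z ≠ 0 := by
  unfold expHalf; exact_mod_cast (Real.exp_pos _).ne'

lemma conj_expHalf (v : ℂ → ℝ) (z : ℂ) : conj (expHalf v z) = expHalf v z := Complex.conj_ofReal _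

lemma hasWirt_ofReal {v : ℂ → ℝ} {y : ℂ} (h : DifferentiableAt ℝ v y) :
    HasWirt (fun y => (v y : ℂ)) (dz (fun y => (v y : ℂ)) y) (conj (dz (fun y => (v y : ℂ)) y)) y := by
  rw [← dzb_ofReal v h]
  exact DifferentiableAt.hasWirt (Complex.ofRealCLM.differentiableAt.comp y h)

section
variable {N : ℕ} {v κ : ℂ → ℝ} {z : ℂ}

lemma hasWirt_expHalf (hv : ContDiff ℝ 2 v) (hz : z ≠ 0) :
    HasWirt (expHalf v) (z ^ N * wDeriv N v z) (conj (z ^ N * wDeriv N v z)) z := by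
  have h1 := hasWirt_ofReal (hv.differentiable (by norm_num) z)
  have h2 := h1.comp_real (f := fun t => Real.exp (-t / 2)) (d := Real.exp (-v z / 2) * (-1 / 2))
    (by simpa using ((hasDerivAt_id (v z)).neg.div_const 2).exp)
  have hzN : z ^ N ≠ 0 := pow_ne_zero _ hz
  have e : z ^ N * wDeriv N v z = -(1 / 2) * (expHalf v z * dz (fun y => (v y : ℂ)) z) := by
    unfold wDeriv; field_simp
  rw [e]
  unfold expHalf
  convert h2 using 1
  · push_cast; ring
  · simp only [map_mul, map_neg, map_div₀, map_one, map_ofNat, Complex.conj_ofReal]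
    push_cast
    ring

lemma hasWirt_wDeriv (hv : ContDiff ℝ 2 v) (hz : z ≠ 0)
    (hpde : lap v z = -(‖z‖ ^ (2 * N) * κ z * Real.exp (v z))) :
    HasWirt (wDeriv N v) (-(1 / 2) * (z ^ (N + 1))⁻¹ * quadDiff N v z * expHalf v z)
      (conj (z ^ N) * wDeriv₂ N v κ z) z := by
  have hzN : z ^ N ≠ 0 := pow_ne_zero _ hz
  have hcz : conj z ≠ 0 := by simpa using hz
  have h1 := hasWirt_expHalf (N := N) hv hz
  have h2 := ContDiff.hasWirt (ContDiff.dz (n := 1) (contDiff_coe hv)) one_ne_zero z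
  have h3 := ((hasWirt_id z).pow N).inv hzN
  have h4 := (h3.mul (h1.mul h2)).const_mul (-(1 / 2))
  have h5 := dzb_dz_ofReal hv z
  rw [hpde] at h5
  have h6 : (Real.exp (v z) : ℂ) = (expHalf v z ^ 2)⁻¹ := by
    unfold expHalf
    rw [← Complex.ofReal_pow, ← Complex.ofReal_inv, ← Real.exp_nat_mul, ← Real.exp_neg]
    congr 2; push_cast; ring
  have h7 : ((‖z‖ ^ (2 * N) : ℝ) : ℂ) = z ^ N * conj z ^ N := by
    rw [← mul_pow, Complex.mul_conj, Complex.normSq_eq_norm_sq]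
    push_cast
    rw [pow_mul]
  have hf := expHalf_ne v z
  have e : wDeriv N v = fun z => -(1 / 2) * ((z ^ N)⁻¹ * (expHalf v z * dz (fun y => (v y : ℂ)) z)) :=
    rfl
  rw [e]
  convert h4 using 1
  · unfold quadDiff wDeriv
    rcases N with _ | n
    · field_simp; simp; ring_nf; simp
    · rw [Nat.add_sub_cancel]
      have : z ^ (n + 1 + 1) = z * z ^ n * z := by ring
      have h' : z ^ (n + 1) = z * z ^ n := by ring
      have hzn : z ^ n ≠ 0 := pow_ne_zero _ hz
      rw [this, h']
      field_simp
      push_cast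
      ring
  · rw [h5]
    simp only [Complex.ofReal_neg, Complex.ofReal_mul]
    rw [h6, h7]
    unfold wDeriv₂ wDeriv
    simp only [map_mul, map_neg, map_inv₀, conj_expHalf, map_pow, map_div₀, map_one, map_ofNat]
    have : conj z ^ N ≠ 0 := pow_ne_zero _ hcz
    field_simp
    ring

lemma hasWirt_wDeriv₂ (hv : ContDiff ℝ 2 v) (hκ : ContDiff ℝ 1 κ) (hz : z ≠ 0)
    (hpde : lap v z = -(‖z‖ ^ (2 * N) * κ z * Real.exp (v z))) :
    HasWirt (wDeriv₂ N v κ)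
      ((1 / 8) * dz (fun y => (κ y : ℂ)) z * (expHalf v z)⁻¹ +
        -(1 / 2) * (z ^ (N + 1))⁻¹ * quadDiff N v z * conj (wDeriv N v z))
      (conj ((1 / 8) * dz (fun y => (κ y : ℂ)) z * (expHalf v z)⁻¹ +
        -(1 / 2) * (z ^ (N + 1))⁻¹ * quadDiff N v z * conj (wDeriv N v z))) z := by
  have h1 := hasWirt_expHalf (N := N) hv hz
  have h2 := hasWirt_wDeriv hv hz hpde
  have h3 := hasWirt_ofReal (hκ.differentiable (by norm_num) z)
  have hf := expHalf_ne v z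
  have h4 := ((h3.const_mul (1 / 8)).add (h2.mul h2.conj)).mul (h1.inv hf)
  have e : wDeriv₂ N v κ = fun z =>
    ((1 / 8) * (κ z : ℂ) + wDeriv N v z * conj (wDeriv N v z)) * (expHalf v z)⁻¹ := rfl
  have hp : (1 / 8) * (κ z : ℂ) + wDeriv N v z * conj (wDeriv N v z) =
      wDeriv₂ N v κ z * expHalf v z := by
    rw [wDeriv₂]; field_simp
  have hpc : conj (wDeriv₂ N v κ z) = wDeriv₂ N v κ z := by
    rw [wDeriv₂]
    simp only [map_mul, map_add, map_inv₀, conj_expHalf, map_div₀, map_one, map_ofNat,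
      Complex.conj_conj, Complex.conj_ofReal]
    ring
  rw [e]
  convert h4 using 1
  · rw [hp]
    simp only [map_mul, hpc, map_pow, Complex.conj_conj]
    field_simp
    ring
  · rw [hp]
    simp only [map_mul, map_add, map_neg, map_inv₀, conj_expHalf, map_div₀, map_one, map_ofNat,
      Complex.conj_conj, map_pow]
    field_simp
    ring

end

section
variable {N : ℕ} {c m : ℝ}

lemma expHalf_bub (hc : 0 < c) (z : ℂ) :
    expHalf (bub N c m) z = ((Real.exp (-m / 2) * bubDen N c m z : ℝ) : ℂ) := by
  unfold expHalf bub
  congr 1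
  rw [show -(m - 2 * Real.log (bubDen N c m z)) / 2 = -m / 2 + Real.log (bubDen N c m z) by ring,
    Real.exp_add, Real.exp_log (bubDen_pos hc z)]

lemma exp_half_mul_exp_neg_half (m : ℝ) : Real.exp (-m / 2) * Real.exp m = Real.exp (m / 2) := by
  rw [← Real.exp_add]; congr 1; ring

lemma wDeriv_bub (hc : 0 < c) {z : ℂ} (hz : z ≠ 0) : wDeriv N (bub N c m) z =
    ((c * (N + 1) * Real.exp (m / 2) : ℝ) : ℂ) * conj (z ^ (N + 1) - 1) := by
  have hzN : z ^ N ≠ 0 := pow_ne_zero _ hz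
  have h0 : (bubDen N c m z : ℂ) ≠ 0 := by exact_mod_cast (bubDen_pos hc z).ne'
  rw [wDeriv, expHalf_bub hc, dz_bub hc, ← exp_half_mul_exp_neg_half m]
  simp only [Complex.ofReal_mul]
  field_simp
  push_cast
  ring

lemma wDeriv₂_bub (hc : 0 < c) {z : ℂ} (hz : z ≠ 0) :
    wDeriv₂ N (bub N c m) (fun _ => 8 * (N + 1) ^ 2 * c) z =
      ((c * (N + 1) ^ 2 * Real.exp (m / 2) : ℝ) : ℂ) := by
  have h0 : (bubDen N c m z : ℂ) ≠ 0 := by exact_mod_cast (bubDen_pos hc z).ne'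
  have h1 : (Real.exp (-m / 2) : ℂ) ≠ 0 := by exact_mod_cast (Real.exp_pos _).ne'
  have h2 : (Real.exp (-m / 2) : ℂ) * (Real.exp (m / 2) : ℂ) = 1 := by
    rw [← Complex.ofReal_mul, ← Real.exp_add, show -m / 2 + m / 2 = 0 by ring]; simp
  have h3 : (Real.exp (m / 2) : ℂ) * (Real.exp (m / 2) : ℂ) = Real.exp m := by
    rw [← Complex.ofReal_mul, ← Real.exp_add]; congr 2; ring
  rw [wDeriv₂, wDeriv_bub hc hz, expHalf_bub hc]
  rw [mul_inv_eq_iff_eq_mul₀ (by simp only [Complex.ofReal_mul]; exact mul_ne_zero h1 h0)]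
  simp only [map_mul, Complex.conj_ofReal, Complex.conj_conj, Complex.ofReal_mul, Complex.ofReal_pow,
    Complex.ofReal_add, Complex.ofReal_natCast, Complex.ofReal_one, Complex.ofReal_ofNat]
  rw [bubDen_coe, show conj ((N : ℂ) + 1) = N + 1 by simp]
  linear_combination (c : ℂ) ^ 2 * (N + 1) ^ 2 * ((z ^ (N + 1) - 1) * conj (z ^ (N + 1) - 1)) * h3 -
    c * (N + 1) ^ 2 * (1 + c * Real.exp m * ((z ^ (N + 1) - 1) * conj (z ^ (N + 1) - 1))) * h2

lemma norm_pow_sub_one_le {z : ℂ} (hz : ‖z‖ ≤ 2) :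
    ‖z ^ (N + 1) - 1‖ ≤ (N + 1) * 2 ^ N * ‖z - 1‖ := by
  rw [← geom_sum_mul, norm_mul]
  gcongr
  refine (norm_sum_le _ _).trans ?_
  calc ∑ i ∈ Finset.range (N + 1), ‖z ^ i‖ ≤ ∑ i ∈ Finset.range (N + 1), (2 : ℝ) ^ N := by
        refine Finset.sum_le_sum fun i hi => ?_
        rw [norm_pow]
        refine (pow_le_pow_left₀ (norm_nonneg _) hz i).trans ?_
        exact pow_le_pow_right₀ one_le_two (by simpa [Nat.lt_succ_iff] using hi)
    _ = _ := by simp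

lemma norm_expHalf_add_norm_wDeriv_bub_le (hc : 0 < c) {z : ℂ} (hz : z ≠ 0) (h : ‖z - 1‖ ≤ 1) :
    ‖expHalf (bub N c m) z‖ + ‖wDeriv N (bub N c m) z‖ ≤
      (1 + 2 * c * ((N + 1) * 2 ^ N) ^ 2) * Real.exp (m / 2) * (Real.exp (-m) + ‖z - 1‖) := by
  have hz2 : ‖z‖ ≤ 2 := by
    have := norm_add_le (z - 1) 1
    simp only [sub_add_cancel, norm_one] at this
    linarith
  have h1 := norm_pow_sub_one_le (N := N) hz2
  set K : ℝ := (N + 1) * 2 ^ N with hK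
  have hNK : (N + 1 : ℝ) ≤ K := by
    have : (1 : ℝ) ≤ 2 ^ N := one_le_pow₀ one_le_two
    have : (0 : ℝ) ≤ N := Nat.cast_nonneg _
    nlinarith
  have hK1 : 1 ≤ K := le_trans (by simp) hNK
  rw [expHalf_bub hc, wDeriv_bub hc hz, norm_mul, RCLike.norm_conj, Complex.norm_real,
    Complex.norm_real, Real.norm_of_nonneg (mul_nonneg (Real.exp_pos _).le (bubDen_pos hc z).le),
    Real.norm_of_nonneg (by positivity), bubDen]
  have he : Real.exp (-m / 2) = Real.exp (m / 2) * Real.exp (-m) := by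
    rw [← Real.exp_add]; congr 1; ring
  have he2 : Real.exp (-m) * Real.exp m = 1 := by rw [← Real.exp_add]; simp
  rw [he]
  set w := ‖z ^ (N + 1) - 1‖
  set r := ‖z - 1‖
  have hr : 0 ≤ r := norm_nonneg _
  have hw : 0 ≤ w := norm_nonneg _
  have hw2 : w ^ 2 ≤ K ^ 2 * r := by
    calc w ^ 2 ≤ (K * r) ^ 2 := by gcongr
      _ = K ^ 2 * r * r := by ring
      _ ≤ K ^ 2 * r * 1 := by gcongr
      _ = _ := by ring
  have hw3 : (N + 1) * w ≤ K ^ 2 * r := by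
    calc (N + 1) * w ≤ K * (K * r) := by gcongr
      _ = _ := by ring
  calc _ = Real.exp (m / 2) * (Real.exp (-m) + c * (Real.exp (-m) * Real.exp m) * w ^ 2 +
        c * ((N + 1) * w)) := by ring
    _ ≤ Real.exp (m / 2) * (Real.exp (-m) + c * (Real.exp (-m) * Real.exp m) * (K ^ 2 * r) +
        c * (K ^ 2 * r)) := by gcongr
    _ = Real.exp (m / 2) * (Real.exp (-m) + 2 * c * K ^ 2 * r) := by rw [he2]; ring
    _ ≤ Real.exp (m / 2) * ((1 + 2 * c * K ^ 2) * (Real.exp (-m) + r)) := by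
        gcongr
        have : 0 ≤ 2 * c * K ^ 2 * Real.exp (-m) := by positivity
        nlinarith
    _ = _ := by ring

end

/-- Difference between the second order data of `e^{-v/2}` and `a` times that of the bubble. -/
def stateDiff (N : ℕ) (v κ : ℂ → ℝ) (m a : ℝ) (z : ℂ) : ℂ × ℂ × ℂ :=
  (expHalf v z - a * expHalf (bub N (κ 1 / (8 * (N + 1) ^ 2)) m) z,
    wDeriv N v z - a * wDeriv N (bub N (κ 1 / (8 * (N + 1) ^ 2)) m) z,
    wDeriv₂ N v κ z - a * wDeriv₂ N (bub N (κ 1 / (8 * (N + 1) ^ 2)) m) (fun _ => κ 1) z)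

lemma norm_re_pair_le (a ω : ℂ) {x : ℝ} (h : ‖a‖ ≤ x) : ‖a * ω + conj a * conj ω‖ ≤ ‖ω‖ * (2 * x) := by
  refine (norm_add_le _ _).trans ?_
  rw [norm_mul, norm_mul, RCLike.norm_conj, RCLike.norm_conj]
  nlinarith [norm_nonneg ω]

lemma HasWirt.hasDerivAt_line {g : ℂ → ℂ} {a b c ω : ℂ} {t : ℝ} (h : HasWirt g a b (c + t * ω)) :
    HasDerivAt (fun t : ℝ => g (c + t * ω)) (a * ω + b * conj ω) t := by
  have h1 : HasDerivAt (fun t : ℝ => c + t * ω) ω t := by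
    have := ((Complex.ofRealCLM.hasDerivAt (x := t)).mul_const ω).const_add c
    simpa using this
  have h' : HasFDerivAt g (wirtL a b) (c + t * ω) := h
  have h2 := h'.comp_hasDerivAt t h1
  simpa [wirtL, Function.comp_def] using h2

lemma BubbleData.one_mem {N : ℕ} {B R μ : ℝ} {v κ : ℂ → ℝ} (D : BubbleData N B R μ v κ) :
    (1 : ℂ) ∈ ball (0 : ℂ) R := by
  have := D.le_R
  simp; linarith

lemma BubbleData.pos {N : ℕ} {B R μ : ℝ} {v κ : ℂ → ℝ} (D : BubbleData N B R μ v κ) : 0 < B :=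
  one_pos.trans_le D.one_le

lemma BubbleData.coeff_pos {N : ℕ} {B R μ : ℝ} {v κ : ℂ → ℝ} (D : BubbleData N B R μ v κ) :
    0 < κ 1 / (8 * (N + 1) ^ 2) := by
  have := (inv_pos.2 D.pos).trans_le (D.le_weight 1 D.one_mem)
  positivity

lemma mem_ball_one_norm {z : ℂ} (hz : z ∈ ball (1 : ℂ) (4 / 5)) :
    z ≠ 0 ∧ 1 / 5 ≤ ‖z‖ ∧ ‖z‖ ≤ 2 ∧ ‖z - 1‖ ≤ 1 := by
  rw [mem_ball, dist_eq_norm] at hz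
  have h1 := norm_sub_norm_le 1 (1 - z)
  rw [norm_sub_rev 1 z] at h1
  simp only [norm_one, sub_sub_cancel] at h1
  have h2 := norm_add_le (z - 1) 1
  simp only [sub_add_cancel, norm_one] at h2
  refine ⟨?_, by linarith, by linarith, by linarith⟩
  rintro rfl
  norm_num at hz

set_option maxHeartbeats 1600000 in
/-- Comparison with the bubble along a segment. -/
lemma norm_stateDiff_le {N : ℕ} {B R μ : ℝ} {v κ : ℂ → ℝ} (D : BubbleData N B R μ v κ) {s a : ℝ}
    (hs : ∀ z ∈ ball (1 : ℂ) (4 / 5), ‖dz (fun y => (κ y : ℂ)) z‖ ≤ s) (ha0 : 0 ≤ a)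
    {c ω : ℂ} (hseg : ∀ t ∈ Icc (0 : ℝ) 1, c + t * ω ∈ ball (1 : ℂ) (4 / 5)) {P : ℝ}
    (hP : κ 1 * Real.exp (μ / 2) ≤ P) {F : ℝ → ℝ} (hF : Continuous F) (hF0 : ∀ t, 0 ≤ F t)
    (hFb : ∀ t ∈ Icc (0 : ℝ) 1,
      ‖expHalf (bub N (κ 1 / (8 * (N + 1) ^ 2)) μ) (c + t * ω)‖ +
      ‖wDeriv N (bub N (κ 1 / (8 * (N + 1) ^ 2)) μ) (c + t * ω)‖ ≤ F t) :
    ‖stateDiff N v κ μ a (c + ω)‖ ≤ (‖stateDiff N v κ μ a c‖ +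
      ∫ t in (0 : ℝ)..1, a * (‖ω‖ * (5 ^ (N + 1) * ‖quadDiff N v (c + t * ω)‖ * F t + 2 * s * B * P))) *
      Real.exp (∫ t in (0 : ℝ)..1,
        ‖ω‖ * (2 ^ (N + 1) + 5 ^ (N + 1) * ‖quadDiff N v (c + t * ω)‖ + 2 * s * B)) := by
  have hs0 : 0 ≤ s := (norm_nonneg _).trans (hs 1 (by simp))
  have hB := D.pos
  have hκ1 : 0 < κ 1 := (inv_pos.2 D.pos).trans_le (D.le_weight 1 D.one_mem)
  have hP0 : 0 ≤ P := le_trans (by positivity) hP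
  have hc0 := D.coeff_pos
  have hG : Continuous fun t : ℝ => ‖quadDiff N v (c + t * ω)‖ :=
    ((continuous_quadDiff N D.contDiff).comp (by fun_prop)).norm
  set b := bub N (κ 1 / (8 * (N + 1) ^ 2)) μ with hb
  have hκc : 8 * ((N : ℝ) + 1) ^ 2 * (κ 1 / (8 * (N + 1) ^ 2)) = κ 1 := by field_simp
  have hbC : ContDiff ℝ 2 b := contDiff_bub hc0
  set E : ℂ → ℂ := fun z => -(1 / 2) * (z ^ (N + 1))⁻¹ * quadDiff N v z with hE
  set q : ℂ → ℂ := fun z => (1 / 8) * dz (fun y => (κ y : ℂ)) z * (expHalf v z)⁻¹ +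
    E z * conj (wDeriv N v z) with hq
  set f := expHalf v with hf
  set w := wDeriv N v with hw
  set p := wDeriv₂ N v κ with hp
  set f₀ := expHalf b with hf₀
  set w₀ := wDeriv N b with hw₀
  set p₀ := wDeriv₂ N b (fun _ => κ 1) with hp₀
  have hX : ∀ t ∈ Icc (0 : ℝ) 1, HasDerivAt (fun t : ℝ => stateDiff N v κ μ a (c + t * ω))
      ((((c + t * ω) ^ N * (w (c + t * ω) - a * w₀ (c + t * ω))) * ω +
        conj ((c + t * ω) ^ N * (w (c + t * ω) - a * w₀ (c + t * ω))) * conj ω),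
      (E (c + t * ω) * f (c + t * ω)) * ω +
        (conj ((c + t * ω) ^ N) * (p (c + t * ω) - a * p₀ (c + t * ω))) * conj ω,
      q (c + t * ω) * ω + conj (q (c + t * ω)) * conj ω) t := by
    intro t ht
    obtain ⟨hz0, h5, h2, -⟩ := mem_ball_one_norm (hseg t ht)
    have hzR : c + t * ω ∈ ball (0 : ℂ) R := by
      have := D.le_R
      simp only [mem_ball, dist_zero_right]; linarith
    have hpb : lap b (c + t * ω) = -(‖c + t * ω‖ ^ (2 * N) * κ 1 * Real.exp (b (c + t * ω))) := by
      have := lap_bub (N := N) (m := μ) hc0 (c + t * ω)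
      rwa [hκc] at this
    have hqb := quadDiff_bub (m := μ) D.one_le_N hc0 (c + t * ω)
    have a1 := hasWirt_expHalf (N := N) D.contDiff hz0
    have a2 := hasWirt_wDeriv D.contDiff hz0 (D.pde _ hzR)
    have a3 := hasWirt_wDeriv₂ D.contDiff D.contDiff_weight hz0 (D.pde _ hzR)
    have b1 := (hasWirt_expHalf (N := N) hbC hz0).const_mul a
    have b2 := (hasWirt_wDeriv (κ := fun _ => κ 1) hbC hz0 hpb).const_mul a
    have b3 := (hasWirt_wDeriv₂ (κ := fun _ => κ 1) hbC contDiff_const hz0 hpb).const_mul a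
    rw [hqb] at b2 b3
    rw [(hasWirt_const _ _).dz] at b3
    have c1 := (a1.sub b1).hasDerivAt_line
    have c2 := (a2.sub b2).hasDerivAt_line
    have c3 := (a3.sub b3).hasDerivAt_line
    have := c1.prodMk (c2.prodMk c3)
    refine (this.congr_deriv ?_)
    refine Prod.ext ?_ (Prod.ext ?_ ?_)
    · simp only [← hw, ← hw₀, map_mul, map_sub, Complex.conj_ofReal]; ring
    · simp only [← hf, hE, ← hp, ← hp₀]; ring
    · simp only [← hf, hE, hq, mul_zero, zero_mul, add_zero, sub_zero, map_zero, ← hw]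
  have key := norm_le_mul_exp_of_norm_deriv_le
    (k := fun t => ‖ω‖ * (2 ^ (N + 1) + 5 ^ (N + 1) * ‖quadDiff N v (c + t * ω)‖ + 2 * s * B))
    (j := fun t => a * (‖ω‖ * (5 ^ (N + 1) * ‖quadDiff N v (c + t * ω)‖ * F t + 2 * s * B * P)))
    (by fun_prop) (by fun_prop) (fun t => by have := hF0 t; positivity) hX ?_ (fun t => by positivity)
  · simpa using key
  intro t ht
  obtain ⟨hz0, h5, h2, h1⟩ := mem_ball_one_norm (hseg t ht)
  have hzs := hs _ (hseg t ht)
  have hFt := hFb t ht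
  have hzR : c + t * ω ∈ ball (0 : ℂ) R := by
    have := D.le_R
    simp only [mem_ball, dist_zero_right]; linarith
  have hκz := D.le_weight _ hzR
  set z := c + t * ω with hz
  set X := stateDiff N v κ μ a z with hXd
  have hX1 : ‖f z - a * f₀ z‖ ≤ ‖X‖ := norm_fst_le X
  have hX2 : ‖w z - a * w₀ z‖ ≤ ‖X‖ := (norm_fst_le X.2).trans (norm_snd_le X)
  have hX3 : ‖p z - a * p₀ z‖ ≤ ‖X‖ := (norm_snd_le X.2).trans (norm_snd_le X)
  have hna : ‖(a : ℂ)‖ = a := by rw [Complex.norm_real, Real.norm_of_nonneg ha0]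
  have hfz : ‖f z‖ ≤ ‖X‖ + a * ‖f₀ z‖ := by
    have := norm_add_le (f z - a * f₀ z) (a * f₀ z)
    rw [sub_add_cancel, norm_mul, hna] at this; linarith
  have hwz : ‖w z‖ ≤ ‖X‖ + a * ‖w₀ z‖ := by
    have := norm_add_le (w z - a * w₀ z) (a * w₀ z)
    rw [sub_add_cancel, norm_mul, hna] at this; linarith
  have hp₀z : ‖p₀ z‖ ≤ P := by
    have h := wDeriv₂_bub (N := N) (m := μ) hc0 hz0
    rw [hκc] at h
    rw [hp₀, hb, h, Complex.norm_real, Real.norm_of_nonneg (by positivity)]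
    refine le_trans ?_ hP
    gcongr
    rw [div_mul_eq_mul_div, div_le_iff₀ (by positivity)]
    nlinarith [sq_nonneg ((N : ℝ) + 1), hκ1]
  have hpz : ‖p z‖ ≤ ‖X‖ + a * P := by
    have := norm_add_le (p z - a * p₀ z) (a * p₀ z)
    rw [sub_add_cancel, norm_mul, hna] at this
    linarith [mul_le_mul_of_nonneg_left hp₀z ha0]
  have hf0 : 0 < ‖f z‖ := norm_pos_iff.2 (expHalf_ne v z)
  have hinv : ‖(f z)⁻¹‖ ≤ 8 * B * ‖p z‖ := by
    have h6 : p z = ((κ z / 8 + ‖w z‖ ^ 2 : ℝ) : ℂ) * (f z)⁻¹ := by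
      rw [hp, wDeriv₂, Complex.mul_conj, Complex.normSq_eq_norm_sq]
      push_cast; ring
    have h7 : B⁻¹ / 8 ≤ κ z / 8 + ‖w z‖ ^ 2 := by nlinarith [sq_nonneg ‖w z‖]
    rw [h6, norm_mul, Complex.norm_real, Real.norm_of_nonneg (le_trans (by positivity) h7)]
    calc ‖(f z)⁻¹‖ = 8 * B * (B⁻¹ / 8 * ‖(f z)⁻¹‖) := by field_simp
      _ ≤ _ := by gcongr
  have hEz : ‖E z‖ ≤ 5 ^ (N + 1) / 2 * ‖quadDiff N v z‖ := by
    rw [hE]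
    simp only [norm_mul, norm_neg, norm_inv, norm_pow]
    gcongr
    rw [show ‖(1 / 2 : ℂ)‖ = 1 / 2 by norm_num]
    have : (‖z‖ ^ (N + 1))⁻¹ ≤ 5 ^ (N + 1) := by
      rw [← inv_pow]
      gcongr
      rw [inv_le_comm₀ (by linarith) (by norm_num)]
      linarith
    linarith
  have hzN : ‖z ^ N‖ ≤ 2 ^ N := by rw [norm_pow]; gcongr
  set g := ‖quadDiff N v z‖ with hg
  have hg0 : 0 ≤ g := norm_nonneg _
  have hXn := norm_nonneg X
  have hωn := norm_nonneg ω
  have hFa : a * ‖f₀ z‖ ≤ a * F t := by gcongr; linarith [norm_nonneg (w₀ z)]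
  have hFa' : a * ‖w₀ z‖ ≤ a * F t := by gcongr; linarith [norm_nonneg (f₀ z)]
  have hT : 0 ≤ a * F t := mul_nonneg ha0 (hF0 t)
  have h5N : (0 : ℝ) ≤ 5 ^ (N + 1) := by positivity
  have h2N : (0 : ℝ) ≤ 2 ^ N := by positivity
  have hgX : 0 ≤ 5 ^ (N + 1) * g * ‖X‖ := by positivity
  have hgF : 0 ≤ 5 ^ (N + 1) * g * (a * F t) := by positivity
  have hsX : 0 ≤ s * B * ‖X‖ := by positivity
  have hsP : 0 ≤ s * B * (a * P) := by positivity
  have h2X : 0 ≤ 2 ^ N * ‖X‖ := by positivity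
  rw [show ‖ω‖ * (2 ^ (N + 1) + 5 ^ (N + 1) * g + 2 * s * B) * ‖X‖ +
      a * (‖ω‖ * (5 ^ (N + 1) * g * F t + 2 * s * B * P)) =
    ‖ω‖ * (2 * (2 ^ N * ‖X‖) + 5 ^ (N + 1) * g * ‖X‖ + 2 * (s * B * ‖X‖) +
      5 ^ (N + 1) * g * (a * F t) + 2 * (s * B * (a * P))) by ring]
  refine max_le ?_ (max_le ?_ ?_)
  · refine (norm_re_pair_le _ ω (x := 2 ^ N * ‖X‖) ?_).trans
      (mul_le_mul_of_nonneg_left (by linarith) hωn)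
    rw [norm_mul]; gcongr
  · refine (norm_add_le _ _).trans ?_
    simp only [norm_mul, RCLike.norm_conj]
    have h8 : ‖E z‖ * ‖f z‖ ≤ 5 ^ (N + 1) / 2 * g * (‖X‖ + a * F t) := by
      gcongr; linarith
    have h9 : ‖z ^ N‖ * ‖p z - a * p₀ z‖ ≤ 2 ^ N * ‖X‖ := by gcongr
    have : ‖E z‖ * ‖f z‖ + ‖z ^ N‖ * ‖p z - a * p₀ z‖ ≤ (2 * (2 ^ N * ‖X‖) + 5 ^ (N + 1) * g * ‖X‖ +
      2 * (s * B * ‖X‖) + 5 ^ (N + 1) * g * (a * F t) + 2 * (s * B * (a * P))) := by linarith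
    nlinarith
  · have hqz : ‖q z‖ ≤ s * B * (‖X‖ + a * P) + 5 ^ (N + 1) / 2 * g * (‖X‖ + a * F t) := ?_
    · exact (norm_re_pair_le _ ω hqz).trans (mul_le_mul_of_nonneg_left (by linarith) hωn)
    rw [hq]
    refine (norm_add_le _ _).trans (add_le_add ?_ ?_)
    · simp only [norm_mul]
      rw [show ‖(1 / 8 : ℂ)‖ = 1 / 8 by norm_num]
      calc 1 / 8 * ‖dz (fun y => (κ y : ℂ)) z‖ * ‖(f z)⁻¹‖ ≤ 1 / 8 * s * (8 * B * ‖p z‖) := by gcongr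
        _ = s * B * ‖p z‖ := by ring
        _ ≤ _ := by gcongr
    · rw [norm_mul, RCLike.norm_conj]
      gcongr; linarith

/-- Integration over a centered disc in polar coordinates. -/
lemma lintegral_ball_polar {f : ℂ → ENNReal} (hf : Measurable f) (ρ : ℝ) :
    ∫⁻ z in ball (0 : ℂ) ρ, f z = ∫⁻ θ in Ioo (-Real.pi) Real.pi, ∫⁻ r in Ioo 0 ρ,
      ENNReal.ofReal r * f (r * (Real.cos θ + Real.sin θ * Complex.I)) := by
  have hn : ∀ r θ : ℝ, ‖(r * (Real.cos θ + Real.sin θ * Complex.I) : ℂ)‖ = |r| := fun r θ => by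
    have := Complex.norm_polarCoord_symm (r, θ)
    rwa [Complex.polarCoord_symm_apply] at this
  rw [← lintegral_indicator measurableSet_ball, ← Complex.lintegral_comp_polarCoord_symm]
  simp only [Complex.polarCoord_symm_apply, smul_eq_mul]
  have hm : Measurable fun p : ℝ × ℝ => ENNReal.ofReal p.1 *
      (ball (0 : ℂ) ρ).indicator f (p.1 * (Real.cos p.2 + Real.sin p.2 * Complex.I)) := by
    have h1 : Measurable fun p : ℝ × ℝ => (p.1 * (Real.cos p.2 + Real.sin p.2 * Complex.I) : ℂ) :=
      Continuous.measurable (by fun_prop)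
    exact (by fun_prop : Measurable fun p : ℝ × ℝ => ENNReal.ofReal p.1).mul
      ((hf.indicator measurableSet_ball).comp h1)
  rw [polarCoord_target, Measure.volume_eq_prod, ← Measure.prod_restrict,
    lintegral_prod_symm _ hm.aemeasurable]
  refine lintegral_congr fun θ => ?_
  rw [← lintegral_indicator measurableSet_Ioi, ← lintegral_indicator measurableSet_Ioo]
  refine lintegral_congr fun r => ?_
  by_cases h0 : 0 < r
  · by_cases h1 : r < ρ
    · rw [indicator_of_mem (mem_Ioi.2 h0), indicator_of_mem (mem_Ioo.2 ⟨h0, h1⟩), indicator_of_mem]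
      rw [mem_ball, dist_zero_right, hn, abs_of_pos h0]; exact h1
    · rw [indicator_of_mem (mem_Ioi.2 h0), indicator_of_notMem (s := Ioo 0 ρ) (fun h => h1 h.2),
        indicator_of_notMem, mul_zero]
      rw [mem_ball, dist_zero_right, hn, abs_of_pos h0]; exact h1
  · rw [indicator_of_notMem (s := Ioi 0) h0, indicator_of_notMem (s := Ioo 0 ρ) (fun h => h0 h.1)]

lemma lintegral_ball_radial {f : ℝ → ENNReal} (hf : Measurable f) (ρ : ℝ) :
    ∫⁻ z in ball (0 : ℂ) ρ, f ‖z‖ =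
      ENNReal.ofReal (2 * Real.pi) * ∫⁻ r in Ioo 0 ρ, ENNReal.ofReal r * f r := by
  refine (lintegral_ball_polar (hf.comp measurable_norm) ρ).trans ?_
  have hn : ∀ r θ : ℝ, ‖(r * (Real.cos θ + Real.sin θ * Complex.I) : ℂ)‖ = |r| := fun r θ => by
    have := Complex.norm_polarCoord_symm (r, θ)
    rwa [Complex.polarCoord_symm_apply] at this
  have : ∀ θ : ℝ, ∫⁻ r in Ioo 0 ρ, ENNReal.ofReal r *
      (f ∘ norm) (r * (Real.cos θ + Real.sin θ * Complex.I) : ℂ) =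
      ∫⁻ r in Ioo 0 ρ, ENNReal.ofReal r * f r := fun θ => by
    refine setLIntegral_congr_fun measurableSet_Ioo fun r hr => ?_
    simp only [Function.comp, hn, abs_of_pos hr.1]
  simp only [this]
  rw [lintegral_const, Measure.restrict_apply_univ, Real.volume_Ioo, mul_comm]
  congr 2; ring

lemma lintegral_Ioc_mul_comp {g : ℝ → ENNReal} (hg : Measurable g) {r : ℝ} (hr : 0 < r) :
    ∫⁻ t in Ioc (0 : ℝ) 1, ENNReal.ofReal r * g (t * r) = ∫⁻ s in Ioc 0 r, g s := by
  have h1 : (fun x : ℝ => x * r) ⁻¹' Ioc 0 r = Ioc 0 1 := by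
    ext x
    simp only [mem_preimage, mem_Ioc]
    constructor
    · rintro ⟨h1, h2⟩
      exact ⟨pos_of_mul_pos_left h1 hr.le, by nlinarith⟩
    · rintro ⟨h1, h2⟩
      exact ⟨by positivity, by nlinarith⟩
  have h2 : ∫⁻ s in Ioc 0 r, g s =
      ∫⁻ s in Ioc 0 r, g s ∂(ENNReal.ofReal |r| • Measure.map (· * r) volume) := by
    rw [Real.smul_map_volume_mul_right hr.ne']
  rw [h2, lintegral_const_mul _ (by fun_prop), Measure.restrict_smul, lintegral_smul_measure,
    smul_eq_mul, abs_of_pos hr, setLIntegral_map measurableSet_Ioc hg (by fun_prop), h1]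

/-- Average over a disc of the line integrals along its radii. -/
lemma lintegral_ball_ray_le {φ : ℂ → ENNReal} (hφ : Measurable φ) (c : ℂ) {ρ : ℝ} (hρ : 0 < ρ) :
    ∫⁻ z in ball (0 : ℂ) ρ, ∫⁻ t in Ioc (0 : ℝ) 1, ‖z‖ₑ * φ (c + t * z) ≤
      ENNReal.ofReal (ρ ^ 2 / 2) * ∫⁻ y in ball (0 : ℂ) ρ, φ (c + y) * ‖y‖ₑ⁻¹ := by
  have hm : Measurable fun z : ℂ => ∫⁻ t in Ioc (0 : ℝ) 1, ‖z‖ₑ * φ (c + t * z) := by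
    refine Measurable.lintegral_prod_right' (f := fun p : ℂ × ℝ => ‖p.1‖ₑ * φ (c + p.2 * p.1)) ?_
    exact (by fun_prop : Measurable fun p : ℂ × ℝ => ‖p.1‖ₑ).mul
      (hφ.comp (Continuous.measurable (by fun_prop)))
  have hm2 : Measurable fun y : ℂ => φ (c + y) * ‖y‖ₑ⁻¹ := by fun_prop
  rw [lintegral_ball_polar hm, lintegral_ball_polar hm2, ← lintegral_const_mul']
  swap; · exact ENNReal.ofReal_ne_top
  refine lintegral_mono fun θ => ?_
  set ω : ℂ := Real.cos θ + Real.sin θ * Complex.I with hω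
  have hn : ∀ r : ℝ, ‖(r * ω : ℂ)‖ = |r| := fun r => by
    have := Complex.norm_polarCoord_symm (r, θ)
    rwa [Complex.polarCoord_symm_apply] at this
  have h1 : ∀ r ∈ Ioo 0 ρ, ENNReal.ofReal r * ∫⁻ t in Ioc (0 : ℝ) 1, ‖(r * ω : ℂ)‖ₑ *
      φ (c + t * (r * ω)) ≤ ENNReal.ofReal r * ∫⁻ s in Ioo 0 ρ, φ (c + s * ω) := fun r hr => by
    refine mul_le_mul_right ?_ _
    rw [← ofReal_norm, hn, abs_of_pos hr.1]
    have hg : Measurable fun s : ℝ => φ (c + s * ω) := hφ.comp (Continuous.measurable (by fun_prop))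
    have := lintegral_Ioc_mul_comp hg hr.1
    have h2 : ∀ t : ℝ, c + ((t * r : ℝ) : ℂ) * ω = c + t * (r * ω) := fun t => by push_cast; ring
    simp only [h2] at this
    rw [this]
    exact lintegral_mono_set fun s hs => ⟨hs.1, hs.2.trans_lt hr.2⟩
  have h2 : ∀ r ∈ Ioo 0 ρ, ENNReal.ofReal r * (φ (c + r * ω) * ‖(r * ω : ℂ)‖ₑ⁻¹) = φ (c + r * ω) :=
      fun r hr => by
    rw [← ofReal_norm, hn, abs_of_pos hr.1, mul_comm, mul_assoc,
      ENNReal.inv_mul_cancel (by simpa using hr.1) ENNReal.ofReal_ne_top, mul_one]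
  rw [setLIntegral_congr_fun measurableSet_Ioo h2]
  refine (setLIntegral_mono' measurableSet_Ioo h1).trans ?_
  rw [lintegral_mul_const _ (by fun_prop)]
  gcongr
  have h3 : ∫⁻ r in Ioo 0 ρ, ENNReal.ofReal r = ENNReal.ofReal (ρ ^ 2 / 2) := by
    rw [← ofReal_integral_eq_lintegral_ofReal, ← integral_Ioc_eq_integral_Ioo,
      ← intervalIntegral.integral_of_le hρ.le, integral_id]
    · simp
    · exact (intervalIntegrable_iff_integrableOn_Ioo_of_le hρ.le).1
        (continuous_id.intervalIntegrable 0 ρ)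
    · exact (ae_restrict_mem measurableSet_Ioo).mono fun r hr => hr.1.le
  rw [h3]

lemma lintegral_ball_inv (ρ : ℝ) :
    ∫⁻ z in ball (0 : ℂ) ρ, ‖z‖ₑ⁻¹ = ENNReal.ofReal (2 * Real.pi * ρ) := by
  have h := lintegral_ball_radial (f := fun r => (ENNReal.ofReal r)⁻¹) (by fun_prop) ρ
  simp only [ofReal_norm] at h
  rw [h, ENNReal.ofReal_mul (p := 2 * Real.pi) (by positivity)]
  congr 1
  have h2 : ∀ r ∈ Ioo 0 ρ, ENNReal.ofReal r * (ENNReal.ofReal r)⁻¹ = 1 := fun r hr =>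
    ENNReal.mul_inv_cancel (by simpa using hr.1) ENNReal.ofReal_ne_top
  rw [setLIntegral_congr_fun measurableSet_Ioo h2]
  simp

lemma lintegral_ball_log_kernel {d : ℝ} (hd : 0 < d) {ρ : ℝ} (hρ : 0 ≤ ρ) :
    ∫⁻ z in ball (0 : ℂ) ρ, ENNReal.ofReal (‖z‖⁻¹ * (d + ‖z‖)⁻¹) =
      ENNReal.ofReal (2 * Real.pi * Real.log ((d + ρ) / d)) := by
  have h := lintegral_ball_radial (f := fun r => ENNReal.ofReal (r⁻¹ * (d + r)⁻¹)) (by fun_prop) ρ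
  rw [h, ENNReal.ofReal_mul (p := 2 * Real.pi) (by positivity)]
  congr 1
  have h2 : ∀ r ∈ Ioo 0 ρ, ENNReal.ofReal r * ENNReal.ofReal (r⁻¹ * (d + r)⁻¹) =
      ENNReal.ofReal ((d + r)⁻¹) := fun r hr => by
    rw [← ENNReal.ofReal_mul hr.1.le, ← mul_assoc, mul_inv_cancel₀ hr.1.ne', one_mul]
  rw [setLIntegral_congr_fun measurableSet_Ioo h2, ← ofReal_integral_eq_lintegral_ofReal,
    ← integral_Ioc_eq_integral_Ioo, ← intervalIntegral.integral_of_le hρ]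
  · congr 1
    rw [intervalIntegral.integral_comp_add_left (fun x => x⁻¹), add_zero, integral_inv]
    rw [uIcc_of_le (by linarith)]
    exact fun h => by linarith [h.1]
  · refine (intervalIntegrable_iff_integrableOn_Ioo_of_le hρ).1 (ContinuousOn.intervalIntegrable ?_)
    rw [uIcc_of_le hρ]
    exact ContinuousOn.inv₀ (by fun_prop) fun x hx => by linarith [hx.1]
  · exact (ae_restrict_mem measurableSet_Ioo).mono fun r hr => by
      have := hr.1
      simp only [Pi.zero_apply]; positivity

lemma inv_norm_mul_inv_norm_sub_le {a y : ℂ} (ha : a ≠ 0) (hy : y ≠ 0) (hya : y ≠ a) :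
    ‖y‖⁻¹ * ‖y - a‖⁻¹ ≤ 3 * (‖y‖⁻¹ * (‖a‖ + ‖y‖)⁻¹) + 3 * (‖y - a‖⁻¹ * (‖a‖ + ‖y - a‖)⁻¹) := by
  have h0 : 0 < ‖a‖ := norm_pos_iff.2 ha
  have h1 : 0 < ‖y‖ := norm_pos_iff.2 hy
  have h2 : 0 < ‖y - a‖ := norm_pos_iff.2 (sub_ne_zero.2 hya)
  have h3 : ‖a‖ ≤ ‖y‖ + ‖y - a‖ := by
    have := norm_sub_le y (y - a)
    simpa using this
  set d := ‖a‖
  set x := ‖y‖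
  set z := ‖y - a‖
  have key : ∀ x z : ℝ, 0 < x → 0 < z → d ≤ x + z → x ≤ z → x⁻¹ * z⁻¹ ≤ 3 * (x⁻¹ * (d + x)⁻¹) := by
    intro x z hx hz h4 h5
    rw [mul_left_comm]
    gcongr
    rw [← div_eq_mul_inv, le_div_iff₀ (by positivity), inv_mul_le_iff₀ hz]
    linarith
  rcases le_total x z with h | h
  · exact (key x z h1 h2 h3 h).trans (le_add_of_nonneg_right (by positivity))
  · rw [mul_comm x⁻¹ z⁻¹]
    exact (key z x h2 h1 (by linarith) h).trans (le_add_of_nonneg_left (by positivity))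

lemma lintegral_ball_two_kernels_le {a : ℂ} (ha : a ≠ 0) (ha6 : ‖a‖ ≤ 6) {ρ : ℝ} (hρ : ρ ≤ 1) :
    ∫⁻ y in ball (0 : ℂ) ρ, ‖a - y‖ₑ⁻¹ * ‖y‖ₑ⁻¹ ≤
      ENNReal.ofReal (12 * Real.pi * Real.log (1 + 16 / ‖a‖)) := by
  have h0 : 0 < ‖a‖ := norm_pos_iff.2 ha
  set k : ℂ → ENNReal := fun z => ENNReal.ofReal (‖z‖⁻¹ * (‖a‖ + ‖z‖)⁻¹) with hk
  have hkm : Measurable k := by fun_prop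
  have h1 : ∀ᵐ y : ℂ, ‖a - y‖ₑ⁻¹ * ‖y‖ₑ⁻¹ ≤ 3 * k y + 3 * k (y - a) := by
    have e1 : ∀ᵐ y : ℂ, y ≠ 0 := by simp [ae_iff]
    have e2 : ∀ᵐ y : ℂ, y ≠ a := by simp [ae_iff]
    filter_upwards [e1, e2] with y hy hya
    have h1 : 0 < ‖y‖ := norm_pos_iff.2 hy
    have h2 : 0 < ‖y - a‖ := norm_pos_iff.2 (sub_ne_zero.2 hya)
    have h := inv_norm_mul_inv_norm_sub_le ha hy hya
    rw [hk]
    simp only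
    rw [← ofReal_norm, ← ofReal_norm, norm_sub_rev a y, ← ENNReal.ofReal_inv_of_pos h2,
      ← ENNReal.ofReal_inv_of_pos h1, ← ENNReal.ofReal_mul (by positivity),
      show (3 : ENNReal) = ENNReal.ofReal 3 by norm_num, ← ENNReal.ofReal_mul (by norm_num),
      ← ENNReal.ofReal_mul (by norm_num), ← ENNReal.ofReal_add (by positivity) (by positivity)]
    exact ENNReal.ofReal_le_ofReal (by linarith)
  have h7 := lintegral_ball_log_kernel h0 (ρ := 7) (by norm_num)
  have h2 : ∫⁻ y in ball (0 : ℂ) ρ, k (y - a) ≤ ∫⁻ y in ball (0 : ℂ) 7, k y := by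
    rw [← lintegral_indicator measurableSet_ball, ← lintegral_indicator measurableSet_ball,
      ← lintegral_sub_right_eq_self ((ball (0 : ℂ) 7).indicator k) a]
    refine lintegral_mono fun y => ?_
    by_cases hy : y ∈ ball (0 : ℂ) ρ
    · rw [indicator_of_mem hy, indicator_of_mem]
      rw [mem_ball, dist_zero_right] at hy ⊢
      linarith [norm_sub_le y a]
    · rw [indicator_of_notMem hy]; exact zero_le
  calc _ ≤ ∫⁻ y in ball (0 : ℂ) ρ, (3 * k y + 3 * k (y - a)) :=
        lintegral_mono_ae (ae_restrict_of_ae h1)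
    _ = 3 * (∫⁻ y in ball (0 : ℂ) ρ, k y) + 3 * ∫⁻ y in ball (0 : ℂ) ρ, k (y - a) := by
        rw [lintegral_add_left (by fun_prop), lintegral_const_mul _ hkm,
          lintegral_const_mul _ (by fun_prop)]
    _ ≤ 3 * (∫⁻ y in ball (0 : ℂ) 7, k y) + 3 * ∫⁻ y in ball (0 : ℂ) 7, k y := by
        gcongr
        linarith
    _ = ENNReal.ofReal (6 * (2 * Real.pi * Real.log ((‖a‖ + 7) / ‖a‖))) := by
        rw [hk, h7, ← add_mul, ENNReal.ofReal_mul (p := 6) (by norm_num)]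
        norm_num
    _ ≤ _ := by
        refine ENNReal.ofReal_le_ofReal ?_
        rw [show 6 * (2 * Real.pi * Real.log ((‖a‖ + 7) / ‖a‖)) =
          12 * Real.pi * Real.log ((‖a‖ + 7) / ‖a‖) by ring]
        gcongr
        rw [add_div, div_self h0.ne']
        gcongr
        norm_num

/-- The logarithmic potential of the density over `ball 0 4`. -/
def logPot (N : ℕ) (v : ℂ → ℝ) (c : ℂ) : ENNReal :=
  ∫⁻ ζ in ball (0 : ℂ) 4, dens N v ζ * ENNReal.ofReal (Real.log (1 + 16 / ‖ζ - c‖))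

lemma lintegral_pot_mul {N : ℕ} {v : ℂ → ℝ} (hv : Continuous v) (c : ℂ) {ρ : ℝ} {g : ℂ → ENNReal}
    (hg : Measurable g) : ∫⁻ y in ball (0 : ℂ) ρ, pot N v (c + y) * g y =
    ∫⁻ ζ in ball (0 : ℂ) 4, dens N v ζ * ∫⁻ y in ball (0 : ℂ) ρ, ‖(ζ - c) - y‖ₑ⁻¹ * g y := by
  have hd := measurable_dens N hv
  have h1 : ∀ y, pot N v (c + y) * g y =
      ∫⁻ ζ in ball (0 : ℂ) 4, dens N v ζ * (‖(ζ - c) - y‖ₑ⁻¹ * g y) := fun y => by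
    rw [pot, ← lintegral_mul_const _ (by fun_prop)]
    refine lintegral_congr fun ζ => ?_
    rw [sub_sub, mul_assoc]
  simp only [h1]
  rw [lintegral_lintegral_swap]
  · refine lintegral_congr fun ζ => ?_
    rw [lintegral_const_mul _ (by fun_prop)]
  · refine Measurable.aemeasurable ?_
    have : Measurable fun p : ℂ × ℂ => dens N v p.2 := hd.comp measurable_snd
    have h2 : Measurable fun p : ℂ × ℂ => g p.1 := hg.comp measurable_fst
    exact this.mul ((by fun_prop : Measurable fun p : ℂ × ℂ => ‖(p.2 - c) - p.1‖ₑ⁻¹).mul h2)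

lemma lintegral_pot_mul_inv_le {N : ℕ} {v : ℂ → ℝ} (hv : Continuous v) {c : ℂ} (hc : ‖c‖ ≤ 2) {ρ : ℝ}
    (hρ : ρ ≤ 1) : ∫⁻ y in ball (0 : ℂ) ρ, pot N v (c + y) * ‖y‖ₑ⁻¹ ≤
      ENNReal.ofReal (12 * Real.pi) * logPot N v c := by
  have hd := measurable_dens N hv
  rw [lintegral_pot_mul hv c (by fun_prop), logPot, ← lintegral_const_mul _ (by fun_prop)]
  refine lintegral_mono_ae ?_
  have e1 : ∀ᵐ ζ : ℂ, ζ ≠ c := by simp [ae_iff]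
  filter_upwards [ae_restrict_mem measurableSet_ball, ae_restrict_of_ae e1] with ζ hζ hne
  have h6 : ‖ζ - c‖ ≤ 6 := by
    rw [mem_ball, dist_zero_right] at hζ
    linarith [norm_sub_le ζ c]
  rw [mul_left_comm]
  gcongr
  rw [← ENNReal.ofReal_mul (by positivity)]
  exact lintegral_ball_two_kernels_le (sub_ne_zero.2 hne) h6 hρ

lemma lintegral_ball_inv_sub_le (a : ℂ) : ∫⁻ y in ball (0 : ℂ) 1, ‖a - y‖ₑ⁻¹ ≤
    ENNReal.ofReal (4 * Real.pi) := by
  have h1 : ∀ y, (ball (0 : ℂ) 1).indicator (fun y => ‖a - y‖ₑ⁻¹) y ≤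
      (ball (0 : ℂ) 1).indicator 1 y + (ball (0 : ℂ) 1).indicator (fun y => ‖y‖ₑ⁻¹) (y - a) := by
    intro y
    by_cases hy : y ∈ ball (0 : ℂ) 1
    · rw [indicator_of_mem hy]
      by_cases hya : y - a ∈ ball (0 : ℂ) 1
      · rw [indicator_of_mem hya, enorm_sub_rev]
        exact le_add_self
      · rw [indicator_of_mem hy]
        refine le_trans ?_ le_self_add
        rw [mem_ball, dist_zero_right, not_lt] at hya
        rw [Pi.one_apply, ENNReal.inv_le_one, ← ofReal_norm, norm_sub_rev, ENNReal.one_le_ofReal]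
        exact hya
    · rw [indicator_of_notMem hy]; exact zero_le
  rw [← lintegral_indicator measurableSet_ball]
  refine (lintegral_mono h1).trans ?_
  rw [lintegral_add_left (measurable_one.indicator measurableSet_ball),
    lintegral_indicator measurableSet_ball, lintegral_sub_right_eq_self
      ((ball (0 : ℂ) 1).indicator fun y => ‖y‖ₑ⁻¹), lintegral_indicator measurableSet_ball,
    lintegral_ball_inv]
  simp only [Pi.one_apply, setLIntegral_one, Complex.volume_ball]
  rw [show ((NNReal.pi : NNReal) : ENNReal) = ENNReal.ofReal Real.pi by
    rw [ENNReal.ofReal]; congr 1; ext; simp [Real.pi_pos.le]]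
  rw [ENNReal.ofReal_one, one_pow, one_mul, ← ENNReal.ofReal_add Real.pi_pos.le (by positivity)]
  exact ENNReal.ofReal_le_ofReal (by linarith [Real.pi_pos])

lemma lintegral_pot_le {N : ℕ} {v : ℂ → ℝ} (hv : Continuous v) (c : ℂ) {ρ : ℝ} (hρ : ρ ≤ 1) :
    ∫⁻ y in ball (0 : ℂ) ρ, pot N v (c + y) ≤
      ENNReal.ofReal (4 * Real.pi) * ∫⁻ ζ in ball (0 : ℂ) 4, dens N v ζ := by
  have hd := measurable_dens N hv
  have := lintegral_pot_mul (N := N) hv c (ρ := ρ) (g := 1) measurable_one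
  simp only [Pi.one_apply, mul_one] at this
  rw [this, ← lintegral_const_mul _ hd]
  refine lintegral_mono fun ζ => ?_
  rw [mul_comm]
  gcongr
  exact (lintegral_mono_set (ball_subset_ball hρ)).trans (lintegral_ball_inv_sub_le _)

lemma log_one_add_div_le {d r : ℝ} (hd : 0 < d) (hd6 : d ≤ 6) (hr : 3 ≤ r) :
    Real.log (1 + 16 / d) ≤ 3 + Real.log (r / d) - 3 / 4 ∨
      r ≤ d ∧ Real.log (1 + 16 / d) ≤ 3 := by
  have h7 : Real.log 8 < 9 / 4 := by
    rw [show (8 : ℝ) = 2 ^ 3 by norm_num, Real.log_pow]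
    have := Real.log_two_lt_d9
    push_cast; linarith
  rcases lt_or_ge d r with h | h
  · left
    have : 1 + 16 / d ≤ 8 * (r / d) := by
      rw [← mul_div_assoc, ← sub_nonneg]
      rw [show 8 * r / d - (1 + 16 / d) = (8 * r - d - 16) / d by field_simp; ring]
      apply div_nonneg _ hd.le
      linarith
    have h2 := Real.log_le_log (by positivity) this
    rw [Real.log_mul (by norm_num) (by positivity)] at h2
    linarith
  · right
    refine ⟨h, ?_⟩
    have : 1 + 16 / d ≤ 8 := by
      have : 16 / d ≤ 16 / 3 := by gcongr; linarith
      linarith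
    linarith [Real.log_le_log (by positivity) this]

lemma BubbleData.lap_nonneg {N : ℕ} {B R μ : ℝ} {v κ : ℂ → ℝ} (D : BubbleData N B R μ v κ) {z : ℂ}
    (hz : z ∈ ball (0 : ℂ) R) : 0 ≤ -lap v z := by
  have := (inv_pos.2 D.pos).trans_le (D.le_weight z hz)
  rw [D.pde z hz, neg_neg]
  positivity

lemma BubbleData.dens_le {N : ℕ} {B R μ : ℝ} {v κ : ℂ → ℝ} (D : BubbleData N B R μ v κ) {z : ℂ}
    (hz : z ∈ ball (0 : ℂ) R) : dens N v z ≤ ENNReal.ofReal B * ENNReal.ofReal (-lap v z) := by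
  have h := D.le_weight z hz
  have hB := D.pos
  rw [dens_eq, ← ENNReal.ofReal_mul hB.le, D.pde z hz, neg_neg]
  refine ENNReal.ofReal_le_ofReal ?_
  have : 1 ≤ B * κ z := by
    calc 1 = B * B⁻¹ := (mul_inv_cancel₀ hB.ne').symm
      _ ≤ _ := by gcongr
  have h0 : 0 ≤ ‖z‖ ^ (2 * N) * Real.exp (v z) := by positivity
  nlinarith

lemma BubbleData.logPot_le {N : ℕ} {B R μ : ℝ} {v κ : ℂ → ℝ} (D : BubbleData N B R μ v κ) {c : ℂ}
    {r : ℝ} (hc : ‖c‖ ≤ 2) (hr : 3 ≤ r) (hcr : ball c r ⊆ ball 0 R) :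
    logPot N v c ≤ ENNReal.ofReal B * ENNReal.ofReal (2 * bubbleMass * v c - discMean v c r) +
      ENNReal.ofReal (3 * B) := by
  have hd := measurable_dens N D.contDiff.continuous
  have hR := D.le_R
  have hm4 : ∫⁻ ζ in ball (0 : ℂ) 4, dens N v ζ ≤ ENNReal.ofReal B :=
    (lintegral_mono_set (ball_subset_ball (by linarith))).trans D.mass
  have hJ := lintegral_truncLog_mul_lap_le D.contDiff (c := c) (r := r) (by linarith)
    fun z hz => D.lap_nonneg (hcr hz)
  have hlapm : Measurable fun z => ENNReal.ofReal (-lap v z) :=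
    (ENNReal.measurable_ofReal.comp D.contDiff.continuous_lap.neg.measurable)
  have hlogm : Measurable fun ζ : ℂ => ENNReal.ofReal (Real.log (r / ‖ζ - c‖) - 3 / 4) :=
    ENNReal.measurable_ofReal.comp ((Real.measurable_log.comp (by fun_prop)).sub_const _)
  have key : logPot N v c ≤ ∫⁻ ζ in ball (0 : ℂ) 4, (dens N v ζ * ENNReal.ofReal 3 +
      (ball c r).indicator (fun ζ => ENNReal.ofReal B *
        (ENNReal.ofReal (Real.log (r / ‖ζ - c‖) - 3 / 4) * ENNReal.ofReal (-lap v ζ))) ζ) := by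
    refine lintegral_mono_ae ?_
    have e1 : ∀ᵐ ζ : ℂ, ζ ≠ c := by simp [ae_iff]
    filter_upwards [ae_restrict_mem measurableSet_ball, ae_restrict_of_ae e1] with ζ hζ hne
    have hd0 : 0 < ‖ζ - c‖ := norm_pos_iff.2 (sub_ne_zero.2 hne)
    have h6 : ‖ζ - c‖ ≤ 6 := by
      rw [mem_ball, dist_zero_right] at hζ
      linarith [norm_sub_le ζ c]
    by_cases hζr : ζ ∈ ball c r
    · rw [indicator_of_mem hζr]
      have hl : Real.log (1 + 16 / ‖ζ - c‖) ≤ 3 + (Real.log (r / ‖ζ - c‖) - 3 / 4) := by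
        rcases log_one_add_div_le hd0 h6 hr with h | ⟨h, -⟩
        · linarith
        · rw [mem_ball, dist_eq_norm] at hζr; linarith
      calc _ ≤ dens N v ζ * (ENNReal.ofReal 3 + ENNReal.ofReal (Real.log (r / ‖ζ - c‖) - 3 / 4)) := by
            gcongr
            exact (ENNReal.ofReal_le_ofReal hl).trans ENNReal.ofReal_add_le
        _ ≤ _ := by
            rw [mul_add, mul_left_comm (ENNReal.ofReal B), mul_comm (dens N v ζ) (ENNReal.ofReal (_ - _))]
            gcongr
            exact D.dens_le (hcr hζr)
    · rw [indicator_of_notMem hζr, add_zero]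
      gcongr
      rw [mem_ball, dist_eq_norm, not_lt] at hζr
      rcases log_one_add_div_le hd0 h6 hr with h | ⟨-, h⟩
      · have : Real.log (r / ‖ζ - c‖) ≤ 0 :=
          Real.log_nonpos (by positivity) ((div_le_one hd0).2 hζr)
        linarith
      · exact h
  refine key.trans ?_
  rw [lintegral_add_left (by fun_prop), lintegral_mul_const _ hd, add_comm]
  refine add_le_add ?_ ?_
  · refine (setLIntegral_le_lintegral _ _).trans ?_
    rw [lintegral_indicator measurableSet_ball, lintegral_const_mul _ (by fun_prop)]
    gcongr
  · rw [mul_comm, ENNReal.ofReal_mul (by norm_num)]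
    gcongr

/-- Averaged line integrals of the obstruction `quadDiff` along the radii of a disc. -/
lemma lintegral_ray_quadDiff_le {N : ℕ} {v : ℂ → ℝ} (hv : ContDiff ℝ 2 v) {c : ℂ} {ρ g b : ℝ}
    (hρ0 : 0 < ρ) (hρ : ρ ≤ 1) (hcρ : ‖c‖ + ρ ≤ 2) (hg : 0 ≤ g) (hb : 0 ≤ b)
    (hG : ∀ y : ℂ, ‖y‖ ≤ 2 → ‖quadDiff N v y‖ₑ ≤ ENNReal.ofReal g * pot N v y + ENNReal.ofReal b) :
    ∫⁻ z in ball (0 : ℂ) ρ, ∫⁻ t in Ioc (0 : ℝ) 1, ‖z‖ₑ * ‖quadDiff N v (c + t * z)‖ₑ ≤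
      ENNReal.ofReal (ρ ^ 2 / 2) * (ENNReal.ofReal (12 * Real.pi * g) * logPot N v c +
        ENNReal.ofReal (2 * Real.pi * ρ * b)) := by
  refine (lintegral_ball_ray_le (φ := fun y => ‖quadDiff N v y‖ₑ)
    (continuous_quadDiff N hv).enorm.measurable c hρ0).trans ?_
  gcongr
  have hp : Measurable fun y => pot N v (c + y) :=
    (measurable_pot N hv.continuous).comp (measurable_const_add c)
  calc _ ≤ ∫⁻ y in ball (0 : ℂ) ρ, (ENNReal.ofReal g * (pot N v (c + y) * ‖y‖ₑ⁻¹) +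
        ENNReal.ofReal b * ‖y‖ₑ⁻¹) := by
        refine setLIntegral_mono' measurableSet_ball fun y hy => ?_
        rw [← mul_assoc, ← add_mul]
        gcongr
        refine hG _ ?_
        rw [mem_ball, dist_zero_right] at hy
        linarith [norm_add_le c y]
    _ ≤ _ := by
        rw [lintegral_add_right _ (by fun_prop), lintegral_const_mul _ (by fun_prop),
          lintegral_const_mul _ (by fun_prop), lintegral_ball_inv]
        refine add_le_add ?_ ?_
        · calc _ ≤ ENNReal.ofReal g * (ENNReal.ofReal (12 * Real.pi) * logPot N v c) := by
                gcongr
                exact lintegral_pot_mul_inv_le hv.continuous (by linarith) hρ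
            _ = _ := by rw [← mul_assoc, ← ENNReal.ofReal_mul hg, mul_comm g]
        · rw [← ENNReal.ofReal_mul hb, mul_comm b]

lemma lintegral_ray_quadDiff_weight_le {N : ℕ} {v : ℂ → ℝ} (hv : ContDiff ℝ 2 v) {ρ g b e m : ℝ}
    (hρ0 : 0 < ρ) (hρ : ρ ≤ 1) (hg : 0 ≤ g) (hb : 0 ≤ b) (he : 0 ≤ e) (he1 : e ≤ 1)
    (hm : ∫⁻ ζ in ball (0 : ℂ) 4, dens N v ζ ≤ ENNReal.ofReal m)
    (hG : ∀ y : ℂ, ‖y‖ ≤ 2 → ‖quadDiff N v y‖ₑ ≤ ENNReal.ofReal g * pot N v y + ENNReal.ofReal b) :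
    ∫⁻ z in ball (0 : ℂ) ρ, ∫⁻ t in Ioc (0 : ℝ) 1, ‖z‖ₑ * (‖quadDiff N v (1 + t * z)‖ₑ *
        ENNReal.ofReal (e + ‖(t * z : ℂ)‖)) ≤
      ENNReal.ofReal (ρ ^ 2 / 2) * (ENNReal.ofReal (12 * Real.pi * g) *
        (ENNReal.ofReal e * logPot N v 1 + ENNReal.ofReal m) + ENNReal.ofReal (4 * Real.pi * b)) := by
  have hqm : Measurable fun y => ‖quadDiff N v y‖ₑ := (continuous_quadDiff N hv).enorm.measurable
  have := lintegral_ball_ray_le (φ := fun y => ‖quadDiff N v y‖ₑ * ENNReal.ofReal (e + ‖y - 1‖))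
    (by fun_prop) 1 hρ0
  simp only [add_sub_cancel_left] at this
  refine this.trans ?_
  gcongr
  have hp : Measurable fun y => pot N v (1 + y) :=
    (measurable_pot N hv.continuous).comp (measurable_const_add 1)
  have hmd : Measurable (dens N v) := measurable_dens N hv.continuous
  calc _ ≤ ∫⁻ y in ball (0 : ℂ) ρ, (ENNReal.ofReal g * (ENNReal.ofReal e * (pot N v (1 + y) * ‖y‖ₑ⁻¹) +
        pot N v (1 + y)) + ENNReal.ofReal (2 * b) * ‖y‖ₑ⁻¹) := by
        refine lintegral_mono_ae ?_
        have e1 : ∀ᵐ y : ℂ, y ≠ 0 := by simp [ae_iff]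
        filter_upwards [ae_restrict_mem measurableSet_ball, ae_restrict_of_ae e1] with y hy h0
        rw [mem_ball, dist_zero_right] at hy
        have h1 := hG (1 + y) (by have := norm_add_le 1 y; rw [norm_one] at this; linarith)
        have hyy : ‖y‖ₑ * ‖y‖ₑ⁻¹ = 1 := ENNReal.mul_inv_cancel (by simpa using h0) (by simp)
        rw [ENNReal.ofReal_add he (norm_nonneg _), ofReal_norm]
        calc _ ≤ (ENNReal.ofReal g * pot N v (1 + y) + ENNReal.ofReal b) *
              (ENNReal.ofReal e + ‖y‖ₑ) * ‖y‖ₑ⁻¹ := by gcongr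
          _ = ENNReal.ofReal g * (ENNReal.ofReal e * (pot N v (1 + y) * ‖y‖ₑ⁻¹) +
                pot N v (1 + y) * (‖y‖ₑ * ‖y‖ₑ⁻¹)) +
                ENNReal.ofReal b * (ENNReal.ofReal e + ‖y‖ₑ) * ‖y‖ₑ⁻¹ := by ring
          _ ≤ _ := by
            rw [hyy, mul_one]
            gcongr
            rw [← ofReal_norm, ← ENNReal.ofReal_add he (norm_nonneg _), ← ENNReal.ofReal_mul hb]
            refine ENNReal.ofReal_le_ofReal ?_
            nlinarith
    _ ≤ _ := by
        rw [lintegral_add_right _ (by fun_prop), lintegral_const_mul _ (by fun_prop),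
          lintegral_const_mul _ (by fun_prop), lintegral_ball_inv, lintegral_add_right _ (by fun_prop),
          lintegral_const_mul _ (by fun_prop)]
        have i1 := lintegral_pot_mul_inv_le (N := N) hv.continuous (c := 1) (by simp) hρ
        have i2 : ∫⁻ y in ball (0 : ℂ) ρ, pot N v (1 + y) ≤
            ENNReal.ofReal (12 * Real.pi) * ENNReal.ofReal m := by
          refine (lintegral_pot_le (N := N) hv.continuous 1 hρ).trans ?_
          gcongr
          norm_num
        refine add_le_add ?_ ?_
        · calc _ ≤ ENNReal.ofReal g * (ENNReal.ofReal e * (ENNReal.ofReal (12 * Real.pi) * logPot N v 1) +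
                ENNReal.ofReal (12 * Real.pi) * ENNReal.ofReal m) := by gcongr
            _ = (ENNReal.ofReal g * ENNReal.ofReal (12 * Real.pi)) *
                (ENNReal.ofReal e * logPot N v 1 + ENNReal.ofReal m) := by ring
            _ = _ := by rw [← ENNReal.ofReal_mul hg, mul_comm g]
        · rw [← ENNReal.ofReal_mul (by positivity)]
          refine ENNReal.ofReal_le_ofReal ?_
          have : Real.pi * b * ρ ≤ Real.pi * b * 1 := by gcongr
          nlinarith

/-- Mass of the negative part on `ball 0 (7R/8)`. -/
def negMass (v : ℂ → ℝ) (R : ℝ) : ℝ := ∫ z in ball (0 : ℂ) (7 * R / 8), max (-v z) 0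

lemma continuous_discWeight (c : ℂ) (r : ℝ) :
    Continuous fun z : ℂ => max (1 - ‖z - c‖ ^ 2 / r ^ 2) 0 := by fun_prop

lemma discWeight_le_one (c z : ℂ) (r : ℝ) : max (1 - ‖z - c‖ ^ 2 / r ^ 2) 0 ≤ 1 :=
  max_le (by have : 0 ≤ ‖z - c‖ ^ 2 / r ^ 2 := by positivity
             linarith) zero_le_one

lemma discWeight_eq_zero {c z : ℂ} {r : ℝ} (hr : 0 < r) (hz : z ∉ ball c r) :
    max (1 - ‖z - c‖ ^ 2 / r ^ 2) 0 = 0 := by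
  rw [mem_ball, dist_eq_norm, not_lt] at hz
  refine max_eq_right ?_
  rw [sub_nonpos, one_le_div (by positivity)]
  gcongr

lemma integrable_mul_discWeight {f : ℂ → ℝ} (hf : Continuous f) (c : ℂ) {r : ℝ} (hr : 0 < r) :
    Integrable fun z => f z * max (1 - ‖z - c‖ ^ 2 / r ^ 2) 0 := by
  refine Continuous.integrable_of_hasCompactSupport (hf.mul (continuous_discWeight c r))
    (HasCompactSupport.intro (isCompact_closedBall c r) fun z hz => ?_)
  rw [discWeight_eq_zero hr fun h => hz (ball_subset_closedBall h), mul_zero]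

lemma integrableOn_ball {f : ℂ → ℝ} (hf : Continuous f) (c : ℂ) (r : ℝ) :
    IntegrableOn f (ball c r) :=
  (hf.continuousOn.integrableOn_compact (isCompact_closedBall c r)).mono_set ball_subset_closedBall

lemma neg_discMean_le_setIntegral {v : ℂ → ℝ} (hv : Continuous v) {c c' : ℂ} {r r' : ℝ} (hr : 0 < r)
    (hcr : ball c r ⊆ ball c' r') :
    -discMean v c r ≤ 4 / r ^ 2 * ∫ z in ball c' r', max (-v z) 0 := by
  rw [discMean, ← mul_neg, ← integral_neg]
  gcongr
  rw [← integral_indicator measurableSet_ball]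
  refine integral_mono (integrable_mul_discWeight hv c hr).neg ?_ fun z => ?_
  · exact (integrable_indicator_iff measurableSet_ball).2
      (integrableOn_ball (by fun_prop) _ _)
  · simp only
    by_cases hz : z ∈ ball c r
    · rw [indicator_of_mem (hcr hz), ← neg_mul]
      calc _ ≤ max (-v z) 0 * max (1 - ‖z - c‖ ^ 2 / r ^ 2) 0 := by
            gcongr; exact le_max_left _ _
        _ ≤ max (-v z) 0 * 1 := by gcongr; exact discWeight_le_one _ _ _
        _ = _ := mul_one _
    · rw [discWeight_eq_zero hr hz, mul_zero, neg_zero]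
      exact indicator_nonneg (fun _ _ => le_max_right _ _) _

lemma neg_discMean_le {v : ℂ → ℝ} (hv : Continuous v) {c : ℂ} {r R : ℝ} (hr : 0 < r)
    (hcr : ball c r ⊆ ball 0 (7 * R / 8)) : -discMean v c r ≤ 4 / r ^ 2 * negMass v R :=
  neg_discMean_le_setIntegral hv hr hcr

lemma BubbleData.lintegral_ofReal_le {N : ℕ} {B R μ : ℝ} {v κ : ℂ → ℝ} (D : BubbleData N B R μ v κ) :
    ∫⁻ z in ball (0 : ℂ) R, ENNReal.ofReal (v z) ≤ ENNReal.ofReal (B + 4 * Real.pi * N) := by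
  have hR := D.le_R
  have hd := measurable_dens N D.contDiff.continuous
  have hpt : ∀ᵐ z : ℂ, ENNReal.ofReal (v z) ≤ dens N v z +
      (ball (0 : ℂ) 1).indicator (fun z => ENNReal.ofReal (2 * N) * ‖z‖ₑ⁻¹) z := by
    have e1 : ∀ᵐ y : ℂ, y ≠ 0 := by simp [ae_iff]
    filter_upwards [e1] with z hz
    have h0 : 0 < ‖z‖ := norm_pos_iff.2 hz
    have h1 : v z + 2 * N * Real.log ‖z‖ ≤ ‖z‖ ^ (2 * N) * Real.exp (v z) := by
      have : ‖z‖ ^ (2 * N) * Real.exp (v z) = Real.exp (v z + 2 * N * Real.log ‖z‖) := by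
        rw [Real.exp_add, mul_comm, show 2 * (N : ℝ) * Real.log ‖z‖ = Real.log (‖z‖ ^ (2 * N)) by
          rw [Real.log_pow]; push_cast; ring, Real.exp_log (by positivity)]
      rw [this]
      linarith [Real.add_one_le_exp (v z + 2 * N * Real.log ‖z‖)]
    rw [dens_eq]
    by_cases hz1 : z ∈ ball (0 : ℂ) 1
    · rw [indicator_of_mem hz1, ← ofReal_norm, ← ENNReal.ofReal_inv_of_pos h0,
        ← ENNReal.ofReal_mul (by positivity), ← ENNReal.ofReal_add (by positivity) (by positivity)]
      refine ENNReal.ofReal_le_ofReal ?_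
      have h2 := Real.add_one_le_exp (Real.log ‖z‖⁻¹)
      rw [Real.exp_log (by positivity), Real.log_inv] at h2
      have : (2 * N : ℝ) * (-Real.log ‖z‖) ≤ 2 * N * ‖z‖⁻¹ := by gcongr; linarith
      linarith
    · rw [indicator_of_notMem hz1, add_zero]
      refine ENNReal.ofReal_le_ofReal ?_
      rw [mem_ball, dist_zero_right, not_lt] at hz1
      have := Real.log_nonneg hz1
      have : 0 ≤ 2 * N * Real.log ‖z‖ := by positivity
      linarith
  refine (lintegral_mono_ae (ae_restrict_of_ae hpt)).trans ?_
  rw [lintegral_add_left hd, ENNReal.ofReal_add D.pos.le (by positivity)]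
  refine add_le_add D.mass ((setLIntegral_le_lintegral _ _).trans ?_)
  rw [lintegral_indicator measurableSet_ball, lintegral_const_mul _ (by fun_prop), lintegral_ball_inv,
    ← ENNReal.ofReal_mul (by positivity)]
  exact ENNReal.ofReal_le_ofReal (by linarith)

/-- The a priori scale: a bound for the size of the solution in terms of its disc mean. -/
def aprioriScale (v : ℂ → ℝ) (R : ℝ) : ℝ := 2 + Real.log R + max (-discMean v 1 (15 * R / 16)) 0

lemma BubbleData.one_le_log {N : ℕ} {B R μ : ℝ} {v κ : ℂ → ℝ} (D : BubbleData N B R μ v κ) :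
    1 ≤ Real.log R := by
  rw [Real.le_log_iff_exp_le (by linarith [D.le_R])]
  linarith [D.le_R, Real.exp_one_lt_d9]

lemma BubbleData.log_le_scale {N : ℕ} {B R μ : ℝ} {v κ : ℂ → ℝ} (_ : BubbleData N B R μ v κ) :
    2 + Real.log R ≤ aprioriScale v R := by
  unfold aprioriScale
  linarith [le_max_right (-discMean v 1 (15 * R / 16)) 0]

lemma negMass_le (N : ℕ) (B : ℝ) : ∃ C : ℝ, 0 < C ∧ ∀ {R μ : ℝ} {v κ : ℂ → ℝ}
    (_ : BubbleData N B R μ v κ), negMass v R ≤ C * R ^ 2 * aprioriScale v R := by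
  refine ⟨10 + 10 * (|B| + 4 * Real.pi * N), by positivity, fun {R μ v κ} D => ?_⟩
  have hR := D.le_R
  have hR0 : 0 < R := by linarith
  have hB := D.pos
  have hv := D.contDiff.continuous
  set r := 15 * R / 16 with hr
  have hr0 : 0 < r := by positivity
  have hpos : ∫ z, max (v z) 0 * max (1 - ‖z - 1‖ ^ 2 / r ^ 2) 0 ≤ B + 4 * Real.pi * N := by
    rw [integral_eq_lintegral_of_nonneg_ae (Eventually.of_forall fun z =>
      mul_nonneg (le_max_right _ _) (le_max_right _ _))
      (integrable_mul_discWeight (by fun_prop) 1 hr0).aestronglyMeasurable]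
    refine ENNReal.toReal_le_of_le_ofReal (by positivity) (le_trans ?_ D.lintegral_ofReal_le)
    rw [← lintegral_indicator measurableSet_ball]
    refine lintegral_mono fun z => ?_
    by_cases hz : z ∈ ball (1 : ℂ) r
    · rw [indicator_of_mem]
      · rw [show ENNReal.ofReal (v z) = ENNReal.ofReal (max (v z) 0) by
          rcases le_total (v z) 0 with h | h
          · rw [max_eq_right h, ENNReal.ofReal_of_nonpos h, ENNReal.ofReal_zero]
          · rw [max_eq_left h]]
        refine ENNReal.ofReal_le_ofReal ?_
        calc _ ≤ max (v z) 0 * 1 := by gcongr; exact discWeight_le_one _ _ _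
          _ = _ := mul_one _
      · rw [mem_ball, dist_eq_norm] at hz
        rw [mem_ball, dist_zero_right]
        have := norm_add_le (z - 1) 1
        rw [sub_add_cancel, norm_one] at this
        linarith
    · rw [discWeight_eq_zero hr0 hz, mul_zero, ENNReal.ofReal_zero]; exact zero_le
  have hneg : 39 / 400 * negMass v R ≤ ∫ z, max (-v z) 0 * max (1 - ‖z - 1‖ ^ 2 / r ^ 2) 0 := by
    rw [negMass, ← integral_const_mul, ← integral_indicator measurableSet_ball]
    refine integral_mono ((integrable_indicator_iff measurableSet_ball).2
      (integrableOn_ball (by fun_prop) _ _)) (integrable_mul_discWeight (by fun_prop) 1 hr0) fun z => ?_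
    by_cases hz : z ∈ ball (0 : ℂ) (7 * R / 8)
    · rw [indicator_of_mem hz, mul_comm]
      simp only
      gcongr
      refine le_max_of_le_left ?_
      rw [mem_ball, dist_zero_right] at hz
      have h1 : ‖z - 1‖ ≤ 19 / 20 * r := by
        have := norm_sub_le z 1
        rw [norm_one] at this
        rw [hr]; linarith
      have h2 : ‖z - 1‖ ^ 2 ≤ (19 / 20 * r) ^ 2 := by gcongr
      rw [le_sub_comm, div_le_iff₀ (by positivity)]
      nlinarith
    · rw [indicator_of_notMem hz]
      exact mul_nonneg (le_max_right _ _) (le_max_right _ _)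
  have hsplit : -discMean v 1 r = 4 / r ^ 2 *
      (∫ z, max (-v z) 0 * max (1 - ‖z - 1‖ ^ 2 / r ^ 2) 0) - 4 / r ^ 2 *
      (∫ z, max (v z) 0 * max (1 - ‖z - 1‖ ^ 2 / r ^ 2) 0) := by
    rw [← mul_sub, ← integral_sub (integrable_mul_discWeight (by fun_prop) 1 hr0)
      (integrable_mul_discWeight (by fun_prop) 1 hr0), discMean, ← mul_neg, ← integral_neg]
    congr 2
    funext z
    rw [← sub_mul, ← neg_mul]
    congr 1
    rcases le_total (v z) 0 with h | h
    · rw [max_eq_left (by linarith), max_eq_right h, sub_zero]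
    · rw [max_eq_right (by linarith), max_eq_left h, zero_sub]
  have hX : 2 + max (-discMean v 1 r) 0 ≤ aprioriScale v R := by
    unfold aprioriScale
    linarith [D.one_le_log]
  have hD := le_max_left (-discMean v 1 r) 0
  have hD0 := le_max_right (-discMean v 1 r) 0
  set X := aprioriScale v R
  set P := ∫ z, max (v z) 0 * max (1 - ‖z - 1‖ ^ 2 / r ^ 2) 0
  set Q := ∫ z, max (-v z) 0 * max (1 - ‖z - 1‖ ^ 2 / r ^ 2) 0
  have h1 : Q = r ^ 2 / 4 * (-discMean v 1 r) + P := by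
    rw [hsplit]; field_simp; ring
  have h2 : r ^ 2 ≤ R ^ 2 := by gcongr; rw [hr]; linarith
  have h3 : Q ≤ R ^ 2 / 4 * X + (B + 4 * Real.pi * N) := by
    have h6 : r ^ 2 / 4 * (-discMean v 1 r) ≤ r ^ 2 / 4 * X := by gcongr; linarith
    have h7 : r ^ 2 / 4 * X ≤ R ^ 2 / 4 * X := by
      have : 0 ≤ X := by linarith
      gcongr
    linarith
  have hX1 : 2 ≤ X := by linarith
  have hE : 0 ≤ |B| + 4 * Real.pi * N := by positivity
  have hBE : B + 4 * Real.pi * N ≤ |B| + 4 * Real.pi * N := by linarith [le_abs_self B]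
  have h4 : |B| + 4 * Real.pi * N ≤ (|B| + 4 * Real.pi * N) * (R ^ 2 * X) / 2 := by
    have : 2 ≤ R ^ 2 * X := by nlinarith
    nlinarith
  have h5 : 0 ≤ R ^ 2 * X := by positivity
  nlinarith

lemma BubbleData.coeff_le {N : ℕ} {B R μ : ℝ} {v κ : ℂ → ℝ} (D : BubbleData N B R μ v κ) :
    κ 1 / (8 * (N + 1) ^ 2) ≤ B := by
  have h := D.weight_le 1 D.one_mem
  have hB := D.pos
  rw [div_le_iff₀ (by positivity)]
  have : (1 : ℝ) ≤ 8 * (N + 1) ^ 2 := by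
    have : (0 : ℝ) ≤ N := Nat.cast_nonneg _
    nlinarith
  nlinarith

lemma BubbleData.le_coeff {N : ℕ} {B R μ : ℝ} {v κ : ℂ → ℝ} (D : BubbleData N B R μ v κ) :
    (8 * (N + 1) ^ 2 * B)⁻¹ ≤ κ 1 / (8 * (N + 1) ^ 2) := by
  have h := D.le_weight 1 D.one_mem
  rw [mul_inv, mul_comm, ← div_eq_mul_inv]
  gcongr

lemma abs_bub_le (N : ℕ) (B : ℝ) : ∃ C : ℝ, 0 < C ∧ ∀ {R μ : ℝ} {v κ : ℂ → ℝ}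
    (_ : BubbleData N B R μ v κ), ∀ z ∈ closedBall (0 : ℂ) (3 * R / 4),
      |bub N (κ 1 / (8 * (N + 1) ^ 2)) μ z| ≤ C * Real.log R := by
  refine ⟨|B| + 2 * |Real.log (1 + B)| + 4 * (N + 1), by positivity, fun {R μ v κ} D z hz => ?_⟩
  have hR := D.le_R
  have hB := D.pos
  have hc := D.coeff_pos
  have hl := D.one_le_log
  have hμ := D.mu_le
  have hμ0 := D.mu_nonneg
  rw [mem_closedBall, dist_zero_right] at hz
  have h1 := bub_le (N := N) (m := μ) hc z
  have hRp : R ≤ R ^ (N + 1) := le_self_pow₀ (by linarith) (by simp)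
  have ha : ‖z ^ (N + 1) - 1‖ ≤ R ^ (N + 1) := by
    refine (norm_sub_le _ _).trans ?_
    rw [norm_pow, norm_one]
    have : ‖z‖ ^ (N + 1) ≤ (3 / 4) ^ (N + 1) * R ^ (N + 1) := by
      rw [← mul_pow]; gcongr; linarith
    have h2 : ((3 : ℝ) / 4) ^ (N + 1) ≤ 3 / 4 := pow_le_of_le_one (by norm_num) (by norm_num) (by simp)
    nlinarith
  have h2 := le_bub (m := μ) hc hμ0 (by linarith : 1 ≤ R ^ (N + 1)) ha
  rw [Real.log_pow] at h2
  have h3 : Real.log (1 + κ 1 / (8 * (N + 1) ^ 2)) ≤ |Real.log (1 + B)| :=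
    (Real.log_le_log (by positivity) (by linarith [D.coeff_le])).trans (le_abs_self _)
  rw [abs_of_pos hB]
  have h4 : |Real.log (1 + B)| ≤ |Real.log (1 + B)| * Real.log R := le_mul_of_one_le_right (abs_nonneg _) hl
  have h5 : 0 ≤ (N + 1) * Real.log R := by positivity
  push_cast at h2
  have h6 : 0 ≤ |Real.log (1 + B)| * Real.log R := by positivity
  rw [abs_le]
  constructor <;> nlinarith

lemma abs_sub_bub_le (N : ℕ) (B : ℝ) : ∃ C : ℝ, 0 < C ∧ ∀ {R μ : ℝ} {v κ : ℂ → ℝ}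
    (_ : BubbleData N B R μ v κ), ∀ z ∈ refAnnulus R,
      |v z - bub N (κ 1 / (8 * (N + 1) ^ 2)) μ z| ≤ C * aprioriScale v R := by
  obtain ⟨C₁, hC₁, h₁⟩ := negMass_le N B
  obtain ⟨C₂, hC₂, h₂⟩ := abs_bub_le N B
  have hI := bubbleMass_pos
  refine ⟨|B| + 128 * C₁ / bubbleMass + C₂, by positivity, fun {R μ v κ} D z hz => ?_⟩
  have hR := D.le_R
  have hB := D.pos
  have h1 := h₁ D
  have h2 := h₂ D z hz.1
  have hX := D.log_le_scale
  have hl := D.one_le_log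
  have hz1 : ‖z‖ ≤ 3 * R / 4 := by simpa using hz.1
  have hz2 : 3 * R / 8 ≤ ‖z‖ := by simpa using hz.2
  have hzR : z ∈ ball (0 : ℂ) R := by simp; linarith
  have hup := D.le_outer z hzR (by linarith)
  have hsub : ball z (R / 8) ⊆ ball 0 (7 * R / 8) := by
    refine ball_subset_ball' ?_
    rw [dist_zero_right]; linarith
  have h3 := neg_discMean_le D.contDiff.continuous (by positivity : 0 < R / 8) hsub
  have h4 := discMean_le D.contDiff (by positivity : 0 < R / 8)
    (fun y hy => D.lap_nonneg (ball_subset_ball (by linarith) (hsub hy)))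
  have h5 : 4 / (R / 8) ^ 2 * negMass v R ≤ 256 * C₁ * aprioriScale v R := by
    calc _ ≤ 4 / (R / 8) ^ 2 * (C₁ * R ^ 2 * aprioriScale v R) := by gcongr
      _ = _ := by field_simp; ring
  have h6 : -v z ≤ 128 * C₁ / bubbleMass * aprioriScale v R := by
    rw [div_mul_eq_mul_div, le_div_iff₀ hI]
    linarith
  set X := aprioriScale v R
  have h7 : |v z| ≤ (|B| + 128 * C₁ / bubbleMass) * X := by
    have : 0 ≤ 128 * C₁ / bubbleMass * X := by
      have : 0 ≤ X := by linarith
      positivity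
    rw [abs_of_pos hB, abs_le]
    constructor <;> nlinarith
  calc _ ≤ |v z| + |bub N (κ 1 / (8 * (N + 1) ^ 2)) μ z| := abs_sub _ _
    _ ≤ (|B| + 128 * C₁ / bubbleMass) * X + C₂ * X := by
        gcongr
        refine h2.trans ?_
        gcongr
        linarith
    _ = _ := by ring

lemma lap_sub {f g : ℂ → ℝ} (hf : ContDiff ℝ 2 f) (hg : ContDiff ℝ 2 g) (z : ℂ) :
    lap (fun y => f y - g y) z = lap f z - lap g z := by
  have hfc := contDiff_coe hf
  have hgc := contDiff_coe hg
  have h1 := dzb_dz_ofReal (hf.sub hg) z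
  have e : (dz fun y => ((f y - g y : ℝ) : ℂ)) =
      fun y => dz (fun y => (f y : ℂ)) y - dz (fun y => (g y : ℂ)) y := by
    funext y
    simp_rw [Complex.ofReal_sub]
    exact ((hfc.hasWirt (by norm_num) y).sub (hgc.hasWirt (by norm_num) y)).dz
  have hf1 : ContDiff ℝ 1 (dz fun y => (f y : ℂ)) := ContDiff.dz (n := 1) hfc
  have hg1 : ContDiff ℝ 1 (dz fun y => (g y : ℂ)) := ContDiff.dz (n := 1) hgc
  have h2 : dzb (dz fun y => ((f y - g y : ℝ) : ℂ)) z = lap f z / 4 - lap g z / 4 := by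
    rw [e, ((hf1.hasWirt (by norm_num) z).sub (hg1.hasWirt (by norm_num) z)).dzb,
      dzb_dz_ofReal hf, dzb_dz_ofReal hg]
  have h3 : ((lap (fun y => f y - g y) z : ℝ) : ℂ) = ((lap f z - lap g z : ℝ) : ℂ) := by
    have h4 : ((lap (fun y => f y - g y) z : ℝ) : ℂ) / 4 = lap f z / 4 - lap g z / 4 := by
      rw [← h2]; exact h1.symm
    push_cast
    linear_combination 4 * h4
  exact_mod_cast h3

lemma bub_decay (N : ℕ) (B : ℝ) : ∃ C : ℝ, 0 < C ∧ ∀ {R μ : ℝ} {v κ : ℂ → ℝ}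
    (_ : BubbleData N B R μ v κ), ∀ z : ℂ, 2 ≤ ‖z‖ →
      ‖z‖ ^ (2 * N) * Real.exp (bub N (κ 1 / (8 * (N + 1) ^ 2)) μ z) ≤ C * (‖z‖ ^ 6)⁻¹ := by
  refine ⟨16 * (8 * (N + 1) ^ 2 * (|B| + 1)) ^ 2, by positivity, fun {R μ v κ} D z hz => ?_⟩
  have hB := D.pos
  have hc := D.coeff_pos
  have hcl := D.le_coeff
  set c := κ 1 / (8 * ((N : ℝ) + 1) ^ 2)
  have hz0 : 0 < ‖z‖ := by linarith
  have h1 := exp_bub_le (m := μ) hc (by positivity : 0 < ‖z‖ ^ (N + 1) / 2)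
    (half_pow_le_norm_pow_sub_one hz)
  have h2 : c⁻¹ ≤ 8 * (N + 1) ^ 2 * (|B| + 1) := by
    refine (inv_le_of_inv_le₀ (by positivity) hcl).trans ?_
    gcongr
    linarith [le_abs_self B]
  have h3 : Real.exp (-μ) ≤ 1 := Real.exp_le_one_iff.2 (by linarith [D.mu_nonneg])
  calc _ ≤ ‖z‖ ^ (2 * N) * (1 * (c ^ 2 * (‖z‖ ^ (N + 1) / 2) ^ 4)⁻¹) := by
        gcongr; exact h1.trans (by gcongr)
    _ = 16 * (c⁻¹) ^ 2 * (‖z‖ ^ (2 * N + 4))⁻¹ := by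
        have : (‖z‖ ^ (N + 1) / 2) ^ 4 = ‖z‖ ^ (2 * N + 4) * ‖z‖ ^ (2 * N) / 16 := by ring
        rw [this]
        field_simp
    _ ≤ _ := by
        gcongr
        · linarith
        · have := D.one_le_N; omega

lemma BubbleData.setIntegral_neg_lap_le {N : ℕ} {B R μ : ℝ} {v κ : ℂ → ℝ}
    (D : BubbleData N B R μ v κ) {s : Set ℂ} (hs : MeasurableSet s) (hsR : s ⊆ ball 0 R) :
    ∫ z in s, -lap v z ≤ B ^ 2 := by
  have hB := D.pos
  have hd := measurable_dens N D.contDiff.continuous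
  rw [integral_eq_lintegral_of_nonneg_ae]
  · refine ENNReal.toReal_le_of_le_ofReal (by positivity) ?_
    calc _ ≤ ∫⁻ z in s, ENNReal.ofReal B * dens N v z := by
          refine setLIntegral_mono (hd.const_mul _) fun z hz => ?_
          rw [dens_eq, ← ENNReal.ofReal_mul hB.le, D.pde z (hsR hz), neg_neg]
          refine ENNReal.ofReal_le_ofReal ?_
          have := D.weight_le z (hsR hz)
          calc _ ≤ ‖z‖ ^ (2 * N) * B * Real.exp (v z) := by gcongr
            _ = _ := by ring
      _ ≤ ∫⁻ z in ball 0 R, ENNReal.ofReal B * dens N v z := lintegral_mono_set hsR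
      _ ≤ _ := by
          rw [lintegral_const_mul _ hd, sq, ENNReal.ofReal_mul hB.le]
          gcongr
          exact D.mass
  · exact (ae_restrict_iff' hs).2 (Eventually.of_forall fun z hz => D.lap_nonneg (hsR hz))
  · exact D.contDiff.continuous_lap.neg.aestronglyMeasurable

lemma measurableSet_refAnnulus (R : ℝ) : MeasurableSet (refAnnulus R) :=
  measurableSet_closedBall.diff measurableSet_ball

lemma mem_refAnnulus {R : ℝ} {z : ℂ} : z ∈ refAnnulus R ↔ ‖z‖ ≤ 3 * R / 4 ∧ 3 * R / 8 ≤ ‖z‖ := by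
  simp [refAnnulus]

lemma integral_refAnnulus_le {f : ℂ → ℝ} {R a : ℝ} (hR : 1 ≤ R) (ha : 0 ≤ a)
    (hf : ∀ z ∈ refAnnulus R, |f z| ≤ a * (‖z‖ ^ 6)⁻¹) :
    ∫ z in refAnnulus R, |f z| ≤ 3000 * a / R ^ 2 := by
  have hR0 : 0 < R := by linarith
  have h0 : ∀ z ∈ refAnnulus R, ‖|f z|‖ ≤ a * (((3 * R / 8) ^ 6)⁻¹) := fun z hz => by
    rw [Real.norm_of_nonneg (abs_nonneg _)]
    refine (hf z hz).trans ?_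
    have := (mem_refAnnulus.1 hz).2
    gcongr
  have hvol : volume (refAnnulus R) ≤ ENNReal.ofReal (Real.pi * (3 * R / 4) ^ 2) := by
    refine (measure_mono sdiff_subset).trans ?_
    rw [Complex.volume_closedBall, mul_comm, ENNReal.ofReal_mul Real.pi_pos.le,
      ← ENNReal.ofReal_pow (by positivity)]
    gcongr
    rw [ENNReal.le_ofReal_iff_toReal_le (by simp) Real.pi_pos.le]
    simp
  have h1 := norm_setIntegral_le_of_norm_le_const (hvol.trans_lt ENNReal.ofReal_lt_top) h0
  refine (Real.le_norm_self _).trans (h1.trans ?_)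
  have h2 : volume.real (refAnnulus R) ≤ Real.pi * (3 * R / 4) ^ 2 :=
    ENNReal.toReal_le_of_le_ofReal (by positivity) hvol
  calc _ ≤ a * (((3 * R / 8) ^ 6)⁻¹) * (4 * (3 * R / 4) ^ 2) := by
        gcongr; exact h2.trans (by gcongr; linarith [Real.pi_lt_four])
    _ = a * (4 * (3 / 4) ^ 2 / (3 / 8) ^ 6) / R ^ 4 := by field_simp; try ring
    _ ≤ a * 3000 / R ^ 2 := by
        gcongr
        · norm_num
        · norm_num
    _ = _ := by ring

lemma abs_lap_bub_le (N : ℕ) (B : ℝ) : ∃ C : ℝ, 0 < C ∧ ∀ {R μ : ℝ} {v κ : ℂ → ℝ}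
    (_ : BubbleData N B R μ v κ), ∀ z : ℂ, 2 ≤ ‖z‖ →
      |lap (bub N (κ 1 / (8 * (N + 1) ^ 2)) μ) z| ≤ C * (‖z‖ ^ 6)⁻¹ := by
  obtain ⟨C, hC, h⟩ := bub_decay N B
  refine ⟨(|B| + 1) * C, by positivity, fun {R μ v κ} D z hz => ?_⟩
  have h1 := h D z hz
  have h2 := D.weight_le 1 D.one_mem
  have h3 := D.le_weight 1 D.one_mem
  have hB := D.pos
  have h4 : 0 < κ 1 := lt_of_lt_of_le (by positivity) h3
  rw [lap_bub D.coeff_pos, abs_neg, abs_of_nonneg (by have := D.coeff_pos; positivity)]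
  have e : 8 * ((N : ℝ) + 1) ^ 2 * (κ 1 / (8 * (N + 1) ^ 2)) = κ 1 := by field_simp
  rw [e]
  calc _ = κ 1 * (‖z‖ ^ (2 * N) * Real.exp (bub N (κ 1 / (8 * (N + 1) ^ 2)) μ z)) := by ring
    _ ≤ (|B| + 1) * (C * (‖z‖ ^ 6)⁻¹) := by
        gcongr
        linarith [le_abs_self B]
    _ = _ := by ring

lemma integral_abs_lap_sub_bub_le (N : ℕ) (B : ℝ) : ∃ C : ℝ, 0 < C ∧ ∀ {R μ : ℝ} {v κ : ℂ → ℝ}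
    (_ : BubbleData N B R μ v κ),
    ∫ z in refAnnulus R, |lap (fun y => v y - bub N (κ 1 / (8 * (N + 1) ^ 2)) μ y) z| ≤ C := by
  obtain ⟨C, hC, h⟩ := abs_lap_bub_le N B
  refine ⟨B ^ 2 + 3000 * C, by positivity, fun {R μ v κ} D => ?_⟩
  have hR := D.le_R
  have hb := contDiff_bub (N := N) (m := μ) D.coeff_pos
  have hm := measurableSet_refAnnulus R
  have hsub : refAnnulus R ⊆ ball 0 R := fun z hz => by
    have := (mem_refAnnulus.1 hz).1
    simp; linarith
  have hk : ∀ {f : ℂ → ℝ}, Continuous f → IntegrableOn f (refAnnulus R) := fun hf =>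
    (hf.continuousOn.integrableOn_compact (isCompact_closedBall 0 (3 * R / 4))).mono_set sdiff_subset
  have h1 := integral_refAnnulus_le (R := R) (by linarith) hC.le fun z hz =>
    h D z (by linarith [(mem_refAnnulus.1 hz).2])
  have h2 : ∫ z in refAnnulus R, |lap (fun y => v y - bub N (κ 1 / (8 * (N + 1) ^ 2)) μ y) z| ≤
      ∫ z in refAnnulus R, (-lap v z + |lap (bub N (κ 1 / (8 * (N + 1) ^ 2)) μ) z|) := by
    refine setIntegral_mono_on (hk (D.contDiff.sub hb).continuous_lap.abs)
      (hk (D.contDiff.continuous_lap.neg.add hb.continuous_lap.abs)) hm fun z hz => ?_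
    rw [lap_sub D.contDiff hb]
    refine (abs_sub _ _).trans ?_
    rw [abs_of_nonpos (by linarith [D.lap_nonneg (hsub hz)])]
  rw [integral_add (f := fun z => -lap v z) (hk D.contDiff.continuous_lap.neg)
    (hk hb.continuous_lap.abs)] at h2
  have h3 := D.setIntegral_neg_lap_le hm hsub
  have h4 : 3000 * C / R ^ 2 ≤ 3000 * C := div_le_self (by positivity) (by nlinarith)
  linarith

lemma integral_abs_lap_sub_bub_le_of_le (N : ℕ) (B : ℝ) : ∃ C : ℝ, 0 < C ∧
    ∀ {R μ : ℝ} {v κ : ℂ → ℝ} (_ : BubbleData N B R μ v κ)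
    (_ : ∀ z ∈ refAnnulus R, v z ≤ bub N (κ 1 / (8 * (N + 1) ^ 2)) μ z + 1),
    ∫ z in refAnnulus R, |lap (fun y => v y - bub N (κ 1 / (8 * (N + 1) ^ 2)) μ y) z| ≤
      C / R ^ 2 := by
  obtain ⟨C, hC, h⟩ := abs_lap_bub_le N B
  obtain ⟨C', hC', h'⟩ := bub_decay N B
  refine ⟨3000 * ((|B| + 1) * Real.exp 1 * C' + C), by positivity, fun {R μ v κ} D hvb => ?_⟩
  have hR := D.le_R
  refine integral_refAnnulus_le (by linarith) (by positivity) fun z hz => ?_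
  have hz1 := mem_refAnnulus.1 hz
  have hzR : z ∈ ball (0 : ℂ) R := by simp; linarith
  have hz2 : 2 ≤ ‖z‖ := by linarith
  rw [lap_sub D.contDiff (contDiff_bub D.coeff_pos)]
  refine (abs_sub _ _).trans ?_
  rw [add_mul]
  refine add_le_add ?_ (h D z hz2)
  rw [D.pde z hzR, abs_neg]
  have hκ0 : 0 ≤ κ z := le_trans (by have := D.pos; positivity) (D.le_weight z hzR)
  have hκ := D.weight_le z hzR
  rw [abs_of_nonneg (by positivity)]
  have h5 : Real.exp (v z) ≤ Real.exp 1 * Real.exp (bub N (κ 1 / (8 * (N + 1) ^ 2)) μ z) := by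
    rw [← Real.exp_add, Real.exp_le_exp]
    linarith [hvb z hz]
  have h6 := h' D z hz2
  calc _ ≤ ‖z‖ ^ (2 * N) * (|B| + 1) *
        (Real.exp 1 * Real.exp (bub N (κ 1 / (8 * (N + 1) ^ 2)) μ z)) := by
        gcongr; linarith [le_abs_self B]
    _ = (|B| + 1) * Real.exp 1 *
        (‖z‖ ^ (2 * N) * Real.exp (bub N (κ 1 / (8 * (N + 1) ^ 2)) μ z)) := by ring
    _ ≤ (|B| + 1) * Real.exp 1 * (C' * (‖z‖ ^ 6)⁻¹) := by gcongr
    _ = _ := by ring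

lemma logPot_one_le (N : ℕ) (B : ℝ) : ∃ C : ℝ, 0 < C ∧ ∀ {R μ : ℝ} {v κ : ℂ → ℝ}
    (_ : BubbleData N B R μ v κ), logPot N v 1 ≤ ENNReal.ofReal (C * aprioriScale v R) := by
  have hI := bubbleMass_pos
  refine ⟨(|B| + 1) * (2 * bubbleMass * (|B| + 1) + 1) + 3 * (|B| + 1), by positivity,
    fun {R μ v κ} D => ?_⟩
  have hR := D.le_R
  have hB := D.pos
  have hX := D.log_le_scale
  have hl := D.one_le_log
  have h1 := D.logPot_le (c := 1) (r := 15 * R / 16) (by simp) (by linarith)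
    (ball_subset_ball' (by simp; linarith))
  have h2 : -discMean v 1 (15 * R / 16) ≤ aprioriScale v R := by
    unfold aprioriScale
    linarith [le_max_left (-discMean v 1 (15 * R / 16)) 0]
  have hμ := D.mu_le
  set X := aprioriScale v R
  refine h1.trans ?_
  rw [D.apply_one, abs_of_pos hB]
  have h3 : 2 * bubbleMass * μ - discMean v 1 (15 * R / 16) ≤ (2 * bubbleMass * (B + 1) + 1) * X := by
    have : μ ≤ (B + 1) * X := by nlinarith
    have : 2 * bubbleMass * μ ≤ 2 * bubbleMass * ((B + 1) * X) := by gcongr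
    nlinarith
  have hX0 : 0 ≤ X := by linarith
  rw [add_mul, ENNReal.ofReal_add (by positivity) (by positivity), mul_assoc (B + 1),
    ENNReal.ofReal_mul (p := B + 1) (by positivity)]
  refine add_le_add (mul_le_mul' (ENNReal.ofReal_le_ofReal (by linarith))
    (ENNReal.ofReal_le_ofReal h3)) (ENNReal.ofReal_le_ofReal ?_)
  nlinarith

lemma enorm_quadDiff_le_scale (N : ℕ) (B : ℝ) : ∃ C : ℝ, 0 < C ∧ ∀ {R μ : ℝ} {v κ : ℂ → ℝ}
    (_ : BubbleData N B R μ v κ) (y : ℂ), ‖y‖ ≤ 2 →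
    ‖quadDiff N v y‖ₑ ≤ ENNReal.ofReal (C / R) * pot N v y +
      ENNReal.ofReal (C * aprioriScale v R ^ 2 / R) := by
  obtain ⟨C₁, hC₁, h₁⟩ := enorm_quadDiff_le_pot N B
  obtain ⟨C₂, hC₂, h₂⟩ := abs_sub_bub_le N B
  obtain ⟨C₃, hC₃, h₃⟩ := integral_abs_lap_sub_bub_le N B
  refine ⟨C₁ * (|B| + B ^ 2 + (C₂ + C₃) * (1 + C₂)), by positivity, fun {R μ v κ} D y hy => ?_⟩
  have hR := D.le_R
  have hB := D.pos
  have hR0 : 0 < R := by linarith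
  have hX := D.log_le_scale
  have hl := D.one_le_log
  have hd := measurable_dens N D.contDiff.continuous
  have hX1 : 1 ≤ aprioriScale v R := by linarith
  have hfar : ∫⁻ z in ball (0 : ℂ) R \ ball 0 4, dens N v z * ‖dz (fun y => (κ y : ℂ)) z‖ₑ ≤
      ENNReal.ofReal (B ^ 2 / R) := by
    calc _ ≤ ∫⁻ z in ball (0 : ℂ) R, dens N v z * ‖dz (fun y => (κ y : ℂ)) z‖ₑ :=
          lintegral_mono_set sdiff_subset
      _ ≤ ∫⁻ z in ball (0 : ℂ) R, ENNReal.ofReal (B / R) * dens N v z := by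
          refine setLIntegral_mono (hd.const_mul _) fun z hz => ?_
          rw [mul_comm]
          gcongr
          rw [← ofReal_norm]
          exact ENNReal.ofReal_le_ofReal (D.dz_weight_le z hz)
      _ ≤ ENNReal.ofReal (B / R) * ENNReal.ofReal B := by
          rw [lintegral_const_mul _ hd]; gcongr; exact D.mass
      _ = _ := by rw [← ENNReal.ofReal_mul (by positivity)]; congr 1; ring
  refine (h₁ D (by positivity) hC₃.le (by positivity) (by positivity) (h₂ D) (h₃ D)
    (fun z hz => D.dz_weight_le z (ball_subset_ball (by linarith) hz)) hfar y hy).trans ?_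
  set X := aprioriScale v R
  refine add_le_add (mul_le_mul' (ENNReal.ofReal_le_ofReal ?_) le_rfl) (ENNReal.ofReal_le_ofReal ?_)
  · rw [abs_of_pos hB, ← mul_div_assoc]
    gcongr
    nlinarith [mul_pos (add_pos hC₂ hC₃) (by linarith : 0 < 1 + C₂), sq_nonneg B]
  · rw [← add_div, ← mul_div_assoc, mul_assoc]
    gcongr
    have h5 : 1 ≤ X ^ 2 := by nlinarith
    have h6 : (C₂ * X + C₃) * (1 + C₂ * X) ≤ ((C₂ + C₃) * X) * ((1 + C₂) * X) := by
      gcongr <;> nlinarith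
    nlinarith [sq_nonneg B, abs_nonneg B, mul_nonneg (sq_nonneg B) (sub_nonneg.2 h5),
      mul_nonneg (abs_nonneg B) (by positivity : 0 ≤ X ^ 2)]

lemma ofReal_intervalIntegral {f : ℝ → ℝ} (hf : Continuous f) (h0 : ∀ t, 0 ≤ f t) :
    ENNReal.ofReal (∫ t in (0 : ℝ)..1, f t) = ∫⁻ t in Ioc (0 : ℝ) 1, ENNReal.ofReal (f t) := by
  rw [intervalIntegral.integral_of_le zero_le_one]
  refine ofReal_integral_eq_lintegral_ofReal ?_ (Eventually.of_forall h0)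
  exact (hf.integrableOn_Icc (a := 0) (b := 1)).mono_set Ioc_subset_Icc_self

lemma lintegral_ball_add (f : ℂ → ENNReal) (c : ℂ) (r : ℝ) :
    ∫⁻ z in ball c r, f z = ∫⁻ z in ball (0 : ℂ) r, f (c + z) := by
  have h := (measurePreserving_add_left (volume : Measure ℂ) c).setLIntegral_comp_preimage_emb
    (measurableEmbedding_addLeft c) f (ball c r)
  rw [← h]
  congr 2
  ext z
  simp

lemma BubbleData.norm_stateDiff_zero_one_le {N : ℕ} {B R μ : ℝ} {v κ : ℂ → ℝ}
    (D : BubbleData N B R μ v κ) : ‖stateDiff N v κ μ 0 1‖ ≤ (1 + B) * Real.exp (μ / 2) := by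
  have hB := D.pos
  have hκ := D.weight_le 1 D.one_mem
  have hκ0 : 0 ≤ κ 1 := le_trans (by positivity) (D.le_weight 1 D.one_mem)
  have hw : wDeriv N v 1 = 0 := by simp [wDeriv, D.dz_one]
  have hμ := D.mu_nonneg
  have h1 : 1 ≤ Real.exp (μ / 2) := Real.one_le_exp (by linarith)
  simp only [stateDiff, wDeriv₂, hw, Complex.ofReal_zero, zero_mul, sub_zero, add_zero]
  refine norm_prod_le_iff.2 ⟨?_, norm_prod_le_iff.2 ⟨?_, ?_⟩⟩
  · simp only
    rw [expHalf, D.apply_one, Complex.norm_real, Real.norm_of_nonneg (Real.exp_pos _).le]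
    have : Real.exp (-μ / 2) ≤ 1 := Real.exp_le_one_iff.2 (by linarith)
    nlinarith
  · simp only [norm_zero]; positivity
  · simp only
    rw [expHalf, D.apply_one, norm_mul, norm_mul, norm_inv, Complex.norm_real, Complex.norm_real,
      Real.norm_of_nonneg (Real.exp_pos _).le, Real.norm_of_nonneg hκ0, ← Real.exp_neg,
      show -(-μ / 2) = μ / 2 by ring]
    gcongr
    norm_num
    linarith

lemma ofReal_neg_le_ray (N : ℕ) (B : ℝ) : ∃ C : ℝ, 0 < C ∧ ∀ {R μ : ℝ} {v κ : ℂ → ℝ}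
    (_ : BubbleData N B R μ v κ), ∀ z ∈ ball (0 : ℂ) (4 / 5),
      ENNReal.ofReal (-v (1 + z)) ≤ ENNReal.ofReal (C + μ) +
        ENNReal.ofReal C * ∫⁻ t in Ioc (0 : ℝ) 1, ‖z‖ₑ * ‖quadDiff N v (1 + t * z)‖ₑ := by
  refine ⟨2 * |B| + 2 * 2 ^ (N + 1) + 4 * B ^ 2 + 2 * 5 ^ (N + 1), by positivity,
    fun {R μ v κ} D z hz => ?_⟩
  have hB := D.pos
  have hR := D.le_R
  have hc := D.coeff_pos
  have hμ := D.mu_nonneg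
  rw [mem_ball, dist_zero_right] at hz
  have hseg : ∀ t ∈ Icc (0 : ℝ) 1, (1 : ℂ) + t * z ∈ ball (1 : ℂ) (4 / 5) := fun t ht => by
    rw [mem_ball, dist_eq_norm, add_sub_cancel_left, norm_mul, Complex.norm_real,
      Real.norm_of_nonneg ht.1]
    nlinarith [ht.2, norm_nonneg z]
  have h1 := norm_stateDiff_le D (s := B / R) (a := 0) (fun y hy => D.dz_weight_le y (by
    have := (mem_ball_one_norm hy).2.2.1
    simp; linarith)) le_rfl hseg le_rfl
    (F := fun _ => (1 + 2 * (κ 1 / (8 * (N + 1) ^ 2)) * ((N + 1) * 2 ^ N) ^ 2) * Real.exp (μ / 2) *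
      (Real.exp (-μ) + 1)) continuous_const (fun _ => by positivity) (fun t ht => by
      have h2 := mem_ball_one_norm (hseg t ht)
      refine (norm_expHalf_add_norm_wDeriv_bub_le hc h2.1 h2.2.2.2).trans ?_
      gcongr
      exact h2.2.2.2)
  simp only [zero_mul, intervalIntegral.integral_zero, add_zero] at h1
  have hG : Continuous fun t : ℝ => ‖quadDiff N v (1 + t * z)‖ :=
    ((continuous_quadDiff N D.contDiff).comp (by fun_prop)).norm
  have h2 : ‖expHalf v (1 + z)‖ ≤ ‖stateDiff N v κ μ 0 (1 + z)‖ := by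
    refine le_trans (le_of_eq ?_) (norm_fst_le _)
    simp [stateDiff]
  rw [expHalf, Complex.norm_real, Real.norm_of_nonneg (Real.exp_pos _).le] at h2
  set I := ∫ t in (0 : ℝ)..1, ‖z‖ * ‖quadDiff N v (1 + t * z)‖ with hI
  have h3 : ∫ t in (0 : ℝ)..1, ‖z‖ * (2 ^ (N + 1) + 5 ^ (N + 1) * ‖quadDiff N v (1 + t * z)‖ +
      2 * (B / R) * B) = ‖z‖ * (2 ^ (N + 1) + 2 * (B / R) * B) + 5 ^ (N + 1) * I := by
    rw [hI, ← intervalIntegral.integral_const_mul]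
    have e : ∀ t : ℝ, ‖z‖ * (2 ^ (N + 1) + 5 ^ (N + 1) * ‖quadDiff N v (1 + t * z)‖ +
      2 * (B / R) * B) = ‖z‖ * (2 ^ (N + 1) + 2 * (B / R) * B) +
        5 ^ (N + 1) * (‖z‖ * ‖quadDiff N v (1 + t * z)‖) := fun t => by ring
    simp_rw [e]
    rw [intervalIntegral.integral_add (by simp)
      ((by fun_prop : Continuous fun t : ℝ => 5 ^ (N + 1) * (‖z‖ * ‖quadDiff N v (1 + t * z)‖)).intervalIntegrable _ _)]
    simp
  rw [h3] at h1
  have h4 := h2.trans (h1.trans (mul_le_mul_of_nonneg_right D.norm_stateDiff_zero_one_le (Real.exp_pos _).le))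
  have h5 : 1 + B ≤ Real.exp B := by linarith [Real.add_one_le_exp B]
  have h6 : Real.exp (-v (1 + z) / 2) ≤ Real.exp (B + μ / 2 +
      (‖z‖ * (2 ^ (N + 1) + 2 * (B / R) * B) + 5 ^ (N + 1) * I)) := by
    rw [Real.exp_add, Real.exp_add]
    refine h4.trans ?_
    gcongr
  rw [Real.exp_le_exp] at h6
  have hI0 : 0 ≤ I := intervalIntegral.integral_nonneg zero_le_one fun t _ => by positivity
  have h7 : ‖z‖ * (2 ^ (N + 1) + 2 * (B / R) * B) ≤ 1 * (2 ^ (N + 1) + 2 * (B / 1) * B) := by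
    gcongr <;> linarith
  have h8 : ENNReal.ofReal I = ∫⁻ t in Ioc (0 : ℝ) 1, ‖z‖ₑ * ‖quadDiff N v (1 + t * z)‖ₑ := by
    rw [hI, ofReal_intervalIntegral (by fun_prop) (fun t => by positivity)]
    refine lintegral_congr fun t => ?_
    rw [ENNReal.ofReal_mul (by positivity), ofReal_norm, ofReal_norm]
  rw [← h8, ← ENNReal.ofReal_mul (by positivity), ← ENNReal.ofReal_add (by positivity) (by positivity)]
  refine ENNReal.ofReal_le_ofReal ?_
  rw [abs_of_pos hB]
  nlinarith [mul_nonneg (by positivity : 0 ≤ 2 * B + 2 * 2 ^ (N + 1) + 4 * B ^ 2) hI0, sq_nonneg B,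
    (by positivity : (0 : ℝ) ≤ 5 ^ (N + 1))]

lemma volume_ball_eq (c : ℂ) {r : ℝ} (hr : 0 ≤ r) :
    volume (ball c r) = ENNReal.ofReal (Real.pi * r ^ 2) := by
  rw [Complex.volume_ball, mul_comm, ENNReal.ofReal_mul Real.pi_pos.le, ENNReal.ofReal_pow hr]
  congr 1
  rw [← NNReal.coe_real_pi, ENNReal.ofReal_coe_nnreal]

lemma neg_discMean_scale_le (N : ℕ) (B : ℝ) : ∃ C : ℝ, 0 < C ∧ ∀ {R μ : ℝ} {v κ : ℂ → ℝ}
    (_ : BubbleData N B R μ v κ),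
      -discMean v 1 (1 / aprioriScale v R) ≤ C * (1 + μ + aprioriScale v R / R) := by
  obtain ⟨C₁, hC₁, h₁⟩ := ofReal_neg_le_ray N B
  obtain ⟨C₂, hC₂, h₂⟩ := enorm_quadDiff_le_scale N B
  obtain ⟨C₃, hC₃, h₃⟩ := logPot_one_le N B
  refine ⟨4 * (Real.pi * (C₁ + 1)) + 4 * (C₁ / 2 * (12 * Real.pi * C₂ * C₃ + 2 * Real.pi * C₂)),
    by positivity, fun {R μ v κ} D => ?_⟩
  have hR := D.le_R
  have hR0 : 0 < R := by linarith
  have hX := D.log_le_scale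
  have hl := D.one_le_log
  have hμ := D.mu_nonneg
  have hv := D.contDiff.continuous
  have h1 := h₁ D
  have h2 := h₂ D
  have h3 := h₃ D
  set X := aprioriScale v R with hXd
  have hX0 : 0 < X := by linarith
  have hl0 : 0 < 1 / X := by positivity
  have hl1 : 1 / X ≤ 1 / 3 := by gcongr; linarith
  have h4 := lintegral_ray_quadDiff_le D.contDiff (c := 1) (g := C₂ / R) (b := C₂ * X ^ 2 / R) hl0
    (by linarith) (by rw [norm_one]; linarith) (by positivity) (by positivity) h2
  have h5 := neg_discMean_le_setIntegral hv hl0 (Subset.refl (ball (1 : ℂ) (1 / X)))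
  have hGm : Measurable fun z : ℂ => ∫⁻ t in Ioc (0 : ℝ) 1, ‖z‖ₑ * ‖quadDiff N v (1 + t * z)‖ₑ := by
    have hq := continuous_quadDiff N D.contDiff
    have : Measurable fun p : ℂ × ℝ => ‖p.1‖ₑ * ‖quadDiff N v (1 + p.2 * p.1)‖ₑ :=
      (continuous_fst.enorm.measurable).mul ((hq.comp (by fun_prop)).enorm.measurable)
    exact this.lintegral_prod_right'
  have h6 : ∫ z in ball (1 : ℂ) (1 / X), max (-v z) 0 ≤ (C₁ + μ) * (Real.pi * (1 / X) ^ 2) +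
      C₁ * ((1 / X) ^ 2 / 2 * (12 * Real.pi * (C₂ / R) * (C₃ * X) +
        2 * Real.pi * (1 / X) * (C₂ * X ^ 2 / R))) := by
    rw [integral_eq_lintegral_of_nonneg_ae (f := fun z => max (-v z) 0)
      (Eventually.of_forall fun _ => le_max_right _ _)
      (by fun_prop : Continuous fun z => max (-v z) 0).aestronglyMeasurable]
    refine ENNReal.toReal_le_of_le_ofReal (by positivity) ?_
    rw [lintegral_ball_add]
    calc _ ≤ ∫⁻ z in ball (0 : ℂ) (1 / X), (ENNReal.ofReal (C₁ + μ) + ENNReal.ofReal C₁ *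
          ∫⁻ t in Ioc (0 : ℝ) 1, ‖z‖ₑ * ‖quadDiff N v (1 + t * z)‖ₑ) := by
          refine setLIntegral_mono (by fun_prop) fun z hz => ?_
          refine le_trans (le_of_eq ?_) (h1 z (ball_subset_ball (by linarith) hz))
          rcases le_total (-v (1 + z)) 0 with h | h
          · rw [max_eq_right h, ENNReal.ofReal_of_nonpos h, ENNReal.ofReal_zero]
          · rw [max_eq_left h]
      _ ≤ _ := by
          rw [lintegral_add_left measurable_const, lintegral_const_mul _ hGm, lintegral_const,
            Measure.restrict_apply_univ, volume_ball_eq 0 hl0.le, ENNReal.ofReal_add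
            (p := (C₁ + μ) * (Real.pi * (1 / X) ^ 2)) (by positivity)
            (by positivity), ENNReal.ofReal_mul (p := C₁ + μ) (by positivity),
            ENNReal.ofReal_mul (p := C₁) (by positivity), ENNReal.ofReal_mul (p := (1 / X) ^ 2 / 2)
            (by positivity), ENNReal.ofReal_add (p := 12 * Real.pi * (C₂ / R) * (C₃ * X))
            (by positivity) (by positivity),
            ENNReal.ofReal_mul (p := 12 * Real.pi * (C₂ / R)) (by positivity)]
          gcongr
          exact h4.trans (by gcongr)
  refine h5.trans ((mul_le_mul_of_nonneg_left h6 (by positivity)).trans ?_)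
  have e : 4 / (1 / X) ^ 2 * ((C₁ + μ) * (Real.pi * (1 / X) ^ 2) +
      C₁ * ((1 / X) ^ 2 / 2 * (12 * Real.pi * (C₂ / R) * (C₃ * X) +
        2 * Real.pi * (1 / X) * (C₂ * X ^ 2 / R)))) = 4 * (Real.pi * (C₁ + μ)) +
      4 * (C₁ / 2 * (12 * Real.pi * C₂ * C₃ + 2 * Real.pi * C₂)) * (X / R) := by
    field_simp
  rw [e]
  have h7 : 0 ≤ X / R := by positivity
  have h8 : C₁ + μ ≤ (C₁ + 1) * (1 + μ + X / R) := by nlinarith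
  have h9 : 4 * (Real.pi * (C₁ + μ)) ≤ 4 * (Real.pi * ((C₁ + 1) * (1 + μ + X / R))) := by gcongr
  have h10 : 4 * (C₁ / 2 * (12 * Real.pi * C₂ * C₃ + 2 * Real.pi * C₂)) * (X / R) ≤
      4 * (C₁ / 2 * (12 * Real.pi * C₂ * C₃ + 2 * Real.pi * C₂)) * (1 + μ + X / R) := by
    gcongr; linarith
  linarith

lemma log_le_div_add {x K : ℝ} (hx : 0 < x) (hK : 0 < K) : Real.log x ≤ x / K + Real.log K - 1 := by
  have := Real.log_le_sub_one_of_pos (by positivity : 0 < x / K)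
  rw [Real.log_div hx.ne' hK.ne'] at this
  linarith

lemma aprioriScale_le (N : ℕ) (B : ℝ) : ∃ C > 0, ∃ R₀ : ℝ, ∀ {R μ : ℝ} {v κ : ℂ → ℝ}
    (_ : BubbleData N B R μ v κ), R₀ ≤ R → aprioriScale v R ≤ C * Real.log R := by
  obtain ⟨C, hC, h⟩ := neg_discMean_scale_le N B
  refine ⟨2 * (3 + C * (1 + |B|) + 2 * B ^ 2 + B ^ 2 * |Real.log (4 * B ^ 2)|), by positivity, 4 * C,
    fun {R μ v κ} D hR₀ => ?_⟩
  have hR := D.le_R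
  have hB := D.pos
  have hB1 := D.one_le
  have hR0 : 0 < R := by linarith
  have hX := D.log_le_scale
  have hl := D.one_le_log
  have hμ := D.mu_le
  have hμ0 := D.mu_nonneg
  have h1 := h D
  have h2 : aprioriScale v R = 2 + Real.log R + max (-discMean v 1 (15 * R / 16)) 0 := rfl
  set X := aprioriScale v R
  have hX3 : 3 ≤ X := by linarith
  have hX0 : 0 < X := by linarith
  have hsub : ball (1 : ℂ) (15 * R / 16) ⊆ ball 0 R := ball_subset_ball' (by simp; linarith)
  have hl1 : 1 / X ≤ 1 / 3 := by gcongr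
  have h3 := discMean_sub_discMean_le D.contDiff (c := 1) (l := 1 / X) (r := 15 * R / 16)
    (by positivity) (by linarith) (fun z hz => D.lap_nonneg (hsub hz))
    (D.setIntegral_neg_lap_le measurableSet_ball hsub)
  have h4 : Real.log (15 * R / 16 / (1 / X)) ≤ Real.log R + Real.log X := by
    rw [← Real.log_mul hR0.ne' hX0.ne']
    refine Real.log_le_log (by positivity) ?_
    rw [div_div_eq_mul_div, div_one]
    gcongr
    linarith
  have h5 := log_le_div_add hX0 (by positivity : 0 < 4 * B ^ 2)
  have h6 : B ^ 2 * Real.log X ≤ X / 4 + B ^ 2 * |Real.log (4 * B ^ 2)| := by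
    have : B ^ 2 * Real.log X ≤ B ^ 2 * (X / (4 * B ^ 2) + |Real.log (4 * B ^ 2)|) := by
      gcongr
      linarith [le_abs_self (Real.log (4 * B ^ 2))]
    refine this.trans (le_of_eq ?_)
    field_simp
  have h7 : C * (X / R) ≤ X / 4 := by
    rw [← mul_div_assoc, div_le_div_iff₀ hR0 (by norm_num)]
    nlinarith
  have h8 : (Real.log (15 * R / 16 / (1 / X)) + 3 / 4) * B ^ 2 ≤
      (Real.log R + Real.log X + 3 / 4) * B ^ 2 := by gcongr
  have h9 : C * μ ≤ C * (B * Real.log R) := by gcongr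
  have hlX : 0 ≤ Real.log X := Real.log_nonneg (by linarith)
  have h10 : max (-discMean v 1 (15 * R / 16)) 0 ≤ C * (1 + B * Real.log R) + X / 4 +
      ((Real.log R + 3 / 4) * B ^ 2 + (X / 4 + B ^ 2 * |Real.log (4 * B ^ 2)|)) := by
    refine max_le ?_ (by positivity)
    nlinarith
  rw [abs_of_pos hB]
  have h11 : X / 2 ≤ 2 + Real.log R + C * (1 + B * Real.log R) +
      ((Real.log R + 3 / 4) * B ^ 2 + B ^ 2 * |Real.log (4 * B ^ 2)|) := by linarith
  have a1 : 0 ≤ C * (Real.log R - 1) := mul_nonneg hC.le (by linarith)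
  have a2 : 0 ≤ B ^ 2 * (Real.log R - 1) := mul_nonneg (by positivity) (by linarith)
  have a3 : 0 ≤ B ^ 2 * |Real.log (4 * B ^ 2)| * (Real.log R - 1) :=
    mul_nonneg (by positivity) (by linarith)
  nlinarith

lemma logPot_le_of_apriori (N : ℕ) (B : ℝ) : ∃ C > 0, ∀ {R μ : ℝ} {v κ : ℂ → ℝ}
    (_ : BubbleData N B R μ v κ) (y : ℂ), ‖y‖ ≤ 2 →
    logPot N v y ≤ ENNReal.ofReal (C * (max (v y) 0 + aprioriScale v R)) := by
  have hI := bubbleMass_pos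
  obtain ⟨C, hC, h⟩ := negMass_le N B
  refine ⟨(|B| + 1) * (2 * bubbleMass + 9 * C + 3), by positivity, fun {R μ v κ} D y hy => ?_⟩
  have hR := D.le_R
  have hB := D.pos
  have hR0 : 0 < R := by linarith
  have hX := D.log_le_scale
  have hl := D.one_le_log
  have hsub : ball y (11 * R / 16) ⊆ ball 0 (7 * R / 8) := ball_subset_ball' (by simp; linarith)
  have h1 := D.logPot_le hy (by linarith : 3 ≤ 11 * R / 16)
    (hsub.trans (ball_subset_ball (by linarith)))
  have h2 := neg_discMean_le D.contDiff.continuous (by positivity : 0 < 11 * R / 16) hsub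
  have h3 := h D
  set X := aprioriScale v R
  have h4 : 4 / (11 * R / 16) ^ 2 * negMass v R ≤ 9 * C * X := by
    have hX0 : 0 < X := by linarith
    calc _ ≤ 4 / (11 * R / 16) ^ 2 * (C * R ^ 2 * X) := by gcongr
      _ = 1024 / 121 * (C * X) := by field_simp; ring
      _ ≤ 9 * (C * X) := by gcongr; norm_num
      _ = _ := by ring
  refine h1.trans ?_
  have hX0 : 0 ≤ X := by linarith
  rw [abs_of_pos hB, ← ENNReal.ofReal_mul hB.le]
  rcases le_total (2 * bubbleMass * v y - discMean v y (11 * R / 16)) 0 with h0 | h0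
  · rw [ENNReal.ofReal_of_nonpos (mul_nonpos_of_nonneg_of_nonpos hB.le h0), zero_add]
    refine ENNReal.ofReal_le_ofReal ?_
    have : 3 ≤ (2 * bubbleMass + 9 * C + 3) * (max (v y) 0 + X) := by
      nlinarith [le_max_right (v y) 0]
    nlinarith
  · rw [← ENNReal.ofReal_add (by positivity) (by positivity)]
    refine ENNReal.ofReal_le_ofReal ?_
    have h5 : 2 * bubbleMass * v y - discMean v y (11 * R / 16) + 3 ≤
        (2 * bubbleMass + 9 * C + 3) * (max (v y) 0 + X) := by
      have : 2 * bubbleMass * v y ≤ 2 * bubbleMass * max (v y) 0 := by gcongr; exact le_max_left _ _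
      nlinarith [le_max_right (v y) 0]
    have h6 : 0 ≤ (2 * bubbleMass + 9 * C + 3) * (max (v y) 0 + X) := by
      have := le_max_right (v y) 0
      positivity
    nlinarith

lemma exists_mem_ball_three_le {c : ℂ} {r : ℝ} (hr : 0 < r) {f₁ f₂ f₃ : ℂ → ENNReal} {m₁ m₂ m₃ : ℝ}
    (hf₁ : Measurable f₁) (hf₂ : Measurable f₂) (hf₃ : Measurable f₃)
    (hm₁ : 0 < m₁) (hm₂ : 0 < m₂) (hm₃ : 0 < m₃)
    (h₁ : ∫⁻ z in ball c r, f₁ z ≤ ENNReal.ofReal m₁) (h₂ : ∫⁻ z in ball c r, f₂ z ≤ ENNReal.ofReal m₂)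
    (h₃ : ∫⁻ z in ball c r, f₃ z ≤ ENNReal.ofReal m₃) :
    ∃ z ∈ ball c r, f₁ z ≤ ENNReal.ofReal (3 * m₁ / (Real.pi * r ^ 2)) ∧
      f₂ z ≤ ENNReal.ofReal (3 * m₂ / (Real.pi * r ^ 2)) ∧
      f₃ z ≤ ENNReal.ofReal (3 * m₃ / (Real.pi * r ^ 2)) := by
  have hV := volume_ball_eq c hr.le
  have hV0 : 0 < Real.pi * r ^ 2 := by positivity
  have hn : ∀ {f : ℂ → ENNReal} {m : ℝ}, 0 < m → ∫⁻ z in ball c r, f z ≤ ENNReal.ofReal m →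
      ENNReal.ofReal m⁻¹ * ∫⁻ z in ball c r, f z ≤ 1 := fun hm h => by
    refine (mul_le_mul_right h _).trans ?_
    rw [← ENNReal.ofReal_mul (by positivity), inv_mul_cancel₀ hm.ne', ENNReal.ofReal_one]
  obtain ⟨z, hz, hle⟩ := exists_le_setLAverage (μ := volume) (s := ball c r)
    (f := fun z => ENNReal.ofReal m₁⁻¹ * f₁ z + ENNReal.ofReal m₂⁻¹ * f₂ z + ENNReal.ofReal m₃⁻¹ * f₃ z)
    (by rw [hV]; simpa using hV0) (by rw [hV]; exact ENNReal.ofReal_ne_top) (by fun_prop)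
  have hav : (⨍⁻ z in ball c r, (ENNReal.ofReal m₁⁻¹ * f₁ z + ENNReal.ofReal m₂⁻¹ * f₂ z +
      ENNReal.ofReal m₃⁻¹ * f₃ z) ∂volume) ≤ ENNReal.ofReal (3 / (Real.pi * r ^ 2)) := by
    rw [setLAverage_eq, hV, ENNReal.ofReal_div_of_pos hV0]
    gcongr
    rw [lintegral_add_left (by fun_prop), lintegral_add_left (by fun_prop),
        lintegral_const_mul _ hf₁, lintegral_const_mul _ hf₂, lintegral_const_mul _ hf₃]
    refine (add_le_add (add_le_add (hn hm₁ h₁) (hn hm₂ h₂)) (hn hm₃ h₃)).trans ?_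
    norm_num
  have hex : ∀ {x : ENNReal} {m : ℝ}, 0 < m → ENNReal.ofReal m⁻¹ * x ≤
      ENNReal.ofReal (3 / (Real.pi * r ^ 2)) → x ≤ ENNReal.ofReal (3 * m / (Real.pi * r ^ 2)) :=
    fun {x m} hm h => by
      calc x = ENNReal.ofReal m * (ENNReal.ofReal m⁻¹ * x) := by
            rw [← mul_assoc, ← ENNReal.ofReal_mul hm.le, mul_inv_cancel₀ hm.ne', ENNReal.ofReal_one, one_mul]
        _ ≤ ENNReal.ofReal m * ENNReal.ofReal (3 / (Real.pi * r ^ 2)) := by gcongr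
        _ = _ := by rw [← ENNReal.ofReal_mul hm.le]; congr 1; ring
  have hle' := hle.trans hav
  exact ⟨z, hz, hex hm₁ ((le_self_add.trans le_self_add).trans hle'),
    hex hm₂ ((le_add_self.trans le_self_add).trans hle'), hex hm₃ (le_add_self.trans hle')⟩

/-- Upper bound for the size of the rescaled bubble state. -/
def bubConst (N : ℕ) (B : ℝ) : ℝ := 1 + 2 * B * ((N + 1) * 2 ^ N) ^ 2

lemma norm_stateDiff_leg_le {N : ℕ} {B R μ : ℝ} {v κ : ℂ → ℝ} (D : BubbleData N B R μ v κ) {s : ℝ}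
    (hs : ∀ z ∈ ball (1 : ℂ) (4 / 5), ‖dz (fun y => (κ y : ℂ)) z‖ ≤ s)
    {c ω : ℂ} (hseg : ∀ t ∈ Icc (0 : ℝ) 1, c + t * ω ∈ ball (1 : ℂ) (4 / 5)) (hω : ‖ω‖ ≤ 1)
    {q : ℝ → ℝ} (hq : Continuous q) (hq0 : ∀ t, 0 ≤ q t)
    (hqb : ∀ t ∈ Icc (0 : ℝ) 1, Real.exp (-μ) + ‖(c + t * ω) - 1‖ ≤ q t) {I J : ℝ}
    (hI : ∫ t in (0 : ℝ)..1, ‖ω‖ * ‖quadDiff N v (c + t * ω)‖ ≤ I)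
    (hJ : ∫ t in (0 : ℝ)..1, ‖ω‖ * (‖quadDiff N v (c + t * ω)‖ * q t) ≤ J) :
    ‖stateDiff N v κ μ 1 (c + ω)‖ ≤ (‖stateDiff N v κ μ 1 c‖ + Real.exp (μ / 2) *
      (5 ^ (N + 1) * bubConst N B * J + 2 * s * B ^ 2)) *
      Real.exp (2 ^ (N + 1) + 5 ^ (N + 1) * I + 2 * s * B) := by
  have hB := D.pos
  have hc := D.coeff_pos
  have hcB := D.coeff_le
  have hs0 : 0 ≤ s := (norm_nonneg _).trans (hs 1 (by simp))
  have hK : 0 ≤ bubConst N B := by unfold bubConst; positivity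
  have h1 := norm_stateDiff_le D (a := 1) hs zero_le_one hseg
    (P := B * Real.exp (μ / 2)) (by gcongr; exact D.weight_le 1 D.one_mem)
    (F := fun t => bubConst N B * Real.exp (μ / 2) * q t) (by fun_prop)
    (fun t => by have := hq0 t; positivity) (fun t ht => by
      have h2 := mem_ball_one_norm (hseg t ht)
      refine (norm_expHalf_add_norm_wDeriv_bub_le hc h2.1 h2.2.2.2).trans ?_
      unfold bubConst
      have := hqb t ht
      gcongr)
  have hG : Continuous fun t : ℝ => ‖quadDiff N v (c + t * ω)‖ :=
    ((continuous_quadDiff N D.contDiff).comp (by fun_prop)).norm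
  refine h1.trans ?_
  have e1 : ∫ t in (0 : ℝ)..1, (1 : ℝ) * (‖ω‖ * (5 ^ (N + 1) * ‖quadDiff N v (c + t * ω)‖ *
      (bubConst N B * Real.exp (μ / 2) * q t) + 2 * s * B * (B * Real.exp (μ / 2)))) =
      5 ^ (N + 1) * bubConst N B * Real.exp (μ / 2) *
        (∫ t in (0 : ℝ)..1, ‖ω‖ * (‖quadDiff N v (c + t * ω)‖ * q t)) +
        ‖ω‖ * (2 * s * B * (B * Real.exp (μ / 2))) := by
    rw [← intervalIntegral.integral_const_mul]
    have e : ∀ t : ℝ, (1 : ℝ) * (‖ω‖ * (5 ^ (N + 1) * ‖quadDiff N v (c + t * ω)‖ *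
      (bubConst N B * Real.exp (μ / 2) * q t) + 2 * s * B * (B * Real.exp (μ / 2)))) =
      5 ^ (N + 1) * bubConst N B * Real.exp (μ / 2) * (‖ω‖ * (‖quadDiff N v (c + t * ω)‖ * q t)) +
        ‖ω‖ * (2 * s * B * (B * Real.exp (μ / 2))) := fun t => by ring
    simp_rw [e]
    rw [intervalIntegral.integral_add ((by fun_prop : Continuous fun t : ℝ =>
      5 ^ (N + 1) * bubConst N B * Real.exp (μ / 2) *
        (‖ω‖ * (‖quadDiff N v (c + t * ω)‖ * q t))).intervalIntegrable _ _) (by simp)]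
    simp
  have e2 : ∫ t in (0 : ℝ)..1, ‖ω‖ * (2 ^ (N + 1) + 5 ^ (N + 1) * ‖quadDiff N v (c + t * ω)‖ +
      2 * s * B) = 5 ^ (N + 1) * (∫ t in (0 : ℝ)..1, ‖ω‖ * ‖quadDiff N v (c + t * ω)‖) +
        ‖ω‖ * (2 ^ (N + 1) + 2 * s * B) := by
    rw [← intervalIntegral.integral_const_mul]
    have e : ∀ t : ℝ, ‖ω‖ * (2 ^ (N + 1) + 5 ^ (N + 1) * ‖quadDiff N v (c + t * ω)‖ +
      2 * s * B) = 5 ^ (N + 1) * (‖ω‖ * ‖quadDiff N v (c + t * ω)‖) +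
        ‖ω‖ * (2 ^ (N + 1) + 2 * s * B) := fun t => by ring
    simp_rw [e]
    rw [intervalIntegral.integral_add ((by fun_prop : Continuous fun t : ℝ =>
      5 ^ (N + 1) * (‖ω‖ * ‖quadDiff N v (c + t * ω)‖)).intervalIntegrable _ _) (by simp)]
    simp
  rw [e1, e2]
  have f1 : ‖ω‖ * (2 * s * B * (B * Real.exp (μ / 2))) ≤ 1 * (2 * s * B * (B * Real.exp (μ / 2))) := by
    gcongr
  have f2 : ‖ω‖ * (2 ^ (N + 1) + 2 * s * B) ≤ 1 * (2 ^ (N + 1) + 2 * s * B) := by gcongr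
  have f3 := mul_le_mul_of_nonneg_left hI (by positivity : (0 : ℝ) ≤ 5 ^ (N + 1))
  have f4 := mul_le_mul_of_nonneg_left hJ
    (by positivity : (0 : ℝ) ≤ 5 ^ (N + 1) * bubConst N B * Real.exp (μ / 2))
  have hJ0 : 0 ≤ J := le_trans (intervalIntegral.integral_nonneg zero_le_one fun t _ => by
    have := hq0 t; positivity) hJ
  refine mul_le_mul ?_ (Real.exp_le_exp.2 (by linarith)) (Real.exp_pos _).le (by positivity)
  refine add_le_add le_rfl ?_
  linarith

lemma stateDiff_one_one {N : ℕ} {B R μ : ℝ} {v κ : ℂ → ℝ} (D : BubbleData N B R μ v κ) :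
    stateDiff N v κ μ 1 1 = 0 := by
  have hw : wDeriv N v 1 = 0 := by simp [wDeriv, D.dz_one]
  have hw' : wDeriv N (bub N (κ 1 / (8 * (N + 1) ^ 2)) μ) 1 = 0 := by
    rw [wDeriv_bub D.coeff_pos one_ne_zero]; simp
  simp [stateDiff, wDeriv₂, hw, hw', expHalf, D.apply_one, bub_one]

lemma intervalIntegral_le_of_lintegral_le {f : ℝ → ℝ} (hf : Continuous f) (h0 : ∀ t, 0 ≤ f t) {m : ℝ}
    (hm : 0 ≤ m) (h : ∫⁻ t in Ioc (0 : ℝ) 1, ENNReal.ofReal (f t) ≤ ENNReal.ofReal m) :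
    ∫ t in (0 : ℝ)..1, f t ≤ m := by
  rw [← ofReal_intervalIntegral hf h0] at h
  exact (ENNReal.ofReal_le_ofReal_iff hm).1 h

lemma abs_log_le_of_abs_sub_one_le {x e : ℝ} (h : |x - 1| ≤ e) (he : e ≤ 1 / 2) : |Real.log x| ≤ 2 * e := by
  rw [abs_le] at h
  have hx : 0 < x := by linarith
  have h1 := Real.log_le_sub_one_of_pos hx
  have h2 := Real.one_sub_inv_le_log_of_pos hx
  have h3 : x⁻¹ ≤ 1 + 2 * e := by
    rw [inv_le_iff_one_le_mul₀ hx]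
    nlinarith
  rw [abs_le]
  constructor <;> linarith

lemma dz_eq_of_wDeriv {N : ℕ} {v : ℂ → ℝ} {y : ℂ} (hy : y ≠ 0) :
    dz (fun z => (v z : ℂ)) y = -2 * y ^ N * wDeriv N v y / expHalf v y := by
  have := expHalf_ne v y
  have hyN : y ^ N ≠ 0 := pow_ne_zero _ hy
  unfold wDeriv
  field_simp

lemma abs_sub_bub_le_of_norm_stateDiff_le {N : ℕ} {B a : ℝ} (ha : 0 < a) {R μ : ℝ} {v κ : ℂ → ℝ}
    (D : BubbleData N B R μ v κ) {y : ℂ} (hy0 : y ≠ 0) (hy2 : ‖y‖ ≤ 2) (hya : a ≤ ‖y ^ (N + 1) - 1‖)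
    {E L : ℝ} (hL : 8 * (N + 1) ^ 2 * B / a ^ 2 = L)
    (h : ‖stateDiff N v κ μ 1 y‖ ≤ E * Real.exp (μ / 2)) (hE : E * L ≤ 1 / 2) :
    |v y - bub N (κ 1 / (8 * (N + 1) ^ 2)) μ y| ≤ 4 * L * E ∧
    ‖dz (fun z => (v z : ℂ)) y - dz (fun z => (bub N (κ 1 / (8 * (N + 1) ^ 2)) μ z : ℂ)) y‖ ≤
      2 ^ (N + 1) * (2 * L + 2 * B * (N + 1) * (2 ^ (N + 1) + 1) * L ^ 2) * E := by
  have hB := D.pos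
  have hc := D.coeff_pos
  have hcB := D.coeff_le
  have hcL := D.le_coeff
  set c := κ 1 / (8 * (N + 1) ^ 2) with hcdef
  have hL0 : 0 < L := by rw [← hL]; positivity
  have hE0 : 0 ≤ E := nonneg_of_mul_nonneg_left ((norm_nonneg _).trans h) (Real.exp_pos _)
  set M := Real.exp (μ / 2) with hM
  have hM0 : 0 < M := Real.exp_pos _
  set f := Real.exp (-v y / 2) with hf
  set F := Real.exp (-μ / 2) * bubDen N c μ y with hFdef
  have hfe : expHalf v y = (f : ℂ) := rfl
  have hFe : expHalf (bub N c μ) y = (F : ℂ) := expHalf_bub hc y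
  have hf0 : 0 < f := Real.exp_pos _
  have hFM : M ≤ L * F := by
    have e1 : c * a ^ 2 * M ≤ F := by
      rw [hFdef, bubDen, hM, ← exp_half_mul_exp_neg_half μ]
      have : c * Real.exp μ * a ^ 2 ≤ c * Real.exp μ * ‖y ^ (N + 1) - 1‖ ^ 2 := by gcongr
      have h2 := Real.exp_pos (-μ / 2)
      nlinarith
    have e2 : 1 ≤ L * (c * a ^ 2) := by
      calc (1 : ℝ) = L * ((8 * (N + 1) ^ 2 * B)⁻¹ * a ^ 2) := by rw [← hL]; field_simp
        _ ≤ _ := by gcongr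
    nlinarith
  have hF0 : 0 < F := by
    have := hM0.trans_le hFM
    exact pos_of_mul_pos_right this hL0.le
  have h1 : |f - F| ≤ E * M := by
    have := (norm_fst_le (stateDiff N v κ μ 1 y)).trans h
    simp only [stateDiff, Complex.ofReal_one, one_mul] at this
    rw [← hcdef, hfe, hFe, ← Complex.ofReal_sub, Complex.norm_real] at this
    exact this
  have h2 : ‖wDeriv N v y - wDeriv N (bub N c μ) y‖ ≤ E * M := by
    have := ((norm_fst_le _).trans (norm_snd_le (stateDiff N v κ μ 1 y))).trans h
    simpa only [stateDiff, Complex.ofReal_one, one_mul] using this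
  have h3 : |f / F - 1| ≤ E * L := by
    rw [div_sub_one hF0.ne', abs_div, abs_of_pos hF0, div_le_iff₀ hF0]
    nlinarith
  have hfF : F ≤ 2 * f := by
    have := (abs_le.1 (h3.trans hE)).1
    have h4 : 1 / 2 ≤ f / F := by linarith
    rw [le_div_iff₀ hF0] at h4
    linarith
  constructor
  · have h4 := abs_log_le_of_abs_sub_one_le h3 hE
    have h5 : v y - bub N c μ y = -2 * Real.log (f / F) := by
      rw [Real.log_div hf0.ne' hF0.ne', hf, Real.log_exp, hFdef, Real.log_mul (Real.exp_pos _).ne'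
        (bubDen_pos hc y).ne', Real.log_exp, bub]
      ring
    rw [h5, abs_mul, abs_neg, abs_two]
    linarith
  · rw [dz_eq_of_wDeriv (N := N) hy0, dz_eq_of_wDeriv (N := N) hy0, hfe, hFe]
    set b := wDeriv N v y
    set b₀ := wDeriv N (bub N c μ) y with hb₀
    have hf1 : (f : ℂ) ≠ 0 := by exact_mod_cast hf0.ne'
    have hF1 : (F : ℂ) ≠ 0 := by exact_mod_cast hF0.ne'
    have e : -2 * y ^ N * b / f - -2 * y ^ N * b₀ / F =
        -2 * y ^ N * ((b - b₀) / f - b₀ * ((f - F : ℝ) : ℂ) / (f * F)) := by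
      push_cast
      field_simp
      ring
    have hb₀n : ‖b₀‖ ≤ B * (N + 1) * (2 ^ (N + 1) + 1) * M := by
      rw [hb₀, wDeriv_bub hc hy0, norm_mul, Complex.norm_real, RCLike.norm_conj, Real.norm_eq_abs,
        abs_of_pos (by positivity)]
      have h5 : ‖y ^ (N + 1) - 1‖ ≤ 2 ^ (N + 1) + 1 := by
        refine (norm_sub_le _ _).trans ?_
        rw [norm_pow, norm_one]
        gcongr
      calc _ ≤ B * (N + 1) * M * (2 ^ (N + 1) + 1) := by gcongr
        _ = _ := by ring
    have hMf : M / f ≤ 2 * L := by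
      rw [div_le_iff₀ hf0]
      nlinarith
    have hMF : M / F ≤ L := by
      rwa [div_le_iff₀ hF0]
    rw [e, norm_mul, norm_mul, norm_neg, norm_pow]
    have h6 : ‖(b - b₀) / f‖ ≤ 2 * L * E := by
      rw [norm_div, Complex.norm_real, Real.norm_eq_abs, abs_of_pos hf0]
      calc _ ≤ E * M / f := by gcongr
        _ = (M / f) * E := by ring
        _ ≤ _ := by gcongr
    have h7 : ‖b₀ * ((f - F : ℝ) : ℂ) / (f * F)‖ ≤ 2 * B * (N + 1) * (2 ^ (N + 1) + 1) * L ^ 2 * E := by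
      rw [norm_div, norm_mul, norm_mul, Complex.norm_real, Complex.norm_real, Complex.norm_real,
        Real.norm_eq_abs, Real.norm_eq_abs, Real.norm_eq_abs, abs_of_pos hf0, abs_of_pos hF0]
      calc _ ≤ (B * (N + 1) * (2 ^ (N + 1) + 1) * M) * (E * M) / (f * F) := by gcongr
        _ = B * (N + 1) * (2 ^ (N + 1) + 1) * ((M / f) * (M / F)) * E := by field_simp
        _ ≤ B * (N + 1) * (2 ^ (N + 1) + 1) * ((2 * L) * L) * E := by gcongr
        _ = _ := by ring
    calc _ ≤ ‖(2 : ℂ)‖ * 2 ^ N * (2 * L * E + 2 * B * (N + 1) * (2 ^ (N + 1) + 1) * L ^ 2 * E) := by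
          gcongr
          exact (norm_sub_le _ _).trans (add_le_add h6 h7)
      _ = _ := by rw [Complex.norm_two]; ring

lemma ofReal_mul_norm_mul {E : Type*} [NormedAddCommGroup E] {F : Type*} [NormedAddCommGroup F] (x : E) (y : F) (q : ℝ) :
    ENNReal.ofReal (‖x‖ * (‖y‖ * q)) = ‖x‖ₑ * (‖y‖ₑ * ENNReal.ofReal q) := by
  rw [ENNReal.ofReal_mul (norm_nonneg _), ENNReal.ofReal_mul (norm_nonneg _), ofReal_norm, ofReal_norm]

lemma measurable_ray {N : ℕ} {v : ℂ → ℝ} (hv : ContDiff ℝ 2 v) (c : ℂ) {q : ℝ × ℂ → ℝ} (hq : Continuous q) :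
    Measurable fun z : ℂ => ∫⁻ t in Ioc (0 : ℝ) 1,
      ‖z - c‖ₑ * (‖quadDiff N v (c + t * (z - c))‖ₑ * ENNReal.ofReal (q (t, z - c))) := by
  have hG := continuous_quadDiff N hv
  have : Measurable fun p : ℂ × ℝ => ‖p.1 - c‖ₑ * (‖quadDiff N v (c + p.2 * (p.1 - c))‖ₑ *
      ENNReal.ofReal (q (p.2, p.1 - c))) := by
    have h1 : Measurable fun p : ℂ × ℝ => ‖p.1 - c‖ₑ :=
      (continuous_fst.sub continuous_const).enorm.measurable
    have h2 : Measurable fun p : ℂ × ℝ => ‖quadDiff N v (c + p.2 * (p.1 - c))‖ₑ :=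
      (hG.comp (by fun_prop)).enorm.measurable
    have h3 : Measurable fun p : ℂ × ℝ => ENNReal.ofReal (q (p.2, p.1 - c)) :=
      (ENNReal.continuous_ofReal.comp (hq.comp (by fun_prop))).measurable
    exact h1.mul (h2.mul h3)
  exact this.lintegral_prod_right'

lemma ofReal_mass_le {g b x m : ℝ} {p : ENNReal} (hg : 0 ≤ g) (hb : 0 ≤ b) (hx : 0 ≤ x)
    {k : ℝ} (hk : 0 ≤ k) (hk4 : k ≤ 16) {r : ℝ} (hr : 0 ≤ r) (hr1 : r ≤ 1)
    (hp : p ≤ ENNReal.ofReal x) (hm : 48 * (g * x + b) ≤ m) :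
    ENNReal.ofReal r * (ENNReal.ofReal (12 * Real.pi * g) * p + ENNReal.ofReal (k * b)) ≤
      ENNReal.ofReal m := by
  have hpi := Real.pi_le_four
  have hpi0 := Real.pi_pos
  calc _ ≤ ENNReal.ofReal r * (ENNReal.ofReal (12 * Real.pi * g) * ENNReal.ofReal x +
        ENNReal.ofReal (k * b)) := by gcongr
    _ = ENNReal.ofReal (r * (12 * Real.pi * g * x + k * b)) := by
        rw [ENNReal.ofReal_mul hr, ENNReal.ofReal_add (by positivity) (by positivity),
          ENNReal.ofReal_mul (p := 12 * Real.pi * g) (by positivity)]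
    _ ≤ _ := by
        apply ENNReal.ofReal_le_ofReal
        have h1 : r * (12 * Real.pi * g * x + k * b) ≤ 1 * (12 * 4 * g * x + 16 * b) := by gcongr
        nlinarith [mul_nonneg hg hx]

set_option maxHeartbeats 2000000 in
lemma abs_sub_bub_le_of_small (N : ℕ) {B a c₁ A : ℝ} (hB : 0 < B) (ha : 0 < a) (hc₁ : 0 < c₁) (hc₁' : c₁ ≤ 1 / 20)
    (hA : 0 ≤ A) : ∃ C > 0, ∃ η₀ > 0, ∀ {R μ : ℝ} {v κ : ℂ → ℝ}, BubbleData N B R μ v κ →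
    ∀ {g b L₁ L₂ : ℝ}, 0 < g → 0 ≤ b → 0 ≤ L₁ → 0 ≤ L₂ →
    (∀ y : ℂ, ‖y‖ ≤ 2 → ‖quadDiff N v y‖ₑ ≤ ENNReal.ofReal g * pot N v y + ENNReal.ofReal b) →
    (∀ z ∈ ball (1 : ℂ) (4 / 5), ‖dz (fun y => (κ y : ℂ)) z‖ ≤ g) →
    logPot N v 1 ≤ ENNReal.ofReal L₁ → g * L₁ + b + g ≤ A →
    ∀ y : ℂ, logPot N v y ≤ ENNReal.ofReal L₂ → ‖y - 1‖ ≤ 7 / 10 → a ≤ ‖y ^ (N + 1) - 1‖ →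
    g * (1 + Real.exp (-μ) * L₁ + L₂) + b ≤ η₀ →
    |v y - bub N (κ 1 / (8 * (N + 1) ^ 2)) μ y| ≤ C * (g * (1 + Real.exp (-μ) * L₁ + L₂) + b) ∧
    ‖dz (fun z => (v z : ℂ)) y - dz (fun z => (bub N (κ 1 / (8 * (N + 1) ^ 2)) μ z : ℂ)) y‖ ≤
      C * (g * (1 + Real.exp (-μ) * L₁ + L₂) + b) := by
  set k := 3 / (Real.pi * c₁ ^ 2) with hk
  have hpi := Real.pi_pos
  have hk0 : 0 < k := by positivity
  have hK : 0 < bubConst N B := by unfold bubConst; positivity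
  set C₁ := (5 ^ (N + 1) * bubConst N B * (k * (48 * (1 + B))) + 2 * B ^ 2) *
    Real.exp (2 ^ (N + 1) + 5 ^ (N + 1) * (k * (48 * (A + 1))) + 2 * A * B) with hC₁
  have hC₁0 : 0 < C₁ := by positivity
  set C₂ := (C₁ + (5 ^ (N + 1) * bubConst N B * (2 * (k * 48)) + 2 * B ^ 2)) *
    Real.exp (2 ^ (N + 1) + 5 ^ (N + 1) * (k * 48) + 2 * A * B) with hC₂
  have hC₂0 : 0 < C₂ := by positivity
  set L := 8 * (N + 1) ^ 2 * B / a ^ 2 with hL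
  have hL0 : 0 < L := by positivity
  refine ⟨max (4 * L * C₂) (2 ^ (N + 1) * (2 * L + 2 * B * (N + 1) * (2 ^ (N + 1) + 1) * L ^ 2) * C₂),
    lt_max_of_lt_left (by positivity), min 1 (1 / (2 * L * C₂)), by positivity, ?_⟩
  intro R μ v κ D g b L₁ L₂ hg hb hL₁ hL₂ hG hdz h1 hgA y h2 hy hya hη
  set e := Real.exp (-μ) with he
  have he0 : 0 < e := Real.exp_pos _
  have he1 : e ≤ 1 := Real.exp_le_one_iff.2 (by linarith [D.mu_nonneg])
  set η := g * (1 + e * L₁ + L₂) + b with hηdef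
  have heL : 0 ≤ e * L₁ := by positivity
  have hη1 : η ≤ 1 := hη.trans (min_le_left _ _)
  have hη2 : η ≤ 1 / (2 * L * C₂) := hη.trans (min_le_right _ _)
  have hgη : g ≤ η := by
    have : 0 ≤ g * (e * L₁ + L₂) := by positivity
    rw [hηdef]; linarith
  have hgeη : g * (e * L₁ + B) + b ≤ (1 + B) * η := by
    have : g * (e * L₁ + B) + b = η - g - g * L₂ + g * B := by rw [hηdef]; ring
    have h3 : 0 ≤ g * L₂ := by positivity
    have h4 := mul_le_mul_of_nonneg_right hgη hB.le
    linarith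
  have hη0 : 0 < η := hg.trans_le hgη
  have hv := D.contDiff
  have hyn : ‖y‖ ≤ 17 / 10 := by
    have := norm_add_le (y - 1) 1
    rw [sub_add_cancel, norm_one] at this
    linarith
  have hk16 : 2 * Real.pi * c₁ ≤ 16 := by linarith [mul_le_mul Real.pi_le_four (hc₁'.trans (by norm_num : _ ≤ (1 : ℝ))) hc₁.le zero_le_four]
  have hc16 : c₁ ^ 2 / 2 ≤ 1 := by linarith [pow_le_one₀ hc₁.le (hc₁'.trans (by norm_num : _ ≤ (1 : ℝ))) (n := 2)]
  have hgL₁ : g * L₁ + b ≤ A + 1 := by linarith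
  have hgL₂ : g * L₂ + b ≤ η := by rw [hηdef]; linarith [mul_nonneg hg.le heL]
  have hmass : ∫⁻ ζ in ball (0 : ℂ) 4, dens N v ζ ≤ ENNReal.ofReal B :=
    (lintegral_mono_set (ball_subset_ball (by linarith [D.le_R]))).trans D.mass
  have hsub : ball y c₁ ⊆ ball (1 : ℂ) (4 / 5) := by
    refine ball_subset_ball' ?_
    rw [dist_eq_norm]; linarith
  obtain ⟨y', hy', hf₁, hf₂, hf₃⟩ := exists_mem_ball_three_le (c := y) hc₁
    (measurable_ray (N := N) hv 1 (q := fun _ => 1) (by fun_prop))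
    (measurable_ray (N := N) hv 1 (q := fun p => e + ‖(p.1 * p.2 : ℂ)‖) (by fun_prop))
    (measurable_ray (N := N) hv y (q := fun _ => 1) (by fun_prop))
    (m₁ := 48 * (A + 1)) (m₂ := 48 * (1 + B) * η) (m₃ := 48 * η) (by positivity) (by positivity)
    (by positivity)
    (by
      refine (lintegral_mono_set hsub).trans ?_
      rw [lintegral_ball_add]
      simp only [add_sub_cancel_left, ENNReal.ofReal_one, mul_one]
      refine (lintegral_ray_quadDiff_le hv (by norm_num) (by norm_num) (by rw [norm_one]; norm_num)
        hg.le hb hG).trans ?_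
      exact ofReal_mass_le hg.le hb hL₁ (by positivity) (by linarith [Real.pi_le_four]) (by norm_num)
        (by norm_num) h1 (by linarith))
    (by
      refine (lintegral_mono_set hsub).trans ?_
      rw [lintegral_ball_add]
      simp only [add_sub_cancel_left]
      refine (lintegral_ray_quadDiff_weight_le hv (by norm_num) (by norm_num)
        hg.le hb he0.le he1 hmass hG).trans ?_
      refine ofReal_mass_le hg.le hb (x := e * L₁ + B) (by positivity) (by positivity)
        (by linarith [Real.pi_le_four]) (by norm_num) (by norm_num) ?_ (by linarith)
      rw [ENNReal.ofReal_add heL hB.le, ENNReal.ofReal_mul he0.le]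
      gcongr)
    (by
      rw [lintegral_ball_add]
      simp only [add_sub_cancel_left, ENNReal.ofReal_one, mul_one]
      refine (lintegral_ray_quadDiff_le hv hc₁ (by linarith) (by linarith)
        hg.le hb hG).trans ?_
      exact ofReal_mass_le hg.le hb hL₂ (by positivity) hk16
        (by positivity) hc16 h2 (by linarith))
  rw [mul_div_right_comm, ← hk] at hf₁ hf₂ hf₃
  have hGc : ∀ c ω : ℂ, Continuous fun t : ℝ => ‖quadDiff N v (c + t * ω)‖ := fun c ω =>
    ((continuous_quadDiff N hv).comp (by fun_prop)).norm
  have hreal : ∀ {c z : ℂ} {q : ℝ × ℂ → ℝ} {m : ℝ}, Continuous q → (∀ p, 0 ≤ q p) → 0 ≤ m →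
      (∫⁻ t in Ioc (0 : ℝ) 1, ‖z - c‖ₑ * (‖quadDiff N v (c + t * (z - c))‖ₑ *
        ENNReal.ofReal (q (t, z - c)))) ≤ ENNReal.ofReal m →
      ∫ t in (0 : ℝ)..1, ‖z - c‖ * (‖quadDiff N v (c + t * (z - c))‖ * q (t, z - c)) ≤ m := by
    intro c z q m hq hq0 hm h
    refine intervalIntegral_le_of_lintegral_le ?_ (fun t => ?_) hm ?_
    · have := hGc c (z - c)
      fun_prop
    · have := hq0 (t, z - c)
      positivity
    · simpa only [ofReal_mul_norm_mul] using h
  have hI₁ := hreal (q := fun _ => 1) (by fun_prop) (fun _ => zero_le_one) (by positivity) hf₁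
  have hJ₁ := hreal (q := fun p => e + ‖(p.1 * p.2 : ℂ)‖) (by fun_prop) (fun _ => by positivity)
    (by positivity) hf₂
  have hI₂ := hreal (q := fun _ => 1) (by fun_prop) (fun _ => zero_le_one) (by positivity) hf₃
  simp only [mul_one] at hI₁ hI₂
  have hy'1 : ‖y' - 1‖ < 4 / 5 := by
    have := hsub hy'
    rwa [mem_ball, dist_eq_norm] at this
  have hyy' : ‖y' - y‖ < c₁ := by rwa [mem_ball, dist_eq_norm] at hy'
  have hseg : ∀ p ∈ ball (1 : ℂ) (4 / 5), ∀ q ∈ ball (1 : ℂ) (4 / 5), ∀ t ∈ Icc (0 : ℝ) 1,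
      p + t * (q - p) ∈ ball (1 : ℂ) (4 / 5) := fun p hp q hq t ht => by
    have := (convex_ball (1 : ℂ) (4 / 5)).add_smul_sub_mem hp hq ht
    simpa using this
  have hb1 : (1 : ℂ) ∈ ball (1 : ℂ) (4 / 5) := by simp
  have hby : y ∈ ball (1 : ℂ) (4 / 5) := hsub (mem_ball_self hc₁)
  have hgAA : g ≤ A := by linarith [mul_nonneg hg.le hL₁]
  have leg₁ := norm_stateDiff_leg_le D hdz (c := 1) (ω := y' - 1) (hseg 1 hb1 y' (hsub hy'))
    (by linarith) (q := fun t => e + ‖(t * (y' - 1) : ℂ)‖) (by fun_prop) (fun t => by positivity)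
    (fun t _ => by simp [he]) hI₁ hJ₁
  rw [stateDiff_one_one D, norm_zero, zero_add, add_sub_cancel] at leg₁
  have leg₁' : ‖stateDiff N v κ μ 1 y'‖ ≤ C₁ * η * Real.exp (μ / 2) := by
    refine leg₁.trans ?_
    calc _ ≤ Real.exp (μ / 2) * (5 ^ (N + 1) * bubConst N B * (k * (48 * (1 + B) * η)) + 2 * η * B ^ 2) *
        Real.exp (2 ^ (N + 1) + 5 ^ (N + 1) * (k * (48 * (A + 1))) + 2 * A * B) := by gcongr
      _ = _ := by rw [hC₁]; ring
  have hrev : ∀ φ : ℂ → ℝ, ∫ t in (0 : ℝ)..1, φ (y' + t * (y - y')) =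
      ∫ t in (0 : ℝ)..1, φ (y + t * (y' - y)) := fun φ => by
    have := intervalIntegral.integral_comp_sub_left (a := 0) (b := 1)
      (fun t : ℝ => φ (y + t * (y' - y))) 1
    rw [sub_self, sub_zero] at this
    rw [← this]
    refine intervalIntegral.integral_congr fun t _ => ?_
    refine congrArg φ ?_
    push_cast; ring
  have hI₂' : ∫ t in (0 : ℝ)..1, ‖y - y'‖ * ‖quadDiff N v (y' + t * (y - y'))‖ ≤ k * (48 * η) := by
    rw [hrev (fun z => ‖y - y'‖ * ‖quadDiff N v z‖), norm_sub_rev]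
    exact hI₂
  have hJ₂ : ∫ t in (0 : ℝ)..1, ‖y - y'‖ * (‖quadDiff N v (y' + t * (y - y'))‖ * 2) ≤
      2 * (k * (48 * η)) := by
    have e1 : ∀ t : ℝ, ‖y - y'‖ * (‖quadDiff N v (y' + t * (y - y'))‖ * 2) =
      2 * (‖y - y'‖ * ‖quadDiff N v (y' + t * (y - y'))‖) := fun t => by ring
    simp_rw [e1]
    rw [intervalIntegral.integral_const_mul]
    linarith
  have leg₂ := norm_stateDiff_leg_le D hdz (c := y') (ω := y - y') (hseg y' (hsub hy') y hby)
    (by rw [norm_sub_rev]; linarith) (q := fun _ => 2) (by fun_prop) (fun t => by norm_num)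
    (fun t ht => by
      have := hseg y' (hsub hy') y hby t ht
      rw [mem_ball, dist_eq_norm] at this
      linarith) hI₂' hJ₂
  rw [add_sub_cancel] at leg₂
  have hfin : ‖stateDiff N v κ μ 1 y‖ ≤ C₂ * η * Real.exp (μ / 2) := by
    refine leg₂.trans ?_
    calc _ ≤ (C₁ * η * Real.exp (μ / 2) + Real.exp (μ / 2) *
          (5 ^ (N + 1) * bubConst N B * (2 * (k * (48 * η))) + 2 * η * B ^ 2)) *
        Real.exp (2 ^ (N + 1) + 5 ^ (N + 1) * (k * (48 * 1)) + 2 * A * B) := by gcongr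
      _ = _ := by rw [hC₂, mul_one 48]; ring
  have hEL : C₂ * η * L ≤ 1 / 2 := by
    rw [le_div_iff₀ (by positivity)] at hη2
    linarith
  obtain ⟨r1, r2⟩ := abs_sub_bub_le_of_norm_stateDiff_le ha D (mem_ball_one_norm hby).1
    (mem_ball_one_norm hby).2.2.1 hya hL.symm hfin hEL
  refine ⟨r1.trans ?_, r2.trans ?_⟩
  · rw [← mul_assoc]
    gcongr
    exact le_max_left _ _
  · rw [← mul_assoc]
    gcongr
    exact le_max_right _ _

lemma BubbleData.bub_le_neg {N : ℕ} {B R μ : ℝ} {v κ : ℂ → ℝ} (D : BubbleData N B R μ v κ) {a : ℝ} (ha : 0 < a)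
    {y : ℂ} (hy : a ≤ ‖y ^ (N + 1) - 1‖) :
    bub N (κ 1 / (8 * (N + 1) ^ 2)) μ y ≤ -μ + 2 * Real.log (8 * (N + 1) ^ 2 * B / a ^ 2) := by
  have hB := D.pos
  have hc := D.coeff_pos
  have hL := D.le_coeff
  rw [← Real.exp_le_exp, Real.exp_add]
  refine (exp_bub_le hc ha hy).trans ?_
  gcongr
  rw [two_mul, Real.exp_add, Real.exp_log (by positivity)]
  calc _ ≤ (((8 * (N + 1) ^ 2 * B)⁻¹) ^ 2 * a ^ 4)⁻¹ := by gcongr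
    _ = _ := by field_simp

lemma exists_mem_ball_le_of_mass (N : ℕ) {B c₁ : ℝ} (hc₁ : 0 < c₁) (hc₁' : c₁ ≤ 1 / 20) :
    ∃ V : ℝ, 0 ≤ V ∧ ∀ {R μ : ℝ} {v κ : ℂ → ℝ}, BubbleData N B R μ v κ → ∀ y : ℂ, ‖y - 1‖ ≤ 7 / 10 →
      ∃ z ∈ ball y c₁, v z ≤ V := by
  have hpi := Real.pi_pos
  refine ⟨Real.log (1 + B * 25 ^ N / (Real.pi * c₁ ^ 2)) ⊔ 0, le_max_right _ _, ?_⟩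
  intro R μ v κ D y hy
  have hB := D.pos
  have hV0 : 0 < 1 + B * 25 ^ N / (Real.pi * c₁ ^ 2) := by positivity
  by_contra! hcon
  have hsub : ball y c₁ ⊆ ball (1 : ℂ) (4 / 5) := by
    refine ball_subset_ball' ?_
    rw [dist_eq_norm]; linarith
  have hsub' : ball y c₁ ⊆ ball (0 : ℂ) R := fun z hz => by
    have := (mem_ball_one_norm (hsub hz)).2.2.1
    rw [mem_ball, dist_zero_right]
    linarith [D.le_R]
  have h1 := (lintegral_mono_set hsub').trans D.mass
  have h2 : ENNReal.ofReal ((25 ^ N)⁻¹ * (1 + B * 25 ^ N / (Real.pi * c₁ ^ 2))) * volume (ball y c₁) ≤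
      ∫⁻ z in ball y c₁, dens N v z := by
    rw [← setLIntegral_const]
    refine setLIntegral_mono' measurableSet_ball fun z hz => ?_
    rw [dens_eq]
    apply ENNReal.ofReal_le_ofReal
    have h3 := (mem_ball_one_norm (hsub hz)).2.1
    gcongr
    · calc ((25 : ℝ) ^ N)⁻¹ = (1 / 5) ^ (2 * N) := by rw [pow_mul, ← inv_pow]; norm_num
        _ ≤ _ := by gcongr
    · rw [← Real.log_le_iff_le_exp hV0]
      exact (le_max_left _ _).trans (hcon z hz).le
  have h4 := h2.trans h1
  rw [volume_ball_eq y hc₁.le, ← ENNReal.ofReal_mul (by positivity), ENNReal.ofReal_le_ofReal_iff hB.le] at h4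
  have e : (25 ^ N)⁻¹ * (1 + B * 25 ^ N / (Real.pi * c₁ ^ 2)) * (Real.pi * c₁ ^ 2) =
      (25 ^ N)⁻¹ * (Real.pi * c₁ ^ 2) + B := by
    field_simp
  rw [e] at h4
  have : 0 < ((25 : ℝ) ^ N)⁻¹ * (Real.pi * c₁ ^ 2) := by positivity
  linarith

lemma eventually_log_sq_div_le {e : ℝ} (he : 0 < e) : ∃ R₀ : ℝ, 1 ≤ R₀ ∧ ∀ R, R₀ ≤ R → Real.log R ^ 2 / R ≤ e := by
  have h : Tendsto (fun x : ℝ => Real.log x ^ 2 / x) atTop (nhds 0) :=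
    (Real.isLittleO_pow_log_id_atTop (n := 2)).tendsto_div_nhds_zero
  obtain ⟨R₀, h0⟩ := eventually_atTop.1 (h.eventually_le_const he)
  exact ⟨max R₀ 1, le_max_right _ _, fun R hR => h0 R ((le_max_left _ _).trans hR)⟩

lemma abs_sub_bub_le_log (N : ℕ) {B a c₁ : ℝ} (hB : 0 < B) (ha : 0 < a) (hc₁ : 0 < c₁) (hc₁' : c₁ ≤ 1 / 50) :
    ∃ C > 0, ∃ R₀ μ₀ : ℝ, ∀ {R μ : ℝ} {v κ : ℂ → ℝ}, BubbleData N B R μ v κ → R₀ ≤ R → μ₀ ≤ μ →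
    ∀ y : ℂ, ‖y - 1‖ ≤ 17 / 25 → (∀ z ∈ ball y c₁, a ≤ ‖z ^ (N + 1) - 1‖) →
    |v y - bub N (κ 1 / (8 * (N + 1) ^ 2)) μ y| ≤ C * (Real.log R ^ 2 / R) ∧
    ‖dz (fun z => (v z : ℂ)) y - dz (fun z => (bub N (κ 1 / (8 * (N + 1) ^ 2)) μ z : ℂ)) y‖ ≤
      C * (Real.log R ^ 2 / R) := by
  obtain ⟨C₁, hC₁, η₀, hη₀, core⟩ := abs_sub_bub_le_of_small N hB ha hc₁ (by linarith) zero_le_one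
  obtain ⟨V, hV, hmass⟩ := exists_mem_ball_le_of_mass N (B := B) hc₁ (by linarith)
  obtain ⟨C₂, hC₂, hG⟩ := enorm_quadDiff_le_scale N B
  obtain ⟨C₃, hC₃, R₁, hX⟩ := aprioriScale_le N B
  obtain ⟨C₄, hC₄, hpot⟩ := logPot_le_of_apriori N B
  obtain ⟨C₅, hC₅, hpot1⟩ := logPot_one_le N B
  set g' := C₂ + B with hg'
  have hg'0 : 0 < g' := by positivity
  set K := g' * (1 + (C₅ * C₃ + C₄ * (V + C₃))) + C₂ * C₃ ^ 2 with hK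
  have hK0 : 0 < K := by positivity
  obtain ⟨R₂, hR₂1, hR₂⟩ := eventually_log_sq_div_le (e := min 1 η₀ / K) (by positivity)
  refine ⟨C₁ * K, by positivity, max R₁ R₂, C₁ * η₀ + 2 * Real.log (8 * (N + 1) ^ 2 * B / a ^ 2) + 1, ?_⟩
  intro R μ v κ D hR hμ y hy hya
  have hX' := hX D ((le_max_left _ _).trans hR)
  have hX0 := D.log_le_scale
  have hl := D.one_le_log
  have hsm := hR₂ R ((le_max_right _ _).trans hR)
  have hR0 : 0 < R := by linarith [D.le_R]
  set Λ := Real.log R with hΛ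
  set X := aprioriScale v R with hXd
  have hX00 : 0 ≤ X := by linarith
  have hΛΛ : Λ ≤ Λ ^ 2 := by nlinarith
  have h1ΛΛ : 1 ≤ Λ ^ 2 := by nlinarith
  have hKsm : K * (Λ ^ 2 / R) ≤ min 1 η₀ := by
    rw [le_div_iff₀ hK0] at hsm; linarith
  have hb : C₂ * X ^ 2 / R ≤ C₂ * C₃ ^ 2 * (Λ ^ 2 / R) := by
    calc _ ≤ C₂ * (C₃ * Λ) ^ 2 / R := by gcongr
      _ = _ := by ring
  -- the core estimate at points where `v` is bounded
  have main : ∀ z : ℂ, ‖z - 1‖ ≤ 7 / 10 → a ≤ ‖z ^ (N + 1) - 1‖ → v z ≤ V →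
      |v z - bub N (κ 1 / (8 * (N + 1) ^ 2)) μ z| ≤ C₁ * (K * (Λ ^ 2 / R)) ∧
      ‖dz (fun z => (v z : ℂ)) z - dz (fun z => (bub N (κ 1 / (8 * (N + 1) ^ 2)) μ z : ℂ)) z‖ ≤
      C₁ * (K * (Λ ^ 2 / R)) := by
    intro z hz hza hzV
    have he1 : Real.exp (-μ) ≤ 1 := Real.exp_le_one_iff.2 (by linarith [D.mu_nonneg])
    have hz2 : ‖z‖ ≤ 2 := by
      have := norm_add_le (z - 1) 1
      rw [sub_add_cancel, norm_one] at this
      linarith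
    have hm : max (v z) 0 ≤ V := max_le hzV hV
    have hηle : g' / R * (1 + Real.exp (-μ) * (C₅ * X) + C₄ * (max (v z) 0 + X)) + C₂ * X ^ 2 / R ≤
        K * (Λ ^ 2 / R) := by
      calc _ ≤ g' / R * (Λ ^ 2 + 1 * (C₅ * (C₃ * Λ ^ 2)) + C₄ * (V * Λ ^ 2 + C₃ * Λ ^ 2)) +
            C₂ * C₃ ^ 2 * (Λ ^ 2 / R) := by
            have : X ≤ C₃ * Λ ^ 2 := hX'.trans (by gcongr)
            have : V ≤ V * Λ ^ 2 := le_mul_of_one_le_right hV h1ΛΛ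
            gcongr
            linarith
        _ = _ := by rw [hK]; ring
    have hAle : g' / R * (C₅ * X) + C₂ * X ^ 2 / R + g' / R ≤ 1 := by
      calc _ ≤ g' / R * (C₅ * (C₃ * Λ ^ 2)) + C₂ * C₃ ^ 2 * (Λ ^ 2 / R) + g' / R * Λ ^ 2 := by
            have : X ≤ C₃ * Λ ^ 2 := hX'.trans (by gcongr)
            gcongr
            exact le_mul_of_one_le_right (by positivity) h1ΛΛ
        _ ≤ K * (Λ ^ 2 / R) := by
            have h5 : 0 ≤ g' * (C₄ * (V + C₃)) * (Λ ^ 2 / R) := by positivity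
            rw [hK]
            have e : g' / R * (C₅ * (C₃ * Λ ^ 2)) + C₂ * C₃ ^ 2 * (Λ ^ 2 / R) + g' / R * Λ ^ 2 +
              g' * (C₄ * (V + C₃)) * (Λ ^ 2 / R) =
              (g' * (1 + (C₅ * C₃ + C₄ * (V + C₃))) + C₂ * C₃ ^ 2) * (Λ ^ 2 / R) := by ring
            linarith
        _ ≤ 1 := hKsm.trans (min_le_left _ _)
    have hmx : 0 ≤ max (v z) 0 := le_max_right _ _
    have := core D (g := g' / R) (b := C₂ * X ^ 2 / R) (L₁ := C₅ * X) (L₂ := C₄ * (max (v z) 0 + X))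
      (by positivity) (by positivity) (by positivity) (by positivity)
      (fun y hy => (hG D y hy).trans (by gcongr; rw [hg']; linarith))
      (fun ζ hζ => (D.dz_weight_le ζ (by
        have := (mem_ball_one_norm hζ).2.2.1
        rw [mem_ball, dist_zero_right]
        linarith [D.le_R])).trans (by gcongr; rw [hg']; linarith))
      (hpot1 D) hAle z (hpot D z hz2) hz hza (hηle.trans (hKsm.trans (min_le_right _ _)))
    exact ⟨this.1.trans (by gcongr), this.2.trans (by gcongr)⟩
  rw [mul_assoc]
  have hyb := mem_ball_self (x := y) hc₁
  by_cases hyV : v y ≤ V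
  · exact main y (by linarith) (hya y hyb) hyV
  · exfalso
    obtain ⟨z, hz, hzV⟩ := hmass D y (by linarith)
    obtain ⟨x, hx, hxV⟩ := (convex_ball y c₁).isPreconnected.intermediate_value hz hyb
      D.contDiff.continuous.continuousOn ⟨hzV, (not_le.1 hyV).le⟩
    have hx1 : ‖x - 1‖ ≤ 7 / 10 := by
      rw [mem_ball, dist_eq_norm] at hx
      have := norm_add_le (x - y) (y - 1)
      rw [sub_add_sub_cancel] at this
      linarith
    have h1 := (abs_le.1 (main x hx1 (hya x hx) hxV.le).1).2
    have h2 := D.bub_le_neg ha (hya x hx)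
    have h3 : C₁ * (K * (Λ ^ 2 / R)) ≤ C₁ * η₀ := by
      gcongr
      exact hKsm.trans (min_le_right _ _)
    rw [hxV] at h1
    linarith

lemma neg_discMean_le_of_le {v : ℂ → ℝ} (hv : Continuous v) {c : ℂ} {r k : ℝ} (hr : 0 < r)
    (h : ∀ z ∈ ball c r, -k ≤ v z) : -discMean v c r ≤ 2 * bubbleMass * k := by
  rw [discMean, ← discMean_one c hr, ← mul_neg, ← integral_neg, mul_assoc, ← integral_mul_const]
  refine mul_le_mul_of_nonneg_left ?_ (by positivity)
  refine integral_mono (integrable_mul_discWeight hv c hr).neg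
    ?_ fun z => ?_
  · simpa only [mul_comm] using integrable_mul_discWeight (f := fun _ => k) (by fun_prop) c hr
  simp only
  by_cases hz : z ∈ ball c r
  · have h1 := h z hz
    have h2 : 0 ≤ max (1 - ‖z - c‖ ^ 2 / r ^ 2) 0 := le_max_right _ _
    nlinarith
  · rw [discWeight_eq_zero hr hz]
    simp

/-- Far from the unit circle the weighted density is integrable against a linear weight, uniformly. -/
lemma lintegral_dens_weight_le (N : ℕ) (B : ℝ) : ∃ C > 0, ∀ {R μ : ℝ} {v κ : ℂ → ℝ},
    BubbleData N B R μ v κ → ∀ {σ M : ℝ}, 0 ≤ σ → M ≤ 1 →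
    (∀ z ∈ ball (0 : ℂ) R, |v z - bub N (κ 1 / (8 * (N + 1) ^ 2)) μ z| ≤ M) →
    (∀ z ∈ ball (0 : ℂ) R, ‖dz (fun y => (κ y : ℂ)) z‖ ≤ σ * (1 + ‖z‖)) →
    ∫⁻ z in ball 0 R \ ball 0 4, dens N v z * ‖dz (fun y => (κ y : ℂ)) z‖ₑ ≤ ENNReal.ofReal (C * σ) := by
  obtain ⟨C, hC, hdec⟩ := bub_decay N B
  have hbm := bubbleMass_pos
  refine ⟨Real.exp 1 * C * 8 * bubbleMass, by positivity, ?_⟩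
  intro R μ v κ D σ M hσ hM hvM hκ
  have hle : ∀ z ∈ ball (0 : ℂ) R \ ball 0 4, dens N v z * ‖dz (fun y => (κ y : ℂ)) z‖ₑ ≤
      ENNReal.ofReal (Real.exp 1 * C * 8 * σ * ((1 + ‖z‖ ^ 2) ^ 2)⁻¹) := by
    rintro z ⟨hzR, hz4⟩
    rw [mem_ball, dist_zero_right, not_lt] at hz4
    rw [dens_eq, ← ofReal_norm, ← ENNReal.ofReal_mul (by positivity)]
    apply ENNReal.ofReal_le_ofReal
    have h1 := hdec D z (by linarith)
    have h2 : Real.exp (v z) ≤ Real.exp 1 * Real.exp (bub N (κ 1 / (8 * (N + 1) ^ 2)) μ z) := by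
      rw [← Real.exp_add]
      apply Real.exp_le_exp.2
      have := (abs_le.1 (hvM z hzR)).2
      linarith
    have h3 : ‖dz (fun y => (κ y : ℂ)) z‖ ≤ σ * (2 * ‖z‖) :=
      (hκ z hzR).trans (by gcongr; linarith)
    have h4 : (1 + ‖z‖ ^ 2) ^ 2 ≤ 4 * ‖z‖ ^ 4 := by
      have : 1 + ‖z‖ ^ 2 ≤ 2 * ‖z‖ ^ 2 := by nlinarith
      calc _ ≤ (2 * ‖z‖ ^ 2) ^ 2 := by gcongr
        _ = _ := by ring
    have hz0 : 0 < ‖z‖ := by linarith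
    have h5 : (‖z‖ ^ 6)⁻¹ * ‖z‖ ≤ 4 * ((1 + ‖z‖ ^ 2) ^ 2)⁻¹ := by
      rw [← div_eq_mul_inv 4, inv_mul_eq_div, div_le_div_iff₀ (by positivity) (by positivity)]
      calc ‖z‖ * (1 + ‖z‖ ^ 2) ^ 2 ≤ ‖z‖ * (4 * ‖z‖ ^ 4) := by gcongr
        _ = 4 * ‖z‖ ^ 5 := by ring
        _ ≤ 4 * ‖z‖ ^ 6 := by gcongr <;> linarith
    calc _ ≤ (‖z‖ ^ (2 * N) * (Real.exp 1 * Real.exp (bub N (κ 1 / (8 * (N + 1) ^ 2)) μ z))) *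
          (σ * (2 * ‖z‖)) := by gcongr
      _ = Real.exp 1 * (‖z‖ ^ (2 * N) * Real.exp (bub N (κ 1 / (8 * (N + 1) ^ 2)) μ z)) *
          (σ * (2 * ‖z‖)) := by ring
      _ ≤ Real.exp 1 * (C * (‖z‖ ^ 6)⁻¹) * (σ * (2 * ‖z‖)) := by gcongr
      _ = Real.exp 1 * C * 2 * σ * ((‖z‖ ^ 6)⁻¹ * ‖z‖) := by ring
      _ ≤ Real.exp 1 * C * 2 * σ * (4 * ((1 + ‖z‖ ^ 2) ^ 2)⁻¹) := by gcongr
      _ = _ := by ring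
  refine (setLIntegral_mono' (measurableSet_ball.diff measurableSet_ball) hle).trans ?_
  refine (setLIntegral_le_lintegral _ _).trans ?_
  rw [← ofReal_integral_eq_lintegral_ofReal (integrable_one_add_normSq_inv_sq.const_mul _)
    (ae_of_all _ fun z => by dsimp only [Pi.zero_apply]; positivity), integral_const_mul]
  apply ENNReal.ofReal_le_ofReal
  rw [bubbleMass]
  apply le_of_eq
  ring

lemma BubbleData.neg_le_of_close {N : ℕ} {B R μ : ℝ} {v κ : ℂ → ℝ} (D : BubbleData N B R μ v κ) {M : ℝ}
    (hM : M ≤ 1) (hvM : ∀ z ∈ ball (0 : ℂ) R, |v z - bub N (κ 1 / (8 * (N + 1) ^ 2)) μ z| ≤ M)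
    {z : ℂ} (hz : ‖z‖ ≤ 5) :
    -(μ + (2 * Real.log (1 + B) + 4 * Real.log (5 ^ (N + 1) + 1) + 1)) ≤ v z := by
  have hc := D.coeff_pos
  have h0 : ‖z ^ (N + 1) - 1‖ ≤ 5 ^ (N + 1) + 1 := by
    refine (norm_sub_le _ _).trans ?_
    rw [norm_pow, norm_one]
    gcongr
  have h1 := le_bub hc D.mu_nonneg (le_add_of_nonneg_left (by positivity)) h0
  have h2 := (abs_le.1 (hvM z (by rw [mem_ball, dist_zero_right]; linarith [D.le_R]))).1
  have h3 := Real.log_le_log (by positivity) (add_le_add_right D.coeff_le 1)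
  linarith

lemma logPot_le_of_close (N : ℕ) (B : ℝ) : ∃ K > 0, ∀ {R μ : ℝ} {v κ : ℂ → ℝ},
    BubbleData N B R μ v κ → ∀ {M : ℝ}, M ≤ 1 →
    (∀ z ∈ ball (0 : ℂ) R, |v z - bub N (κ 1 / (8 * (N + 1) ^ 2)) μ z| ≤ M) →
    ∀ c : ℂ, ‖c‖ ≤ 2 → logPot N v c ≤ ENNReal.ofReal (K * (1 + max (v c + μ) 0)) := by
  have hbm := bubbleMass_pos
  set k := 2 * Real.log (1 + B) + 4 * Real.log (5 ^ (N + 1) + 1) + 1 with hk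
  refine ⟨max 1 (B * (2 * bubbleMass * (1 + |k|)) + 3 * B), lt_max_of_lt_left one_pos, ?_⟩
  intro R μ v κ D M hM hvM c hc
  have hB := D.pos
  have hsub : ∀ z ∈ ball c 3, ‖z‖ ≤ 5 := fun z hz => by
    rw [mem_ball, dist_eq_norm] at hz
    have := norm_add_le (z - c) c
    rw [sub_add_cancel] at this
    linarith
  have h1 := D.logPot_le hc le_rfl fun z hz => by
    rw [mem_ball, dist_zero_right]
    linarith [hsub z hz, D.le_R]
  have h2 := neg_discMean_le_of_le D.contDiff.continuous (c := c) (r := 3) (k := μ + k) (by norm_num)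
    fun z hz => D.neg_le_of_close hM hvM (hsub z hz)
  refine h1.trans ?_
  rw [← ENNReal.ofReal_mul hB.le]
  set m := max (v c + μ) 0 with hm
  have hm0 : 0 ≤ m := le_max_right _ _
  have h3 : 2 * bubbleMass * v c - discMean v c 3 ≤ 2 * bubbleMass * (m + |k|) := by
    have : v c + μ + k ≤ m + |k| := add_le_add (le_max_left _ _) (le_abs_self _)
    have h4 := mul_le_mul_of_nonneg_left this (by positivity : 0 ≤ 2 * bubbleMass)
    linarith
  calc _ ≤ ENNReal.ofReal (B * (2 * bubbleMass * (m + |k|))) + ENNReal.ofReal (3 * B) := by gcongr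
    _ = ENNReal.ofReal (B * (2 * bubbleMass * (m + |k|)) + 3 * B) := by
      rw [ENNReal.ofReal_add (by positivity) (by positivity)]
    _ ≤ _ := by
      apply ENNReal.ofReal_le_ofReal
      calc B * (2 * bubbleMass * (m + |k|)) + 3 * B ≤
          B * (2 * bubbleMass * ((1 + |k|) * (1 + m))) + 3 * B * (1 + m) := by
            have : m + |k| ≤ (1 + |k|) * (1 + m) := by linarith [abs_nonneg k, mul_nonneg (abs_nonneg k) hm0]
            have h5 : 3 * B ≤ 3 * B * (1 + m) := le_mul_of_one_le_right (by positivity) (by linarith)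
            have h6 : B * (2 * bubbleMass * (m + |k|)) ≤ B * (2 * bubbleMass * ((1 + |k|) * (1 + m))) := by
              gcongr
            exact add_le_add h6 h5
        _ = (B * (2 * bubbleMass * (1 + |k|)) + 3 * B) * (1 + m) := by ring
        _ ≤ _ := by gcongr; exact le_max_right _ _

set_option maxHeartbeats 1000000 in
lemma abs_sub_bub_le_of_close (N : ℕ) {B a c₁ : ℝ} (hB : 0 < B) (ha : 0 < a) (hc₁ : 0 < c₁) (hc₁' : c₁ ≤ 1 / 20) :
    ∃ C > 0, ∃ R₀ : ℝ, ∀ {R μ : ℝ} {v κ : ℂ → ℝ}, BubbleData N B R μ v κ → R₀ ≤ R →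
    ∀ {σ M : ℝ}, 0 ≤ σ → σ ≤ B / R → 0 < M → M ≤ 1 →
    (∀ z ∈ ball (0 : ℂ) R, |v z - bub N (κ 1 / (8 * (N + 1) ^ 2)) μ z| ≤ M) →
    (∀ z ∈ ball (0 : ℂ) R, ‖dz (fun y => (κ y : ℂ)) z‖ ≤ σ * (1 + ‖z‖)) →
    ∀ y : ℂ, ‖y - 1‖ ≤ 7 / 10 → a ≤ ‖y ^ (N + 1) - 1‖ →
    |v y - bub N (κ 1 / (8 * (N + 1) ^ 2)) μ y| ≤ C * (σ + M / R + 1 / R ^ 2) ∧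
    ‖dz (fun z => (v z : ℂ)) y - dz (fun z => (bub N (κ 1 / (8 * (N + 1) ^ 2)) μ z : ℂ)) y‖ ≤
      C * (σ + M / R + 1 / R ^ 2) := by
  obtain ⟨C₁, hC₁, hG⟩ := enorm_quadDiff_le_pot N B
  obtain ⟨C₂, hC₂, hlap⟩ := integral_abs_lap_sub_bub_le_of_le N B
  obtain ⟨C₃, hC₃, hdens⟩ := lintegral_dens_weight_le N B
  obtain ⟨K₁, hK₁, hpot⟩ := logPot_le_of_close N B
  set l := |2 * Real.log (8 * (N + 1) ^ 2 * B / a ^ 2) + 1| with hl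
  have hl0 : 0 ≤ l := abs_nonneg _
  set γ := 5 * C₁ + 4 with hγ
  have hγ0 : 0 < γ := by positivity
  set β := C₁ * (C₃ + 2 + 2 * C₂) with hβ
  have hβ0 : 0 < β := by positivity
  obtain ⟨R₁, hR₁1, hR₁⟩ := eventually_log_sq_div_le (e := 1) one_pos
  set A := γ * (B + 2) * (K₁ * (1 + 2 * B)) + β * (B + 2) + γ * (B + 2) with hA
  have hA0 : 0 ≤ A := by positivity
  obtain ⟨C, hC, η₀, hη₀, core⟩ := abs_sub_bub_le_of_small N hB ha hc₁ hc₁' hA0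
  set K := γ * (1 + 3 * K₁ + K₁ * (1 + l)) + β with hK
  have hK0 : 0 < K := by positivity
  refine ⟨C * K, by positivity, max R₁ (K * (B + 2) / η₀), ?_⟩
  intro R μ v κ D hR σ M hσ hσB hM hM1 hvM hκ y hy hya
  have hR64 := D.le_R
  have hR0 : 0 < R := by linarith
  have hR1 := hR₁ R ((le_max_left _ _).trans hR)
  have hRη : K * (B + 2) / R ≤ η₀ := by
    have := (le_max_right _ _).trans hR
    rw [div_le_iff₀ hη₀] at this
    rw [div_le_iff₀ hR0]
    linarith
  have hlog := D.one_le_log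
  have hy2 : ‖y‖ ≤ 2 := by
    have := norm_add_le (y - 1) 1
    rw [sub_add_cancel, norm_one] at this
    linarith
  set s := σ + M / R + 1 / R ^ 2 with hs
  have hs0 : 0 < s := by positivity
  have hRR : 1 / R ^ 2 ≤ 1 / R := by
    gcongr
    exact le_self_pow₀ (by linarith) two_ne_zero
  have hsR : s ≤ (B + 2) / R := by
    have : M / R ≤ 1 / R := by gcongr
    have e : (B + 2) / R = B / R + 1 / R + 1 / R := by ring
    rw [e, hs]; linarith
  have href : refAnnulus R ⊆ ball 0 R := fun z hz => by
    have := hz.1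
    rw [mem_closedBall, dist_zero_right] at this
    rw [mem_ball, dist_zero_right]
    linarith
  have hGy : ∀ y : ℂ, ‖y‖ ≤ 2 → ‖quadDiff N v y‖ₑ ≤
      ENNReal.ofReal (γ * s) * pot N v y + ENNReal.ofReal (β * s) := by
    intro y hy
    refine (hG D (S := M) (m := C₂ / R ^ 2) (s₁ := 5 * σ) (s₂ := C₃ * σ) hM (by positivity)
      (by positivity) (by positivity) (fun z hz => hvM z (href hz))
      (hlap D fun z hz => by have := (abs_le.1 (hvM z (href hz))).2; linarith)
      (fun z hz => ?_) (hdens D hσ hM1 hvM hκ) y hy).trans ?_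
    · rw [mem_ball, dist_zero_right] at hz
      refine (hκ z (by rw [mem_ball, dist_zero_right]; linarith)).trans ?_
      linarith [mul_le_mul_of_nonneg_left hz.le hσ]
    · have hσs : σ ≤ s := by
        have : 0 ≤ M / R + 1 / R ^ 2 := by positivity
        rw [hs]; linarith
      gcongr ENNReal.ofReal ?_ * _ + ENNReal.ofReal ?_
      · rw [hγ]; linarith [mul_le_mul_of_nonneg_left hσs hC₁.le]
      · rw [hβ, mul_assoc]
        gcongr
        have h1 : (M + C₂ / R ^ 2) * (1 + M) / R ≤ (M + C₂ / R ^ 2) * (1 + 1) / R := by gcongr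
        have h2 : C₂ / R ^ 2 / R ≤ C₂ * s := by
          have : 1 / R ^ 2 / R ≤ s := by
            calc 1 / R ^ 2 / R ≤ 1 / R ^ 2 := div_le_self (by positivity) (by linarith)
              _ ≤ s := by
                have : 0 ≤ σ + M / R := by positivity
                rw [hs]; linarith
          calc _ = C₂ * (1 / R ^ 2 / R) := by ring
            _ ≤ _ := by gcongr
        have h3 : M / R ≤ s := by
          have : 0 ≤ σ + 1 / R ^ 2 := by positivity
          rw [hs]; linarith
        have h4 : C₃ * σ ≤ C₃ * s := by gcongr
        have e : (M + C₂ / R ^ 2) * (1 + 1) / R = 2 * (M / R) + 2 * (C₂ / R ^ 2 / R) := by ring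
        linarith
  have hμ0 := D.mu_nonneg
  have hL₁ : logPot N v 1 ≤ ENNReal.ofReal (K₁ * (1 + 2 * μ)) := by
    have := hpot D hM1 hvM 1 (by simp)
    rwa [D.apply_one, max_eq_left (by linarith), ← two_mul] at this
  have hL₂ : logPot N v y ≤ ENNReal.ofReal (K₁ * (1 + l)) := by
    refine (hpot D hM1 hvM y hy2).trans ?_
    gcongr
    refine max_le ?_ hl0
    have h1 := (abs_le.1 (hvM y (by rw [mem_ball, dist_zero_right]; linarith))).2
    have h2 := D.bub_le_neg ha hya
    refine le_trans ?_ (le_abs_self _)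
    linarith
  have hgA : γ * s * (K₁ * (1 + 2 * μ)) + β * s + γ * s ≤ A := by
    have h1 : s ≤ B + 2 := hsR.trans (div_le_self (by positivity) (by linarith))
    have h2 : s * (1 + 2 * μ) ≤ (B + 2) * (1 + 2 * B) := by
      have h3 : 1 + 2 * μ ≤ (1 + 2 * B) * Real.log R ^ 2 := by
        have := D.mu_le
        have h4 : Real.log R ≤ Real.log R ^ 2 := le_self_pow₀ hlog two_ne_zero
        have h5 : B * Real.log R ≤ B * Real.log R ^ 2 := by gcongr
        linarith
      calc _ ≤ (B + 2) / R * ((1 + 2 * B) * Real.log R ^ 2) := by gcongr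
        _ = (B + 2) * (1 + 2 * B) * (Real.log R ^ 2 / R) := by ring
        _ ≤ (B + 2) * (1 + 2 * B) * 1 := by gcongr
        _ = _ := mul_one _
    calc _ = γ * K₁ * (s * (1 + 2 * μ)) + β * s + γ * s := by ring
      _ ≤ γ * K₁ * ((B + 2) * (1 + 2 * B)) + β * (B + 2) + γ * (B + 2) := by gcongr
      _ = _ := by rw [hA]; ring
  have hη : γ * s * (1 + Real.exp (-μ) * (K₁ * (1 + 2 * μ)) + K₁ * (1 + l)) + β * s ≤ K * s := by
    have h1 : Real.exp (-μ) * (1 + 2 * μ) ≤ 3 := by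
      have h2 : μ + 1 ≤ Real.exp μ := Real.add_one_le_exp μ
      have h3 : Real.exp (-μ) * Real.exp μ = 1 := by rw [← Real.exp_add]; simp
      have h4 := Real.exp_pos (-μ)
      linarith [mul_le_mul_of_nonneg_left h2 h4.le]
    calc _ = γ * s * (1 + K₁ * (Real.exp (-μ) * (1 + 2 * μ)) + K₁ * (1 + l)) + β * s := by ring
      _ ≤ γ * s * (1 + K₁ * 3 + K₁ * (1 + l)) + β * s := by gcongr
      _ = _ := by rw [hK]; ring
  have hKs : K * s ≤ η₀ := by
    calc _ ≤ K * ((B + 2) / R) := by gcongr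
      _ = K * (B + 2) / R := by ring
      _ ≤ _ := hRη
  have := core D (g := γ * s) (b := β * s) (L₁ := K₁ * (1 + 2 * μ)) (L₂ := K₁ * (1 + l))
    (by positivity) (by positivity) (by positivity) (by positivity) hGy
    (fun z hz => by
      have h1 := (mem_ball_one_norm hz).2.2.1
      refine (hκ z (by rw [mem_ball, dist_zero_right]; linarith)).trans ?_
      have hσs : σ ≤ s := by
        have : 0 ≤ M / R + 1 / R ^ 2 := by positivity
        rw [hs]; linarith
      calc σ * (1 + ‖z‖) ≤ s * (1 + 2) := by gcongr
        _ ≤ γ * s := by rw [hγ]; linarith [mul_nonneg hC₁.le hs0.le]) hL₁ hgA y hL₂ hy hya (hη.trans hKs)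
  rw [mul_assoc]
  exact ⟨this.1.trans (by gcongr), this.2.trans (by gcongr)⟩

lemma exists_contDiff_eqOn_ball {f : ℂ → ℝ} {n : ℕ} {r r' : ℝ} (hr : 0 < r) (hrr : r < r')
    (hf : ContDiffOn ℝ n f (ball (0 : ℂ) r')) :
    ∃ g : ℂ → ℝ, ContDiff ℝ n g ∧ EqOn g f (ball (0 : ℂ) r) := by
  let χ : ContDiffBump (0 : ℂ) := ⟨r, (r + r') / 2, hr, by linarith⟩
  refine ⟨fun z => χ z * f z, ?_, fun z hz => ?_⟩
  · rw [contDiff_iff_contDiffAt]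
    intro z
    by_cases hz : z ∈ ball (0 : ℂ) r'
    · exact χ.contDiffAt.mul (hf.contDiffAt (isOpen_ball.mem_nhds hz))
    · have hz' : z ∉ tsupport χ := by
        rw [χ.tsupport_eq]
        intro h
        apply hz
        rw [mem_closedBall] at h
        rw [mem_ball]
        have : dist z 0 ≤ (r + r') / 2 := h
        linarith
      have : (fun z => χ z * f z) =ᶠ[nhds z] fun _ => 0 := by
        filter_upwards [notMem_tsupport_iff_eventuallyEq.1 hz'] with y hy
        simp only [hy, Pi.zero_apply, zero_mul]
      exact contDiffAt_const.congr_of_eventuallyEq this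
  · have : χ z = 1 := χ.one_of_mem_closedBall (ball_subset_closedBall hz)
    simp [this]

lemma Filter.EventuallyEq.lap_eq {f g : ℂ → ℝ} {z : ℂ} (h : f =ᶠ[nhds z] g) : lap f z = lap g z := by
  have key : ∀ (ω : ℂ) {f g : ℂ → ℝ} {z : ℂ}, f =ᶠ[nhds z] g → dderiv ω f =ᶠ[nhds z] dderiv ω g := by
    intro ω f g z h
    filter_upwards [h.fderiv (𝕜 := ℝ)] with y hy
    simp only [dderiv, hy]
  simp only [lap, pd, Function.iterate_succ, Function.iterate_zero, Function.comp, id]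
  rw [(key 1 (key 1 h)).eq_of_nhds, (key Complex.I (key Complex.I h)).eq_of_nhds]

lemma Filter.EventuallyEq.dz_eq {f g : ℂ → ℂ} {z : ℂ} (h : f =ᶠ[nhds z] g) : dz f z = dz g z := by
  simp only [dz, h.fderiv_eq]

lemma Filter.EventuallyEq.dz_ofReal_eq {f g : ℂ → ℝ} {z : ℂ} (h : f =ᶠ[nhds z] g) :
    dz (fun y => (f y : ℂ)) z = dz (fun y => (g y : ℂ)) z := by
  refine Filter.EventuallyEq.dz_eq ?_
  filter_upwards [h] with y hy
  rw [hy]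

/-- A rescaled blowup solution that is only defined on a ball of radius `R'`. -/
structure LocalBubbleData (N : ℕ) (B R R' μ : ℝ) (v κ : ℂ → ℝ) : Prop where
  one_le_N : 1 ≤ N
  one_le : 1 ≤ B
  le_R : 64 ≤ R
  lt : R < R'
  contDiff : ContDiffOn ℝ 2 v (ball 0 R')
  contDiff_weight : ContDiffOn ℝ 1 κ (ball 0 R')
  pde : ∀ z ∈ ball (0 : ℂ) R, lap v z = -(‖z‖ ^ (2 * N) * κ z * Real.exp (v z))
  le_weight : ∀ z ∈ ball (0 : ℂ) R, B⁻¹ ≤ κ z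
  weight_le : ∀ z ∈ ball (0 : ℂ) R, κ z ≤ B
  dz_weight_le : ∀ z ∈ ball (0 : ℂ) R, ‖dz (fun y => (κ y : ℂ)) z‖ ≤ B / R
  mass : ∫⁻ z in ball (0 : ℂ) R, dens N v z ≤ ENNReal.ofReal B
  apply_one : v 1 = μ
  dz_one : dz (fun y => (v y : ℂ)) 1 = 0
  le_outer : ∀ z ∈ ball (0 : ℂ) R, R / 8 ≤ ‖z‖ → v z ≤ B
  mu_nonneg : 0 ≤ μ
  mu_le : μ ≤ B * Real.log R

lemma LocalBubbleData.exists_extension {N : ℕ} {B R R' μ : ℝ} {v κ : ℂ → ℝ}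
    (D : LocalBubbleData N B R R' μ v κ) :
    ∃ v' κ' : ℂ → ℝ, EqOn v' v (ball 0 R) ∧ EqOn κ' κ (ball 0 R) ∧ BubbleData N B R μ v' κ' := by
  have hR0 : 0 < R := by linarith [D.le_R]
  obtain ⟨v', hv', hve⟩ := exists_contDiff_eqOn_ball (n := 2) hR0 D.lt D.contDiff
  obtain ⟨κ', hκ', hκe⟩ := exists_contDiff_eqOn_ball (n := 1) hR0 D.lt D.contDiff_weight
  have hvn : ∀ z ∈ ball (0 : ℂ) R, v' =ᶠ[nhds z] v := fun z hz =>
    hve.eventuallyEq_of_mem (isOpen_ball.mem_nhds hz)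
  have hκn : ∀ z ∈ ball (0 : ℂ) R, κ' =ᶠ[nhds z] κ := fun z hz =>
    hκe.eventuallyEq_of_mem (isOpen_ball.mem_nhds hz)
  have h1 : (1 : ℂ) ∈ ball (0 : ℂ) R := by
    simp; linarith [D.le_R]
  refine ⟨v', κ', hve, hκe, D.one_le_N, D.one_le, D.le_R, hv', hκ', fun z hz => ?_, fun z hz => ?_,
    fun z hz => ?_, fun z hz => ?_, ?_, ?_, ?_, fun z hz h => ?_, D.mu_nonneg, D.mu_le⟩
  · rw [(hvn z hz).lap_eq, D.pde z hz, hve hz, hκe hz]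
  · rw [hκe hz]; exact D.le_weight z hz
  · rw [hκe hz]; exact D.weight_le z hz
  · rw [(hκn z hz).dz_ofReal_eq]; exact D.dz_weight_le z hz
  · refine le_of_eq_of_le (setLIntegral_congr_fun measurableSet_ball fun z hz => ?_) D.mass
    simp only [dens, hve hz]
  · rw [hve h1, D.apply_one]
  · rw [(hvn 1 h1).dz_ofReal_eq, D.dz_one]
  · rw [hve hz]; exact D.le_outer z hz h

lemma abs_sub_bub_le_uniform (N : ℕ) {B a c₁ : ℝ} (hB : 0 < B) (ha : 0 < a) (hc₁ : 0 < c₁)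
    (hc₁' : c₁ ≤ 1 / 50) :
    ∃ C : ℝ, 0 < C ∧ ∃ R₀ μ₀ : ℝ, ∀ {R R' μ : ℝ} {v κ : ℂ → ℝ}, LocalBubbleData N B R R' μ v κ →
    R₀ ≤ R → μ₀ ≤ μ → ∀ {σ M : ℝ}, 0 ≤ σ → σ ≤ B / R → 0 < M →
    (∀ z ∈ ball (0 : ℂ) R, |v z - bub N (κ 1 / (8 * (N + 1) ^ 2)) μ z| ≤ M) →
    (∀ z ∈ ball (0 : ℂ) R, ‖dz (fun y => (κ y : ℂ)) z‖ ≤ σ * (1 + ‖z‖)) →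
    ∀ y : ℂ, ‖y - 1‖ ≤ 17 / 25 → (∀ z ∈ ball y c₁, a ≤ ‖z ^ (N + 1) - 1‖) →
    |v y - bub N (κ 1 / (8 * (N + 1) ^ 2)) μ y| ≤
      C * M * (σ / M + Real.log R ^ 2 / R + 1 / R + 1 / (R ^ 2 * M)) ∧
    ‖dz (fun z => (v z : ℂ)) y - dz (fun z => (bub N (κ 1 / (8 * (N + 1) ^ 2)) μ z : ℂ)) y‖ ≤
      C * M * (σ / M + Real.log R ^ 2 / R + 1 / R + 1 / (R ^ 2 * M)) := by
  obtain ⟨C₁, hC₁, R₁, μ₁, h₁⟩ := abs_sub_bub_le_log N hB ha hc₁ hc₁'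
  obtain ⟨C₂, hC₂, R₂, h₂⟩ := abs_sub_bub_le_of_close N hB ha hc₁ (by linarith)
  refine ⟨C₁ + C₂, by positivity, max R₁ R₂, μ₁, ?_⟩
  intro R R' μ v κ D hR hμ σ M hσ hσR hM hvM hκ y hy hya
  obtain ⟨v', κ', hve, hκe, D'⟩ := D.exists_extension
  have hR64 := D.le_R
  have hR0 : 0 < R := by linarith
  have h1 : (1 : ℂ) ∈ ball (0 : ℂ) R := by
    simp; linarith
  have hyR : y ∈ ball (0 : ℂ) R := by
    have := norm_add_le (y - 1) 1
    rw [sub_add_cancel, norm_one] at this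
    rw [mem_ball, dist_zero_right]; linarith
  have hvn : v' =ᶠ[nhds y] v := hve.eventuallyEq_of_mem (isOpen_ball.mem_nhds hyR)
  rw [← hκe h1, ← hve hyR, ← hvn.dz_ofReal_eq]
  by_cases hM1 : M ≤ 1
  · have := h₂ D' ((le_max_right _ _).trans hR) hσ hσR hM hM1
      (fun z hz => by rw [hve hz, hκe h1]; exact hvM z hz)
      (fun z hz => by
        have : κ' =ᶠ[nhds z] κ := hκe.eventuallyEq_of_mem (isOpen_ball.mem_nhds hz)
        rw [this.dz_ofReal_eq]; exact hκ z hz) y (by linarith) (hya y (mem_ball_self hc₁))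
    have hle : C₂ * (σ + M / R + 1 / R ^ 2) ≤
        (C₁ + C₂) * M * (σ / M + Real.log R ^ 2 / R + 1 / R + 1 / (R ^ 2 * M)) := by
      have e : M * (σ / M + Real.log R ^ 2 / R + 1 / R + 1 / (R ^ 2 * M)) =
          σ + M * (Real.log R ^ 2 / R) + M / R + 1 / R ^ 2 := by
        field_simp
      rw [mul_assoc, e]
      have : 0 ≤ M * (Real.log R ^ 2 / R) := by positivity
      gcongr <;> linarith
    exact ⟨this.1.trans hle, this.2.trans hle⟩
  · have := h₁ D' ((le_max_left _ _).trans hR) hμ y hy hya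
    have hle : C₁ * (Real.log R ^ 2 / R) ≤
        (C₁ + C₂) * M * (σ / M + Real.log R ^ 2 / R + 1 / R + 1 / (R ^ 2 * M)) := by
      have h3 : C₁ ≤ (C₁ + C₂) * M := by nlinarith
      have h4 : 0 ≤ σ / M + 1 / R + 1 / (R ^ 2 * M) := by positivity
      gcongr
      linarith
    exact ⟨this.1.trans hle, this.2.trans hle⟩

/-- On `ball 0 r` the function and its first derivative are bounded by `K`, and the derivative is
`K`-Lipschitz at the origin. -/
structure C1Bound (r K : ℝ) (f : ℂ → ℝ) : Prop where
  diff : ∀ x ∈ ball (0 : ℂ) r, DifferentiableAt ℝ f x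
  bdd : ∀ x ∈ ball (0 : ℂ) r, |f x| ≤ K
  dz_le : ∀ x ∈ ball (0 : ℂ) r, ‖dz (fun y => (f y : ℂ)) x‖ ≤ K
  dz_sub_le : ∀ x ∈ ball (0 : ℂ) r, ‖dz (fun y => (f y : ℂ)) x - dz (fun y => (f y : ℂ)) 0‖ ≤ K * ‖x‖

lemma DifferentiableAt.hasWirt_coe {f : ℂ → ℝ} {x : ℂ} (h : DifferentiableAt ℝ f x) :
    HasWirt (fun y => (f y : ℂ)) (dz (fun y => (f y : ℂ)) x) (conj (dz (fun y => (f y : ℂ)) x)) x := by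
  rw [← dzb_ofReal f h]
  exact DifferentiableAt.hasWirt h.hasFDerivAt.hasWirt_ofReal.differentiableAt

lemma norm_fderiv_le_dz {f : ℂ → ℝ} {x : ℂ} (h : DifferentiableAt ℝ f x) :
    ‖fderiv ℝ f x‖ ≤ 2 * ‖dz (fun y => (f y : ℂ)) x‖ := by
  refine ContinuousLinearMap.opNorm_le_bound _ (by positivity) fun ω => ?_
  rw [fderiv_ofReal_apply h, Real.norm_eq_abs, abs_mul, abs_two]
  have := (Complex.abs_re_le_norm (ω * dz (fun y => (f y : ℂ)) x))
  rw [norm_mul] at this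
  linarith

lemma abs_sub_le_of_dz_le {f : ℂ → ℝ} {r K : ℝ} (hd : ∀ x ∈ ball (0 : ℂ) r, DifferentiableAt ℝ f x)
    (hK : ∀ x ∈ ball (0 : ℂ) r, ‖dz (fun y => (f y : ℂ)) x‖ ≤ K) {x : ℂ} (hx : x ∈ ball (0 : ℂ) r) :
    |f x - f 0| ≤ 2 * K * ‖x‖ := by
  have hr : 0 < r := (dist_nonneg).trans_lt hx
  have := (convex_ball (0 : ℂ) r).norm_image_sub_le_of_norm_fderiv_le (𝕜 := ℝ) hd
    (fun y hy => (norm_fderiv_le_dz (hd y hy)).trans (by have := hK y hy; linarith : _ ≤ 2 * K))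
    (mem_ball_self hr) hx
  simpa using this

lemma C1Bound.nonneg {r K : ℝ} {f : ℂ → ℝ} (hf : C1Bound r K f) (hr : 0 < r) : 0 ≤ K :=
  (abs_nonneg _).trans (hf.bdd 0 (mem_ball_self hr))

lemma C1Bound.mul {r K L : ℝ} {f g : ℂ → ℝ} (hr : 0 < r) (hf : C1Bound r K f) (hg : C1Bound r L g) :
    C1Bound r (6 * K * L) (fun x => f x * g x) := by
  have hK := hf.nonneg hr
  have hL := hg.nonneg hr
  have hKL : 0 ≤ K * L := by positivity
  have hdz : ∀ x ∈ ball (0 : ℂ) r, dz (fun y => ((f y * g y : ℝ) : ℂ)) x =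
      dz (fun y => (f y : ℂ)) x * g x + f x * dz (fun y => (g y : ℂ)) x := by
    intro x hx
    have := ((hf.diff x hx).hasWirt_coe.mul (hg.diff x hx).hasWirt_coe).dz
    simp only [Complex.ofReal_mul]
    exact this
  refine ⟨fun x hx => (hf.diff x hx).mul (hg.diff x hx), fun x hx => ?_, fun x hx => ?_, fun x hx => ?_⟩
  · rw [abs_mul]
    calc _ ≤ K * L := mul_le_mul (hf.bdd x hx) (hg.bdd x hx) (abs_nonneg _) hK
      _ ≤ _ := by linarith
  · rw [hdz x hx]
    refine (norm_add_le _ _).trans ?_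
    rw [norm_mul, norm_mul, Complex.norm_real, Complex.norm_real]
    have h1 := mul_le_mul (hf.dz_le x hx) (hg.bdd x hx) (abs_nonneg _) hK
    have h2 := mul_le_mul (hf.bdd x hx) (hg.dz_le x hx) (norm_nonneg _) hK
    simp only [Real.norm_eq_abs]
    linarith
  · have h0 := mem_ball_self (x := (0 : ℂ)) hr
    rw [hdz x hx, hdz 0 h0]
    have hfx := abs_sub_le_of_dz_le hf.diff hf.dz_le hx
    have hgx := abs_sub_le_of_dz_le hg.diff hg.dz_le hx
    set a := dz (fun y => (f y : ℂ)) x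
    set a0 := dz (fun y => (f y : ℂ)) 0
    set b := dz (fun y => (g y : ℂ)) x
    set b0 := dz (fun y => (g y : ℂ)) 0
    have e : a * g x + f x * b - (a0 * g 0 + f 0 * b0) =
        (a - a0) * (g x : ℝ) + a0 * ((g x - g 0 : ℝ) : ℂ) + ((f x : ℝ) * (b - b0) + ((f x - f 0 : ℝ) : ℂ) * b0) := by
      push_cast; ring
    rw [e]
    have t1 : ‖(a - a0) * (g x : ℝ)‖ ≤ K * ‖x‖ * L := by
      rw [norm_mul, Complex.norm_real]
      exact mul_le_mul (hf.dz_sub_le x hx) (hg.bdd x hx) (abs_nonneg _) (by positivity)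
    have t2 : ‖a0 * ((g x - g 0 : ℝ) : ℂ)‖ ≤ K * (2 * L * ‖x‖) := by
      rw [norm_mul, Complex.norm_real]
      exact mul_le_mul (hf.dz_le 0 h0) hgx (abs_nonneg _) hK
    have t3 : ‖((f x : ℝ) : ℂ) * (b - b0)‖ ≤ K * (L * ‖x‖) := by
      rw [norm_mul, Complex.norm_real]
      exact mul_le_mul (hf.bdd x hx) (hg.dz_sub_le x hx) (norm_nonneg _) hK
    have t4 : ‖((f x - f 0 : ℝ) : ℂ) * b0‖ ≤ 2 * K * ‖x‖ * L := by
      rw [norm_mul, Complex.norm_real]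
      exact mul_le_mul hfx (hg.dz_le 0 h0) (norm_nonneg _) (by positivity)
    refine (norm_add_le _ _).trans ((add_le_add (norm_add_le _ _) (norm_add_le _ _)).trans ?_)
    linarith

lemma C1Bound.exp {r K : ℝ} {f : ℂ → ℝ} (hr : 0 < r) (hf : C1Bound r K f) :
    C1Bound r (Real.exp K * (1 + K + 2 * K ^ 2)) (fun x => Real.exp (f x)) := by
  have hK := hf.nonneg hr
  have he : ∀ x ∈ ball (0 : ℂ) r, Real.exp (f x) ≤ Real.exp K := fun x hx =>
    Real.exp_le_exp.2 ((abs_le.1 (hf.bdd x hx)).2)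
  have hdz : ∀ x ∈ ball (0 : ℂ) r, dz (fun y => ((Real.exp (f y) : ℝ) : ℂ)) x =
      Real.exp (f x) * dz (fun y => (f y : ℂ)) x := by
    intro x hx
    have := (hf.diff x hx).hasWirt_coe.cexp.dz
    simp only [Complex.ofReal_exp]
    exact this
  have hd : ∀ x ∈ ball (0 : ℂ) r, DifferentiableAt ℝ (fun x => Real.exp (f x)) x :=
    fun x hx => (hf.diff x hx).exp
  have hdl : ∀ x ∈ ball (0 : ℂ) r, ‖dz (fun y => ((Real.exp (f y) : ℝ) : ℂ)) x‖ ≤ Real.exp K * K := by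
    intro x hx
    rw [hdz x hx, norm_mul, Complex.norm_real, Real.norm_eq_abs, Real.abs_exp]
    exact mul_le_mul (he x hx) (hf.dz_le x hx) (norm_nonneg _) (by positivity)
  have hE := Real.exp_pos K
  have p1 : 0 ≤ Real.exp K * K := by positivity
  have p2 : 0 ≤ Real.exp K * K ^ 2 := by positivity
  refine ⟨hd, fun x hx => ?_, fun x hx => ?_, fun x hx => ?_⟩
  · rw [Real.abs_exp]
    have := he x hx
    linarith
  · have := hdl x hx
    linarith
  · have h0 := mem_ball_self (x := (0 : ℂ)) hr
    have hfx := abs_sub_le_of_dz_le hd hdl hx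
    rw [hdz x hx, hdz 0 h0]
    set a := dz (fun y => (f y : ℂ)) x
    set a0 := dz (fun y => (f y : ℂ)) 0
    have e : Real.exp (f x) * a - Real.exp (f 0) * a0 =
        ((Real.exp (f x) : ℝ) : ℂ) * (a - a0) + ((Real.exp (f x) - Real.exp (f 0) : ℝ) : ℂ) * a0 := by
      push_cast; ring
    rw [e]
    have t3 : ‖((Real.exp (f x) : ℝ) : ℂ) * (a - a0)‖ ≤ Real.exp K * (K * ‖x‖) := by
      rw [norm_mul, Complex.norm_real, Real.norm_eq_abs, Real.abs_exp]
      exact mul_le_mul (he x hx) (hf.dz_sub_le x hx) (norm_nonneg _) hE.le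
    have t4 : ‖((Real.exp (f x) - Real.exp (f 0) : ℝ) : ℂ) * a0‖ ≤
        2 * (Real.exp K * K) * ‖x‖ * K := by
      rw [norm_mul, Complex.norm_real]
      exact mul_le_mul hfx (hf.dz_le 0 h0) (norm_nonneg _) (by positivity)
    refine (norm_add_le _ _).trans ?_
    have : 0 ≤ Real.exp K * ‖x‖ := by positivity
    linarith

lemma lap_eq_laplacian {f : ℂ → ℝ} {z : ℂ} (h : ContDiffAt ℝ 2 f z) :
    lap f z = Laplacian.laplacian f z := by
  have hd : DifferentiableAt ℝ (fderiv ℝ f) z :=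
    (h.fderiv_right (m := 1) (by norm_num)).differentiableAt (by norm_num)
  have key : ∀ ω : ℂ, HasFDerivAt (fun y => fderiv ℝ f y ω)
      ((fderiv ℝ (fderiv ℝ f) z).flip ω) z := fun ω => by
    simpa using hd.hasFDerivAt.clm_apply (hasFDerivAt_const ω z)
  rw [InnerProductSpace.laplacian_eq_iteratedFDeriv_complexPlane]
  simp only [iteratedFDeriv_two_apply, lap, pd, Function.iterate_succ, Function.iterate_zero,
    Function.comp, id]
  have e : ∀ ω : ℂ, dderiv ω (dderiv ω f) z = fderiv ℝ (fderiv ℝ f) z ω ω := fun ω => by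
    have h1 : HasFDerivAt (dderiv ω f) ((fderiv ℝ (fderiv ℝ f) z).flip ω) z := key ω
    rw [dderiv, h1.fderiv, ContinuousLinearMap.flip_apply]
  rw [e, e]
  simp

lemma exists_holomorphic_re_eq {f : ℂ → ℝ} {τ : ℝ} (hf : ContDiffOn ℝ 2 f (ball (0 : ℂ) τ))
    (hl : ∀ x ∈ ball (0 : ℂ) τ, lap f x = 0) :
    ∃ F : ℂ → ℂ, DifferentiableOn ℂ F (ball 0 τ) ∧ ∀ x ∈ ball (0 : ℂ) τ, (F x).re = f x := by
  have hh : InnerProductSpace.HarmonicOnNhd f (ball (0 : ℂ) τ) := fun x hx =>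
    ⟨hf.contDiffAt (isOpen_ball.mem_nhds hx), by
      filter_upwards [isOpen_ball.mem_nhds hx] with y hy
      rw [← lap_eq_laplacian (hf.contDiffAt (isOpen_ball.mem_nhds hy)), hl y hy]; rfl⟩
  obtain ⟨F, hF, he⟩ := hh.exists_analyticOnNhd_ball_re_eq
  exact ⟨F, hF.differentiableOn, he⟩

lemma re_le_of_sphere_le {f : ℂ → ℝ} {F : ℂ → ℂ} {τ C : ℝ} (hτ : 0 < τ)
    (hc : ContinuousOn f (closedBall 0 τ)) (hF : DifferentiableOn ℂ F (ball 0 τ))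
    (he : ∀ x ∈ ball (0 : ℂ) τ, (F x).re = f x) (hs : ∀ x ∈ sphere (0 : ℂ) τ, f x ≤ C) :
    ∀ x ∈ closedBall (0 : ℂ) τ, f x ≤ C := by
  obtain ⟨c, hcm, hmax⟩ := (isCompact_closedBall (0 : ℂ) τ).exists_isMaxOn
    (nonempty_closedBall.2 hτ.le) hc
  suffices h : f c ≤ C from fun x hx => (hmax hx).trans h
  rcases (mem_closedBall.1 hcm).lt_or_eq with hlt | heq
  · have hm : IsMaxOn (norm ∘ fun x => Complex.exp (F x)) (ball 0 τ) c := fun x hx => by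
      simp only [mem_ofPred_eq, Function.comp, Complex.norm_exp, he x hx, he c hlt, Real.exp_le_exp]
      exact hmax (ball_subset_closedBall hx)
    have hcst := Complex.norm_eqOn_of_isPreconnected_of_isMaxOn
      (convex_ball (0 : ℂ) τ).isPreconnected isOpen_ball hF.cexp hlt hm
    have hcst' : EqOn f (fun _ => f c) (ball 0 τ) := fun x hx => by
      have := hcst hx
      simpa [Complex.norm_exp, he x hx, he c hlt] using this
    have hcl : EqOn f (fun _ => f c) (closedBall 0 τ) :=
      hcst'.of_subset_closure hc continuousOn_const ball_subset_closedBall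
        (by rw [closure_ball _ hτ.ne'])
    have hτs : ((τ : ℝ) : ℂ) ∈ sphere (0 : ℂ) τ := by simp [abs_of_pos hτ]
    have := hcl (sphere_subset_closedBall hτs)
    simp only at this
    rw [← this]
    exact hs _ hτs
  · exact hs c heq

lemma exists_c1Bound_of_harmonic {τ C : ℝ} (hτ : 0 < τ) :
    ∃ K : ℝ, 0 < K ∧ ∀ f : ℂ → ℝ, ContinuousOn f (closedBall (0 : ℂ) τ) →
      ContDiffOn ℝ 2 f (ball (0 : ℂ) τ) → (∀ x ∈ ball (0 : ℂ) τ, lap f x = 0) →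
      (∀ x ∈ sphere (0 : ℂ) τ, |f x| ≤ C) →
      (∀ x ∈ closedBall (0 : ℂ) τ, |f x| ≤ C) ∧ C1Bound (τ / 2) K f := by
  set D : ℝ := Real.exp C * Real.exp C / (τ / 4) with hD
  have hD0 : 0 < D := by positivity
  refine ⟨|C| + D + D / (τ / 8), by positivity, fun f hc hf hl hs => ?_⟩
  obtain ⟨F, hF, he⟩ := exists_holomorphic_re_eq hf hl
  have hmax := re_le_of_sphere_le hτ hc hF he fun x hx => (abs_le.1 (hs x hx)).2
  have hmin := re_le_of_sphere_le (F := fun x => -F x) (f := fun x => -f x) hτ hc.neg hF.neg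
    (fun x hx => by rw [Complex.neg_re, he x hx]) fun x hx => (by
      have := (abs_le.1 (hs x hx)).1
      linarith : -f x ≤ C)
  have hab : ∀ x ∈ closedBall (0 : ℂ) τ, |f x| ≤ C := fun x hx =>
    abs_le.2 ⟨by have := hmin x hx; linarith, hmax x hx⟩
  refine ⟨hab, ?_⟩
  have hFd : ∀ x ∈ ball (0 : ℂ) τ, DifferentiableAt ℂ F x := fun x hx =>
    hF.differentiableAt (isOpen_ball.mem_nhds hx)
  have hF1 : ∀ x : ℂ, ‖x‖ ≤ 3 * τ / 4 - τ / 8 → ‖deriv F x‖ ≤ D := by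
    intro x hx
    have hsub : closedBall x (τ / 4) ⊆ ball 0 τ := fun y hy => by
      rw [mem_closedBall, dist_eq_norm] at hy
      have := norm_add_le (y - x) x
      rw [sub_add_cancel] at this
      rw [mem_ball, dist_zero_right]; linarith
    have hxb : x ∈ ball (0 : ℂ) τ := hsub (mem_closedBall_self (by positivity))
    have hdc : DiffContOnCl ℂ (fun y => Complex.exp (F y)) (ball x (τ / 4)) :=
      DifferentiableOn.diffContOnCl_ball (hF.cexp.mono hsub) le_rfl
    have h1 := Complex.norm_deriv_le_of_forall_mem_sphere_norm_le (C := Real.exp C)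
      (by positivity) hdc fun z hz => by
        have hz' := hsub (sphere_subset_closedBall hz)
        rw [Complex.norm_exp, he z hz', Real.exp_le_exp]
        exact hmax z (ball_subset_closedBall hz')
    have h2 : deriv (fun y => Complex.exp (F y)) x = Complex.exp (F x) * deriv F x :=
      (hFd x hxb).hasDerivAt.cexp.deriv
    rw [h2, norm_mul, Complex.norm_exp, he x hxb] at h1
    have h3 : Real.exp (-C) ≤ Real.exp (f x) := by
      rw [Real.exp_le_exp]
      linarith [(abs_le.1 (hab x (ball_subset_closedBall hxb))).1]
    have h4 : Real.exp (-C) * ‖deriv F x‖ ≤ Real.exp C / (τ / 4) :=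
      (mul_le_mul_of_nonneg_right h3 (norm_nonneg _)).trans h1
    rw [Real.exp_neg, inv_mul_le_iff₀ (Real.exp_pos _)] at h4
    rw [hD]
    exact h4.trans (le_of_eq (by ring))
  have hFa := hF.analyticOnNhd isOpen_ball
  have hF2 : ∀ x ∈ ball (0 : ℂ) (τ / 2), ‖deriv (deriv F) x‖ ≤ D / (τ / 8) := by
    intro x hx
    rw [mem_ball, dist_zero_right] at hx
    have hsub : ∀ y ∈ closedBall x (τ / 8), ‖y‖ ≤ 3 * τ / 4 - τ / 8 := fun y hy => by
      rw [mem_closedBall, dist_eq_norm] at hy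
      have := norm_add_le (y - x) x
      rw [sub_add_cancel] at this
      linarith
    refine Complex.norm_deriv_le_of_forall_mem_sphere_norm_le (by positivity)
      (DifferentiableOn.diffContOnCl_ball (U := closedBall x (τ / 8)) (fun y hy => ?_) le_rfl)
      fun z hz => hF1 z (hsub z (sphere_subset_closedBall hz))
    refine (hFa.deriv y ?_).differentiableAt.differentiableWithinAt
    have := hsub y hy
    rw [mem_ball, dist_zero_right]; linarith
  have hlt : ball (0 : ℂ) (τ / 2) ⊆ ball 0 τ := ball_subset_ball (by linarith)
  have hdz : ∀ x ∈ ball (0 : ℂ) τ, dz (fun y => (f y : ℂ)) x = deriv F x / 2 := by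
    intro x hx
    have h1 : HasWirt F (deriv F x) 0 x := by
      simpa using (hasWirt_id x).comp_holo (hFd x hx).hasDerivAt
    have h2 := ((h1.add h1.conj).const_mul (1 / 2)).dz
    have e : (fun y => (f y : ℂ)) =ᶠ[nhds x] fun y : ℂ => 1 / 2 * (F y + conj (F y)) := by
      filter_upwards [isOpen_ball.mem_nhds hx] with y hy
      rw [Complex.add_conj, he y hy]; push_cast; ring
    rw [e.dz_eq, h2]; simp; ring
  have hDτ : 0 ≤ D / (τ / 8) := by positivity
  have h0 : (0 : ℂ) ∈ ball (0 : ℂ) (τ / 2) := mem_ball_self (by positivity)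
  refine ⟨fun x hx => (hf.contDiffAt (isOpen_ball.mem_nhds (hlt hx))).differentiableAt (by norm_num),
    fun x hx => ?_, fun x hx => ?_, fun x hx => ?_⟩
  · have := hab x (ball_subset_closedBall (hlt hx))
    have := le_abs_self C
    linarith
  · rw [hdz x (hlt hx), norm_div, Complex.norm_ofNat]
    rw [mem_ball, dist_zero_right] at hx
    have := hF1 x (by linarith)
    have := abs_nonneg C
    linarith
  · rw [hdz x (hlt hx), hdz 0 (hlt h0), ← sub_div, norm_div, Complex.norm_ofNat]
    have := (convex_ball (0 : ℂ) (τ / 2)).norm_image_sub_le_of_norm_deriv_le (𝕜 := ℂ)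
      (fun y hy => (hFa.deriv y (hlt hy)).differentiableAt) hF2 h0 hx
    rw [sub_zero] at this
    have h2 : 0 ≤ (|C| + D) * ‖x‖ := by positivity
    have := norm_nonneg (deriv F x - deriv F 0)
    nlinarith

lemma norm_dz_ofReal_sub_le {f : ℂ → ℝ} {x y : ℂ} (hx : DifferentiableAt ℝ f x)
    (hy : DifferentiableAt ℝ f y) :
    ‖dz (fun z => (f z : ℂ)) x - dz (fun z => (f z : ℂ)) y‖ ≤ ‖fderiv ℝ f x - fderiv ℝ f y‖ := by
  rw [(hx.hasFDerivAt.hasWirt_ofReal).dz, (hy.hasFDerivAt.hasWirt_ofReal).dz]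
  set L := fderiv ℝ f x - fderiv ℝ f y with hL
  have h1 := L.le_opNorm 1
  have h2 := L.le_opNorm Complex.I
  simp only [norm_one, mul_one, Complex.norm_I] at h1 h2
  have e : ((fderiv ℝ f x 1 : ℂ) - fderiv ℝ f x Complex.I * Complex.I) / 2 -
      ((fderiv ℝ f y 1 : ℂ) - fderiv ℝ f y Complex.I * Complex.I) / 2 =
      ((L 1 : ℂ) - L Complex.I * Complex.I) / 2 := by
    simp only [hL, sub_apply]
    push_cast; ring
  rw [e, norm_div, Complex.norm_ofNat]
  have := norm_sub_le ((L 1 : ℂ)) (L Complex.I * Complex.I)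
  rw [norm_mul, Complex.norm_real, Complex.norm_real, Complex.norm_I, mul_one] at this
  linarith

lemma c1Bound_of_norm_iteratedFDerivWithin_le {f : ℂ → ℝ} {τ C : ℝ} {n : ℕ} (hτ : 0 < τ)
    (hn : 2 ≤ n) (hf : ContDiffOn ℝ n f (closedBall (0 : ℂ) τ))
    (hC : ∀ i ≤ n, ∀ x ∈ closedBall (0 : ℂ) τ,
      ‖iteratedFDerivWithin ℝ i f (closedBall (0 : ℂ) τ) x‖ ≤ C) : C1Bound τ C f := by
  have hsub : ball (0 : ℂ) τ ⊆ closedBall 0 τ := ball_subset_closedBall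
  have hud : UniqueDiffOn ℝ (closedBall (0 : ℂ) τ) := uniqueDiffOn_convex (convex_closedBall _ _)
    ⟨0, ball_subset_interior_closedBall (mem_ball_self hτ)⟩
  have hat : ∀ x ∈ ball (0 : ℂ) τ, ContDiffAt ℝ n f x := fun x hx =>
    (hf.mono hsub).contDiffAt (isOpen_ball.mem_nhds hx)
  have hit : ∀ i ≤ n, ∀ x ∈ ball (0 : ℂ) τ, ‖iteratedFDeriv ℝ i f x‖ ≤ C := fun i hi x hx => by
    rw [← iteratedFDerivWithin_eq_iteratedFDeriv hud
      ((hat x hx).of_le (by exact_mod_cast hi)) (hsub hx)]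
    exact hC i hi x (hsub hx)
  have h2 : ∀ x ∈ ball (0 : ℂ) τ, ContDiffAt ℝ 2 f x := fun x hx =>
    (hat x hx).of_le (by exact_mod_cast hn)
  have hd : ∀ x ∈ ball (0 : ℂ) τ, DifferentiableAt ℝ f x := fun x hx =>
    (h2 x hx).differentiableAt (by norm_num)
  have h0 := mem_ball_self (x := (0 : ℂ)) hτ
  refine ⟨hd, fun x hx => ?_, fun x hx => ?_, fun x hx => ?_⟩
  · have := hit 0 (by omega) x hx
    rwa [norm_iteratedFDeriv_zero, Real.norm_eq_abs] at this
  · refine (norm_dz_ofReal_le (hd x hx)).trans ?_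
    rw [← norm_iteratedFDeriv_one]
    exact hit 1 (by omega) x hx
  · refine (norm_dz_ofReal_sub_le (hd x hx) (hd 0 h0)).trans ?_
    have := (convex_ball (0 : ℂ) τ).norm_image_sub_le_of_norm_fderiv_le (𝕜 := ℝ)
      (f := fderiv ℝ f) (C := C)
      (fun y hy => ((h2 y hy).fderiv_right (m := 1) (by norm_num)).differentiableAt (by norm_num))
      (fun y hy => by
        rw [← norm_iteratedFDeriv_one, norm_iteratedFDeriv_fderiv]
        exact hit 2 hn y hy) h0 hx
    rwa [sub_zero] at this

lemma C1Bound.mono {r r' K : ℝ} {f : ℂ → ℝ} (hf : C1Bound r K f) (h : r' ≤ r) : C1Bound r' K f :=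
  ⟨fun x hx => hf.diff x (ball_subset_ball h hx), fun x hx => hf.bdd x (ball_subset_ball h hx),
    fun x hx => hf.dz_le x (ball_subset_ball h hx), fun x hx => hf.dz_sub_le x (ball_subset_ball h hx)⟩

lemma hasWirt_const_mul_id (c y : ℂ) : HasWirt (fun z => c * z) c 0 y := by
  simpa using (hasWirt_id y).const_mul c

lemma HasWirt.comp_mul_left {g : ℂ → ℂ} {a b c y : ℂ} (hg : HasWirt g a b (c * y)) :
    HasWirt (fun z => g (c * z)) (a * c) (b * conj c) y := by
  refine (HasFDerivAt.comp y hg (hasWirt_const_mul_id c y)).congr_fderiv ?_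
  ext ω; simp; ring

lemma dz_comp_mul_left {f : ℂ → ℝ} {c y : ℂ} (hf : DifferentiableAt ℝ f (c * y)) :
    dz (fun z => (f (c * z) : ℂ)) y = dz (fun z => (f z : ℂ)) (c * y) * c :=
  (hf.hasWirt_coe.comp_mul_left).dz

lemma lap_comp_mul_left_add {f : ℂ → ℝ} (hf : ContDiff ℝ 2 f) (c : ℂ) (b : ℝ) (z : ℂ) :
    lap (fun y => f (c * y) + b) z = ‖c‖ ^ 2 * lap f (c * z) := by
  have hg : ContDiff ℝ 2 fun y => f (c * y) + b := by fun_prop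
  have h1 := dzb_dz_ofReal hg z
  have e : dz (fun y => ((f (c * y) + b : ℝ) : ℂ)) = fun y => c * dz (fun z => (f z : ℂ)) (c * y) := by
    funext y
    have h2 := ((hf.differentiable (by norm_num) (c * y)).hasWirt_coe.comp_mul_left).add
      (hasWirt_const b y)
    simp only [Complex.ofReal_add]
    rw [h2.dz]; ring
  have h3 : ContDiff ℝ 1 (dz fun z => (f z : ℂ)) := ContDiff.dz (n := 1) (contDiff_coe hf)
  have h4 := (((h3.hasWirt (by norm_num) (c * z)).comp_mul_left).const_mul c).dzb
  rw [e, h4, dzb_dz_ofReal hf] at h1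
  have h5 : c * (lap f (c * z) / 4 * conj c) = ((‖c‖ ^ 2 * lap f (c * z) / 4 : ℝ) : ℂ) := by
    have := Complex.mul_conj c
    rw [Complex.normSq_eq_norm_sq] at this
    push_cast at this ⊢
    linear_combination (lap f (c * z) / 4 : ℂ) * this
  rw [h5] at h1
  have h6 : ‖c‖ ^ 2 * lap f (c * z) / 4 = lap (fun y => f (c * y) + b) z / 4 := by exact_mod_cast h1
  linarith

lemma lap_sub_comp_mul_left_add {f g : ℂ → ℝ} {τ : ℝ} (hf : ContDiffOn ℝ 2 f (ball (0 : ℂ) τ))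
    (hg : ContDiffOn ℝ 2 g (ball (0 : ℂ) τ)) (c : ℂ) (b : ℝ) {z : ℂ} (hz : c * z ∈ ball (0 : ℂ) τ) :
    lap (fun y => f (c * y) - g (c * y) + b) z = ‖c‖ ^ 2 * (lap f (c * z) - lap g (c * z)) := by
  have hz' := hz
  rw [mem_ball, dist_zero_right] at hz'
  obtain ⟨r, hr1, hr2⟩ := exists_between hz'
  have hr0 : 0 < r := (norm_nonneg _).trans_lt hr1
  obtain ⟨f', hf', hfe⟩ := exists_contDiff_eqOn_ball (n := 2) hr0 hr2 hf
  obtain ⟨g', hg', hge⟩ := exists_contDiff_eqOn_ball (n := 2) hr0 hr2 hg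
  have hzr : ball (0 : ℂ) r ∈ nhds (c * z) := isOpen_ball.mem_nhds (by simpa using hr1)
  have hfn : f' =ᶠ[nhds (c * z)] f := hfe.eventuallyEq_of_mem hzr
  have hgn : g' =ᶠ[nhds (c * z)] g := hge.eventuallyEq_of_mem hzr
  have ht : Tendsto (fun y => c * y) (nhds z) (nhds (c * z)) := by
    exact (continuous_const.mul continuous_id).tendsto z
  have h : (fun y => f (c * y) - g (c * y) + b) =ᶠ[nhds z]
      fun y => (fun x => f' x - g' x) (c * y) + b := by
    filter_upwards [ht.eventually hfn, ht.eventually hgn] with y h1 h2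
    simp only [h1, h2]
  rw [h.lap_eq, lap_comp_mul_left_add (hf'.sub hg'), lap_sub hf' hg', hfn.lap_eq, hgn.lap_eq]

lemma lintegral_comp_mul_left {G : ℂ → ENNReal} (hG : Measurable G) {c : ℂ} (hc : c ≠ 0) :
    ∫⁻ z, G (c * z) = ENNReal.ofReal ((‖c‖ ^ 2)⁻¹) * ∫⁻ z, G z := by
  have hdet : LinearMap.det (LinearMap.mulLeft ℝ c) = ‖c‖ ^ 2 := by
    rw [← Complex.normSq_eq_norm_sq, ← Algebra.norm_complex_apply]
    rfl
  have hne : ‖c‖ ^ 2 ≠ 0 := by simpa using hc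
  have h := Measure.map_linearMap_addHaar_eq_smul_addHaar (volume : Measure ℂ)
    (f := LinearMap.mulLeft ℝ c) (by rw [hdet]; exact hne)
  have hm : Measurable fun z : ℂ => c * z := by fun_prop
  have h2 : ∫⁻ z, G z ∂(Measure.map (fun z : ℂ => c * z) volume) = ∫⁻ z, G (c * z) :=
    lintegral_map hG hm
  rw [← h2]
  have h3 : Measure.map (fun z : ℂ => c * z) volume =
      ENNReal.ofReal ((‖c‖ ^ 2)⁻¹) • (volume : Measure ℂ) := by
    rw [hdet, abs_of_nonneg (by positivity)] at h
    exact h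
  rw [h3, lintegral_smul_measure, smul_eq_mul]

lemma le_mul_log_of_le_neg_log {τ δ μ : ℝ} (hδ : 0 < δ) (hδτ : δ ≤ τ ^ 2 / 4)
    (hμ : μ ≤ -4 * Real.log δ) : μ ≤ 8 * Real.log (τ / (2 * δ)) := by
  have h1 : Real.log (δ⁻¹) ≤ Real.log ((τ / (2 * δ)) ^ 2) := by
    refine Real.log_le_log (by positivity) ?_
    rw [div_pow, le_div_iff₀ (by positivity)]
    have : δ⁻¹ * (2 * δ) ^ 2 = 4 * δ := by field_simp; ring
    rw [this]; linarith
  rw [Real.log_inv, Real.log_pow] at h1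
  push_cast at h1
  linarith

lemma lintegral_dens_le {τ δ C P : ℝ} {N : ℕ} {H U φ v : ℂ → ℝ} {c : ℂ} (hτ : 0 < τ)
    (hC : 0 < C) (hcδ : ‖c‖ = δ) (hδ : 0 < δ)
    (hU : ContinuousOn U (ball 0 τ)) (hφ : ContinuousOn φ (ball 0 τ))
    (hH : ∀ x ∈ ball (0 : ℂ) τ, 1 / C ≤ H x) (hP : ∀ x ∈ ball (0 : ℂ) τ, |φ x| ≤ P)
    (hmass : ∫⁻ x in ball (0 : ℂ) τ, ENNReal.ofReal (H x * Real.exp (U x)) ≤ ENNReal.ofReal C)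
    (hv : ∀ y, v y = U (c * y) - φ (c * y) + 2 * (N + 1) * Real.log δ) :
    ∫⁻ z in ball (0 : ℂ) (τ / δ), dens N v z ≤
      ENNReal.ofReal (τ ^ (2 * N) * Real.exp P * C * C) := by
  have hc0 : c ≠ 0 := by rw [← norm_pos_iff, hcδ]; exact hδ
  set g : ℂ → ENNReal := fun x => ENNReal.ofReal (‖x‖ ^ (2 * N) * Real.exp (U x - φ x)) with hg
  have hgc : ContinuousOn g (ball 0 τ) := by
    refine ENNReal.continuous_ofReal.comp_continuousOn ?_
    exact ContinuousOn.mul (by fun_prop) (Real.continuous_exp.comp_continuousOn (hU.sub hφ))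
  set G : ℂ → ENNReal := (ball (0 : ℂ) τ).indicator g with hG
  have hGm : Measurable G := by
    classical
    rw [hG, ← piecewise_eq_indicator]
    exact hgc.measurable_piecewise continuousOn_const measurableSet_ball
  have h1 : ∫⁻ z in ball (0 : ℂ) (τ / δ), dens N v z =
      ∫⁻ z, ENNReal.ofReal (δ ^ 2) * G (c * z) := by
    rw [← lintegral_indicator measurableSet_ball]
    congr 1
    funext z
    have hiff : z ∈ ball (0 : ℂ) (τ / δ) ↔ c * z ∈ ball (0 : ℂ) τ := by
      rw [mem_ball, mem_ball, dist_zero_right, dist_zero_right, norm_mul, hcδ, lt_div_iff₀ hδ,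
        mul_comm]
    by_cases hz : z ∈ ball (0 : ℂ) (τ / δ)
    · rw [indicator_of_mem hz, hG, indicator_of_mem (hiff.1 hz), dens_eq, hg,
        ← ENNReal.ofReal_mul (by positivity)]
      congr 1
      rw [hv, Real.exp_add]
      have : Real.exp (2 * (N + 1) * Real.log δ) = δ ^ (2 * N + 2) := by
        rw [← Real.exp_log (pow_pos hδ (2 * N + 2)), Real.log_pow]
        push_cast; ring_nf
      rw [this, norm_mul, hcδ]
      ring
    · rw [indicator_of_notMem hz, hG, indicator_of_notMem (fun h => hz (hiff.2 h)), mul_zero]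
  rw [h1, lintegral_const_mul _ (by fun_prop), lintegral_comp_mul_left hGm hc0, ← mul_assoc,
    ← ENNReal.ofReal_mul (by positivity), hcδ, mul_inv_cancel₀ (by positivity), ENNReal.ofReal_one,
    one_mul, hG, lintegral_indicator measurableSet_ball]
  have hle : ∀ x ∈ ball (0 : ℂ) τ, g x ≤
      ENNReal.ofReal (τ ^ (2 * N) * Real.exp P * C) * ENNReal.ofReal (H x * Real.exp (U x)) := by
    intro x hx
    rw [hg, ← ENNReal.ofReal_mul (by positivity)]
    refine ENNReal.ofReal_le_ofReal ?_
    have h2 : ‖x‖ ≤ τ := by simpa using (mem_ball.1 hx).le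
    have h3 : Real.exp (U x - φ x) ≤ Real.exp P * Real.exp (U x) := by
      rw [← Real.exp_add, Real.exp_le_exp]
      linarith [(abs_le.1 (hP x hx)).1]
    have h4 : 1 ≤ C * H x := by
      have := hH x hx
      rw [div_le_iff₀ hC] at this
      linarith
    calc ‖x‖ ^ (2 * N) * Real.exp (U x - φ x) ≤ τ ^ (2 * N) * (Real.exp P * Real.exp (U x)) := by
          gcongr
      _ ≤ τ ^ (2 * N) * (Real.exp P * Real.exp (U x)) * (C * H x) :=
          le_mul_of_one_le_right (by positivity) h4
      _ = _ := by ring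
  calc _ ≤ ∫⁻ x in ball (0 : ℂ) τ,
        ENNReal.ofReal (τ ^ (2 * N) * Real.exp P * C) * ENNReal.ofReal (H x * Real.exp (U x)) :=
        setLIntegral_mono' measurableSet_ball hle
    _ = ENNReal.ofReal (τ ^ (2 * N) * Real.exp P * C) *
        ∫⁻ x in ball (0 : ℂ) τ, ENNReal.ofReal (H x * Real.exp (U x)) :=
        lintegral_const_mul' _ _ ENNReal.ofReal_ne_top
    _ ≤ _ := by
        rw [ENNReal.ofReal_mul (p := τ ^ (2 * N) * Real.exp P * C) (by positivity)]
        exact mul_le_mul' le_rfl hmass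

lemma localBubbleData_of_blowup {τ C P K A : ℝ} {N : ℕ} (hτ : 0 < τ) (hN : 1 ≤ N) (hC : 0 < C)
    (hP : 0 ≤ P) (hK : 0 ≤ K) :
    ∃ B : ℝ, 1 ≤ B ∧ (1 + K) * (2 * K + 1) * τ ≤ B ∧ ∀ {δ μ : ℝ} {c : ℂ} {H U φ v κ : ℂ → ℝ},
      ‖c‖ = δ → 0 < δ → δ ≤ 1 → δ ≤ τ ^ 2 / 4 → δ ≤ τ / 128 →
      ContDiffOn ℝ 2 U (ball 0 τ) → ContDiffOn ℝ 2 φ (ball 0 τ) → ContDiffOn ℝ 1 H (ball 0 τ) →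
      (∀ x ∈ ball (0 : ℂ) τ, lap φ x = 0) →
      (∀ x ∈ ball (0 : ℂ) τ, lap U x + ‖x‖ ^ (2 * N) * H x * Real.exp (U x) = 0) →
      (∀ x ∈ ball (0 : ℂ) τ, 1 / C ≤ H x) → (∀ x ∈ ball (0 : ℂ) τ, |φ x| ≤ P) →
      C1Bound (τ / 2) K (fun x => H x * Real.exp (φ x)) →
      ∫⁻ x in ball (0 : ℂ) τ, ENNReal.ofReal (H x * Real.exp (U x)) ≤ ENNReal.ofReal C →
      (∀ x ∈ closedBall (0 : ℂ) (τ / 2) \ ball 0 (τ / 16), U x ≤ A) →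
      IsLocalMax (fun x => U x - φ x) c →
      μ = U c - φ c + 2 * (N + 1) * Real.log δ → 0 ≤ μ → μ ≤ -4 * Real.log δ →
      (∀ y, v y = U (c * y) - φ (c * y) + 2 * (N + 1) * Real.log δ) →
      (∀ y, κ y = H (c * y) * Real.exp (φ (c * y))) →
      LocalBubbleData N B (τ / (2 * δ)) (τ / δ) μ v κ := by
  set B₁ : ℝ := τ ^ (2 * N) * Real.exp P * C * C with hB₁
  set B₂ : ℝ := C * Real.exp P with hB₂
  set B₃ : ℝ := (1 + K) * (2 * K + 1) * τ with hB₃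
  have h1 : 0 < B₁ := by positivity
  have h2 : 0 < B₂ := by positivity
  have h3 : 0 < B₃ := by positivity
  have hKτ : 0 ≤ K * τ := by positivity
  have hA := abs_nonneg A
  have hA' := le_abs_self A
  refine ⟨8 + K + K * τ + B₁ + B₂ + B₃ + |A| + P, by linarith, by linarith, ?_⟩
  intro δ μ c H U φ v κ hcδ hδ hδ1 hδ2 hδ3 hU hφ hH hφh hUp hHC hφP hκb hmass hout hmax hμ hμ0 hμδ hv hκ
  set B : ℝ := 8 + K + K * τ + B₁ + B₂ + B₃ + |A| + P with hB
  have hR2 : τ / (2 * δ) < τ / δ := by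
    rw [div_lt_div_iff₀ (by positivity) hδ]
    nlinarith [mul_pos hτ hδ]
  have hR64 : 64 ≤ τ / (2 * δ) := by
    rw [le_div_iff₀ (by positivity)]; linarith
  have hvf : v = fun y => U (c * y) - φ (c * y) + 2 * (N + 1) * Real.log δ := funext hv
  have hκf : κ = fun y => H (c * y) * Real.exp (φ (c * y)) := funext hκ
  have hmaps : ∀ z ∈ ball (0 : ℂ) (τ / δ), c * z ∈ ball (0 : ℂ) τ := fun z hz => by
    rw [mem_ball, dist_zero_right, lt_div_iff₀ hδ] at hz
    rw [mem_ball, dist_zero_right, norm_mul, hcδ, mul_comm]; exact hz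
  have hmaps2 : ∀ z ∈ ball (0 : ℂ) (τ / (2 * δ)), c * z ∈ ball (0 : ℂ) (τ / 2) := fun z hz => by
    rw [mem_ball, dist_zero_right, lt_div_iff₀ (by positivity)] at hz
    rw [mem_ball, dist_zero_right, norm_mul, hcδ]; linarith
  have hsub : ball (0 : ℂ) (τ / 2) ⊆ ball 0 τ := ball_subset_ball (by linarith)
  have hlin : ContDiff ℝ 2 fun y : ℂ => c * y := by fun_prop
  have hvc : ContDiffOn ℝ 2 v (ball 0 (τ / δ)) := by
    rw [hvf]
    exact ((hU.comp hlin.contDiffOn hmaps).sub (hφ.comp hlin.contDiffOn hmaps)).add contDiffOn_const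
  have hκc : ContDiffOn ℝ 1 κ (ball 0 (τ / δ)) := by
    rw [hκf]
    have hlin1 : ContDiff ℝ 1 fun y : ℂ => c * y := by fun_prop
    exact (hH.comp hlin1.contDiffOn hmaps).mul
      (((hφ.of_le (by norm_num)).comp hlin1.contDiffOn hmaps).exp)
  refine ⟨hN, by linarith, hR64, hR2, hvc, hκc, fun z hz => ?_, fun z hz => ?_, fun z hz => ?_,
    fun z hz => ?_, ?_, ?_, ?_, fun z hz hzR => ?_, hμ0, ?_⟩
  · have hz' := hsub (hmaps2 z hz)
    rw [hvf, lap_sub_comp_mul_left_add hU hφ c _ hz', hφh _ hz', hκ]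
    have e1 : lap U (c * z) = -(‖c * z‖ ^ (2 * N) * H (c * z) * Real.exp (U (c * z))) := by
      linarith [hUp _ hz']
    have e2 : Real.exp (U (c * z) - φ (c * z) + 2 * (N + 1) * Real.log δ) =
        Real.exp (U (c * z)) * (Real.exp (φ (c * z)))⁻¹ * δ ^ (2 * N + 2) := by
      rw [Real.exp_add, Real.exp_sub, div_eq_mul_inv]
      congr 1
      rw [← Real.exp_log (pow_pos hδ (2 * N + 2)), Real.log_pow]
      push_cast; ring_nf
    rw [e1, e2, norm_mul, hcδ]
    have := (Real.exp_pos (φ (c * z))).ne'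
    field_simp
    ring
  · have hz' := hsub (hmaps2 z hz)
    rw [hκ]
    have h4 : Real.exp (-P) ≤ Real.exp (φ (c * z)) :=
      Real.exp_le_exp.2 (abs_le.1 (hφP _ hz')).1
    calc B⁻¹ ≤ B₂⁻¹ := inv_anti₀ h2 (by linarith)
      _ = 1 / C * Real.exp (-P) := by rw [hB₂, mul_inv, Real.exp_neg, one_div]
      _ ≤ _ := mul_le_mul (hHC _ hz') h4 (Real.exp_pos _).le
          ((by positivity : (0 : ℝ) ≤ 1 / C).trans (hHC _ hz'))
  · rw [hκ]
    have := (abs_le.1 (hκb.bdd _ (hmaps2 z hz))).2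
    linarith
  · have hz' := hmaps2 z hz
    rw [hκf, dz_comp_mul_left (f := fun x => H x * Real.exp (φ x)) (hκb.diff _ hz'), norm_mul, hcδ]
    have h4 := hκb.dz_le _ hz'
    rw [le_div_iff₀ (by positivity)]
    calc _ ≤ K * δ * (τ / (2 * δ)) := by gcongr
      _ = K * τ / 2 := by field_simp
      _ ≤ B := by linarith
  · calc _ ≤ ∫⁻ z in ball (0 : ℂ) (τ / δ), dens N v z :=
          lintegral_mono_set (ball_subset_ball hR2.le)
      _ ≤ ENNReal.ofReal B₁ := lintegral_dens_le hτ hC hcδ hδ hU.continuousOn hφ.continuousOn hHC hφP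
          hmass hv
      _ ≤ _ := ENNReal.ofReal_le_ofReal (by linarith)
  · rw [hv, mul_one, hμ]
  · have h1b : (1 : ℂ) ∈ ball (0 : ℂ) (τ / δ) := by
      rw [mem_ball, dist_zero_right, norm_one]; linarith
    have hd : DifferentiableAt ℝ v 1 :=
      (hvc.contDiffAt (isOpen_ball.mem_nhds h1b)).differentiableAt (by norm_num)
    have hm : IsLocalMax v 1 := by
      have ht : Tendsto (fun y => c * y) (nhds 1) (nhds c) := by
        simpa using (by fun_prop : Continuous fun y : ℂ => c * y).tendsto 1
      filter_upwards [ht.eventually hmax] with y hy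
      rw [hv, hv, mul_one]
      simpa using hy
    rw [hd.hasFDerivAt.hasWirt_ofReal.dz, hm.fderiv_eq_zero]
    simp
  · have hz' := hmaps2 z hz
    rw [hv]
    have h4 := hout (c * z) ⟨ball_subset_closedBall hz', fun h => by
      rw [mem_ball, dist_zero_right, norm_mul, hcδ] at h
      have : τ / (2 * δ) / 8 * δ = τ / 16 := by field_simp; norm_num
      nlinarith⟩
    have h5 := (abs_le.1 (hφP _ (hsub hz'))).1
    have h6 : Real.log δ ≤ 0 := Real.log_nonpos hδ.le hδ1
    have h7 : 2 * ((N : ℝ) + 1) * Real.log δ ≤ 0 := mul_nonpos_of_nonneg_of_nonpos (by positivity) h6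
    linarith
  · have h4 := le_mul_log_of_le_neg_log hδ hδ2 hμδ
    have h5 : 0 ≤ Real.log (τ / (2 * δ)) := Real.log_nonneg (by linarith)
    have : 8 * Real.log (τ / (2 * δ)) ≤ B * Real.log (τ / (2 * δ)) := by
      gcongr; linarith
    linarith

lemma abs_sub_circleAverage_le {τ C : ℝ} {U f : ℂ → ℝ} (hτ : 0 < τ)
    (hf : ContinuousOn f (closedBall (0 : ℂ) τ))
    (hosc : ∀ x ∈ sphere (0 : ℂ) τ, ∀ y ∈ sphere (0 : ℂ) τ, |U x - U y| ≤ C)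
    (hfU : ∀ x ∈ sphere (0 : ℂ) τ, f x = U x - (1 / (2 * Real.pi)) *
      ∫ θ in (0 : ℝ)..(2 * Real.pi), U (τ * Complex.exp (θ * Complex.I))) :
    ∀ x ∈ sphere (0 : ℂ) τ, |f x| ≤ C := by
  intro x hx
  set m : ℝ := (1 / (2 * Real.pi)) *
    ∫ θ in (0 : ℝ)..(2 * Real.pi), U (τ * Complex.exp (θ * Complex.I)) with hm
  have hπ := Real.pi_pos
  have hmem : ∀ θ : ℝ, (τ * Complex.exp (θ * Complex.I) : ℂ) ∈ sphere (0 : ℂ) τ := fun θ => by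
    simp [Complex.norm_exp_ofReal_mul_I, abs_of_pos hτ]
  have hc : Continuous fun θ : ℝ => U (τ * Complex.exp (θ * Complex.I)) := by
    have h1 : Continuous fun θ : ℝ => f (τ * Complex.exp (θ * Complex.I)) + m := by
      refine Continuous.add ?_ continuous_const
      exact hf.comp_continuous (by fun_prop) fun θ => sphere_subset_closedBall (hmem θ)
    refine h1.congr fun θ => ?_
    rw [hfU _ (hmem θ)]
    ring
  have hi := hc.intervalIntegrable (μ := volume) 0 (2 * Real.pi)
  have h2 : f x = (1 / (2 * Real.pi)) *
      ∫ θ in (0 : ℝ)..(2 * Real.pi), (U x - U (τ * Complex.exp (θ * Complex.I))) := by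
    rw [intervalIntegral.integral_sub (by simp) hi, hfU x hx]
    simp only [intervalIntegral.integral_const, smul_eq_mul, sub_zero]
    rw [mul_sub, ← hm]
    field_simp
  have h3 := intervalIntegral.norm_integral_le_of_norm_le_const (a := (0 : ℝ)) (b := 2 * Real.pi)
    (f := fun θ : ℝ => U x - U (τ * Complex.exp (θ * Complex.I))) (C := C)
    fun θ _ => hosc x hx _ (hmem θ)
  rw [h2, abs_mul, abs_of_pos (by positivity)]
  rw [sub_zero, abs_of_pos (by positivity), Real.norm_eq_abs] at h3
  calc _ ≤ 1 / (2 * Real.pi) * (C * (2 * Real.pi)) := by gcongr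
    _ = C := by field_simp

lemma lintegral_mul_exp_le {τ C m : ℝ} {H U : ℂ → ℝ} (hH : ContinuousOn H (ball (0 : ℂ) τ))
    (hU : ContinuousOn U (ball (0 : ℂ) τ)) (hH0 : ∀ x ∈ ball (0 : ℂ) τ, 0 ≤ H x)
    (hHC : ∀ x ∈ ball (0 : ℂ) τ, H x ≤ C) (hUm : ∀ x ∈ ball (0 : ℂ) τ, U x ≤ m)
    (hint : (∫ x in ball (0 : ℂ) τ, H x * Real.exp (U x)) ≤ C) :
    ∫⁻ x in ball (0 : ℂ) τ, ENNReal.ofReal (H x * Real.exp (U x)) ≤ ENNReal.ofReal C := by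
  have hc : ContinuousOn (fun x => H x * Real.exp (U x)) (ball (0 : ℂ) τ) :=
    hH.mul (Real.continuous_exp.comp_continuousOn hU)
  have hi : IntegrableOn (fun x => H x * Real.exp (U x)) (ball (0 : ℂ) τ) := by
    refine IntegrableOn.of_bound measure_ball_lt_top
      (hc.aestronglyMeasurable measurableSet_ball) (C * Real.exp m) ?_
    refine (ae_restrict_iff' measurableSet_ball).2 (ae_of_all _ fun x hx => ?_)
    have h0 := hH0 x hx
    rw [Real.norm_eq_abs, abs_of_nonneg (by positivity)]
    exact mul_le_mul (hHC x hx) (Real.exp_le_exp.2 (hUm x hx)) (Real.exp_pos _).le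
      (h0.trans (hHC x hx))
  rw [← ofReal_integral_eq_lintegral_ofReal hi]
  · exact ENNReal.ofReal_le_ofReal hint
  · refine (ae_restrict_iff' measurableSet_ball).2 (ae_of_all _ fun x hx => ?_)
    have h0 := hH0 x hx
    simp only [Pi.zero_apply]
    positivity

lemma le_biSup_of_pos {α : Type*} {s : Set α} {f : α → ℝ} (h : 0 < ⨆ y ∈ s, f y) {y : α}
    (hy : y ∈ s) : f y ≤ ⨆ y ∈ s, f y := by
  have hb : BddAbove (range fun y => ⨆ (_ : y ∈ s), f y) := by
    by_contra hb
    rw [Real.iSup_of_not_bddAbove hb] at h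
    exact lt_irrefl _ h
  have := le_ciSup hb y
  rwa [ciSup_pos hy] at this

lemma exists_le_norm_pow_sub_one {N : ℕ} {d : ℝ} (hd : 0 < d)
    (h : ∀ l : Fin (N + 1), l ≠ 0 →
      3 * d ≤ ‖Complex.exp (2 * Real.pi * (l : ℕ) / (N + 1) * Complex.I) - 1‖) :
    ∃ a : ℝ, 0 < a ∧ ∀ z : ℂ, d / 16 ≤ ‖z - 1‖ → ‖z - 1‖ ≤ 2 * d → a ≤ ‖z ^ (N + 1) - 1‖ := by
  have hK : IsCompact (closedBall (1 : ℂ) (2 * d) ∩ {z | d / 16 ≤ ‖z - 1‖}) :=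
    (isCompact_closedBall _ _).inter_right (isClosed_le continuous_const (by fun_prop))
  have hne : (closedBall (1 : ℂ) (2 * d) ∩ {z | d / 16 ≤ ‖z - 1‖}).Nonempty := by
    refine ⟨1 + d, ?_, ?_⟩
    · simp [abs_of_pos hd]; linarith
    · simp [abs_of_pos hd]; linarith
  obtain ⟨z₀, hz₀, hmin⟩ := hK.exists_isMinOn hne
    (f := fun z : ℂ => ‖z ^ (N + 1) - 1‖) (by fun_prop)
  refine ⟨‖z₀ ^ (N + 1) - 1‖, ?_, fun z h1 h2 => hmin ⟨by simpa [dist_eq_norm] using h2, h1⟩⟩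
  rw [norm_pos_iff]
  intro h0
  have hp := Complex.isPrimitiveRoot_exp (N + 1) (Nat.succ_ne_zero N)
  obtain ⟨i, hi, he⟩ := hp.eq_pow_of_pow_eq_one (sub_eq_zero.1 h0)
  rw [← Complex.exp_nat_mul] at he
  have he' : Complex.exp (2 * Real.pi * (i : ℕ) / (N + 1) * Complex.I) = z₀ := by
    rw [← he]
    congr 1
    push_cast
    ring
  have hz1 : d / 16 ≤ ‖z₀ - 1‖ := hz₀.2
  have hz2 : ‖z₀ - 1‖ ≤ 2 * d := by simpa [dist_eq_norm] using hz₀.1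
  rcases Nat.eq_zero_or_pos i with hi0 | hi0
  · subst hi0
    have : z₀ = 1 := by rw [← he']; simp
    rw [this] at hz1
    simp at hz1
    linarith
  · have := h ⟨i, hi⟩ (by simpa [Fin.ext_iff] using hi0.ne')
    simp only [he'] at this
    linarith

lemma le_norm_exp_sub_one_of_tendsto {N : ℕ} {d : ℝ} {p Q : ℕ → Fin (N + 1) → ℂ} {δ θ : ℕ → ℝ}
    (hlim : ∀ l : Fin (N + 1), Tendsto (fun k => p k l / (δ k : ℂ) -
      Complex.exp ((θ k + 2 * Real.pi * (l : ℕ) / (N + 1)) * Complex.I)) atTop (nhds 0))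
    (hQ : ∀ k l, Q k l = Complex.exp (-θ k * Complex.I) * p k l / (δ k : ℂ))
    (h : ∀ᶠ k in atTop, ∀ l : Fin (N + 1), l ≠ 0 → Q k l ∉ ball (1 : ℂ) d)
    (l : Fin (N + 1)) (hl : l ≠ 0) :
    d ≤ ‖Complex.exp (2 * Real.pi * (l : ℕ) / (N + 1) * Complex.I) - 1‖ := by
  set e := Complex.exp (2 * Real.pi * (l : ℕ) / (N + 1) * Complex.I) with he
  have h1 : Tendsto (fun k => Q k l - e) atTop (nhds 0) := by
    rw [tendsto_zero_iff_norm_tendsto_zero]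
    refine (tendsto_zero_iff_norm_tendsto_zero.1 (hlim l)).congr fun k => ?_
    have h2 : Q k l - e = Complex.exp ((-θ k : ℝ) * Complex.I) * (p k l / (δ k : ℂ) -
        Complex.exp ((θ k + 2 * Real.pi * (l : ℕ) / (N + 1)) * Complex.I)) := by
      rw [mul_sub, ← Complex.exp_add, hQ, he]
      push_cast
      congr 1
      · ring
      · congr 1; ring
    rw [h2, norm_mul, Complex.norm_exp_ofReal_mul_I, one_mul]
  have h3 : Tendsto (fun k => Q k l) atTop (nhds e) := tendsto_sub_nhds_zero_iff.1 h1
  have h4 : e ∈ (ball (1 : ℂ) d)ᶜ := isOpen_ball.isClosed_compl.mem_of_tendsto h3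
    (h.mono fun k hk => hk l hl)
  simpa [dist_eq_norm] using h4

lemma C1Bound.norm_dz_comp_mul_left_le {r K δ : ℝ} {h : ℂ → ℝ} (hr : 0 < r) (hh : C1Bound r K h)
    {c z : ℂ} (hδ : ‖c‖ = δ) (hz : c * z ∈ ball (0 : ℂ) r) :
    ‖dz (fun y => (h (c * y) : ℂ)) z‖ ≤
      (1 + K) * (2 * ‖dz (fun y => (h y : ℂ)) 0‖ * δ + δ ^ 2) * (1 + ‖z‖) := by
  have hK := hh.nonneg hr
  have h0 : 0 ≤ δ := hδ ▸ norm_nonneg c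
  rw [dz_comp_mul_left (hh.diff _ hz), norm_mul, hδ]
  have h1 := hh.dz_sub_le _ hz
  have h2 := norm_sub_norm_le (dz (fun y => (h y : ℂ)) (c * z)) (dz (fun y => (h y : ℂ)) 0)
  rw [norm_mul, hδ] at h1
  set a := ‖dz (fun y => (h y : ℂ)) 0‖
  have ha : 0 ≤ a := norm_nonneg _
  have hzn := norm_nonneg z
  calc _ ≤ (a + K * (δ * ‖z‖)) * δ := by gcongr; linarith
    _ ≤ _ := by
      have e : (1 + K) * (2 * a * δ + δ ^ 2) * (1 + ‖z‖) - (a + K * (δ * ‖z‖)) * δ =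
        a * δ + 2 * a * δ * ‖z‖ + 2 * a * δ * K * (1 + ‖z‖) + δ ^ 2 * (1 + K + ‖z‖) := by ring
      have : 0 ≤ a * δ + 2 * a * δ * ‖z‖ + 2 * a * δ * K * (1 + ‖z‖) + δ ^ 2 * (1 + K + ‖z‖) := by
        positivity
      linarith

lemma le_neg_four_log {δ μ : ℝ} (hδ : 0 < δ) (hμ : 0 < μ)
    (h : δ / (Real.exp (-μ / 2) * Real.sqrt μ) ≤ 1) : μ ≤ -4 * Real.log δ := by
  have hs := Real.sqrt_pos.2 hμ
  rw [div_le_one (by positivity)] at h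
  have h1 := Real.log_le_log hδ h
  rw [Real.log_mul (Real.exp_pos _).ne' hs.ne', Real.log_exp, Real.log_sqrt hμ.le] at h1
  have h2 : Real.log μ ≤ μ / 2 := by
    have h5 : Real.log (μ / 2) ≤ μ / 2 - 1 := Real.log_le_sub_one_of_pos (by positivity)
    rw [Real.log_div hμ.ne' two_ne_zero] at h5
    have h6 := Real.log_two_lt_d9
    linarith
  linarith

lemma log_exp_div_eq_bub (N : ℕ) {κ μ : ℝ} (hκ : 0 < κ) (y : ℂ) :
    Real.log (Real.exp μ / (1 + Real.exp μ * κ / (8 * (1 + N) ^ 2) * ‖y ^ (N + 1) - 1‖ ^ 2) ^ 2) =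
      bub N (κ / (8 * (N + 1) ^ 2)) μ y := by
  have h : 0 < 1 + Real.exp μ * κ / (8 * (1 + N) ^ 2) * ‖y ^ (N + 1) - 1‖ ^ 2 := by positivity
  rw [Real.log_div (Real.exp_pos _).ne' (by positivity), Real.log_exp, Real.log_pow, bub, bubDen]
  push_cast
  congr 4
  ring

lemma norm_grad_div_sub {f g : ℂ → ℝ} {y : ℂ} (hf : DifferentiableAt ℝ f y)
    (hg : DifferentiableAt ℝ g y) {M : ℝ} (hM : 0 < M) :
    ‖grad (fun z => (f z - g z) / M) y‖ =
      2 * ‖dz (fun z => (f z : ℂ)) y - dz (fun z => (g z : ℂ)) y‖ / M := by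
  have h1 : DifferentiableAt ℝ (fun z => (f z - g z) / M) y := by
    simp only [div_eq_mul_inv]; fun_prop
  have h2 : (fun z => (((f z - g z) / M : ℝ) : ℂ)) =
      fun z => (M⁻¹ : ℂ) * ((f z : ℂ) - (g z : ℂ)) := by
    funext z; push_cast; ring
  rw [norm_grad h1, h2, ((hf.hasWirt_coe.sub hg.hasWirt_coe).const_mul (M⁻¹ : ℂ)).dz, norm_mul,
    norm_inv, Complex.norm_real, Real.norm_eq_abs, abs_of_pos hM]
  ring

/-- **Lemma 4.1**: `w̃_k → 0` and `∇w̃_k → 0` uniformly on the annulus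
`B(e₁, δ) \ B(e₁, δ/8)` for small `δ > 0`. -/
theorem tw_small_near_e1
    (τ : ℝ) (hτ : 0 < τ) (N : ℕ) (hN : 1 ≤ N)
    (H U phi : ℕ → ℂ → ℝ) (C₀ : ℝ) (hC₀ : 0 < C₀)
    (hHreg : ∀ k, ContDiffOn ℝ (N + 2) (H k) (closedBall (0 : ℂ) τ))
    (hHnorm : ∀ k, ∀ i ≤ N + 2, ∀ x ∈ closedBall (0 : ℂ) τ,
      ‖iteratedFDerivWithin ℝ i (H k) (closedBall (0 : ℂ) τ) x‖ ≤ C₀)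
    (hHpos : ∀ k, ∀ x ∈ closedBall (0 : ℂ) τ, 1 / C₀ ≤ H k x ∧ H k x ≤ C₀)
    (hUreg : ∀ k, ContDiffOn ℝ 2 (U k) (ball (0 : ℂ) τ))
    (hPDEU : ∀ k, ∀ x ∈ ball (0 : ℂ) τ,
      lap (U k) x + ‖x‖ ^ (2 * N) * H k x * Real.exp (U k x) = 0)
    (hint : ∀ k, (∫ x in ball (0 : ℂ) τ, H k x * Real.exp (U k x)) ≤ C₀)
    (hosc : ∀ k, ∀ x ∈ sphere (0 : ℂ) τ, ∀ y ∈ sphere (0 : ℂ) τ, |U k x - U k y| ≤ C₀)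
    (hloc : ∀ K : Set ℂ, K ⊆ ball (0 : ℂ) τ \ {0} → IsCompact K →
      ∃ CK : ℝ, ∀ k, ∀ x ∈ K, U k x ≤ CK)
    (hns : ∀ M₀ : ℝ, ∀ᶠ k in atTop, ∃ x ∈ ball (0 : ℂ) τ,
      M₀ < U k x + 2 * (1 + N) * Real.log ‖x‖)
    (hphic : ∀ k, ContinuousOn (phi k) (closedBall (0 : ℂ) τ))
    (hphir : ∀ k, ContDiffOn ℝ 2 (phi k) (ball (0 : ℂ) τ))
    (hphih : ∀ k, ∀ x ∈ ball (0 : ℂ) τ, lap (phi k) x = 0)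
    (hphib : ∀ k, ∀ x ∈ sphere (0 : ℂ) τ, phi k x =
      U k x - (1 / (2 * Real.pi)) * ∫ θ in (0:ℝ)..(2 * Real.pi),
        U k (τ * Complex.exp (θ * Complex.I)))
    (u h : ℕ → ℂ → ℝ)
    (hu : ∀ k x, u k x = U k x - phi k x)
    (hhd : ∀ k x, h k x = H k x * Real.exp (phi k x))
    (hh0 : Tendsto (fun k => h k 0) atTop (nhds 1))
    (p : ℕ → Fin (N + 1) → ℂ)
    (hploc : ∀ k l, IsLocalMax (u k) (p k l))
    (hp0 : ∀ l, Tendsto (fun k => p k l) atTop (nhds 0))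
    (δ θk : ℕ → ℝ)
    (hδpos : ∀ k, 0 < δ k)
    (hδ : ∀ k, δ k = ‖p k 0‖)
    (hp0e : ∀ k, p k 0 = (δ k : ℂ) * Complex.exp (θk k * Complex.I))
    (hQlim : ∀ l : Fin (N + 1), Tendsto (fun k =>
        p k l / (δ k : ℂ) -
          Complex.exp ((θk k + 2 * Real.pi * (l : ℕ) / (N + 1)) * Complex.I))
      atTop (nhds 0))
    (μ ε : ℕ → ℝ)
    (hμ : ∀ k, μ k = u k (p k 0) + 2 * (1 + N) * Real.log (δ k))
    (hμtop : Tendsto μ atTop atTop)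
    (hε : ∀ k, ε k = Real.exp (-μ k / 2))
    (v 𝔥 : ℕ → ℂ → ℝ)
    (hv : ∀ k y, v k y = u k ((δ k : ℂ) * Complex.exp (θk k * Complex.I) * y)
      + 2 * (N + 1) * Real.log (δ k))
    (hfrak : ∀ k x, 𝔥 k x = h k (Complex.exp (θk k * Complex.I) * x))
    (Q : ℕ → Fin (N + 1) → ℂ)
    (hQ : ∀ k l, Q k l = Complex.exp (-θk k * Complex.I) * p k l / (δ k : ℂ))
    (V w : ℕ → ℂ → ℝ)
    (hV : ∀ k y, V k y = Real.log (Real.exp (μ k) /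
      (1 + Real.exp (μ k) * 𝔥 k ((δ k : ℂ)) / (8 * (1 + N) ^ 2) * ‖y ^ (N + 1) - 1‖ ^ 2) ^ 2))
    (hw : ∀ k y, w k y = v k y - V k y)
    (tδ : ℕ → ℝ)
    (htδ : ∀ k, tδ k = ‖grad (𝔥 k) 0‖ * δ k + δ k ^ 2)
    (hsmall : Tendsto (fun k => δ k / (ε k * Real.sqrt (μ k))) atTop (nhds 0))
    (hbig : Tendsto (fun k => ‖grad (𝔥 k) 0‖ / δ k) atTop atTop)
    (Mk : ℕ → ℝ)
    (hMk : ∀ k, Mk k = ⨆ y ∈ closedBall (0 : ℂ) (τ / δ k), |w k y|)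
    (hMbig : Tendsto (fun k => Mk k / tδ k) atTop atTop)
    (tw : ℕ → ℂ → ℝ)
    (htw : ∀ k y, tw k y = w k y / Mk k)
 :
    ∀ δ' : ℝ, 0 < δ' →
      (∀ᶠ k in atTop, ∀ l : Fin (N + 1), l ≠ 0 → Q k l ∉ ball (1 : ℂ) (3 * δ')) →
      TendstoUniformlyOn (fun k y => tw k y) 0 atTop
        (ball (1 : ℂ) δ' \ ball (1 : ℂ) (δ' / 8)) ∧
      TendstoUniformlyOn (fun k y => grad (tw k) y) 0 atTop
        (ball (1 : ℂ) δ' \ ball (1 : ℂ) (δ' / 8)) := by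
  obtain ⟨Kφ, hKφ, hφb⟩ := exists_c1Bound_of_harmonic (C := C₀) hτ
  have hφb' := fun k => hφb (phi k) (hphic k) (hphir k) (hphih k)
    (abs_sub_circleAverage_le hτ (hphic k) (hosc k) (hphib k))
  have hcb : ball (0 : ℂ) τ ⊆ closedBall 0 τ := ball_subset_closedBall
  have hH1 : ∀ k, C1Bound (τ / 2) C₀ (H k) := fun k =>
    (c1Bound_of_norm_iteratedFDerivWithin_le hτ (n := N + 2) (by omega)
      (by exact_mod_cast hHreg k) (hHnorm k)).mono (by linarith)
  set K : ℝ := 6 * C₀ * (Real.exp Kφ * (1 + Kφ + 2 * Kφ ^ 2)) with hKdef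
  have hK0 : 0 ≤ K := by positivity
  have hh : ∀ k, C1Bound (τ / 2) K (fun x => H k x * Real.exp (phi k x)) := fun k =>
    (hH1 k).mul (by linarith) ((hφb' k).2.exp (by linarith))
  have hhk : ∀ k, h k = fun x => H k x * Real.exp (phi k x) := fun k => funext (hhd k)
  obtain ⟨A, hA⟩ := hloc (closedBall (0 : ℂ) (τ / 2) \ ball 0 (τ / 16))
    (fun x hx => ⟨closedBall_subset_ball (by linarith) hx.1, fun h0 => hx.2 (by
      rw [mem_singleton_iff.1 h0]; exact mem_ball_self (by linarith))⟩)
    ((isCompact_closedBall _ _).diff isOpen_ball)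
  obtain ⟨B, hB1, hBK, hdata⟩ := localBubbleData_of_blowup (A := A) hτ hN hC₀ hC₀.le hK0
  intro d hd hQd
  have hdist := le_norm_exp_sub_one_of_tendsto hQlim hQ hQd
  have hd23 : d ≤ 17 / 25 := by
    have hl : (⟨1, by omega⟩ : Fin (N + 1)) ≠ 0 := by simp [Fin.ext_iff]
    have h1 := hdist _ hl
    have h2 := norm_sub_le (Complex.exp (2 * Real.pi * ((⟨1, by omega⟩ : Fin (N + 1)) : ℕ) / (N + 1) *
      Complex.I)) 1
    have h3 : ‖Complex.exp (2 * Real.pi * ((⟨1, by omega⟩ : Fin (N + 1)) : ℕ) / (N + 1) *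
        Complex.I)‖ = 1 := by
      rw [← Complex.norm_exp_ofReal_mul_I (2 * Real.pi * ((⟨1, by omega⟩ : Fin (N + 1)) : ℕ) / (N + 1))]
      push_cast
      rfl
    rw [h3, norm_one] at h2
    linarith
  obtain ⟨a, ha, haz⟩ := exists_le_norm_pow_sub_one hd hdist
  set c₁ : ℝ := min (d / 16) (1 / 50) with hc₁
  have hc₁0 : 0 < c₁ := by positivity
  have hc₁d : c₁ ≤ d / 16 := min_le_left _ _
  obtain ⟨C, hC, R₀, μ₀, hunif⟩ := abs_sub_bub_le_uniform N (B := B) (by linarith) ha hc₁0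
    (min_le_right _ _)
  set e : ℕ → ℝ := fun k => (1 + K) * tδ k / Mk k + Real.log (τ / (2 * δ k)) ^ 2 / (τ / (2 * δ k)) +
    1 / (τ / (2 * δ k)) + 1 / ((τ / (2 * δ k)) ^ 2 * Mk k) with he
  have hδ0 : Tendsto δ atTop (nhds 0) := by
    have := (hp0 0).norm
    rw [norm_zero] at this
    exact this.congr fun k => (hδ k).symm
  have htδpos : ∀ k, 0 < tδ k := fun k => by
    have := hδpos k
    rw [htδ]; positivity
  have hR : Tendsto (fun k => τ / (2 * δ k)) atTop atTop := by
    have h1 : Tendsto δ atTop (nhdsWithin 0 (Ioi 0)) :=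
      tendsto_nhdsWithin_iff.2 ⟨hδ0, Eventually.of_forall hδpos⟩
    have h2 := (tendsto_inv_nhdsGT_zero.comp h1).const_mul_atTop (half_pos hτ)
    refine h2.congr fun k => ?_
    have := hδpos k
    simp only [Function.comp]
    field_simp
  have hMt : Tendsto (fun k => tδ k / Mk k) atTop (nhds 0) :=
    hMbig.inv_tendsto_atTop.congr fun k => by simp
  have hMpos : ∀ᶠ k in atTop, 0 < Mk k := by
    filter_upwards [hMbig.eventually_gt_atTop 0] with k hk
    exact (div_pos_iff_of_pos_right (htδpos k)).1 hk
  have helim : Tendsto e atTop (nhds 0) := by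
    have h1 : Tendsto (fun k => (1 + K) * tδ k / Mk k) atTop (nhds 0) := by
      have := hMt.const_mul (1 + K)
      rw [mul_zero] at this
      exact this.congr fun k => by ring
    have h2 : Tendsto (fun k => Real.log (τ / (2 * δ k)) ^ 2 / (τ / (2 * δ k))) atTop (nhds 0) :=
      ((Real.isLittleO_pow_log_id_atTop (n := 2)).tendsto_div_nhds_zero).comp hR
    have h3 : Tendsto (fun k => 1 / (τ / (2 * δ k))) atTop (nhds 0) := by
      exact hR.inv_tendsto_atTop.congr fun k => by simp
    have h4 : Tendsto (fun k => 1 / ((τ / (2 * δ k)) ^ 2 * Mk k)) atTop (nhds 0) := by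
      have h5 := hMt.const_mul (4 / τ ^ 2)
      rw [mul_zero] at h5
      refine squeeze_zero' (hMpos.mono fun k hk => by positivity) (hMpos.mono fun k hk => ?_) h5
      have hδk := hδpos k
      have h6 : δ k ^ 2 ≤ tδ k := by
        rw [htδ]; linarith [mul_nonneg (norm_nonneg (grad (𝔥 k) 0)) hδk.le]
      have h7 : 1 / ((τ / (2 * δ k)) ^ 2 * Mk k) = 4 / τ ^ 2 * (δ k ^ 2 / Mk k) := by
        field_simp; norm_num
      rw [h7]
      gcongr
    have h5 := ((h1.add h2).add h3).add h4
    simp only [add_zero] at h5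
    exact h5
  have main : ∀ᶠ k in atTop, ∀ y ∈ ball (1 : ℂ) d \ ball (1 : ℂ) (d / 8),
      |tw k y| ≤ 2 * C * e k ∧ ‖grad (tw k) y‖ ≤ 2 * C * e k := by
    filter_upwards [hMpos, hδ0.eventually_le_const one_pos,
      hδ0.eventually_le_const (by positivity : 0 < τ ^ 2 / 4),
      hδ0.eventually_le_const (by positivity : 0 < τ / 128), hμtop.eventually_gt_atTop 0,
      hμtop.eventually_ge_atTop μ₀, hR.eventually_ge_atTop R₀,
      hsmall.eventually_le_const one_pos] with k hM hδ1 hδ2 hδ3 hμ0 hμμ hRR hsm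
    have hδk := hδpos k
    set c : ℂ := (δ k : ℂ) * Complex.exp (θk k * Complex.I) with hc
    have hcn : ‖c‖ = δ k := by
      rw [hc, norm_mul, Complex.norm_exp_ofReal_mul_I, mul_one, Complex.norm_real, Real.norm_eq_abs,
        abs_of_pos hδk]
    have hc0 : c ≠ 0 := by rw [← norm_pos_iff, hcn]; exact hδk
    have hexp : ∀ x : ℂ, Complex.exp (θk k * Complex.I) * (δ k * x) = c * x := fun x => by
      rw [hc]; ring
    have h𝔥 : 𝔥 k (δ k : ℂ) = H k (c * 1) * Real.exp (phi k (c * 1)) := by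
      rw [hfrak, ← hhd, ← hexp, mul_one]
    have hcτ : c ∈ closedBall (0 : ℂ) τ := by
      rw [mem_closedBall, dist_zero_right, hcn]; linarith
    have hκpos : 0 < H k (c * 1) * Real.exp (phi k (c * 1)) := by
      rw [mul_one]
      exact mul_pos ((by positivity : 0 < 1 / C₀).trans_le (hHpos k c hcτ).1) (Real.exp_pos _)
    set κ : ℂ → ℝ := fun y => H k (c * y) * Real.exp (phi k (c * y)) with hκ
    have hVb : ∀ y, V k y = bub N (κ 1 / (8 * (N + 1) ^ 2)) (μ k) y := fun y => by
      rw [hV, h𝔥]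
      exact log_exp_div_eq_bub N hκpos y
    have hcoef : 0 < κ 1 / (8 * ((N : ℝ) + 1) ^ 2) := div_pos hκpos (by positivity)
    have hwM : ∀ y ∈ closedBall (0 : ℂ) (τ / δ k), |w k y| ≤ Mk k := fun y hy => by
      rw [hMk]
      rw [hMk] at hM
      exact le_biSup_of_pos hM hy
    have hvU : ∀ y, v k y = U k (c * y) - phi k (c * y) + 2 * (N + 1) * Real.log (δ k) := fun y => by
      rw [hv, hu]
    have hφC : ∀ x ∈ ball (0 : ℂ) τ, |phi k x| ≤ C₀ := fun x hx => (hφb' k).1 x (hcb hx)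
    have hUb : ∀ x ∈ ball (0 : ℂ) τ,
        U k x ≤ μ k + Mk k + C₀ - 2 * (N + 1) * Real.log (δ k) := fun x hx => by
      have hx' : c⁻¹ * x ∈ closedBall (0 : ℂ) (τ / δ k) := by
        rw [mem_closedBall, dist_zero_right, norm_mul, norm_inv, hcn, le_div_iff₀ hδk]
        have : (δ k)⁻¹ * ‖x‖ * δ k = ‖x‖ := by field_simp
        rw [this]
        simpa using (mem_ball.1 hx).le
      have h1 := (abs_le.1 (hwM _ hx')).2
      have h2 := bub_le (N := N) (m := μ k) hcoef (c⁻¹ * x)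
      have h3 := hvU (c⁻¹ * x)
      rw [mul_inv_cancel_left₀ hc0] at h3
      rw [hw, hVb] at h1
      linarith [(abs_le.1 (hφC x hx)).2]
    have hmass := lintegral_mul_exp_le ((hHreg k).continuousOn.mono hcb) (hUreg k).continuousOn
      (fun x hx => (by positivity : (0 : ℝ) ≤ 1 / C₀).trans (hHpos k x (hcb hx)).1)
      (fun x hx => (hHpos k x (hcb hx)).2) hUb (hint k)
    have hpc : p k 0 = c := hp0e k
    have hmax : IsLocalMax (fun x => U k x - phi k x) c := by
      have h1 := hploc k 0
      rw [hpc] at h1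
      exact (funext (hu k) : u k = fun x => U k x - phi k x) ▸ h1
    have hμδ : μ k ≤ -4 * Real.log (δ k) := le_neg_four_log hδk hμ0 (by rw [← hε]; exact hsm)
    have D : LocalBubbleData N B (τ / (2 * δ k)) (τ / δ k) (μ k) (v k) κ :=
      hdata hcn hδk hδ1 hδ2 hδ3 (hUreg k) (hphir k)
        (((hHreg k).mono hcb).of_le (by exact_mod_cast (by omega : 1 ≤ N + 2))) (hphih k) (hPDEU k)
        (fun x hx => (hHpos k x (hcb hx)).1) hφC (hh k) hmass (hA k) hmax
        (by rw [hμ, hpc, hu]; ring) hμ0.le hμδ hvU (fun _ => rfl)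
    have hg : ‖grad (𝔥 k) 0‖ = 2 * ‖dz (fun x => ((H k x * Real.exp (phi k x) : ℝ) : ℂ)) 0‖ := by
      have hd0 : DifferentiableAt ℝ (h k) (Complex.exp (θk k * Complex.I) * 0) := by
        rw [mul_zero, hhk]
        exact (hh k).diff 0 (mem_ball_self (by linarith))
      have h1 : 𝔥 k = fun x => h k (Complex.exp (θk k * Complex.I) * x) := funext (hfrak k)
      have hd1 : DifferentiableAt ℝ (fun x => h k (Complex.exp (θk k * Complex.I) * x)) 0 :=
        DifferentiableAt.comp (f := fun x => Complex.exp (θk k * Complex.I) * x) 0 hd0 (by fun_prop)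
      rw [h1, norm_grad hd1, dz_comp_mul_left hd0, norm_mul, Complex.norm_exp_ofReal_mul_I, mul_one,
        mul_zero, hhk]
    have hmap : ∀ z ∈ ball (0 : ℂ) (τ / (2 * δ k)), c * z ∈ ball (0 : ℂ) (τ / 2) := fun z hz => by
      rw [mem_ball, dist_zero_right, lt_div_iff₀ (by positivity)] at hz
      rw [mem_ball, dist_zero_right, norm_mul, hcn]
      linarith
    have hσ : ∀ z ∈ ball (0 : ℂ) (τ / (2 * δ k)),
        ‖dz (fun y => (κ y : ℂ)) z‖ ≤ (1 + K) * tδ k * (1 + ‖z‖) := fun z hz => by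
      rw [htδ, hg]
      exact (hh k).norm_dz_comp_mul_left_le (by linarith) hcn (hmap z hz)
    have htle : tδ k ≤ (2 * K + 1) * δ k := by
      have h1 := (hh k).dz_le 0 (mem_ball_self (by linarith))
      rw [htδ, hg]
      nlinarith
    have hσB : (1 + K) * tδ k ≤ B / (τ / (2 * δ k)) := by
      rw [le_div_iff₀ (by positivity)]
      have h1 : τ / (2 * δ k) * ((2 * K + 1) * δ k) = (2 * K + 1) * τ / 2 := by field_simp
      calc (1 + K) * tδ k * (τ / (2 * δ k)) ≤
          (1 + K) * ((2 * K + 1) * δ k) * (τ / (2 * δ k)) := by gcongr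
        _ = (1 + K) * (2 * K + 1) * τ / 2 := by field_simp
        _ ≤ B := by linarith
    have hσ0 : 0 ≤ (1 + K) * tδ k := mul_nonneg (by linarith) (htδpos k).le
    intro y hy
    have hyd : ‖y - 1‖ < d := by simpa [dist_eq_norm] using hy.1
    have hyd' : d / 8 ≤ ‖y - 1‖ := by simpa [dist_eq_norm] using hy.2
    have hball : ball (0 : ℂ) (τ / (2 * δ k)) ⊆ closedBall 0 (τ / δ k) :=
      (ball_subset_ball D.lt.le).trans ball_subset_closedBall
    obtain ⟨h1, h2⟩ := hunif D hRR hμμ hσ0 hσB hM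
      (fun z hz => by rw [← hVb, ← hw]; exact hwM z (hball hz)) hσ y (by linarith)
      (fun z hz => by
        rw [mem_ball, dist_eq_norm] at hz
        have t1 := norm_sub_le_norm_sub_add_norm_sub z y 1
        have t2 := norm_sub_le_norm_sub_add_norm_sub y z 1
        rw [norm_sub_rev y z] at t2
        exact haz z (by linarith) (by linarith))
    have hek : C * Mk k * e k = C * Mk k * ((1 + K) * tδ k / Mk k +
      Real.log (τ / (2 * δ k)) ^ 2 / (τ / (2 * δ k)) + 1 / (τ / (2 * δ k)) +
      1 / ((τ / (2 * δ k)) ^ 2 * Mk k)) := rfl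
    rw [← hek] at h1 h2
    constructor
    · rw [htw, hw, hVb, abs_div, abs_of_pos hM, div_le_iff₀ hM]
      have := (abs_nonneg _).trans h1
      linarith
    · have hy1 : y ∈ ball (0 : ℂ) (τ / δ k) := by
        have := norm_le_norm_sub_add y 1
        have h64 := D.le_R
        have hlt := D.lt
        rw [norm_one] at this
        rw [mem_ball, dist_zero_right]
        linarith
      have hvd : DifferentiableAt ℝ (v k) y :=
        (D.contDiff.contDiffAt (isOpen_ball.mem_nhds hy1)).differentiableAt (by norm_num)
      have hbd := (contDiff_bub (N := N) (m := μ k) hcoef).differentiable (by norm_num) y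
      have htwf : tw k = fun z => (v k z - bub N (κ 1 / (8 * (N + 1) ^ 2)) (μ k) z) / Mk k := by
        funext z
        rw [htw, hw, hVb]
      rw [htwf, norm_grad_div_sub hvd hbd hM, div_le_iff₀ hM]
      linarith
  have hlim : Tendsto (fun k => 2 * C * e k) atTop (nhds 0) := by
    simpa using helim.const_mul (2 * C)
  refine ⟨Metric.tendstoUniformlyOn_iff.2 fun r hr => ?_, Metric.tendstoUniformlyOn_iff.2 fun r hr => ?_⟩
  · filter_upwards [main, hlim.eventually_lt_const hr] with k hk hkr y hy
    rw [Pi.zero_apply, dist_comm, dist_zero_right, Real.norm_eq_abs]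
    exact (hk y hy).1.trans_lt hkr
  · filter_upwards [main, hlim.eventually_lt_const hr] with k hk hkr y hy
    rw [Pi.zero_apply, dist_comm, dist_zero_right]
    exact (hk y hy).2.trans_lt hkr
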